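/- Let 1 < q < 2, α, μ > 0 and let φ ∈ L¹(ℝ) be nonnegative with mass M = ∫_ℝ φ > 0. Let u be the classical solution of the regularized problem with initial datum φ. Then: (i) 0 ≤ u(t,x) ≤ (qM/((q−1)t))^{1/q} for all t > 0 and a.e. x ∈ ℝ; (ii) for every p ∈ [1, ∞) there exists C(M,p,q) > 0, independent of α, μ and J, such that ‖u(t)‖_{L^p(ℝ)} ≤ C(M,p,q)·t^{−(1/q)(1−1/p)} for all t > 0; (iii) there exists C(M,q) > 0, independent of α, μ and J, such that ∂_x u(t,x) ≤ C(M,q)·t^{−2/q} for all t > 0 and a.e. x ∈ ℝ. -/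

import Mathlib

open MeasureTheory Filter

/-- `u` is a classical solution of the regularized problem
`u_t + |u|^{q-1} u_x = α (J ∗ u - u) + μ u_xx` with initial datum `φ ∈ L¹(ℝ)`. -/
def IsRegSol (J : ℝ → ℝ) (q α μ : ℝ) (φ : ℝ → ℝ) (u : ℝ → ℝ → ℝ) : Prop :=
  (∀ t : ℝ, 0 ≤ t → Integrable (u t)) ∧
  (∀ t₀ : ℝ, 0 ≤ t₀ →
    Tendsto (fun t => ∫ x, |u t x - u t₀ x|) (nhdsWithin t₀ (Set.Ici 0)) (nhds 0)) ∧
  (∀ t : ℝ, 0 < t → ContDiff ℝ 2 (u t)) ∧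
  (∀ x : ℝ, ContDiffOn ℝ 1 (fun s => u s x) (Set.Ioi 0)) ∧
  (∀ t : ℝ, 0 < t → ∀ x : ℝ,
    deriv (fun s => u s x) t + |u t x| ^ (q - 1) * deriv (u t) x
      = α * ((∫ y, J (x - y) * u t y) - u t x) + μ * deriv (deriv (u t)) x) ∧
  (u 0 =ᵐ[volume] φ)

/-- The hypotheses on the data: `J` is a nonnegative even kernel of mass one, `α, μ > 0`,
`φ ∈ L¹(ℝ)` is nonnegative with mass `M`, and `u` is the classical solution of the
regularized problem with initial datum `φ`. -/
def RegData (J : ℝ → ℝ) (q α μ : ℝ) (φ : ℝ → ℝ) (M : ℝ) (u : ℝ → ℝ → ℝ) : Prop :=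
  (∀ x, 0 ≤ J x) ∧ (∀ x, J (-x) = J x) ∧ Integrable J ∧ (∫ x, J x = 1) ∧
  0 < α ∧ 0 < μ ∧ Integrable φ ∧ (∀ x, 0 ≤ φ x) ∧ (∫ x, φ x) = M ∧
  IsRegSol J q α μ φ u

namespace RegAux
open Set Topology

noncomputable def fq (q s : ℝ) : ℝ := ∫ r in (0:ℝ)..s, |r| ^ (q - 1)

lemma cont_absrpow {q : ℝ} (hq : 1 < q) : Continuous (fun r : ℝ => |r| ^ (q - 1)) :=
  continuous_abs.rpow_const (fun _ => Or.inr (by linarith))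

lemma fq_hasDerivAt {q : ℝ} (hq : 1 < q) (s : ℝ) : HasDerivAt (fq q) (|s| ^ (q - 1)) s :=
  intervalIntegral.integral_hasDerivAt_right ((cont_absrpow hq).intervalIntegrable _ _)
    ((cont_absrpow hq).stronglyMeasurableAtFilter _ _) (cont_absrpow hq).continuousAt

lemma fq_zero (q : ℝ) : fq q 0 = 0 := by simp [fq]

lemma fq_continuous {q : ℝ} (hq : 1 < q) : Continuous (fq q) :=
  continuous_iff_continuousAt.2 fun s => (fq_hasDerivAt hq s).continuousAt

lemma fq_sub_le {q : ℝ} (hq : 1 < q) (a b : ℝ) :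
    |fq q a - fq q b| ≤ (|a| ^ (q - 1) + |b| ^ (q - 1)) * |a - b| := by
  have h1 : fq q a - fq q b = ∫ r in b..a, |r| ^ (q - 1) := by
    unfold fq
    rw [intervalIntegral.integral_interval_sub_left] <;>
      exact (cont_absrpow hq).intervalIntegrable _ _
  rw [h1, ← Real.norm_eq_abs]
  refine intervalIntegral.norm_integral_le_of_norm_le_const fun r hr => ?_
  have hm : |r| ≤ max |a| |b| := by
    rcases Set.mem_uIoc.1 hr with h | h
    · rcases le_total 0 r with h0 | h0
      · rw [abs_of_nonneg h0]; exact le_max_of_le_left (h.2.trans (le_abs_self a))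
      · rw [abs_of_nonpos h0]; refine le_max_of_le_right ?_
        rw [abs_of_nonpos (by linarith)]; linarith
    · rcases le_total 0 r with h0 | h0
      · rw [abs_of_nonneg h0]; exact le_max_of_le_right (h.2.trans (le_abs_self b))
      · rw [abs_of_nonpos h0]; refine le_max_of_le_left ?_
        rw [abs_of_nonpos (by linarith)]; linarith
  rw [Real.norm_of_nonneg (by positivity)]
  have h0 : 0 ≤ q - 1 := by linarith
  rcases le_max_iff.1 hm with h | h
  · have := Real.rpow_le_rpow (abs_nonneg r) h h0
    have : 0 ≤ |b| ^ (q - 1) := by positivity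
    linarith
  · have := Real.rpow_le_rpow (abs_nonneg r) h h0
    have : 0 ≤ |a| ^ (q - 1) := by positivity
    linarith

lemma fq_abs_le {q : ℝ} (hq : 1 < q) (a : ℝ) : |fq q a| ≤ |a| ^ q := by
  have h := fq_sub_le hq a 0
  rw [fq_zero, sub_zero, sub_zero, abs_zero, Real.zero_rpow (by linarith), add_zero] at h
  refine h.trans (le_of_eq ?_)
  rcases eq_or_lt_of_le (abs_nonneg a) with h0 | h0
  · rw [← h0, mul_zero, Real.zero_rpow (by linarith)]
  · rw [Real.rpow_sub_one h0.ne']; field_simp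

/-- subadditivity of `r ^ (q-1)` -/
lemma rpow_add_le {q : ℝ} (hq : 1 < q) (hq2 : q < 2) (a b : ℝ) :
    |a + b| ^ (q - 1) ≤ |a| ^ (q - 1) + |b| ^ (q - 1) := by
  refine (Real.rpow_le_rpow (abs_nonneg _) (abs_add_le a b) (by linarith)).trans ?_
  exact Real.rpow_add_le_add_rpow (abs_nonneg a) (abs_nonneg b) (by linarith) (by linarith)

lemma rpow_mul_self {q : ℝ} (hq : 1 < q) (a : ℝ) : |a| ^ (q - 1) * |a| = |a| ^ q := by
  rcases eq_or_lt_of_le (abs_nonneg a) with h0 | h0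
  · rw [← h0, mul_zero, Real.zero_rpow (by linarith)]
  · rw [Real.rpow_sub_one h0.ne']; field_simp

/-- flux difference bound -/
lemma fq_diff_le {q n : ℝ} (hq : 1 < q) (hq2 : q < 2) (v d : ℝ) (hn : |v| ≤ n) :
    |fq q (v + d) - fq q v| ≤ (2 * n ^ (q - 1) + 1) * (|d| + |d| ^ q) := by
  have h := fq_sub_le hq (v + d) v
  have h2 := rpow_add_le hq hq2 v d
  have h3 : |v| ^ (q - 1) ≤ n ^ (q - 1) := Real.rpow_le_rpow (abs_nonneg _) hn (by linarith)
  have e : v + d - v = d := by ring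
  rw [e] at h
  have h4 := rpow_mul_self hq d
  have hd := abs_nonneg d
  have hdq : 0 ≤ |d| ^ q := by positivity
  have hv : 0 ≤ |v| ^ (q - 1) := by positivity
  calc _ ≤ (|v + d| ^ (q - 1) + |v| ^ (q - 1)) * |d| := h
    _ ≤ (2 * n ^ (q-1) + |d| ^ (q-1)) * |d| := by
        apply mul_le_mul_of_nonneg_right _ hd; linarith
    _ = 2 * n ^ (q-1) * |d| + |d| ^ q := by rw [← h4]; ring
    _ ≤ _ := by
        have : 0 ≤ n ^ (q-1) := hv.trans h3
        nlinarith [mul_nonneg this hdq]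

noncomputable def gg (J : ℝ → ℝ) (u : ℝ → ℝ → ℝ) (t x : ℝ) : ℝ := ∫ y, J (x - y) * u t y

structure Sol (J : ℝ → ℝ) (q α μ : ℝ) (u : ℝ → ℝ → ℝ) : Prop where
  q1 : 1 < q
  q2 : q < 2
  α0 : 0 < α
  μ0 : 0 < μ
  J0 : ∀ x, 0 ≤ J x
  Jm : Measurable J
  Ji : Integrable J
  J1 : ∫ x, J x = 1
  ui : ∀ t, Integrable (u t)
  uc : ∀ t, ContDiff ℝ 2 (u t)
  ul : ∀ t₀ : ℝ, 0 < t₀ → Tendsto (fun t => ∫ x, |u t x - u t₀ x|) (𝓝 t₀) (𝓝 0)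
  ut : ∀ x, ContDiffOn ℝ 1 (fun s => u s x) (Ioi 0)
  pde : ∀ t : ℝ, 0 < t → ∀ x : ℝ,
    deriv (fun s => u s x) t + |u t x| ^ (q - 1) * deriv (u t) x
      = α * (gg J u t x - u t x) + μ * deriv (deriv (u t)) x
  um : Measurable (Function.uncurry u)

lemma conv_aux {J h : ℝ → ℝ} (J0 : ∀ x, 0 ≤ J x) (Ji : Integrable J)
    (J1 : ∫ x, J x = 1) (hh : Integrable h) :
    Integrable (fun x => ∫ y, J (x - y) * h y) ∧
    ∫ x, |∫ y, J (x - y) * h y| ≤ ∫ x, |h x| := by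
  have key : ∀ k : ℝ → ℝ, Integrable k → Integrable (fun x => ∫ y, J (x - y) * k y) ∧
      ∫ x, (∫ y, J (x - y) * k y) = ∫ x, k x := by
    intro k hk
    have h1 := hk.integrable_convolution (ContinuousLinearMap.mul ℝ ℝ) Ji
    have h2 := integral_convolution (ContinuousLinearMap.mul ℝ ℝ) hk Ji
    have e : (convolution k J (ContinuousLinearMap.mul ℝ ℝ) volume)
        = fun x => ∫ y, J (x - y) * k y := by
      funext x; simp only [convolution, ContinuousLinearMap.mul_apply']
      exact integral_congr_ae (Eventually.of_forall fun y => mul_comm _ _)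
    rw [e] at h1 h2
    refine ⟨h1, ?_⟩
    rw [h2]; simp [J1]
  obtain ⟨a1, -⟩ := key h hh
  obtain ⟨b1, b2⟩ := key (fun x => |h x|) hh.abs
  refine ⟨a1, ?_⟩
  rw [← b2]
  refine integral_mono a1.abs b1 fun x => ?_
  refine (abs_integral_le_integral_abs).trans (le_of_eq ?_)
  exact integral_congr_ae (Eventually.of_forall fun y => by simp [abs_mul, abs_of_nonneg (J0 _)])

/-- convolution is a.e. additive -/
lemma conv_sub {J h k : ℝ → ℝ} (Ji : Integrable J)
    (hh : Integrable h) (hk : Integrable k) :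
    ∀ᵐ x, (∫ y, J (x - y) * (h y - k y)) = (∫ y, J (x - y) * h y) - ∫ y, J (x - y) * k y := by
  have h1 := hh.ae_convolution_exists (ContinuousLinearMap.mul ℝ ℝ) Ji
  have h2 := hk.ae_convolution_exists (ContinuousLinearMap.mul ℝ ℝ) Ji
  filter_upwards [h1, h2] with x hx1 hx2
  have a1 : Integrable (fun y => J (x - y) * h y) := by
    refine Integrable.congr (ConvolutionExistsAt.integrable hx1) (Eventually.of_forall fun y => ?_)
    simp [mul_comm]
  have a2 : Integrable (fun y => J (x - y) * k y) := by
    refine Integrable.congr (ConvolutionExistsAt.integrable hx2) (Eventually.of_forall fun y => ?_)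
    simp [mul_comm]
  rw [← integral_sub a1 a2]
  exact integral_congr_ae (Eventually.of_forall fun y => by ring)

namespace Sol
variable {J : ℝ → ℝ} {q α μ : ℝ} {u : ℝ → ℝ → ℝ}

lemma g_int (h : Sol J q α μ u) (t : ℝ) : Integrable (gg J u t) :=
  (conv_aux h.J0 h.Ji h.J1 (h.ui t)).1

lemma g_le (h : Sol J q α μ u) (t : ℝ) : ∫ x, |gg J u t x| ≤ ∫ x, |u t x| :=
  (conv_aux h.J0 h.Ji h.J1 (h.ui t)).2

lemma g_sub_le (h : Sol J q α μ u) (s t : ℝ) :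
    ∫ x, |gg J u t x - gg J u s x| ≤ ∫ x, |u t x - u s x| := by
  have h1 := (conv_aux h.J0 h.Ji h.J1 ((h.ui t).sub (h.ui s))).2
  refine le_trans (le_of_eq ?_) h1
  refine integral_congr_ae ?_
  filter_upwards [conv_sub h.Ji (h.ui t) (h.ui s)] with x hx
  simp only [Pi.sub_apply]
  rw [hx]; rfl

lemma g_meas (h : Sol J q α μ u) : Measurable (Function.uncurry (gg J u)) := by
  have : StronglyMeasurable (fun p : ℝ × ℝ => ∫ y, J (p.2 - y) * u p.1 y) := by
    refine StronglyMeasurable.integral_prod_right (f := fun p : ℝ × ℝ => fun y => J (p.2 - y) * u p.1 y) ?_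
    refine Measurable.stronglyMeasurable ?_
    refine Measurable.mul (h.Jm.comp (by fun_prop)) ?_
    exact h.um.comp (f := fun z : (ℝ × ℝ) × ℝ => (z.1.1, z.2)) (by fun_prop)
  exact this.measurable

end Sol

/-- joint measurability of the row derivative -/
lemma meas_deriv {w : ℝ → ℝ → ℝ} (hm : Measurable (Function.uncurry w))
    (hd : ∀ t, Differentiable ℝ (w t)) :
    Measurable (Function.uncurry fun t x => deriv (w t) x) := by
  have hlim : ∀ p : ℝ × ℝ, Tendsto (fun n : ℕ => ((n:ℝ) + 1) * (w p.1 (p.2 + 1 / ((n:ℝ) + 1)) - w p.1 p.2))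
      atTop (𝓝 (deriv (w p.1) p.2)) := by
    intro p
    have h1 := (hd p.1 p.2).hasDerivAt
    rw [hasDerivAt_iff_tendsto_slope_zero] at h1
    have h2 : Tendsto (fun n : ℕ => 1 / ((n:ℝ) + 1)) atTop (𝓝[≠] 0) := by
      refine tendsto_nhdsWithin_iff.2 ⟨tendsto_one_div_add_atTop_nhds_zero_nat, ?_⟩
      exact Eventually.of_forall fun n => by simp; positivity
    refine (h1.comp h2).congr fun n => ?_
    simp
  refine measurable_of_tendsto_metrizable (f := fun (n : ℕ) (p : ℝ × ℝ) => ((n:ℝ) + 1) * (w p.1 (p.2 + 1 / ((n:ℝ) + 1)) - w p.1 p.2)) (fun n => ?_) (tendsto_pi_nhds.2 fun p => hlim p)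
  refine Measurable.mul measurable_const (Measurable.sub ?_ hm)
  exact hm.comp (f := fun p : ℝ × ℝ => (p.1, p.2 + 1 / ((n:ℝ) + 1))) (by fun_prop)

end RegAux

namespace RegAux
open Set Topology
open scoped ContDiff Convolution

/-! ### test functions -/
def Test (r : ℝ) (ψ : ℝ → ℝ) : Prop := ContDiff ℝ ∞ ψ ∧ ∀ x, r < |x| → ψ x = 0

namespace Test
variable {r : ℝ} {ψ : ℝ → ℝ}

lemma cont (h : Test r ψ) : Continuous ψ := h.1.continuous

lemma diff (h : Test r ψ) : Differentiable ℝ ψ := h.1.differentiable (by simp)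

lemma hcs (h : Test r ψ) : HasCompactSupport ψ := by
  refine HasCompactSupport.intro (isCompact_Icc (a := -r) (b := r)) fun x hx => h.2 x ?_
  by_contra hc
  exact hx (abs_le.1 (not_lt.1 hc))

lemma der (h : Test r ψ) : Test r (deriv ψ) := by
  refine ⟨(contDiff_infty_iff_deriv.1 h.1).2, fun x hx => ?_⟩
  have : ψ =ᶠ[𝓝 x] fun _ => 0 := by
    filter_upwards [(isOpen_lt continuous_const continuous_abs).mem_nhds hx] with y hy
    exact h.2 y hy
  rw [this.deriv_eq]; simp

lemma mono (h : Test r ψ) {r' : ℝ} (hr : r ≤ r') : Test r' ψ :=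
  ⟨h.1, fun x hx => h.2 x (lt_of_le_of_lt hr hx)⟩

lemma bdd (h : Test r ψ) : ∃ C, 0 ≤ C ∧ ∀ x, |ψ x| ≤ C := by
  obtain ⟨C, hC⟩ := h.hcs.exists_bound_of_continuous h.cont
  exact ⟨C, (abs_nonneg (ψ 0)).trans (hC 0), hC⟩

lemma integrable_mul (h : Test r ψ) {k : ℝ → ℝ} (hk : LocallyIntegrable k) :
    Integrable (fun x => ψ x * k x) :=
  hk.integrable_smul_left_of_hasCompactSupport h.cont h.hcs

lemma integrable_mul_cont (h : Test r ψ) {k : ℝ → ℝ} (hk : Continuous k) :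
    Integrable (fun x => ψ x * k x) := h.integrable_mul hk.locallyIntegrable

lemma ibp (h : Test r ψ) {G G' : ℝ → ℝ} (hG : ∀ x, HasDerivAt G (G' x) x) (hG' : Continuous G') :
    ∫ x, ψ x * G' x = - ∫ x, deriv ψ x * G x := by
  have hGc : Continuous G := continuous_iff_continuousAt.2 fun x => (hG x).continuousAt
  exact integral_mul_deriv_eq_deriv_mul_of_integrable (u := ψ) (v := G)
    (fun x _ => (h.diff x).hasDerivAt) (fun x _ => hG x) (h.integrable_mul_cont hG')
    (h.der.integrable_mul_cont hGc) (h.integrable_mul_cont hGc)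

end Test

/-- integral bound for functions vanishing off `[-r,r]` -/
lemma abs_integral_mul_le {r C : ℝ} {η G : ℝ → ℝ} (hη : ∀ x, r < |x| → η x = 0)
    (hC : ∀ x, |η x| ≤ C) (hG : IntegrableOn G (Icc (-r) r)) :
    |∫ x, η x * G x| ≤ C * ∫ x in Icc (-r) r, |G x| := by
  have h1 : ∫ x, η x * G x = ∫ x in Icc (-r) r, η x * G x := by
    symm
    refine setIntegral_eq_integral_of_forall_compl_eq_zero fun x hx => ?_
    rw [hη x, zero_mul]
    by_contra hc
    exact hx (abs_le.1 (not_lt.1 hc))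
  rw [h1, ← integral_const_mul]
  refine (abs_integral_le_integral_abs).trans ?_
  by_cases hi : IntegrableOn (fun x => |η x * G x|) (Icc (-r) r)
  · refine setIntegral_mono_on hi (hG.abs.const_mul C) measurableSet_Icc fun x _ => ?_
    rw [abs_mul]; exact mul_le_mul_of_nonneg_right (hC x) (abs_nonneg _)
  · rw [integral_undef hi]
    refine integral_nonneg fun x => mul_nonneg ((abs_nonneg _).trans (hC x)) (abs_nonneg _)

/-! ### mollifiers -/
noncomputable def bmp (n : ℕ) : ContDiffBump (0:ℝ) :=
  ⟨1 / ((n:ℝ) + 1) / 2, 1 / ((n:ℝ) + 1), by positivity, by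
    have : (0:ℝ) < 1 / ((n:ℝ) + 1) := by positivity
    linarith⟩

noncomputable def ρ (n : ℕ) : ℝ → ℝ := (bmp n).normed volume

lemma ρ_nonneg (n : ℕ) (x : ℝ) : 0 ≤ ρ n x := (bmp n).nonneg_normed x
lemma ρ_smooth (n : ℕ) : ContDiff ℝ ∞ (ρ n) := (bmp n).contDiff_normed
lemma ρ_cont (n : ℕ) : Continuous (ρ n) := (ρ_smooth n).continuous
lemma ρ_int (n : ℕ) : ∫ x, ρ n x = 1 := (bmp n).integral_normed
lemma ρ_neg (n : ℕ) (x : ℝ) : ρ n (-x) = ρ n x := (bmp n).normed_neg x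
lemma ρ_zero (n : ℕ) (x : ℝ) (h : 1 / ((n:ℝ) + 1) < |x|) : ρ n x = 0 := by
  have h1 := (bmp n).tsupport_normed_eq (μ := (volume : Measure ℝ))
  by_contra hc
  have : x ∈ tsupport (ρ n) := subset_tsupport _ hc
  rw [ρ, h1] at this
  have h2 : |x| ≤ 1 / ((n:ℝ) + 1) := by simpa [bmp] using this
  linarith
lemma ρ_test (n : ℕ) : Test (1 / ((n:ℝ) + 1)) (ρ n) := ⟨ρ_smooth n, ρ_zero n⟩

noncomputable def km (k h : ℝ → ℝ) (x : ℝ) : ℝ := ∫ y, k (x - y) * h y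

lemma km_eq (k h : ℝ → ℝ) : km k h = k ⋆[ContinuousLinearMap.lsmul ℝ ℝ, volume] h := by
  funext x; rw [convolution_lsmul_swap]; rfl

/-- translated test -/
lemma Test.trans {ε : ℝ} {k : ℝ → ℝ} (hk : Test ε k) {x r r' : ℝ} (hx : |x| ≤ r) (hr : r + ε ≤ r') :
    Test r' (fun y => k (x - y)) := by
  refine ⟨hk.1.comp (contDiff_const.sub contDiff_id), fun y hy => hk.2 _ ?_⟩
  have : |y| - |x| ≤ |x - y| := by
    rw [abs_sub_comm]; exact abs_sub_abs_le_abs_sub y x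
  linarith

lemma km_integrable {ε : ℝ} {k h : ℝ → ℝ} (hk : Test ε k) (hh : LocallyIntegrable h) (x : ℝ) :
    Integrable (fun y => k (x - y) * h y) :=
  (hk.trans (le_refl |x|) (le_refl _)).integrable_mul hh

lemma km_hasDeriv {ε : ℝ} {k h : ℝ → ℝ} (hk : Test ε k) (hh : LocallyIntegrable h) (x : ℝ) :
    HasDerivAt (km k h) (km (deriv k) h x) x := by
  rw [km_eq, km_eq]
  exact hk.hcs.hasDerivAt_convolution_left _ (hk.1.of_le (by simp)) hh x

lemma km_cont {ε : ℝ} {k h : ℝ → ℝ} (hk : Test ε k) (hh : LocallyIntegrable h) :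
    Continuous (km k h) :=
  continuous_iff_continuousAt.2 fun x => (km_hasDeriv hk hh x).continuousAt

/-- shifting the derivative to `h` -/
lemma km_deriv_comm {ε : ℝ} {k h : ℝ → ℝ} (hk : Test ε k) (hh : ContDiff ℝ 1 h) (x : ℝ) :
    km (deriv k) h x = km k (deriv h) x := by
  have h1 := (hk.trans (le_refl |x|) (le_refl _)).ibp
    (fun y => ((hh.differentiable (by simp)) y).hasDerivAt) (hh.continuous_deriv (by simp))
  have h2 : deriv (fun y => k (x - y)) = fun y => - deriv k (x - y) := by
    funext y; rw [deriv_comp_const_sub]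
  rw [h2] at h1
  unfold km
  rw [h1, ← integral_neg]
  exact integral_congr_ae (Eventually.of_forall fun y => by ring)

lemma km_meas {k : ℝ → ℝ} {h : ℝ → ℝ → ℝ} (hk : Continuous k)
    (hh : Measurable (Function.uncurry h)) :
    Measurable (fun p : ℝ × ℝ => km k (h p.1) p.2) := by
  have : StronglyMeasurable (fun p : ℝ × ℝ => ∫ y, k (p.2 - y) * h p.1 y) := by
    refine StronglyMeasurable.integral_prod_right (f := fun p : ℝ × ℝ => fun y => k (p.2 - y) * h p.1 y) ?_
    refine Measurable.stronglyMeasurable ?_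
    refine Measurable.mul (hk.measurable.comp (by fun_prop)) ?_
    exact hh.comp (f := fun z : (ℝ × ℝ) × ℝ => (z.1.1, z.2)) (by fun_prop)
  exact this.measurable

lemma ρ_shift_int (n : ℕ) (x : ℝ) : ∫ y, ρ n (x - y) = 1 := by
  rw [integral_sub_left_eq_self (fun y => ρ n y) volume x, ρ_int]

lemma ρ_shift_integrable (n : ℕ) (x : ℝ) : Integrable (fun y => ρ n (x - y)) := by
  have := km_integrable (ρ_test n) (h := fun _ => (1:ℝ)) (locallyIntegrable_const _) x
  simpa using this

/-- sup bound -/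
lemma km_bound {n : ℕ} {h : ℝ → ℝ} {x C : ℝ} (_hC0 : 0 ≤ C)
    (hC : ∀ y, |x - y| ≤ 1 / ((n:ℝ) + 1) → |h y| ≤ C) : |km (ρ n) h x| ≤ C := by
  unfold km
  calc |∫ y, ρ n (x - y) * h y| = ‖∫ y, ρ n (x - y) * h y‖ := rfl
    _ ≤ ∫ y, ρ n (x - y) * C := by
        refine norm_integral_le_of_norm_le ((ρ_shift_integrable n x).mul_const C)
          (Eventually.of_forall fun y => ?_)
        rw [Real.norm_eq_abs, abs_mul, abs_of_nonneg (ρ_nonneg n _)]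
        by_cases hy : |x - y| ≤ 1 / ((n:ℝ) + 1)
        · exact mul_le_mul_of_nonneg_left (hC y hy) (ρ_nonneg n _)
        · rw [ρ_zero n _ (not_le.1 hy)]; simp
    _ = C := by rw [integral_mul_const, ρ_shift_int, one_mul]

/-- Young / Jensen -/
lemma km_young {n : ℕ} {h : ℝ → ℝ} (hh : LocallyIntegrable h)
    (h2 : LocallyIntegrable fun y => h y ^ 2) {μ : ℝ} (hμ : 0 < μ) (a x : ℝ) :
    a * km (ρ n) h x ≤ μ / 2 * a ^ 2 + 1 / (2 * μ) * km (ρ n) (fun y => h y ^ 2) x := by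
  have i1 := km_integrable (ρ_test n) hh x
  have i2 := km_integrable (ρ_test n) h2 x
  have i3 := ρ_shift_integrable n x
  have e : μ / 2 * a ^ 2 + 1 / (2 * μ) * km (ρ n) (fun y => h y ^ 2) x
      = ∫ y, (μ / 2 * a ^ 2 * ρ n (x - y) + 1 / (2 * μ) * (ρ n (x - y) * h y ^ 2)) := by
    rw [integral_add (i3.const_mul _) (i2.const_mul _), integral_const_mul, integral_const_mul,
      ρ_shift_int, mul_one]; rfl
  rw [e]; unfold km; rw [← integral_const_mul]
  refine integral_mono (i1.const_mul a) ((i3.const_mul _).add (i2.const_mul _)) fun y => ?_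
  have h0 := ρ_nonneg n (x - y)
  have : a * h y ≤ μ / 2 * a ^ 2 + 1 / (2 * μ) * h y ^ 2 := by
    have : 0 ≤ (μ * a - h y) ^ 2 / (2 * μ) := by positivity
    have e2 : (μ * a - h y) ^ 2 / (2 * μ) = μ / 2 * a ^ 2 + 1 / (2 * μ) * h y ^ 2 - a * h y := by
      field_simp; ring
    linarith
  have := mul_le_mul_of_nonneg_left this h0
  simp only
  nlinarith

lemma km_sq_le {n : ℕ} {h : ℝ → ℝ} (hh : LocallyIntegrable h)
    (h2 : LocallyIntegrable fun y => h y ^ 2) (x : ℝ) :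
    km (ρ n) h x ^ 2 ≤ km (ρ n) (fun y => h y ^ 2) x := by
  have := km_young hh h2 (μ := 1) one_pos (km (ρ n) h x) x (n := n)
  nlinarith

lemma km_nonneg {n : ℕ} {h : ℝ → ℝ} (h0 : ∀ y, 0 ≤ h y) (x : ℝ) : 0 ≤ km (ρ n) h x :=
  integral_nonneg fun y => mul_nonneg (ρ_nonneg n _) (h0 y)

lemma rOut_tendsto : Tendsto (fun n : ℕ => (bmp n).rOut) atTop (𝓝 0) :=
  tendsto_one_div_add_atTop_nhds_zero_nat

lemma km_tendsto_joint {h : ℝ → ℝ} (hh : Continuous h) (x : ℝ) :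
    Tendsto (fun p : ℕ × ℝ => km (ρ p.1) h p.2) (atTop ×ˢ 𝓝 x) (𝓝 (h x)) := by
  have hcg : Tendsto (Function.uncurry fun (_ : ℕ × ℝ) => h) ((atTop ×ˢ 𝓝 x) ×ˢ 𝓝 x) (𝓝 (h x)) :=
    Tendsto.comp (g := h) (hh.tendsto x) tendsto_snd
  have hr : Tendsto (fun p : ℕ × ℝ => (bmp p.1).rOut) (atTop ×ˢ 𝓝 x) (𝓝 0) :=
    Tendsto.comp (g := fun n : ℕ => (bmp n).rOut) rOut_tendsto tendsto_fst
  have hk : Tendsto (fun p : ℕ × ℝ => p.2) ((atTop : Filter ℕ) ×ˢ 𝓝 x) (𝓝 x) := tendsto_snd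
  have := ContDiffBump.convolution_tendsto_right (μ := (volume : Measure ℝ))
    (φ := fun p : ℕ × ℝ => bmp p.1) (l := (atTop : Filter ℕ) ×ˢ 𝓝 x)
    (g := fun _ => h) (k := fun p => p.2) (x₀ := x) (z₀ := h x)
    hr (Eventually.of_forall fun _ => hh.aestronglyMeasurable) hcg hk
  refine this.congr fun p => ?_
  rw [km_eq, ρ]

lemma km_tendsto_var {η : ℕ → ℝ → ℝ} {η₀ : ℝ → ℝ} (hc : ∀ n, Continuous (η n)) (x : ℝ)
    (h : Tendsto (fun p : ℕ × ℝ => η p.1 p.2) (atTop ×ˢ 𝓝 x) (𝓝 (η₀ x))) :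
    Tendsto (fun n : ℕ => km (ρ n) (η n) x) atTop (𝓝 (η₀ x)) := by
  have := ContDiffBump.convolution_tendsto_right (μ := (volume : Measure ℝ))
    (φ := fun n : ℕ => bmp n) (l := atTop)
    (g := η) (k := fun _ => x) (x₀ := x) (z₀ := η₀ x)
    rOut_tendsto (Eventually.of_forall fun n => (hc n).aestronglyMeasurable)
    h tendsto_const_nhds
  refine this.congr fun p => ?_
  rw [km_eq, ρ]

lemma km_tendsto {h : ℝ → ℝ} (hh : Continuous h) (x : ℝ) :
    Tendsto (fun n : ℕ => km (ρ n) h x) atTop (𝓝 (h x)) :=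
  km_tendsto_var (η := fun _ => h) (fun _ => hh) x (Tendsto.comp (g := h) (hh.tendsto x) tendsto_snd)

/-- adjoint identity -/
lemma km_adj {n : ℕ} {η G : ℝ → ℝ} {r : ℝ} (hη : Continuous η) (hη0 : ∀ x, r < |x| → η x = 0)
    (hG : LocallyIntegrable G) :
    ∫ x, η x * km (ρ n) G x = ∫ y, km (ρ n) η y * G y := by
  set R := r + 1 / ((n:ℝ) + 1) with hR
  have hz : ∀ x y : ℝ, y ∉ Icc (-R) R → η x * (ρ n (x - y) * G y) = 0 := by
    intro x y hy
    by_cases hx : r < |x|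
    · rw [hη0 x hx, zero_mul]
    · rw [ρ_zero n, zero_mul, mul_zero]
      have h1 : R < |y| := by
        by_contra hc; exact hy (abs_le.1 (not_lt.1 hc))
      have : |y| - |x| ≤ |x - y| := by
        rw [abs_sub_comm]; exact abs_sub_abs_le_abs_sub y x
      linarith
  have hηc : HasCompactSupport η := by
    refine HasCompactSupport.intro (isCompact_Icc (a := -r) (b := r)) fun x hx => hη0 x ?_
    by_contra hc
    exact hx (abs_le.1 (not_lt.1 hc))
  have hGi : Integrable ((Icc (-R) R).indicator G) :=
    (hG.integrableOn_isCompact isCompact_Icc).integrable_indicator measurableSet_Icc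
  obtain ⟨Cρ, hCρ0, hCρ⟩ := (ρ_test n).bdd
  have hintg : Integrable (Function.uncurry fun x y => η x * (ρ n (x - y) * G y))
      (volume.prod volume) := by
    have h1 : Integrable (fun p : ℝ × ℝ => η p.1 * (Icc (-R) R).indicator G p.2)
        (volume.prod volume) := (hη.integrable_of_hasCompactSupport hηc).mul_prod hGi
    have h2 : Integrable (fun p : ℝ × ℝ => ρ n (p.1 - p.2) * (η p.1 * (Icc (-R) R).indicator G p.2))
        (volume.prod volume) := by
      refine h1.bdd_mul (c := Cρ) ?_ (Eventually.of_forall fun p => hCρ _)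
      exact ((ρ_cont n).comp (continuous_fst.sub continuous_snd)).aestronglyMeasurable
    refine h2.congr (Eventually.of_forall fun p => ?_)
    simp only [Function.uncurry]
    by_cases hp : p.2 ∈ Icc (-R) R
    · rw [indicator_of_mem hp]; ring
    · rw [indicator_of_notMem hp, hz _ _ hp]; ring
  calc ∫ x, η x * km (ρ n) G x = ∫ x, ∫ y, η x * (ρ n (x - y) * G y) := by
        refine integral_congr_ae (Eventually.of_forall fun x => ?_)
        simp only [km]; rw [integral_const_mul]
    _ = ∫ y, ∫ x, η x * (ρ n (x - y) * G y) := integral_integral_swap hintg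
    _ = _ := by
        refine integral_congr_ae (Eventually.of_forall fun y => ?_)
        simp only [km]; rw [← integral_mul_const]
        refine integral_congr_ae (Eventually.of_forall fun x => ?_)
        simp only
        rw [← ρ_neg n (x - y), neg_sub]; ring

lemma adj_bound {n : ℕ} {η G : ℝ → ℝ} {r r' C : ℝ} (hη : Continuous η)
    (hη0 : ∀ x, r < |x| → η x = 0) (hr : r + 1 / ((n:ℝ) + 1) ≤ r') (hC : ∀ x, |η x| ≤ C)
    (hG : LocallyIntegrable G) :
    |∫ x, η x * km (ρ n) G x| ≤ C * ∫ x in Icc (-r') r', |G x| := by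
  rw [km_adj hη hη0 hG]
  have hC0 : 0 ≤ C := (abs_nonneg _).trans (hC 0)
  refine abs_integral_mul_le (fun x hx => ?_) (fun x => km_bound hC0 fun y _ => hC y)
    (hG.integrableOn_isCompact isCompact_Icc)
  unfold km
  rw [integral_eq_zero_of_ae]
  refine Eventually.of_forall fun y => ?_
  simp only [Pi.zero_apply]
  by_cases hy : r < |y|
  · rw [hη0 y hy, mul_zero]
  · rw [ρ_zero n, zero_mul]
    have := abs_sub_abs_le_abs_sub x y
    linarith

lemma adj_tendsto {η : ℕ → ℝ → ℝ} {η₀ G : ℝ → ℝ} {r C : ℝ} (hη : ∀ n, Continuous (η n))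
    (hη0 : ∀ n x, r < |x| → η n x = 0) (hC : ∀ n x, |η n x| ≤ C)
    (hG : LocallyIntegrable G)
    (h : ∀ x, Tendsto (fun p : ℕ × ℝ => η p.1 p.2) (atTop ×ˢ 𝓝 x) (𝓝 (η₀ x))) :
    Tendsto (fun n => ∫ x, η n x * km (ρ n) G x) atTop (𝓝 (∫ x, η₀ x * G x)) := by
  have hC0 : 0 ≤ C := (abs_nonneg _).trans (hC 0 0)
  set R := r + 1 with hR
  have hGi : Integrable ((Icc (-R) R).indicator G) :=
    (hG.integrableOn_isCompact isCompact_Icc).integrable_indicator measurableSet_Icc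
  have hk0 : ∀ n x, x ∉ Icc (-R) R → km (ρ n) (η n) x = 0 := by
    intro n x hx
    have hx' : R < |x| := by
      by_contra hc; exact hx (abs_le.1 (not_lt.1 hc))
    unfold km
    rw [integral_eq_zero_of_ae]
    refine Eventually.of_forall fun y => ?_
    simp only [Pi.zero_apply]
    by_cases hy : r < |y|
    · rw [hη0 n y hy, mul_zero]
    · rw [ρ_zero n, zero_mul]
      have := abs_sub_abs_le_abs_sub x y
      have h1 : 1 / ((n:ℝ) + 1) ≤ 1 := by
        rw [div_le_one (by positivity)]; linarith [n.cast_nonneg (α := ℝ)]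
      linarith
  have e : ∀ n, ∫ x, η n x * km (ρ n) G x = ∫ y, km (ρ n) (η n) y * (Icc (-R) R).indicator G y := by
    intro n
    rw [km_adj (hη n) (hη0 n) hG]
    refine integral_congr_ae (Eventually.of_forall fun y => ?_)
    simp only
    by_cases hy : y ∈ Icc (-R) R
    · rw [indicator_of_mem hy]
    · rw [indicator_of_notMem hy, hk0 n y hy]; ring
  have hη00 : ∀ x, x ∉ Icc (-R) R → η₀ x = 0 := by
    intro x hx
    have h1 := km_tendsto_var hη x (h x)
    refine tendsto_nhds_unique h1 ?_
    simp_rw [hk0 _ x hx]; exact tendsto_const_nhds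
  have e0 : ∫ x, η₀ x * G x = ∫ y, η₀ y * (Icc (-R) R).indicator G y := by
    refine integral_congr_ae (Eventually.of_forall fun y => ?_)
    simp only
    by_cases hy : y ∈ Icc (-R) R
    · rw [indicator_of_mem hy]
    · rw [indicator_of_notMem hy, hη00 y hy]; ring
  simp_rw [e, e0]
  refine tendsto_integral_of_dominated_convergence (fun y => C * |(Icc (-R) R).indicator G y|) ?_
    (hGi.abs.const_mul C) ?_ ?_
  · intro n
    refine AEStronglyMeasurable.mul ?_ hGi.aestronglyMeasurable
    exact (km_cont (ρ_test n) (hη n).locallyIntegrable).aestronglyMeasurable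
  · intro n
    refine Eventually.of_forall fun y => ?_
    rw [Real.norm_eq_abs, abs_mul]
    exact mul_le_mul_of_nonneg_right (km_bound hC0 fun z _ => hC n z) (abs_nonneg _)
  · refine Eventually.of_forall fun y => ?_
    exact (km_tendsto_var hη y (h y)).mul_const _

/-- plain dominated convergence on compact sets -/
lemma dct_row {η : ℕ → ℝ → ℝ} {η₀ : ℝ → ℝ} {r C : ℝ} (hη : ∀ n, Continuous (η n))
    (hη0 : ∀ n x, r < |x| → η n x = 0) (hC : ∀ n x, |η n x| ≤ C)
    (h : ∀ x, Tendsto (fun n => η n x) atTop (𝓝 (η₀ x))) :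
    Tendsto (fun n => ∫ x, η n x) atTop (𝓝 (∫ x, η₀ x)) := by
  have hC0 : 0 ≤ C := (abs_nonneg _).trans (hC 0 0)
  refine tendsto_integral_of_dominated_convergence ((Icc (-r) r).indicator fun _ => C)
    (fun n => (hη n).aestronglyMeasurable) ?_ ?_ (Eventually.of_forall h)
  · exact (integrableOn_const (by simp)).integrable_indicator measurableSet_Icc
  · intro n
    refine Eventually.of_forall fun x => ?_
    by_cases hx : x ∈ Icc (-r) r
    · rw [indicator_of_mem hx]; exact hC n x
    · rw [indicator_of_notMem hx, hη0 n x]; simp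
      by_contra hc; exact hx (abs_le.1 (not_lt.1 hc))

/-- Fatou for real integrals -/
lemma fatou_real {X : Type*} [MeasurableSpace X] {ν : Measure X} {h : ℕ → X → ℝ} {h₀ : X → ℝ}
    {Λ : ℕ → ℝ} {Λ₀ : ℝ} (hi : ∀ n, Integrable (h n) ν) (h0 : ∀ n, 0 ≤ᵐ[ν] h n)
    (hle : ∀ n, ∫ x, h n x ∂ν ≤ Λ n) (hΛ : Tendsto Λ atTop (𝓝 Λ₀))
    (ht : ∀ᵐ x ∂ν, Tendsto (fun n => h n x) atTop (𝓝 (h₀ x))) :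
    Integrable h₀ ν ∧ ∫ x, h₀ x ∂ν ≤ Λ₀ := by
  have hm : AEStronglyMeasurable h₀ ν :=
    aestronglyMeasurable_of_tendsto_ae atTop (fun n => (hi n).aestronglyMeasurable) ht
  have hnn : 0 ≤ᵐ[ν] h₀ := by
    have : ∀ᵐ x ∂ν, ∀ n, 0 ≤ h n x := ae_all_iff.2 h0
    filter_upwards [this, ht] with x hx hx2
    exact ge_of_tendsto' hx2 hx
  have hΛ0 : 0 ≤ Λ₀ := ge_of_tendsto' hΛ fun n =>
    (integral_nonneg_of_ae (h0 n)).trans (hle n)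
  have key : ∫⁻ x, ENNReal.ofReal (h₀ x) ∂ν ≤ ENNReal.ofReal Λ₀ := by
    calc ∫⁻ x, ENNReal.ofReal (h₀ x) ∂ν
        = ∫⁻ x, liminf (fun n => ENNReal.ofReal (h n x)) atTop ∂ν := by
          refine lintegral_congr_ae ?_
          filter_upwards [ht] with x hx
          exact ((ENNReal.continuous_ofReal.tendsto _).comp hx).liminf_eq.symm
      _ ≤ liminf (fun n => ∫⁻ x, ENNReal.ofReal (h n x) ∂ν) atTop :=
          lintegral_liminf_le' fun n => (hi n).aemeasurable.ennreal_ofReal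
      _ ≤ liminf (fun n => ENNReal.ofReal (Λ n)) atTop := by
          refine liminf_le_liminf (Eventually.of_forall fun n => ?_)
          rw [← ofReal_integral_eq_lintegral_ofReal (hi n) (h0 n)]
          exact ENNReal.ofReal_le_ofReal (hle n)
      _ = ENNReal.ofReal Λ₀ := ((ENNReal.continuous_ofReal.tendsto _).comp hΛ).liminf_eq
  have hintg : Integrable h₀ ν := by
    refine ⟨hm, ?_⟩
    rw [hasFiniteIntegral_iff_ofReal hnn]
    exact lt_of_le_of_lt key ENNReal.ofReal_lt_top
  refine ⟨hintg, ?_⟩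
  rw [← ofReal_integral_eq_lintegral_ofReal hintg hnn] at key
  exact (ENNReal.ofReal_le_ofReal_iff hΛ0).1 key

/-- Cauchy-Schwarz on an interval -/
lemma sq_integral_le {r : ℝ} (hr : 0 < r) {h : ℝ → ℝ} (hh : IntegrableOn h (Icc (-r) r))
    (h2 : IntegrableOn (fun x => h x ^ 2) (Icc (-r) r)) :
    (∫ x in Icc (-r) r, h x) ^ 2 ≤ 2 * r * ∫ x in Icc (-r) r, h x ^ 2 := by
  set c := (∫ x in Icc (-r) r, h x) / (2 * r) with hc
  have hv : (volume.real (Icc (-r) r)) = 2 * r := by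
    rw [Real.volume_real_Icc_of_le (by linarith)]; ring
  have h0 : 0 ≤ ∫ x in Icc (-r) r, (h x - c) ^ 2 := integral_nonneg fun x => sq_nonneg _
  have e : ∫ x in Icc (-r) r, (h x - c) ^ 2
      = (∫ x in Icc (-r) r, h x ^ 2) - 2 * c * (∫ x in Icc (-r) r, h x) + c ^ 2 * (2 * r) := by
    have : (fun x => (h x - c) ^ 2) = fun x => (h x ^ 2 - 2 * c * h x) + c ^ 2 := by
      funext x; ring
    have i2 : IntegrableOn (fun x => 2 * c * h x) (Icc (-r) r) := hh.const_mul _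
    have i1 : IntegrableOn (fun x => h x ^ 2 - 2 * c * h x) (Icc (-r) r) := h2.sub i2
    rw [this, integral_add i1 (integrableOn_const (by simp)),
      integral_sub h2 i2, integral_const_mul, setIntegral_const, hv]
    simp [mul_comm]
  rw [e] at h0
  have e2 : (∫ x in Icc (-r) r, h x) = c * (2 * r) := by rw [hc]; field_simp
  rw [e2] at h0 ⊢
  nlinarith

end RegAux

namespace RegAux
open Set Topology
open scoped ContDiff

noncomputable def Lf (μ : ℝ) (ψ : ℝ → ℝ) (d F S : ℝ → ℝ → ℝ) (t : ℝ) : ℝ :=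
  μ * (∫ x, deriv (deriv ψ) x * d t x) + (∫ x, deriv ψ x * F t x) + ∫ x, ψ x * S t x

/-- the convex functions used in energy estimates -/
structure JJ (B : ℝ) (j j1 j2 : ℝ → ℝ) : Prop where
  d1 : ∀ s, HasDerivAt j (j1 s) s
  d2 : ∀ s, HasDerivAt j1 (j2 s) s
  c2 : Continuous j2
  n2 : ∀ s, 0 ≤ j2 s
  le : ∀ s, j2 s ≤ B
  z : j 0 = 0
  z1 : j1 0 = 0

namespace JJ
variable {B : ℝ} {j j1 j2 : ℝ → ℝ}
lemma B0 (h : JJ B j j1 j2) : 0 ≤ B := (h.n2 0).trans (h.le 0)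
lemma c (h : JJ B j j1 j2) : Continuous j :=
  continuous_iff_continuousAt.2 fun s => (h.d1 s).continuousAt
lemma c1 (h : JJ B j j1 j2) : Continuous j1 :=
  continuous_iff_continuousAt.2 fun s => (h.d2 s).continuousAt
lemma b1 (h : JJ B j j1 j2) (s : ℝ) : |j1 s| ≤ B * |s| := by
  have := Convex.norm_image_sub_le_of_norm_hasDerivWithin_le (f := j1) (f' := j2) (s := univ)
    (x := 0) (y := s) (C := B) (fun x _ => (h.d2 x).hasDerivWithinAt)
    (fun x _ => by rw [Real.norm_eq_abs, abs_of_nonneg (h.n2 x)]; exact h.le x) convex_univ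
    (mem_univ _) (mem_univ _)
  simpa [h.z1] using this
lemma b0 (h : JJ B j j1 j2) (s : ℝ) : |j s| ≤ B * s ^ 2 := by
  have := Convex.norm_image_sub_le_of_norm_hasDerivWithin_le (f := j) (f' := j1)
    (s := Icc (-|s|) |s|)
    (x := 0) (y := s) (C := B * |s|) (fun x _ => (h.d1 x).hasDerivWithinAt)
    (fun x hx => by
      rw [Real.norm_eq_abs]
      exact (h.b1 x).trans (mul_le_mul_of_nonneg_left (abs_le.2 hx) h.B0)) (convex_Icc _ _)
    (by simp) (abs_le.1 le_rfl)
  rw [h.z] at this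
  simp only [sub_zero, Real.norm_eq_abs] at this
  calc |j s| ≤ B * |s| * |s| := this
    _ = B * s ^ 2 := by rw [mul_assoc, ← sq, sq_abs]
end JJ

structure EL (μ r' t1 t2 : ℝ) (d F S : ℝ → ℝ → ℝ) (b : ℝ → ℝ) : Prop where
  μ0 : 0 < μ
  t12 : t1 ≤ t2
  dm : Measurable (Function.uncurry d)
  Fm : Measurable (Function.uncurry F)
  Sm : Measurable (Function.uncurry S)
  dC : ∀ t ∈ Icc t1 t2, ContDiff ℝ 1 (d t)
  Fl : ∀ t ∈ Icc t1 t2, LocallyIntegrable (F t)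
  F2 : ∀ t ∈ Icc t1 t2, LocallyIntegrable (fun x => F t x ^ 2)
  Sl : ∀ t ∈ Icc t1 t2, LocallyIntegrable (S t)
  bi : IntegrableOn b (Icc t1 t2)
  bd : ∀ t ∈ Icc t1 t2, ∫ x in Icc (-r') r', d t x ^ 2 ≤ b t
  bF : ∀ t ∈ Icc t1 t2, ∫ x in Icc (-r') r', F t x ^ 2 ≤ b t
  bS : ∀ t ∈ Icc t1 t2, ∀ x ∈ Icc (-r') r', |d t x| * ∫ y in Icc (-r') r', |S t y| ≤ b t
  wi : ∀ ψ, Test r' ψ → ∀ t ∈ Icc t1 t2,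
    HasDerivAt (fun s => ∫ x, ψ x * d s x) (Lf μ ψ d F S t) t
  wc : ∀ ψ, Test r' ψ → ContinuousOn (Lf μ ψ d F S) (Icc t1 t2)

/-- km bound by local L1 norm -/
lemma km_loc_le {ε : ℝ} {k h : ℝ → ℝ} (hk : Test ε k) (hh : LocallyIntegrable h) {x r r' C : ℝ}
    (hx : |x| ≤ r) (hr : r + ε ≤ r') (hC : ∀ x, |k x| ≤ C) :
    |km k h x| ≤ C * ∫ y in Icc (-r') r', |h y| :=
  abs_integral_mul_le (hk.trans hx hr).2 (fun y => hC _) (hh.integrableOn_isCompact isCompact_Icc)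

/-- the approximate time derivative -/
noncomputable def An (n : ℕ) (μ : ℝ) (d F S : ℝ → ℝ → ℝ) (t x : ℝ) : ℝ :=
  μ * km (deriv (deriv (ρ n))) (d t) x - km (deriv (ρ n)) (F t) x + km (ρ n) (S t) x

lemma An_eq (n : ℕ) (μ : ℝ) (d F S : ℝ → ℝ → ℝ) (t x : ℝ) :
    Lf μ (fun y => ρ n (x - y)) d F S t = An n μ d F S t x := by
  have e1 : deriv (fun y => ρ n (x - y)) = fun y => - deriv (ρ n) (x - y) := by
    funext y; rw [deriv_comp_const_sub]
  have e2 : deriv (deriv (fun y => ρ n (x - y))) = fun y => deriv (deriv (ρ n)) (x - y) := by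
    rw [e1]; funext y
    have : deriv (fun y => - deriv (ρ n) (x - y)) y = - deriv (fun y => deriv (ρ n) (x - y)) y :=
      deriv.fun_neg
    rw [this, deriv_comp_const_sub, neg_neg]
  unfold Lf An km
  rw [e2, e1]
  have : ∫ y, -deriv (ρ n) (x - y) * F t y = - ∫ y, deriv (ρ n) (x - y) * F t y := by
    rw [← integral_neg]; congr 1; funext y; ring
  simp only [this]; ring

/-- row estimate -/
lemma row_est {n : ℕ} {μ r B : ℝ} (μ0 : 0 < μ) {d F S : ℝ → ℝ → ℝ} {t : ℝ} {j j1 j2 ψ : ℝ → ℝ}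
    (hj : JJ B j j1 j2) (hψ : Test r ψ) (hψ0 : ∀ x, 0 ≤ ψ x)
    (dl : LocallyIntegrable (d t)) (Fl : LocallyIntegrable (F t))
    (F2 : LocallyIntegrable (fun x => F t x ^ 2)) (Sl : LocallyIntegrable (S t)) :
    ∫ x, ψ x * (j1 (km (ρ n) (d t) x) * An n μ d F S t x) ≤
      μ * (∫ x, deriv (deriv ψ) x * j (km (ρ n) (d t) x))
      - μ / 2 * (∫ x, ψ x * (j2 (km (ρ n) (d t) x) * km (deriv (ρ n)) (d t) x ^ 2))
      + 1 / (2 * μ) * (∫ x, ψ x * j2 (km (ρ n) (d t) x) * km (ρ n) (fun y => F t y ^ 2) x)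
      + (∫ x, deriv ψ x * j1 (km (ρ n) (d t) x) * km (ρ n) (F t) x)
      + ∫ x, ψ x * j1 (km (ρ n) (d t) x) * km (ρ n) (S t) x := by
  have T0 := ρ_test n
  have T1 := T0.der
  have T2 := T1.der
  set D := km (ρ n) (d t) with hD
  set Dx := km (deriv (ρ n)) (d t) with hDx
  set Dxx := km (deriv (deriv (ρ n))) (d t) with hDxx
  set K := km (ρ n) (F t) with hK
  set Kx := km (deriv (ρ n)) (F t) with hKx
  set K2 := km (ρ n) (fun y => F t y ^ 2) with hK2
  set Z := km (ρ n) (S t) with hZ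
  have cD : Continuous D := km_cont T0 dl
  have cDx : Continuous Dx := km_cont T1 dl
  have cDxx : Continuous Dxx := km_cont T2 dl
  have cK : Continuous K := km_cont T0 Fl
  have cKx : Continuous Kx := km_cont T1 Fl
  have cK2 : Continuous K2 := km_cont T0 F2
  have cZ : Continuous Z := km_cont T0 Sl
  have dD : ∀ x, HasDerivAt D (Dx x) x := km_hasDeriv T0 dl
  have dDx : ∀ x, HasDerivAt Dx (Dxx x) x := km_hasDeriv T1 dl
  have dK : ∀ x, HasDerivAt K (Kx x) x := km_hasDeriv T0 Fl
  have cj := hj.c.comp cD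
  have cj1 := hj.c1.comp cD
  have cj2 := hj.c2.comp cD
  simp only [Function.comp_def] at cj cj1 cj2
  have dj : ∀ x, HasDerivAt (fun x => j (D x)) (j1 (D x) * Dx x) x := fun x =>
    (hj.d1 (D x)).comp x (dD x)
  have dj1 : ∀ x, HasDerivAt (fun x => j1 (D x)) (j2 (D x) * Dx x) x := fun x =>
    (hj.d2 (D x)).comp x (dD x)
  -- IBPs
  have I1 := hψ.der.ibp dj (cj1.mul cDx)
  have I2 := hψ.ibp (fun x => (dj1 x).mul (dDx x)) (((cj2.mul cDx).mul cDx).add (cj1.mul cDxx))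
  have I3 := hψ.ibp (fun x => (dj1 x).mul (dK x)) (((cj2.mul cDx).mul cK).add (cj1.mul cKx))
  have iA : Integrable fun x => ψ x * (j1 (D x) * Dxx x) := hψ.integrable_mul_cont (cj1.mul cDxx)
  have iB : Integrable fun x => ψ x * (j2 (D x) * Dx x ^ 2) :=
    hψ.integrable_mul_cont (cj2.mul (cDx.pow 2))
  have iC : Integrable fun x => ψ x * (j1 (D x) * Kx x) := hψ.integrable_mul_cont (cj1.mul cKx)
  have iE : Integrable fun x => ψ x * (j2 (D x) * Dx x * K x) :=
    hψ.integrable_mul_cont ((cj2.mul cDx).mul cK)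
  have iG : Integrable fun x => ψ x * (j1 (D x) * Z x) := hψ.integrable_mul_cont (cj1.mul cZ)
  have iH : Integrable fun x => ψ x * (j2 (D x) * K2 x) := hψ.integrable_mul_cont (cj2.mul cK2)
  have E2 : ∫ x, ψ x * (j2 (D x) * Dx x * Dx x + j1 (D x) * Dxx x)
      = (∫ x, ψ x * (j2 (D x) * Dx x ^ 2)) + ∫ x, ψ x * (j1 (D x) * Dxx x) := by
    rw [← integral_add iB iA]; congr 1; funext x; ring
  have E3 : ∫ x, ψ x * (j2 (D x) * Dx x * K x + j1 (D x) * Kx x)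
      = (∫ x, ψ x * (j2 (D x) * Dx x * K x)) + ∫ x, ψ x * (j1 (D x) * Kx x) := by
    rw [← integral_add iE iC]; congr 1; funext x; ring
  have E0 : ∫ x, ψ x * (j1 (D x) * An n μ d F S t x)
      = μ * (∫ x, ψ x * (j1 (D x) * Dxx x)) - (∫ x, ψ x * (j1 (D x) * Kx x))
        + ∫ x, ψ x * (j1 (D x) * Z x) := by
    have i' : Integrable fun x => μ * (ψ x * (j1 (D x) * Dxx x)) - ψ x * (j1 (D x) * Kx x) :=
      (iA.const_mul μ).sub iC
    rw [← integral_const_mul, ← integral_sub (iA.const_mul μ) iC, ← integral_add i' iG]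
    congr 1; funext x; simp only [An]; ring
  have E4 : ∫ x, ψ x * (j2 (D x) * Dx x * K x) ≤ μ / 2 * (∫ x, ψ x * (j2 (D x) * Dx x ^ 2))
      + 1 / (2 * μ) * (∫ x, ψ x * (j2 (D x) * K2 x)) := by
    rw [← integral_const_mul, ← integral_const_mul, ← integral_add (iB.const_mul _) (iH.const_mul _)]
    refine integral_mono iE ((iB.const_mul _).add (iH.const_mul _)) fun x => ?_
    have h1 := km_young (n := n) Fl F2 μ0 (Dx x) x
    have h2 := mul_le_mul_of_nonneg_left h1 (mul_nonneg (hψ0 x) (hj.n2 (D x)))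
    simp only [← hK, ← hK2] at h2
    linarith
  have R1 : ∫ x, deriv ψ x * j1 (D x) * K x = ∫ x, deriv ψ x * (j1 (D x) * K x) := by
    congr 1; funext x; ring
  have R2 : ∫ x, ψ x * j2 (D x) * K2 x = ∫ x, ψ x * (j2 (D x) * K2 x) := by
    congr 1; funext x; ring
  have R3 : ∫ x, ψ x * j1 (D x) * Z x = ∫ x, ψ x * (j1 (D x) * Z x) := by
    congr 1; funext x; ring
  have R4 : ∫ x, deriv ψ x * (j1 (D x) * Dx x) = - ∫ x, deriv (deriv ψ) x * j (D x) := I1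
  have I2' : ∫ x, ψ x * (j2 (D x) * Dx x * Dx x + j1 (D x) * Dxx x)
     = - ∫ x, deriv ψ x * (j1 (D x) * Dx x) := I2
  have I3' : ∫ x, ψ x * (j2 (D x) * Dx x * K x + j1 (D x) * Kx x)
     = - ∫ x, deriv ψ x * (j1 (D x) * K x) := I3
  rw [R1, R2, R3, E0]
  rw [E2] at I2'
  rw [E3] at I3'
  have : ∫ x, ψ x * (j1 (D x) * Dxx x) =
    (∫ x, deriv (deriv ψ) x * j (D x)) - ∫ x, ψ x * (j2 (D x) * Dx x ^ 2) := by linarith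
  rw [this]
  linarith
end RegAux

namespace RegAux
open Set Topology
open scoped ContDiff

noncomputable def Rg (μ : ℝ) (ψ j j1 j2 : ℝ → ℝ) (θ1 θ0 : ℝ) (D K2 K Z : ℝ → ℝ) : ℝ :=
  θ1 * (∫ x, ψ x * j (D x)) + θ0 * (μ * (∫ x, deriv (deriv ψ) x * j (D x))
    + 1 / (2 * μ) * (∫ x, ψ x * j2 (D x) * K2 x) + (∫ x, deriv ψ x * j1 (D x) * K x)
    + ∫ x, ψ x * j1 (D x) * Z x)

lemma meas_row {f : ℝ → ℝ → ℝ} (hf : Measurable (Function.uncurry f)) :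
    Measurable (fun t => ∫ x, f t x) :=
  (StronglyMeasurable.integral_prod_right (f := f) hf.stronglyMeasurable).measurable

/-- row domination -/
lemma row_dom {n : ℕ} {η f G : ℝ → ℝ} {r r' C : ℝ} (hη : Continuous η)
    (hη0 : ∀ x, r < |x| → η x = 0) (hr : r + 1 / ((n:ℝ) + 1) ≤ r') (hC : ∀ x, |η x| ≤ C)
    (hG : LocallyIntegrable G) (hG0 : ∀ x, 0 ≤ G x)
    (hf : ∀ x, |f x| ≤ |η x| * km (ρ n) G x) :
    |∫ x, f x| ≤ C * ∫ x in Icc (-r') r', G x := by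
  have h1 : |∫ x, f x| ≤ ∫ x, |η x| * km (ρ n) G x := by
    rw [← Real.norm_eq_abs]
    refine norm_integral_le_of_norm_le ?_ (Eventually.of_forall fun x => by
      rw [Real.norm_eq_abs]; exact hf x)
    refine (hη.abs.mul (km_cont (ρ_test n) hG)).integrable_of_hasCompactSupport ?_
    refine HasCompactSupport.intro (isCompact_Icc (a := -r) (b := r)) fun x hx => ?_
    have : r < |x| := by
      by_contra hc
      exact hx (abs_le.1 (not_lt.1 hc))
    simp [hη0 x this]
  refine h1.trans ((le_abs_self _).trans ?_)
  have h2 := adj_bound (n := n) (η := fun x => |η x|) (G := G) (r := r) (r' := r') (C := C) hη.abs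
    (fun x hx => by simp [hη0 x hx]) hr (fun x => by simpa using hC x) hG
  have e : ∫ x in Icc (-r') r', |G x| = ∫ x in Icc (-r') r', G x := by
    congr 1; funext x; exact abs_of_nonneg (hG0 x)
  rwa [e] at h2

section
variable {μ r r' t1 t2 B : ℝ} {d F S : ℝ → ℝ → ℝ} {b : ℝ → ℝ} {j j1 j2 ψ : ℝ → ℝ}

lemma EL.b0 (h : EL μ r' t1 t2 d F S b) {t : ℝ} (ht : t ∈ Icc t1 t2) : 0 ≤ b t :=
  (integral_nonneg fun x => sq_nonneg _).trans (h.bd t ht)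

lemma EL.d2 (h : EL μ r' t1 t2 d F S b) {t : ℝ} (ht : t ∈ Icc t1 t2) :
    LocallyIntegrable (fun x => d t x ^ 2) := ((h.dC t ht).continuous.pow 2).locallyIntegrable

lemma EL.dl (h : EL μ r' t1 t2 d F S b) {t : ℝ} (ht : t ∈ Icc t1 t2) :
    LocallyIntegrable (d t) := (h.dC t ht).continuous.locallyIntegrable

/-- uniform row bound -/
lemma EL.row_bound (h : EL μ r' t1 t2 d F S b) (hj : JJ B j j1 j2) (hψ : Test r ψ)
    {Θ C : ℝ} (hC0 : ∀ x, |ψ x| ≤ C) (hC1 : ∀ x, |deriv ψ x| ≤ C)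
    (hC2 : ∀ x, |deriv (deriv ψ) x| ≤ C)
    {n : ℕ} (hr : r + 1 / ((n:ℝ) + 1) ≤ r') (hr0 : 0 < r') {t : ℝ} (ht : t ∈ Icc t1 t2) {θ1 θ0 : ℝ}
    (hθ1 : |θ1| ≤ Θ) (hθ0 : |θ0| ≤ Θ) :
    |Rg μ ψ j j1 j2 θ1 θ0 (km (ρ n) (d t)) (km (ρ n) (fun y => F t y ^ 2))
      (km (ρ n) (F t)) (km (ρ n) (S t))| ≤
      Θ * (C * B * (1 + μ + 1 / (2 * μ) + 1 + 1)) * b t := by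
  have hB := h.b0 ht
  have hB0 := hj.B0
  have μ0 := h.μ0
  have hCn : 0 ≤ C := (abs_nonneg _).trans (hC0 0)
  have hΘ : 0 ≤ Θ := (abs_nonneg _).trans hθ1
  have T0 := ρ_test n
  have dl := h.dl ht
  have d2 := h.d2 ht
  have cD := km_cont T0 dl
  have cb : 0 ≤ C * B := by positivity
  -- a1
  have a1 : ∀ η : ℝ → ℝ, Test r η → (∀ x, |η x| ≤ C) →
      |∫ x, η x * j (km (ρ n) (d t) x)| ≤ C * B * b t := by
    intro η hη hC
    refine (row_dom (η := fun x => η x * B) (C := C * B) (hη.cont.mul_const B)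
      (fun x hx => by simp [hη.2 x hx]) hr (fun x => ?_) d2 (fun x => sq_nonneg _)
      (fun x => ?_)).trans (mul_le_mul_of_nonneg_left (h.bd t ht) cb)
    · rw [abs_mul, abs_of_nonneg hB0]; exact mul_le_mul_of_nonneg_right (hC x) hB0
    · rw [abs_mul, abs_mul, abs_of_nonneg hB0, mul_assoc]
      refine mul_le_mul_of_nonneg_left ?_ (abs_nonneg _)
      exact (hj.b0 _).trans (mul_le_mul_of_nonneg_left (km_sq_le dl d2 x) hB0)
  have a2 : |∫ x, ψ x * j2 (km (ρ n) (d t) x) * km (ρ n) (fun y => F t y ^ 2) x| ≤ C * B * b t := by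
    have := adj_bound (n := n) (η := fun x => ψ x * j2 (km (ρ n) (d t) x)) (r := r) (r' := r')
      (C := C * B) (hψ.cont.mul (hj.c2.comp cD)) (fun x hx => by simp [hψ.2 x hx]) hr (fun x => by
        rw [abs_mul, abs_of_nonneg (hj.n2 _)]
        exact mul_le_mul (hC0 x) (hj.le _) (hj.n2 _) hCn) (h.F2 t ht)
    refine this.trans (mul_le_mul_of_nonneg_left ?_ cb)
    refine le_trans (le_of_eq ?_) (h.bF t ht)
    congr 1; funext x; exact abs_of_nonneg (sq_nonneg _)
  have a3 : |∫ x, deriv ψ x * j1 (km (ρ n) (d t) x) * km (ρ n) (F t) x| ≤ C * B * b t := by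
    have hG : LocallyIntegrable (fun y => d t y ^ 2 + F t y ^ 2) := d2.add (h.F2 t ht)
    have := row_dom (n := n) (η := fun x => deriv ψ x * (B / 2)) (r := r) (r' := r')
      (G := fun y => d t y ^ 2 + F t y ^ 2)
      (f := fun x => deriv ψ x * j1 (km (ρ n) (d t) x) * km (ρ n) (F t) x)
      (C := C * (B / 2)) (hψ.der.cont.mul_const _) (fun x hx => by simp [hψ.der.2 x hx]) hr
      (fun x => by
        rw [abs_mul, abs_of_nonneg ((by linarith : (0:ℝ) ≤ B / 2))]
        exact mul_le_mul_of_nonneg_right (hC1 x) (by linarith)) hG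
      (fun x => by positivity) (fun x => by
        rw [abs_mul, abs_mul, abs_mul, abs_of_nonneg ((by linarith : (0:ℝ) ≤ B / 2)), mul_assoc, mul_assoc]
        refine mul_le_mul_of_nonneg_left ?_ (abs_nonneg _)
        have e : km (ρ n) (fun y => d t y ^ 2 + F t y ^ 2) x
          = km (ρ n) (fun y => d t y ^ 2) x + km (ρ n) (fun y => F t y ^ 2) x := by
          unfold km
          rw [← integral_add (km_integrable T0 d2 x) (km_integrable T0 (h.F2 t ht) x)]
          congr 1; funext y; ring
        rw [e]
        have h1 := km_sq_le (n := n) dl d2 x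
        have h2 := km_sq_le (n := n) (h.Fl t ht) (h.F2 t ht) x
        have h3 := hj.b1 (km (ρ n) (d t) x)
        have h4 := two_mul_le_add_sq |km (ρ n) (d t) x| |km (ρ n) (F t) x|
        rw [sq_abs, sq_abs] at h4
        calc |j1 (km (ρ n) (d t) x)| * |km (ρ n) (F t) x|
            ≤ B * |km (ρ n) (d t) x| * |km (ρ n) (F t) x| :=
              mul_le_mul_of_nonneg_right h3 (abs_nonneg _)
          _ = B / 2 * (2 * |km (ρ n) (d t) x| * |km (ρ n) (F t) x|) := by ring
          _ ≤ _ := mul_le_mul_of_nonneg_left (by linarith) (by linarith))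
    refine this.trans ?_
    have e : ∫ x in Icc (-r') r', (d t x ^ 2 + F t x ^ 2) =
        (∫ x in Icc (-r') r', d t x ^ 2) + ∫ x in Icc (-r') r', F t x ^ 2 :=
      integral_add (d2.integrableOn_isCompact isCompact_Icc)
        ((h.F2 t ht).integrableOn_isCompact isCompact_Icc)
    rw [e]
    have h1 := h.bd t ht
    have h2 := h.bF t ht
    calc C * (B / 2) * _ ≤ C * (B / 2) * (b t + b t) :=
          mul_le_mul_of_nonneg_left (by linarith) (by positivity)
      _ = _ := by ring
  have a4 : |∫ x, ψ x * j1 (km (ρ n) (d t) x) * km (ρ n) (S t) x| ≤ C * B * b t := by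
    obtain ⟨x0, hx0, hmax⟩ := (isCompact_Icc (a := -r') (b := r')).exists_isMaxOn
      (nonempty_Icc.2 (by linarith)) (h.dC t ht).continuous.abs.continuousOn
    have := adj_bound (n := n) (η := fun x => ψ x * j1 (km (ρ n) (d t) x)) (r := r) (r' := r')
      (C := C * (B * |d t x0|)) (hψ.cont.mul (hj.c1.comp cD)) (fun x hx => by simp [hψ.2 x hx]) hr
      (fun x => by
        by_cases hx : r < |x|
        · simp only [hψ.2 x hx]; simp; positivity
        rw [abs_mul]
        refine mul_le_mul (hC0 x) ((hj.b1 _).trans (mul_le_mul_of_nonneg_left ?_ hB0))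
          (abs_nonneg _) hCn
        refine km_bound (abs_nonneg _) fun y hy => ?_
        have : |y| ≤ r' := by
          have := abs_sub_abs_le_abs_sub y x
          rw [abs_sub_comm] at this
          linarith
        exact hmax (abs_le.1 this)) (h.Sl t ht)
    refine this.trans ?_
    calc C * (B * |d t x0|) * (∫ x in Icc (-r') r', |S t x|)
        = C * B * (|d t x0| * ∫ x in Icc (-r') r', |S t x|) := by ring
      _ ≤ _ := mul_le_mul_of_nonneg_left (h.bS t ht x0 hx0) cb
  have b1 := a1 ψ hψ hC0
  have b2 := a1 _ hψ.der.der hC2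
  unfold Rg
  set X1 := ∫ x, ψ x * j (km (ρ n) (d t) x)
  set X2 := ∫ x, deriv (deriv ψ) x * j (km (ρ n) (d t) x)
  set X3 := ∫ x, ψ x * j2 (km (ρ n) (d t) x) * km (ρ n) (fun y => F t y ^ 2) x
  set X4 := ∫ x, deriv ψ x * j1 (km (ρ n) (d t) x) * km (ρ n) (F t) x
  set X5 := ∫ x, ψ x * j1 (km (ρ n) (d t) x) * km (ρ n) (S t) x
  set c := C * B * b t with hc
  have c0 : 0 ≤ c := by positivity
  have hin : |μ * X2 + 1 / (2 * μ) * X3 + X4 + X5| ≤ (μ + 1 / (2 * μ) + 1 + 1) * c := by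
    have e1 : |μ * X2| ≤ μ * c := by
      rw [abs_mul, abs_of_pos μ0]; exact mul_le_mul_of_nonneg_left b2 μ0.le
    have e2 : |1 / (2 * μ) * X3| ≤ 1 / (2 * μ) * c := by
      rw [abs_mul, abs_of_pos (by positivity : 0 < 1 / (2 * μ))]
      exact mul_le_mul_of_nonneg_left a2 (by positivity)
    calc |μ * X2 + 1 / (2 * μ) * X3 + X4 + X5| ≤ |μ * X2| + |1 / (2 * μ) * X3| + |X4| + |X5| := by
          refine (abs_add_le _ _).trans (add_le_add_left ?_ _)
          refine (abs_add_le _ _).trans (add_le_add_left ?_ _)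
          exact abs_add_le _ _
      _ ≤ _ := by linarith
  calc |θ1 * X1 + θ0 * (μ * X2 + 1 / (2 * μ) * X3 + X4 + X5)|
      ≤ |θ1| * |X1| + |θ0| * |μ * X2 + 1 / (2 * μ) * X3 + X4 + X5| := by
        refine (abs_add_le _ _).trans ?_
        rw [abs_mul, abs_mul]
    _ ≤ Θ * c + Θ * ((μ + 1 / (2 * μ) + 1 + 1) * c) :=
        add_le_add (mul_le_mul hθ1 b1 (abs_nonneg _) hΘ) (mul_le_mul hθ0 hin (abs_nonneg _) hΘ)
    _ = _ := by rw [hc]; ring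

end
end RegAux

namespace RegAux
open Set Topology
open scoped ContDiff

section
variable {μ r r' t1 t2 B : ℝ} {j j1 j2 ψ : ℝ → ℝ}

lemma inv_le_one_nat (n : ℕ) : 1 / ((n:ℝ) + 1) ≤ 1 := by
  rw [div_le_one (by positivity)]; linarith [n.cast_nonneg (α := ℝ)]

lemma km_row_bdd {h : ℝ → ℝ} (hh : Continuous h) (r : ℝ) :
    ∃ C, 0 ≤ C ∧ ∀ (n : ℕ) x, |x| ≤ r → |km (ρ n) h x| ≤ C := by
  obtain ⟨C, hC⟩ := (isCompact_Icc (a := -(r+1)) (b := r+1)).exists_bound_of_continuousOn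
    hh.continuousOn
  refine ⟨max C 0, le_max_right _ _, fun n x hx => km_bound (le_max_right _ _) fun y hy => ?_⟩
  have : |y| ≤ r + 1 := by
    have h1 := abs_sub_abs_le_abs_sub y x
    rw [abs_sub_comm] at h1
    linarith [inv_le_one_nat n]
  exact (hC y (abs_le.1 this)).trans (le_max_left _ _)

lemma row_conv_j {h : ℝ → ℝ} (hh : Continuous h) {η k : ℝ → ℝ} (hη : Test r η) (hk : Continuous k) :
    Tendsto (fun n => ∫ x, η x * k (km (ρ n) h x)) atTop (𝓝 (∫ x, η x * k (h x))) := by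
  obtain ⟨C, hC0, hC⟩ := km_row_bdd hh r
  obtain ⟨C1, hC10, hC1⟩ := hη.bdd
  obtain ⟨C2, hC2⟩ := (isCompact_Icc (a := -C) (b := C)).exists_bound_of_continuousOn
    hk.continuousOn
  refine dct_row (r := r) (C := C1 * C2) (fun n => hη.cont.mul (hk.comp (km_cont (ρ_test n)
    hh.locallyIntegrable))) (fun n x hx => by simp [hη.2 x hx]) (fun n x => ?_) (fun x => ?_)
  · have hC20 : 0 ≤ C2 := (norm_nonneg _).trans (hC2 0 (by constructor <;> linarith))
    by_cases hx : r < |x|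
    · simp [hη.2 x hx]; positivity
    · rw [abs_mul]
      exact mul_le_mul (hC1 x) (hC2 _ (abs_le.1 (hC n x (not_lt.1 hx)))) (abs_nonneg _) hC10
  · exact ((hk.tendsto _).comp (km_tendsto hh x)).const_mul _

lemma row_conv_jG {h : ℝ → ℝ} (hh : Continuous h) {η k G : ℝ → ℝ} (hη : Test r η)
    (hk : Continuous k) (hG : LocallyIntegrable G) :
    Tendsto (fun n => ∫ x, η x * k (km (ρ n) h x) * km (ρ n) G x) atTop
      (𝓝 (∫ x, η x * k (h x) * G x)) := by
  obtain ⟨C, hC0, hC⟩ := km_row_bdd hh r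
  obtain ⟨C1, hC10, hC1⟩ := hη.bdd
  obtain ⟨C2, hC2⟩ := (isCompact_Icc (a := -C) (b := C)).exists_bound_of_continuousOn
    hk.continuousOn
  refine adj_tendsto (η := fun n x => η x * k (km (ρ n) h x)) (η₀ := fun x => η x * k (h x))
    (r := r) (C := C1 * C2) (fun n => hη.cont.mul (hk.comp (km_cont (ρ_test n)
    hh.locallyIntegrable))) (fun n x hx => by simp [hη.2 x hx]) (fun n x => ?_) hG (fun x => ?_)
  · have hC20 : 0 ≤ C2 := (norm_nonneg _).trans (hC2 0 (by constructor <;> linarith))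
    by_cases hx : r < |x|
    · simp [hη.2 x hx]; positivity
    · rw [abs_mul]
      exact mul_le_mul (hC1 x) (hC2 _ (abs_le.1 (hC n x (not_lt.1 hx)))) (abs_nonneg _) hC10
  · have h1 : Tendsto (fun p : ℕ × ℝ => η p.2) ((atTop : Filter ℕ) ×ˢ 𝓝 x) (𝓝 (η x)) :=
      Tendsto.comp (g := η) (hη.cont.tendsto x) tendsto_snd
    have h2 : Tendsto (fun p : ℕ × ℝ => k (km (ρ p.1) h p.2)) ((atTop : Filter ℕ) ×ˢ 𝓝 x)
      (𝓝 (k (h x))) := Tendsto.comp (g := k) (hk.tendsto _) (km_tendsto_joint hh x)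
    exact h1.mul h2

lemma row_conv_D {h : ℝ → ℝ} (hh : ContDiff ℝ 1 h) (hψ : Test r ψ) (hk : Continuous j2) :
    Tendsto (fun n => ∫ x, ψ x * (j2 (km (ρ n) h x) * km (deriv (ρ n)) h x ^ 2)) atTop
      (𝓝 (∫ x, ψ x * (j2 (h x) * deriv h x ^ 2))) := by
  have hh' : Continuous (deriv h) := hh.continuous_deriv (by simp)
  obtain ⟨C, hC0, hC⟩ := km_row_bdd hh.continuous r
  obtain ⟨C', hC0', hC'⟩ := km_row_bdd hh' r
  obtain ⟨C1, hC10, hC1⟩ := hψ.bdd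
  obtain ⟨C2, hC2⟩ := (isCompact_Icc (a := -C) (b := C)).exists_bound_of_continuousOn
    hk.continuousOn
  simp_rw [fun n x => km_deriv_comm (ρ_test n) hh x]
  refine dct_row (r := r) (C := C1 * (C2 * C' ^ 2)) (fun n => hψ.cont.mul ((hk.comp (km_cont (ρ_test n)
    hh.continuous.locallyIntegrable)).mul ((km_cont (ρ_test n) hh'.locallyIntegrable).pow 2)))
    (fun n x hx => by simp [hψ.2 x hx]) (fun n x => ?_) (fun x => ?_)
  · have hC20 : 0 ≤ C2 := (norm_nonneg _).trans (hC2 0 (by constructor <;> linarith))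
    by_cases hx : r < |x|
    · simp [hψ.2 x hx]; positivity
    · rw [abs_mul, abs_mul, abs_pow]
      refine mul_le_mul (hC1 x) ?_ (by positivity) hC10
      exact mul_le_mul (hC2 _ (abs_le.1 (hC n x (not_lt.1 hx))))
        (pow_le_pow_left₀ (abs_nonneg _) (hC' n x (not_lt.1 hx)) 2) (by positivity) hC20
  · exact (((hk.tendsto _).comp (km_tendsto hh.continuous x)).mul
      ((km_tendsto hh' x).pow 2)).const_mul _

variable {d F S : ℝ → ℝ → ℝ} {b : ℝ → ℝ}

lemma EL.l1sq (h : EL μ r' t1 t2 d F S b) (hr0 : 0 < r') {t : ℝ} (ht : t ∈ Icc t1 t2) :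
    (∫ x in Icc (-r') r', |d t x|) ^ 2 ≤ 2 * r' * b t := by
  have := sq_integral_le hr0 (h := fun x => |d t x|)
    ((h.dl ht).integrableOn_isCompact isCompact_Icc).abs
    (by simp_rw [sq_abs]; exact (h.d2 ht).integrableOn_isCompact isCompact_Icc)
  simp_rw [sq_abs] at this
  exact this.trans (mul_le_mul_of_nonneg_left (h.bd t ht) (by linarith))

lemma EL.l1sqF (h : EL μ r' t1 t2 d F S b) (hr0 : 0 < r') {t : ℝ} (ht : t ∈ Icc t1 t2) :
    (∫ x in Icc (-r') r', |F t x|) ^ 2 ≤ 2 * r' * b t := by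
  have := sq_integral_le hr0 (h := fun x => |F t x|)
    ((h.Fl t ht).integrableOn_isCompact isCompact_Icc).abs
    (by simp_rw [sq_abs]; exact (h.F2 t ht).integrableOn_isCompact isCompact_Icc)
  simp_rw [sq_abs] at this
  exact this.trans (mul_le_mul_of_nonneg_left (h.bF t ht) (by linarith))

lemma EL.dS (h : EL μ r' t1 t2 d F S b) (hr0 : 0 < r') {t : ℝ} (ht : t ∈ Icc t1 t2) :
    (∫ x in Icc (-r') r', |d t x|) * (∫ x in Icc (-r') r', |S t x|) ≤ 2 * r' * b t := by
  rw [← integral_mul_const]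
  have : ∫ x in Icc (-r') r', |d t x| * (∫ y in Icc (-r') r', |S t y|)
      ≤ ∫ x in Icc (-r') r', b t := by
    refine setIntegral_mono_on (((h.dl ht).integrableOn_isCompact isCompact_Icc).abs.mul_const _)
      (integrableOn_const (by simp)) measurableSet_Icc fun x hx => h.bS t ht x hx
  refine this.trans (le_of_eq ?_)
  rw [setIntegral_const, Real.volume_real_Icc_of_le (by linarith), smul_eq_mul]; ring

lemma exists_bd3 {ε : ℝ} {k : ℝ → ℝ} (h : Test ε k) : ∃ c, 0 ≤ c ∧ (∀ x, |k x| ≤ c) ∧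
    (∀ x, |deriv k x| ≤ c) ∧ ∀ x, |deriv (deriv k) x| ≤ c := by
  obtain ⟨a, ha, h1⟩ := h.bdd
  obtain ⟨b, hb, h2⟩ := h.der.bdd
  obtain ⟨c, hc, h3⟩ := h.der.der.bdd
  exact ⟨a + b + c, by positivity, fun x => (h1 x).trans (by linarith),
    fun x => (h2 x).trans (by linarith), fun x => (h3 x).trans (by linarith)⟩

/-- pointwise crude bounds for fixed n -/
lemma EL.crude (h : EL μ r' t1 t2 d F S b) (hr0 : 0 < r') (n : ℕ) (hr : r + 1 / ((n:ℝ) + 1) ≤ r') :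
    ∃ K, 0 ≤ K ∧ ∀ t ∈ Icc t1 t2, ∀ x, |x| ≤ r →
      km (ρ n) (d t) x ^ 2 ≤ K * b t ∧ km (deriv (ρ n)) (d t) x ^ 2 ≤ K * b t ∧
      |km (ρ n) (d t) x| * |An n μ d F S t x| ≤ K * b t := by
  have T0 := ρ_test n
  obtain ⟨c, hc, c0, c1, c2⟩ := exists_bd3 T0
  have μ0 := h.μ0
  refine ⟨c ^ 2 * (2 * r') * (μ + 1 + 1 + 1), by positivity, fun t ht x hx => ?_⟩
  have k0 := km_loc_le T0 (h.dl ht) hx hr c0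
  have k1 := km_loc_le T0.der (h.dl ht) hx hr c1
  have k2 := km_loc_le T0.der.der (h.dl ht) hx hr c2
  have k3 := km_loc_le T0.der (h.Fl t ht) hx hr c1
  have k4 := km_loc_le T0 (h.Sl t ht) hx hr c0
  have s1 := h.l1sq hr0 ht
  have s2 := h.l1sqF hr0 ht
  have s3 := h.dS hr0 ht
  set a := ∫ x in Icc (-r') r', |d t x|
  set f := ∫ x in Icc (-r') r', |F t x|
  set s := ∫ x in Icc (-r') r', |S t x|
  have a0 : 0 ≤ a := integral_nonneg fun x => abs_nonneg _
  have f0 : 0 ≤ f := integral_nonneg fun x => abs_nonneg _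
  have ss0 : 0 ≤ s := integral_nonneg fun x => abs_nonneg _
  have bt := h.b0 ht
  have af : a * f ≤ 2 * r' * b t := by nlinarith [sq_nonneg (a - f)]
  have hX : c ^ 2 * a ^ 2 ≤ c ^ 2 * (2 * r' * b t) := mul_le_mul_of_nonneg_left s1 (by positivity)
  have hle : c ^ 2 * (2 * r' * b t) ≤ c ^ 2 * (2 * r') * (μ + 1 + 1 + 1) * b t := by
    have : 0 ≤ c ^ 2 * (2 * r' * b t) := by positivity
    nlinarith
  refine ⟨?_, ?_, ?_⟩
  · calc km (ρ n) (d t) x ^ 2 = |km (ρ n) (d t) x| ^ 2 := (sq_abs _).symm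
      _ ≤ (c * a) ^ 2 := pow_le_pow_left₀ (abs_nonneg _) k0 2
      _ ≤ _ := by rw [mul_pow]; linarith
  · calc km (deriv (ρ n)) (d t) x ^ 2 = |km (deriv (ρ n)) (d t) x| ^ 2 := (sq_abs _).symm
      _ ≤ (c * a) ^ 2 := pow_le_pow_left₀ (abs_nonneg _) k1 2
      _ ≤ _ := by rw [mul_pow]; linarith
  · have hA : |An n μ d F S t x| ≤ μ * (c * a) + c * f + c * s := by
      unfold An
      calc _ ≤ |μ * km (deriv (deriv (ρ n))) (d t) x| + |km (deriv (ρ n)) (F t) x|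
            + |km (ρ n) (S t) x| :=
            (abs_add_le _ _).trans (add_le_add_left (abs_sub _ _) _)
        _ ≤ _ := by
            rw [abs_mul, abs_of_pos μ0]
            have := mul_le_mul_of_nonneg_left k2 μ0.le
            linarith
    calc _ ≤ (c * a) * (μ * (c * a) + c * f + c * s) :=
          mul_le_mul k0 hA (abs_nonneg _) (by positivity)
      _ = c ^ 2 * (μ * a ^ 2 + a * f + a * s) := by ring
      _ ≤ c ^ 2 * (μ * (2 * r' * b t) + 2 * r' * b t + 2 * r' * b t) := by
          refine mul_le_mul_of_nonneg_left ?_ (by positivity)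
          have := mul_le_mul_of_nonneg_left s1 μ0.le
          linarith
      _ ≤ _ := by
          have : 0 ≤ c ^ 2 * (2 * r' * b t) := by positivity
          nlinarith
end
end RegAux

namespace RegAux
open Set Topology
open scoped ContDiff

section
variable {μ r r' t1 t2 B : ℝ} {j j1 j2 ψ : ℝ → ℝ} {d F S : ℝ → ℝ → ℝ} {b : ℝ → ℝ} {θ θ' : ℝ → ℝ}

lemma meas_An {n : ℕ} (hd : Measurable (Function.uncurry d)) (hF : Measurable (Function.uncurry F))
    (hS : Measurable (Function.uncurry S)) : Measurable (fun p : ℝ × ℝ => An n μ d F S p.1 p.2) := by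
  have T0 := ρ_test n
  unfold An
  exact (((km_meas T0.der.der.cont hd).const_mul μ).sub (km_meas T0.der.cont hF)).add
    (km_meas T0.cont hS)

lemma meas_row' {f : ℝ × ℝ → ℝ} (hf : Measurable f) : Measurable (fun t => ∫ x, f (t, x)) :=
  meas_row (f := fun t x => f (t, x)) hf

lemma exists_Θ (hθ : Continuous θ) (hθ' : Continuous θ') (t1 t2 : ℝ) :
    ∃ Θ, 0 ≤ Θ ∧ ∀ t ∈ Icc t1 t2, |θ t| ≤ Θ ∧ |θ' t| ≤ Θ := by
  obtain ⟨a, ha⟩ := (isCompact_Icc (a := t1) (b := t2)).exists_bound_of_continuousOn hθ.continuousOn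
  obtain ⟨c, hc⟩ := (isCompact_Icc (a := t1) (b := t2)).exists_bound_of_continuousOn hθ'.continuousOn
  exact ⟨max 0 (max a c), le_max_left _ _, fun t ht => ⟨(ha t ht).trans (by simp),
    (hc t ht).trans (by simp)⟩⟩

lemma EL.ftc (h : EL μ r' t1 t2 d F S b) (hj : JJ B j j1 j2) (hψ : Test r ψ) (hr0 : 0 < r')
    (hθ : ∀ t, HasDerivAt θ (θ' t) t) (hθ' : Continuous θ') {n : ℕ}
    (hr : r + 1 / ((n:ℝ) + 1) ≤ r') :
    IntegrableOn (fun t => ∫ x, ψ x * (θ' t * j (km (ρ n) (d t) x)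
      + θ t * (j1 (km (ρ n) (d t) x) * An n μ d F S t x))) (Icc t1 t2) ∧
    ∫ t in Icc t1 t2, (∫ x, ψ x * (θ' t * j (km (ρ n) (d t) x)
      + θ t * (j1 (km (ρ n) (d t) x) * An n μ d F S t x)))
      = θ t2 * (∫ x, ψ x * j (km (ρ n) (d t2) x)) - θ t1 * ∫ x, ψ x * j (km (ρ n) (d t1) x) := by
  have T0 := ρ_test n
  have hθc : Continuous θ := continuous_iff_continuousAt.2 fun s => (hθ s).continuousAt
  obtain ⟨Θ, hΘ0, hΘ⟩ := exists_Θ hθc hθ' t1 t2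
  obtain ⟨K, hK0, hK⟩ := h.crude hr0 n hr
  obtain ⟨C, hC0, hC⟩ := hψ.bdd
  have hB0 := hj.B0
  set f : ℝ → ℝ → ℝ := fun x t => ψ x * (θ' t * j (km (ρ n) (d t) x)
      + θ t * (j1 (km (ρ n) (d t) x) * An n μ d F S t x)) with hf
  have mD : Measurable (fun p : ℝ × ℝ => km (ρ n) (d p.2) p.1) :=
    (km_meas T0.cont h.dm).comp measurable_swap
  have mA : Measurable (fun p : ℝ × ℝ => An n μ d F S p.2 p.1) :=
    (meas_An h.dm h.Fm h.Sm).comp measurable_swap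
  have mf : Measurable (Function.uncurry f) := by
    simp only [hf, Function.uncurry_def]
    exact (hψ.cont.measurable.comp measurable_fst).mul
      (((hθ'.measurable.comp measurable_snd).mul (hj.c.measurable.comp mD)).add
      ((hθc.measurable.comp measurable_snd).mul ((hj.c1.measurable.comp mD).mul mA)))
  have hintg : Integrable (Function.uncurry f) (volume.prod (volume.restrict (Icc t1 t2))) := by
    have h1 : Integrable (fun p : ℝ × ℝ => (Icc (-r) r).indicator (fun _ => C * (2 * Θ * (B * K))) p.1 * b p.2)
        (volume.prod (volume.restrict (Icc t1 t2))) :=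
      Integrable.mul_prod ((integrableOn_const (by simp)).integrable_indicator measurableSet_Icc) h.bi
    refine h1.mono' mf.aestronglyMeasurable ?_
    have hm : ∀ᵐ p : ℝ × ℝ ∂(volume.prod (volume.restrict (Icc t1 t2))), p.2 ∈ Icc t1 t2 :=
      Measure.quasiMeasurePreserving_snd.ae (ae_restrict_mem measurableSet_Icc)
    filter_upwards [hm] with p hp
    by_cases hx : p.1 ∈ Icc (-r) r
    · rw [indicator_of_mem hx]
      obtain ⟨k1, k2, k3⟩ := hK p.2 hp p.1 (abs_le.2 hx)
      obtain ⟨θa, θb⟩ := hΘ p.2 hp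
      have bt := h.b0 hp
      simp only [Function.uncurry, hf, Real.norm_eq_abs]
      rw [abs_mul, mul_assoc]
      refine mul_le_mul (hC _) ?_ (abs_nonneg _) hC0
      have e1 : |θ' p.2 * j (km (ρ n) (d p.2) p.1)| ≤ Θ * (B * (K * b p.2)) := by
        rw [abs_mul]
        refine mul_le_mul θb ?_ (abs_nonneg _) hΘ0
        exact (hj.b0 _).trans (mul_le_mul_of_nonneg_left k1 hB0)
      have e2 : |θ p.2 * (j1 (km (ρ n) (d p.2) p.1) * An n μ d F S p.2 p.1)| ≤ Θ * (B * (K * b p.2)) := by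
        rw [abs_mul, abs_mul]
        refine mul_le_mul θa ?_ (by positivity) hΘ0
        calc _ ≤ B * |km (ρ n) (d p.2) p.1| * |An n μ d F S p.2 p.1| :=
              mul_le_mul_of_nonneg_right (hj.b1 _) (abs_nonneg _)
          _ = B * (|km (ρ n) (d p.2) p.1| * |An n μ d F S p.2 p.1|) := by ring
          _ ≤ _ := mul_le_mul_of_nonneg_left k3 hB0
      refine (abs_add_le _ _).trans ?_
      calc _ ≤ Θ * (B * (K * b p.2)) + Θ * (B * (K * b p.2)) := add_le_add e1 e2
        _ = _ := by ring
    · rw [indicator_of_notMem hx]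
      have : ψ p.1 = 0 := hψ.2 _ (by by_contra hc; exact hx (abs_le.1 (not_lt.1 hc)))
      simp [Function.uncurry, hf, this]
  refine ⟨hintg.integral_prod_right, ?_⟩
  have hsw := integral_integral_swap hintg
  have e1 : ∀ x, ∫ t in Icc t1 t2, f x t = ψ x * (θ t2 * j (km (ρ n) (d t2) x))
      - ψ x * (θ t1 * j (km (ρ n) (d t1) x)) := by
    intro x
    by_cases hx : r < |x|
    · simp [hf, hψ.2 x hx]
    have Tx := T0.trans (not_lt.1 hx) hr
    have hD : ∀ t ∈ Icc t1 t2, HasDerivAt (fun s => km (ρ n) (d s) x) (An n μ d F S t x) t := by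
      intro t ht
      rw [← An_eq]; exact h.wi _ Tx t ht
    have cA : ContinuousOn (fun t => An n μ d F S t x) (Icc t1 t2) :=
      (h.wc _ Tx).congr fun t ht => (An_eq n μ d F S t x).symm
    have cD : ContinuousOn (fun s => km (ρ n) (d s) x) (Icc t1 t2) := fun t ht =>
      (hD t ht).continuousAt.continuousWithinAt
    have key := intervalIntegral.integral_eq_sub_of_hasDerivAt (a := t1) (b := t2)
      (f := fun t => θ t * j (km (ρ n) (d t) x))
      (f' := fun t => θ' t * j (km (ρ n) (d t) x)
        + θ t * (j1 (km (ρ n) (d t) x) * An n μ d F S t x))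
      (fun t ht => by
        rw [uIcc_of_le h.t12] at ht
        exact (hθ t).mul ((hj.d1 _).comp t (hD t ht)))
      (by
        refine ContinuousOn.intervalIntegrable ?_
        rw [uIcc_of_le h.t12]
        exact (hθ'.continuousOn.mul (hj.c.comp_continuousOn cD)).add
          (hθc.continuousOn.mul ((hj.c1.comp_continuousOn cD).mul cA)))
    rw [intervalIntegral.integral_of_le h.t12, ← integral_Icc_eq_integral_Ioc] at key
    simp only [hf]
    rw [integral_const_mul, key]; ring
  simp_rw [e1] at hsw
  rw [← hsw, integral_sub]
  · congr 1
    · rw [← integral_const_mul]; congr 1; funext x; ring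
    · rw [← integral_const_mul]; congr 1; funext x; ring
  · exact hψ.integrable_mul_cont ((hj.c.comp (km_cont T0 (h.dl ⟨h.t12, le_rfl⟩))).const_mul _)
  · exact hψ.integrable_mul_cont ((hj.c.comp (km_cont T0 (h.dl ⟨le_rfl, h.t12⟩))).const_mul _)

/-- The energy inequality. -/
theorem EL.main (h : EL μ r' t1 t2 d F S b) (hj : JJ B j j1 j2) (hψ : Test r ψ) (hr0 : 0 < r')
    (hrr : r < r') (hψ0 : ∀ x, 0 ≤ ψ x)
    (hθ : ∀ t, HasDerivAt θ (θ' t) t) (hθ' : Continuous θ') (hθ0 : ∀ t ∈ Icc t1 t2, 0 ≤ θ t) :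
    IntegrableOn (fun t => θ t * ∫ x, ψ x * (j2 (d t x) * deriv (d t) x ^ 2)) (Icc t1 t2) ∧
    IntegrableOn (fun t => Rg μ ψ j j1 j2 (θ' t) (θ t) (d t) (fun x => F t x ^ 2) (F t) (S t))
      (Icc t1 t2) ∧
    θ t2 * (∫ x, ψ x * j (d t2 x)) +
      μ / 2 * (∫ t in Icc t1 t2, θ t * ∫ x, ψ x * (j2 (d t x) * deriv (d t) x ^ 2))
    ≤ θ t1 * (∫ x, ψ x * j (d t1 x)) +
      ∫ t in Icc t1 t2, Rg μ ψ j j1 j2 (θ' t) (θ t) (d t) (fun x => F t x ^ 2) (F t) (S t) := by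
  have hθc : Continuous θ := continuous_iff_continuousAt.2 fun s => (hθ s).continuousAt
  obtain ⟨Θ, hΘ0, hΘ⟩ := exists_Θ hθc hθ' t1 t2
  obtain ⟨C, hC0, hC, hC1, hC2⟩ := exists_bd3 hψ
  have hB0 := hj.B0
  have μ0 := h.μ0
  obtain ⟨N, hN⟩ : ∃ N : ℕ, ∀ n, N ≤ n → r + 1 / ((n:ℝ) + 1) ≤ r' := by
    obtain ⟨N, hN⟩ := exists_nat_one_div_lt (sub_pos.2 hrr)
    refine ⟨N, fun n hn => ?_⟩
    have : 1 / ((n:ℝ) + 1) ≤ 1 / ((N:ℝ) + 1) :=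
      one_div_le_one_div_of_le (by positivity) (by exact_mod_cast Nat.succ_le_succ hn)
    linarith
  set I := Icc t1 t2 with hI
  set ν := volume.restrict I with hν
  set U : ℕ → ℝ → ℝ := fun n t => Rg μ ψ j j1 j2 (θ' t) (θ t) (km (ρ (n + N)) (d t))
    (km (ρ (n + N)) (fun y => F t y ^ 2)) (km (ρ (n + N)) (F t)) (km (ρ (n + N)) (S t)) with hU
  set U0 : ℝ → ℝ := fun t => Rg μ ψ j j1 j2 (θ' t) (θ t) (d t) (fun x => F t x ^ 2) (F t) (S t)
    with hU0
  set H : ℕ → ℝ → ℝ := fun n t => θ t * ∫ x, ψ x * (j2 (km (ρ (n + N)) (d t) x)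
    * km (deriv (ρ (n + N))) (d t) x ^ 2) with hH
  set H0 : ℝ → ℝ := fun t => θ t * ∫ x, ψ x * (j2 (d t x) * deriv (d t) x ^ 2) with hH0
  set V : ℕ → ℝ → ℝ := fun n t => ∫ x, ψ x * (θ' t * j (km (ρ (n + N)) (d t) x)
      + θ t * (j1 (km (ρ (n + N)) (d t) x) * An (n + N) μ d F S t x)) with hV
  set c := Θ * (C * B * (1 + μ + 1 / (2 * μ) + 1 + 1)) with hc
  have hrn : ∀ n : ℕ, r + 1 / (((n + N : ℕ):ℝ) + 1) ≤ r' := fun n => hN _ (Nat.le_add_left _ _)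
  have hmem : ∀ᵐ t ∂ν, t ∈ I := ae_restrict_mem measurableSet_Icc
  have hF2m : Measurable (Function.uncurry fun t y => F t y ^ 2) := h.Fm.pow_const 2
  -- U measurable and bounded
  have mU : ∀ n, Measurable (U n) := by
    intro n
    have T0 := ρ_test (n + N)
    have mD : Measurable (fun p : ℝ × ℝ => km (ρ (n + N)) (d p.1) p.2) := km_meas T0.cont h.dm
    have mK : Measurable (fun p : ℝ × ℝ => km (ρ (n + N)) (F p.1) p.2) := km_meas T0.cont h.Fm
    have mZ : Measurable (fun p : ℝ × ℝ => km (ρ (n + N)) (S p.1) p.2) := km_meas T0.cont h.Sm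
    have mK2 : Measurable (fun p : ℝ × ℝ => km (ρ (n + N)) (fun y => F p.1 y ^ 2) p.2) :=
      km_meas T0.cont hF2m
    have p0 : Measurable (fun p : ℝ × ℝ => ψ p.2) := hψ.cont.measurable.comp measurable_snd
    have p1 : Measurable (fun p : ℝ × ℝ => deriv ψ p.2) := hψ.der.cont.measurable.comp measurable_snd
    have p2 : Measurable (fun p : ℝ × ℝ => deriv (deriv ψ) p.2) :=
      hψ.der.der.cont.measurable.comp measurable_snd
    have q0 := hj.c.measurable.comp mD
    have q1 := hj.c1.measurable.comp mD
    have q2 := hj.c2.measurable.comp mD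
    simp only [hU, Rg]
    refine (hθ'.measurable.mul (meas_row' (p0.mul q0))).add (hθc.measurable.mul
      ((((meas_row' (p2.mul q0)).const_mul μ).add ((meas_row' ((p0.mul q2).mul mK2)).const_mul _)).add
      (meas_row' ((p1.mul q1).mul mK)) |>.add (meas_row' ((p0.mul q1).mul mZ))))
  have bU : ∀ n, ∀ t ∈ I, ‖U n t‖ ≤ c * b t := fun n t ht =>
    h.row_bound hj hψ hC hC1 hC2 (hrn n) hr0 ht (hΘ t ht).2 (hΘ t ht).1
  have cbi : Integrable (fun t => c * b t) ν := h.bi.const_mul c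
  have iU : ∀ n, Integrable (U n) ν := fun n => cbi.mono' (mU n).aestronglyMeasurable (by
    filter_upwards [hmem] with t ht using bU n t ht)
  have tU : ∀ t ∈ I, Tendsto (fun n => U n t) atTop (𝓝 (U0 t)) := by
    intro t ht
    have hc := (h.dC t ht).continuous
    have sh : Tendsto (fun n : ℕ => n + N) atTop atTop := tendsto_add_atTop_nat N
    have x1 := (row_conv_j (k := j) hc hψ hj.c).comp sh
    have x2 := (row_conv_j (k := j) hc hψ.der.der hj.c).comp sh
    have x3 := (row_conv_jG (k := j2) hc hψ hj.c2 (h.F2 t ht)).comp sh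
    have x4 := (row_conv_jG (k := j1) hc hψ.der hj.c1 (h.Fl t ht)).comp sh
    have x5 := (row_conv_jG (k := j1) hc hψ hj.c1 (h.Sl t ht)).comp sh
    exact (x1.const_mul (θ' t)).add (((((x2.const_mul μ).add (x3.const_mul _)).add x4).add x5).const_mul (θ t))
  have iU0 : Integrable U0 ν := by
    refine cbi.mono' (aestronglyMeasurable_of_tendsto_ae atTop
      (fun n => (mU n).aestronglyMeasurable) ?_) ?_
    · filter_upwards [hmem] with t ht using tU t ht
    · filter_upwards [hmem] with t ht
      exact le_of_tendsto (tU t ht).norm (Eventually.of_forall fun n => bU n t ht)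
  have tIU : Tendsto (fun n => ∫ t, U n t ∂ν) atTop (𝓝 (∫ t, U0 t ∂ν)) :=
    tendsto_integral_of_dominated_convergence (fun t => c * b t)
      (fun n => (mU n).aestronglyMeasurable) cbi
      (fun n => by filter_upwards [hmem] with t ht using bU n t ht)
      (by filter_upwards [hmem] with t ht using tU t ht)
  -- H
  have iH : ∀ n, Integrable (H n) ν := by
    intro n
    have T0 := ρ_test (n + N)
    obtain ⟨K, hK0, hK⟩ := h.crude hr0 (n + N) (hrn n)
    have mH : Measurable (H n) := by
      have mD : Measurable (fun p : ℝ × ℝ => km (ρ (n + N)) (d p.1) p.2) := km_meas T0.cont h.dm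
      have mDx : Measurable (fun p : ℝ × ℝ => km (deriv (ρ (n + N))) (d p.1) p.2) :=
        km_meas T0.der.cont h.dm
      refine hθc.measurable.mul (meas_row ?_)
      exact (hψ.cont.measurable.comp measurable_snd).mul ((hj.c2.measurable.comp mD).mul (mDx.pow_const 2))
    have : Integrable (fun t => Θ * (C * (B * K) * (volume.real (Icc (-r) r))) * b t) ν :=
      h.bi.const_mul _
    refine this.mono' mH.aestronglyMeasurable ?_
    filter_upwards [hmem] with t ht
    have bt := h.b0 ht
    simp only [hH, Real.norm_eq_abs]
    rw [abs_mul, mul_assoc]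
    refine mul_le_mul (hΘ t ht).1 ?_ (abs_nonneg _) hΘ0
    have h1 := abs_integral_mul_le (r := r) (C := C * (B * K * b t))
      (η := fun x => ψ x * (j2 (km (ρ (n + N)) (d t) x) * km (deriv (ρ (n + N))) (d t) x ^ 2))
      (G := fun _ => 1) (fun x hx => by simp [hψ.2 x hx]) (fun x => by
        by_cases hx : r < |x|
        · simp [hψ.2 x hx]; positivity
        rw [abs_mul]
        refine mul_le_mul (hC x) ?_ (abs_nonneg _) hC0
        rw [abs_of_nonneg (mul_nonneg (hj.n2 _) (sq_nonneg _)), mul_assoc]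
        exact mul_le_mul (hj.le _) (hK t ht x (not_lt.1 hx)).2.1 (sq_nonneg _) hB0)
      (integrableOn_const (by simp))
    simp only [mul_one, abs_one, setIntegral_const, smul_eq_mul] at h1
    refine h1.trans (le_of_eq (by ring))
  have nH : ∀ n, 0 ≤ᵐ[ν] H n := fun n => by
    filter_upwards [hmem] with t ht
    exact mul_nonneg (hθ0 t ht) (integral_nonneg fun x =>
      mul_nonneg (hψ0 x) (mul_nonneg (hj.n2 _) (sq_nonneg _)))
  have tH : ∀ᵐ t ∂ν, Tendsto (fun n => H n t) atTop (𝓝 (H0 t)) := by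
    filter_upwards [hmem] with t ht
    exact ((row_conv_D (h.dC t ht) hψ hj.c2).comp (tendsto_add_atTop_nat N)).const_mul _
  have hVU : ∀ n, ∀ t ∈ I, V n t ≤ U n t - μ / 2 * H n t := by
    intro n t ht
    have T0 := ρ_test (n + N)
    have re := row_est (n := n + N) μ0 hj hψ hψ0 (h.dl ht) (h.Fl t ht) (h.F2 t ht) (h.Sl t ht)
    have cD := km_cont T0 (h.dl ht)
    have cA : Continuous (An (n + N) μ d F S t) := by
      unfold An
      exact (((km_cont T0.der.der (h.dl ht)).const_mul μ).sub (km_cont T0.der (h.Fl t ht))).add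
        (km_cont T0 (h.Sl t ht))
    have e : V n t = θ' t * (∫ x, ψ x * j (km (ρ (n + N)) (d t) x))
        + θ t * ∫ x, ψ x * (j1 (km (ρ (n + N)) (d t) x) * An (n + N) μ d F S t x) := by
      rw [← integral_const_mul, ← integral_const_mul, ← integral_add]
      · simp only [hV]; congr 1; funext x; ring
      · exact (hψ.integrable_mul_cont (hj.c.comp cD)).const_mul _
      · exact (hψ.integrable_mul_cont ((hj.c1.comp cD).mul cA)).const_mul _
    rw [e]
    have := mul_le_mul_of_nonneg_left re (hθ0 t ht)
    simp only [hU, hH, Rg]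
    linarith
  have hle : ∀ n, ∫ t, H n t ∂ν ≤ 2 / μ * ((∫ t, U n t ∂ν) - (θ t2 * (∫ x, ψ x * j (km (ρ (n + N)) (d t2) x))
      - θ t1 * ∫ x, ψ x * j (km (ρ (n + N)) (d t1) x))) := by
    intro n
    obtain ⟨iV, eV⟩ := h.ftc hj hψ hr0 hθ hθ' (hrn n)
    have h1 : ∫ t, V n t ∂ν ≤ ∫ t, (U n t - μ / 2 * H n t) ∂ν := by
      refine integral_mono_ae iV ((iU n).sub ((iH n).const_mul _)) ?_
      filter_upwards [hmem] with t ht using hVU n t ht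
    rw [integral_sub (iU n) ((iH n).const_mul _), integral_const_mul] at h1
    rw [← eV]
    have h2 : μ / 2 * (∫ t, H n t ∂ν) ≤ (∫ t, U n t ∂ν) - ∫ t, V n t ∂ν := by linarith
    have h3 := mul_le_mul_of_nonneg_left h2 (by positivity : 0 ≤ 2 / μ)
    have e : 2 / μ * (μ / 2 * ∫ t, H n t ∂ν) = ∫ t, H n t ∂ν := by field_simp
    rw [e] at h3
    exact h3
  have m2 : t2 ∈ I := ⟨h.t12, le_rfl⟩
  have m1 : t1 ∈ I := ⟨le_rfl, h.t12⟩
  have sh : Tendsto (fun n : ℕ => n + N) atTop atTop := tendsto_add_atTop_nat N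
  have y1 := (row_conv_j (k := j) (h.dC t1 m1).continuous hψ hj.c).comp sh
  have y2 := (row_conv_j (k := j) (h.dC t2 m2).continuous hψ hj.c).comp sh
  have tΛ := (tIU.sub ((y2.const_mul (θ t2)).sub (y1.const_mul (θ t1)))).const_mul (2 / μ)
  obtain ⟨f1, f2⟩ := fatou_real iH nH hle tΛ tH
  refine ⟨f1, iU0, ?_⟩
  have h3 := mul_le_mul_of_nonneg_left f2 (by positivity : 0 ≤ μ / 2)
  rw [← mul_assoc, show μ / 2 * (2 / μ) = 1 by field_simp, one_mul] at h3
  linarith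
end
end RegAux

namespace RegAux
open Set Topology
open scoped ContDiff

lemma rpow_young {a κ : ℝ} (ha0 : 0 ≤ a) (ha : a < 3) (hκ : 0 < κ) :
    ∃ C, 0 ≤ C ∧ ∀ P : ℝ, 0 ≤ P → P ^ a ≤ κ * P ^ 3 + C := by
  set T := max 1 (κ ^ (-(1 / (3 - a)))) with hT
  have hT1 : 1 ≤ T := le_max_left _ _
  have hT0 : 0 < T := by linarith
  refine ⟨T ^ a, by positivity, fun P hP => ?_⟩
  by_cases h : P ≤ T
  · have := Real.rpow_le_rpow hP h ha0
    have : 0 ≤ κ * P ^ 3 := by positivity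
    linarith
  · have hP0 : 0 < P := lt_trans hT0 (not_le.1 h)
    have h1 : κ ^ (-(1 / (3 - a))) ≤ P := (le_max_right _ _).trans (not_le.1 h).le
    have h2 : κ⁻¹ ≤ P ^ (3 - a) := by
      have := Real.rpow_le_rpow (by positivity) h1 (by linarith : 0 ≤ 3 - a)
      rw [← Real.rpow_mul hκ.le, show -(1 / (3 - a)) * (3 - a) = -1 by
        have : 3 - a ≠ 0 := by linarith
        field_simp, Real.rpow_neg_one] at this
      exact this
    have h3 : P ^ 3 = P ^ (3 - a) * P ^ a := by
      rw [← Real.rpow_add hP0, sub_add_cancel]; norm_cast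
    have h4 : P ^ a ≤ κ * P ^ 3 := by
      rw [h3, ← mul_assoc]
      have : 1 ≤ κ * P ^ (3 - a) := by
        calc 1 = κ * κ⁻¹ := by field_simp
          _ ≤ _ := mul_le_mul_of_nonneg_left h2 hκ.le
      nlinarith [Real.rpow_nonneg hP a]
    have : 0 ≤ T ^ a := by positivity
    linarith

lemma row_le {r A : ℝ} {k h : ℝ → ℝ} (hk0 : ∀ x, r < |x| → k x = 0) (hA : 0 ≤ A)
    (hk : ∀ x, |x| ≤ r → k x ≤ A * |h x|) (hh : IntegrableOn h (Icc (-r) r)) :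
    ∫ x, k x ≤ A * ∫ x in Icc (-r) r, |h x| := by
  by_cases hi : Integrable k
  · have e : ∫ x, k x = ∫ x in Icc (-r) r, k x := by
      symm
      refine setIntegral_eq_integral_of_forall_compl_eq_zero fun x hx => hk0 x ?_
      by_contra hc
      exact hx (abs_le.1 (not_lt.1 hc))
    rw [e, ← integral_const_mul]
    exact setIntegral_mono_on hi.integrableOn (hh.abs.const_mul A) measurableSet_Icc
      fun x hx => hk x (abs_le.2 hx)
  · rw [integral_undef hi]
    exact mul_nonneg hA (integral_nonneg fun x => abs_nonneg _)

section
variable {r c : ℝ} {χ : ℝ → ℝ}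

lemma cube_test (h : Test r χ) : Test r (fun x => χ x ^ 3) :=
  ⟨h.1.pow 3, fun x hx => by simp [h.2 x hx]⟩

lemma cube_deriv (h : Test r χ) : deriv (fun x => χ x ^ 3) = fun x => 3 * χ x ^ 2 * deriv χ x := by
  funext x
  have h1 := (h.diff x).hasDerivAt.pow 3
  refine (HasDerivAt.deriv (f := fun x => χ x ^ 3) h1).trans ?_
  simp

lemma cube_deriv2 (h : Test r χ) : deriv (deriv (fun x => χ x ^ 3))
    = fun x => 6 * χ x * deriv χ x ^ 2 + 3 * χ x ^ 2 * deriv (deriv χ) x := by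
  rw [cube_deriv h]
  funext x
  have h1 := (((h.diff x).hasDerivAt.pow 2).const_mul 3).mul (h.der.diff x).hasDerivAt
  refine (HasDerivAt.deriv (f := fun x => 3 * χ x ^ 2 * deriv χ x) h1).trans ?_
  simp; ring

/-- interpolation inequality -/
lemma interp (h : Test r χ) (h0 : ∀ x, 0 ≤ χ x) (h1 : ∀ x, χ x ≤ 1)
    (hc : ∀ x, |deriv χ x| ≤ c) {w : ℝ → ℝ} (hw : ContDiff ℝ 1 w) {m : ℝ} (hm : 0 < m)
    (hwm : ∫ x in Icc (-r) r, |w x| ≤ m) :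
    ∃ P, 0 ≤ P ∧ (∀ x, χ x * |w x| ≤ P) ∧
      P ^ 3 ≤ 18 * m * (∫ x, χ x ^ 3 * (1 * deriv w x ^ 2)) + 256 * (c * m) ^ 3 := by
  have cw := hw.continuous
  have cw' : Continuous (deriv w) := hw.continuous_deriv (by simp)
  have c0 : 0 ≤ c := (abs_nonneg _).trans (hc 0)
  have hcs : HasCompactSupport (fun x => χ x * |w x|) := h.hcs.mul_right
  obtain ⟨x0, hx0⟩ := (h.cont.mul cw.abs).exists_forall_ge_of_hasCompactSupport hcs
  set P := χ x0 * |w x0| with hP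
  have hPle : ∀ x, χ x * |w x| ≤ P := hx0
  have hP0 : 0 ≤ P := mul_nonneg (h0 _) (abs_nonneg _)
  have hT3 := cube_test h
  have iw : IntegrableOn w (Icc (-r) r) := cw.locallyIntegrable.integrableOn_isCompact isCompact_Icc
  refine ⟨P, hP0, hPle, ?_⟩
  set D := ∫ x, χ x ^ 3 * (1 * deriv w x ^ 2) with hD
  -- FTC
  have hG : ∀ x, HasDerivAt (fun x => (χ x * w x) ^ 3)
      (3 * (χ x * w x) ^ 2 * (deriv χ x * w x + χ x * deriv w x)) x := by
    intro x
    have h1 := ((h.diff x).hasDerivAt.mul ((hw.differentiable (by simp)) x).hasDerivAt).pow 3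
    refine HasDerivAt.congr_deriv (f := fun x => (χ x * w x) ^ 3) h1 ?_
    simp
  have cG' : Continuous (fun x => 3 * (χ x * w x) ^ 2 * (deriv χ x * w x + χ x * deriv w x)) :=
    (continuous_const.mul ((h.cont.mul cw).pow 2)).mul ((h.der.cont.mul cw).add (h.cont.mul cw'))
  have hz : ∀ x, r < |x| → (χ x * w x) ^ 3 = 0 := fun x hx => by simp [h.2 x hx]
  have hG'0 : ∀ x, r < |x| → 3 * (χ x * w x) ^ 2 * (deriv χ x * w x + χ x * deriv w x) = 0 :=
    fun x hx => by simp [h.2 x hx]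
  set k := fun x => 3 * (χ x * w x) ^ 2 * (deriv χ x * w x + χ x * deriv w x) with hk
  have hkcs : HasCompactSupport k := by
    refine HasCompactSupport.intro (isCompact_Icc (a := -r) (b := r)) fun x hx => hG'0 x ?_
    by_contra hcc
    exact hx (abs_le.1 (not_lt.1 hcc))
  have ik : Integrable k := cG'.integrable_of_hasCompactSupport hkcs
  have hup : P ^ 3 ≤ ∫ x, |k x| := by
    set y := -|x0| - |r| - 1 with hy
    have hyx : y ≤ x0 := by
      have := neg_abs_le x0
      have := abs_nonneg r
      linarith
    have e := intervalIntegral.integral_eq_sub_of_hasDerivAt (a := y) (b := x0) (fun x _ => hG x)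
      (cG'.intervalIntegrable _ _)
    have : r < |y| := by
      have h1 : y ≤ -|r| - 1 := by have := abs_nonneg x0; linarith
      have h2 := le_abs_self r
      have h3 := neg_abs_le y
      have h4 : |y| = -y := abs_of_nonpos (by have := abs_nonneg r; linarith)
      linarith
    rw [hz y this, sub_zero] at e
    have e2 : P ^ 3 = |(χ x0 * w x0) ^ 3| := by
      rw [abs_pow, abs_mul, abs_of_nonneg (h0 x0)]
    rw [e2, ← e, intervalIntegral.integral_of_le hyx]
    calc |∫ x in Ioc y x0, k x| ≤ ∫ x in Ioc y x0, |k x| := abs_integral_le_integral_abs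
      _ ≤ ∫ x, |k x| := setIntegral_le_integral ik.abs (Eventually.of_forall fun x => abs_nonneg _)
  have iD : Integrable (fun x => χ x ^ 3 * (1 * deriv w x ^ 2)) :=
    hT3.integrable_mul_cont (continuous_const.mul (cw'.pow 2))
  -- the remaining function
  have hle : ∫ x, (|k x| - 9 / 2 * m * (χ x ^ 3 * (1 * deriv w x ^ 2)))
      ≤ (3 * c * P ^ 2 + P ^ 3 / (2 * m)) * ∫ x in Icc (-r) r, |w x| := by
    refine row_le (fun x hx => ?_) (by positivity) (fun x _ => ?_) iw
    · have hk0 : k x = 0 := hG'0 x hx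
      rw [hk0, h.2 x hx]; simp
    · have hx := hPle x
      have hχ0 := h0 x
      have hχ1 := h1 x
      have hcx := hc x
      set a := χ x
      set v := |w x| with hv
      have hv0 : 0 ≤ v := abs_nonneg _
      set p := a * v with hp
      have hp0 : 0 ≤ p := mul_nonneg hχ0 hv0
      have e1 : |k x| ≤ 3 * p ^ 2 * (c * v + a * |deriv w x|) := by
        simp only [hk]
        rw [abs_mul, abs_mul, abs_pow, abs_mul, abs_of_nonneg hχ0]
        simp only [Nat.abs_ofNat]
        refine mul_le_mul_of_nonneg_left ?_ (by positivity)
        refine (abs_add_le _ _).trans ?_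
        rw [abs_mul, abs_mul, abs_of_nonneg hχ0]
        have := mul_le_mul_of_nonneg_right hcx hv0
        linarith
      have e2 : 3 * p ^ 2 * (a * |deriv w x|) ≤ 9 / 2 * m * (a ^ 3 * deriv w x ^ 2) + p ^ 3 / (2 * m) * v := by
        have e3 : p ^ 3 * v = a ^ 3 * v ^ 4 := by rw [hp]; ring
        have e4 : p ^ 3 / (2 * m) * v = a ^ 3 * v ^ 4 / (2 * m) := by rw [← e3]; ring
        rw [e4, hp, ← sq_abs (deriv w x)]
        set z := |deriv w x|
        have : 0 ≤ a ^ 3 * (3 * m * z - v ^ 2) ^ 2 / (2 * m) := by positivity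
        have e5 : a ^ 3 * (3 * m * z - v ^ 2) ^ 2 / (2 * m) =
          9 / 2 * m * (a ^ 3 * z ^ 2) - 3 * (a * v) ^ 2 * (a * z) + a ^ 3 * v ^ 4 / (2 * m) := by
          field_simp; ring
        linarith
      have e6 : p ^ 2 ≤ P ^ 2 := pow_le_pow_left₀ hp0 hx 2
      have e7 : p ^ 3 ≤ P ^ 3 := pow_le_pow_left₀ hp0 hx 3
      have e8 : 3 * p ^ 2 * (c * v) ≤ 3 * P ^ 2 * (c * v) :=
        mul_le_mul_of_nonneg_right (by linarith) (by positivity)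
      have e9 : p ^ 3 / (2 * m) * v ≤ P ^ 3 / (2 * m) * v :=
        mul_le_mul_of_nonneg_right (div_le_div_of_nonneg_right e7 (by positivity)) hv0
      linarith
  rw [integral_sub ik.abs (iD.const_mul _), integral_const_mul] at hle
  have hA : (3 * c * P ^ 2 + P ^ 3 / (2 * m)) * (∫ x in Icc (-r) r, |w x|)
      ≤ 3 * c * P ^ 2 * m + P ^ 3 / 2 := by
    calc _ ≤ (3 * c * P ^ 2 + P ^ 3 / (2 * m)) * m := mul_le_mul_of_nonneg_left hwm (by positivity)
      _ = _ := by field_simp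
  have hB : P ^ 3 / 2 ≤ 3 * (c * m) * P ^ 2 + 9 / 2 * m * D := by nlinarith
  have hC : 0 ≤ (P - 8 * (c * m)) ^ 2 * (P + 4 * (c * m)) := by positivity
  nlinarith

end
end RegAux

namespace RegAux
open Set Topology
open scoped ContDiff

/-- cutoff with bounds -/
structure Cut (r c : ℝ) (χ : ℝ → ℝ) : Prop where
  t : Test r χ
  n : ∀ x, 0 ≤ χ x
  l : ∀ x, χ x ≤ 1
  b1 : ∀ x, |deriv χ x| ≤ c
  b2 : ∀ x, |deriv (deriv χ) x| ≤ c

lemma rpow_cut {a k h : ℝ} (n : ℕ) (hk0 : 0 ≤ k) (hk1 : k ≤ 1) (hh : 0 ≤ h) (ha0 : 0 < a) (ha : a ≤ n) :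
    k ^ n * h ^ a ≤ (k * h) ^ a := by
  rw [Real.mul_rpow hk0 hh]
  refine mul_le_mul_of_nonneg_right ?_ (Real.rpow_nonneg hh a)
  rcases eq_or_lt_of_le hk0 with h0 | h0
  · rw [← h0, Real.zero_rpow ha0.ne']
    have : n ≠ 0 := by rintro rfl; simp at ha; linarith
    simp [this]
  · rw [← Real.rpow_natCast]
    exact Real.rpow_le_rpow_of_exponent_ge h0 hk1 ha

set_option maxHeartbeats 1600000 in
lemma rowB {μ q c mb M1 C0 : ℝ} (hμ : 0 < μ) (hq : 1 < q) (hq2 : q < 2) (hmb : 0 < mb)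
    (hM1 : 0 ≤ M1) (hC0 : 0 ≤ C0) (hc : 0 ≤ c) :
    ∃ K, 0 ≤ K ∧ ∀ (r : ℝ) (χ h f s : ℝ → ℝ) (m : ℝ), Cut r c χ → ContDiff ℝ 1 h →
      LocallyIntegrable s → 0 < m → m ≤ mb →
      ∫ x in Icc (-r) r, |h x| ≤ m → ∫ x in Icc (-r) r, |s x| ≤ M1 →
      (∀ x, |x| ≤ r → |f x| ≤ C0 * (|h x| + |h x| ^ q)) →
      ∃ P, 0 ≤ P ∧ P ^ 3 ≤ 18 * m * (∫ x, χ x ^ 3 * (1 * deriv h x ^ 2)) + 256 * (c * m) ^ 3 ∧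
        ∀ θ1 θ0, 0 ≤ θ1 → 0 ≤ θ0 →
          Rg μ (fun x => χ x ^ 3) (fun s => s ^ 2 / 2) (fun s => s) (fun _ => 1) θ1 θ0 h
            (fun x => f x ^ 2) f s
          ≤ θ1 / 2 * (P * m) + θ0 * (μ / 8 * (∫ x, χ x ^ 3 * (1 * deriv h x ^ 2)) + K) := by
  set A1 := (μ * (6 * c ^ 2 + 3 * c) / 2 + C0 ^ 2 / μ + 3 * c * C0) * mb + M1 with hA1
  set A2 := C0 ^ 2 / μ * mb with hA2
  set A3 := 3 * c * C0 * mb with hA3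
  have a1 : 0 ≤ A1 := by positivity
  have a2 : 0 ≤ A2 := by positivity
  have a3 : 0 ≤ A3 := by positivity
  set A := A1 + A2 + A3 + 1 with hA
  have a0 : 0 < A := by positivity
  set κ := μ / (8 * 18 * mb * A) with hκ
  have κ0 : 0 < κ := by positivity
  obtain ⟨B1, hB1, y1⟩ := rpow_young (a := 1) (by norm_num) (by norm_num) κ0
  obtain ⟨B2, hB2, y2⟩ := rpow_young (a := 2 * q - 1) (by linarith) (by linarith) κ0
  obtain ⟨B3, hB3, y3⟩ := rpow_young (a := q) (by linarith) (by linarith) κ0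
  refine ⟨A * κ * (256 * (c * mb) ^ 3) + A * (B1 + B2 + B3), by positivity, ?_⟩
  intro r χ h f s m hχ hh hs hm hmm hhm hsM hf
  obtain ⟨P, hP0, hP, hP3⟩ := interp hχ.t hχ.n hχ.l hχ.b1 hh hm hhm
  refine ⟨P, hP0, hP3, fun θ1 θ0 h1 h0 => ?_⟩
  set D := ∫ x, χ x ^ 3 * (1 * deriv h x ^ 2) with hD
  have hD0 : 0 ≤ D := integral_nonneg fun x => by
    have := hχ.n x
    positivity
  have ih : IntegrableOn h (Icc (-r) r) :=
    hh.continuous.locallyIntegrable.integrableOn_isCompact isCompact_Icc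
  have is : IntegrableOn s (Icc (-r) r) := hs.integrableOn_isCompact isCompact_Icc
  -- pieces
  have p1 : ∫ x, χ x ^ 3 * (h x ^ 2 / 2) ≤ P / 2 * m := by
    refine (row_le (r := r) (A := P / 2) (h := h) (fun x hx => by simp [hχ.t.2 x hx])
      (by positivity) (fun x _ => ?_) ih).trans (mul_le_mul_of_nonneg_left hhm (by positivity))
    have := hP x
    have k0 := hχ.n x
    have k1 := hχ.l x
    rw [← sq_abs (h x)]
    have e := abs_nonneg (h x)
    have : χ x ^ 3 ≤ χ x := by
      simpa using pow_le_pow_of_le_one k0 k1 (show 1 ≤ 3 by norm_num)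
    nlinarith [mul_le_mul_of_nonneg_right (hP x) e, mul_le_mul_of_nonneg_right this (sq_nonneg |h x|)]
  have p2 : ∫ x, deriv (deriv (fun x => χ x ^ 3)) x * (h x ^ 2 / 2)
      ≤ (6 * c ^ 2 + 3 * c) / 2 * P * m := by
    rw [cube_deriv2 hχ.t]
    refine (row_le (r := r) (A := (6 * c ^ 2 + 3 * c) / 2 * P) (h := h)
      (fun x hx => by simp [hχ.t.2 x hx])
      (by positivity) (fun x _ => ?_) ih).trans (mul_le_mul_of_nonneg_left hhm (by positivity))
    have k0 := hχ.n x
    have k1 := hχ.l x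
    rw [← sq_abs (h x)]
    have e := abs_nonneg (h x)
    have e1 : deriv χ x ^ 2 ≤ c ^ 2 := by
      rw [← sq_abs]; exact pow_le_pow_left₀ (abs_nonneg _) (hχ.b1 x) 2
    have e2 : χ x ^ 2 * deriv (deriv χ) x ≤ χ x * c := by
      have : χ x ^ 2 ≤ χ x := by nlinarith
      calc χ x ^ 2 * deriv (deriv χ) x ≤ χ x ^ 2 * c :=
            mul_le_mul_of_nonneg_left ((le_abs_self _).trans (hχ.b2 x)) (by positivity)
        _ ≤ _ := mul_le_mul_of_nonneg_right this hc
    have e3 : 6 * χ x * deriv χ x ^ 2 + 3 * χ x ^ 2 * deriv (deriv χ) x ≤ (6 * c ^ 2 + 3 * c) * χ x := by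
      have := mul_le_mul_of_nonneg_left e1 k0
      linarith
    calc _ ≤ (6 * c ^ 2 + 3 * c) * χ x * (|h x| ^ 2 / 2) := mul_le_mul_of_nonneg_right e3 (by positivity)
      _ = (6 * c ^ 2 + 3 * c) / 2 * (χ x * |h x|) * |h x| := by ring
      _ ≤ _ := by
        refine mul_le_mul_of_nonneg_right (mul_le_mul_of_nonneg_left (hP x) (by positivity)) e
  have p3 : ∫ x, χ x ^ 3 * 1 * f x ^ 2 ≤ 2 * C0 ^ 2 * (P + P ^ (2 * q - 1)) * m := by
    refine (row_le (r := r) (A := 2 * C0 ^ 2 * (P + P ^ (2 * q - 1))) (h := h)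
      (fun x hx => by simp [hχ.t.2 x hx])
      (by positivity) (fun x hx => ?_) ih).trans (mul_le_mul_of_nonneg_left hhm (by positivity))
    have k0 := hχ.n x
    have k1 := hχ.l x
    have e := abs_nonneg (h x)
    have e1 : f x ^ 2 ≤ 2 * C0 ^ 2 * (|h x| * |h x| + |h x| ^ (2 * q - 1) * |h x|) := by
      have e2 : f x ^ 2 ≤ (C0 * (|h x| + |h x| ^ q)) ^ 2 := by
        rw [← sq_abs]; exact pow_le_pow_left₀ (abs_nonneg _) (hf x hx) 2
      have e3 : |h x| ^ (2 * q - 1) * |h x| = (|h x| ^ q) ^ 2 := by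
        rcases eq_or_lt_of_le e with h0 | h0
        · rw [← h0, Real.zero_rpow (by linarith), Real.zero_rpow (by linarith)]; simp
        · rw [← Real.rpow_natCast, ← Real.rpow_mul e, Real.rpow_sub_one h0.ne']
          field_simp
          norm_num [mul_comm]
      rw [e3]
      nlinarith [sq_nonneg (C0 * (|h x| - |h x| ^ q))]
    have e4 := rpow_cut (a := 2 * q - 1) 3 k0 k1 e (by linarith) (by norm_num; linarith)
    have e5 : (χ x * |h x|) ^ (2 * q - 1) ≤ P ^ (2 * q - 1) :=
      Real.rpow_le_rpow (by positivity) (hP x) (by linarith)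
    have e6 : χ x ^ 3 * |h x| ≤ P := by
      have : χ x ^ 3 ≤ χ x := by
        simpa using pow_le_pow_of_le_one k0 k1 (show 1 ≤ 3 by norm_num)
      exact (mul_le_mul_of_nonneg_right this e).trans (hP x)
    calc χ x ^ 3 * 1 * f x ^ 2 ≤ χ x ^ 3 * 1 *
          (2 * C0 ^ 2 * (|h x| * |h x| + |h x| ^ (2 * q - 1) * |h x|)) :=
          mul_le_mul_of_nonneg_left e1 (by positivity)
      _ = 2 * C0 ^ 2 * (χ x ^ 3 * |h x| + χ x ^ 3 * |h x| ^ (2 * q - 1)) * |h x| := by ring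
      _ ≤ _ := by
        refine mul_le_mul_of_nonneg_right (mul_le_mul_of_nonneg_left ?_ (by positivity)) e
        linarith
  have p4 : ∫ x, deriv (fun x => χ x ^ 3) x * h x * f x ≤ 3 * c * C0 * (P + P ^ q) * m := by
    rw [cube_deriv hχ.t]
    refine (row_le (r := r) (A := 3 * c * C0 * (P + P ^ q)) (h := h)
      (fun x hx => by simp [hχ.t.2 x hx])
      (by positivity) (fun x hx => ?_) ih).trans (mul_le_mul_of_nonneg_left hhm (by positivity))
    have k0 := hχ.n x
    have k1 := hχ.l x
    have e := abs_nonneg (h x)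
    have e4 := rpow_cut (a := q) 2 k0 k1 e (by linarith) (by norm_num; linarith)
    have e5 : (χ x * |h x|) ^ q ≤ P ^ q :=
      Real.rpow_le_rpow (by positivity) (hP x) (by linarith)
    have e6 : χ x ^ 2 * |h x| ≤ P := by
      have : χ x ^ 2 ≤ χ x := by nlinarith
      exact (mul_le_mul_of_nonneg_right this e).trans (hP x)
    calc _ ≤ |3 * χ x ^ 2 * deriv χ x * h x * f x| := le_abs_self _
      _ = 3 * χ x ^ 2 * |deriv χ x| * |h x| * |f x| := by
        rw [abs_mul, abs_mul, abs_mul, abs_mul, abs_of_nonneg (by positivity : 0 ≤ χ x ^ 2)]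
        simp
      _ ≤ 3 * χ x ^ 2 * c * |h x| * (C0 * (|h x| + |h x| ^ q)) := by
        have := hf x hx
        have := hχ.b1 x
        gcongr
      _ = 3 * c * C0 * (χ x ^ 2 * |h x| + χ x ^ 2 * |h x| ^ q) * |h x| := by ring
      _ ≤ _ := by
        refine mul_le_mul_of_nonneg_right (mul_le_mul_of_nonneg_left ?_ (by positivity)) e
        linarith
  have p5 : ∫ x, χ x ^ 3 * h x * s x ≤ P * M1 := by
    refine (row_le (r := r) (A := P) (h := s)
      (fun x hx => by simp [hχ.t.2 x hx])
      (by positivity) (fun x hx => ?_) is).trans (mul_le_mul_of_nonneg_left hsM (by positivity))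
    have k0 := hχ.n x
    have k1 := hχ.l x
    have e := abs_nonneg (h x)
    have e6 : χ x ^ 3 * |h x| ≤ P := by
      have : χ x ^ 3 ≤ χ x := by
        simpa using pow_le_pow_of_le_one k0 k1 (show 1 ≤ 3 by norm_num)
      exact (mul_le_mul_of_nonneg_right this e).trans (hP x)
    calc _ ≤ |χ x ^ 3 * h x * s x| := le_abs_self _
      _ = χ x ^ 3 * |h x| * |s x| := by
        rw [abs_mul, abs_mul, abs_of_nonneg (by positivity : 0 ≤ χ x ^ 3)]
      _ ≤ _ := mul_le_mul_of_nonneg_right e6 (abs_nonneg _)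
  have hq0 : 0 ≤ P ^ q := by positivity
  have hq1 : 0 ≤ P ^ (2 * q - 1) := by positivity
  have tot : μ * ((6 * c ^ 2 + 3 * c) / 2 * P * m) + 1 / (2 * μ) * (2 * C0 ^ 2 * (P + P ^ (2 * q - 1)) * m)
      + 3 * c * C0 * (P + P ^ q) * m + P * M1 ≤ A1 * P + A2 * P ^ (2 * q - 1) + A3 * P ^ q := by
    have e1 : μ * ((6 * c ^ 2 + 3 * c) / 2 * P * m) + 1 / (2 * μ) * (2 * C0 ^ 2 * (P + P ^ (2 * q - 1)) * m)
      + 3 * c * C0 * (P + P ^ q) * m + P * M1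
      = ((μ * (6 * c ^ 2 + 3 * c) / 2 + C0 ^ 2 / μ + 3 * c * C0) * m + M1) * P
        + C0 ^ 2 / μ * m * P ^ (2 * q - 1) + 3 * c * C0 * m * P ^ q := by
      field_simp; ring
    rw [e1, hA1, hA2, hA3]
    gcongr
  have y1' := y1 P hP0
  have y2' := y2 P hP0
  have y3' := y3 P hP0
  rw [Real.rpow_one] at y1'
  have hκA : A * κ * (18 * mb) = μ / 8 := by
    rw [hκ]; field_simp
  have P3 : P ^ 3 ≤ 18 * mb * D + 256 * (c * mb) ^ 3 := by
    refine hP3.trans ?_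
    gcongr
  have fin : A1 * P + A2 * P ^ (2 * q - 1) + A3 * P ^ q ≤
      μ / 8 * D + (A * κ * (256 * (c * mb) ^ 3) + A * (B1 + B2 + B3)) := by
    have z0 : 0 ≤ κ * P ^ 3 := by positivity
    calc _ ≤ A1 * (κ * P ^ 3 + B1) + A2 * (κ * P ^ 3 + B2) + A3 * (κ * P ^ 3 + B3) := by gcongr
      _ ≤ A * (κ * P ^ 3) + A * (B1 + B2 + B3) := by
        have i1 : A1 ≤ A := by linarith
        have i2 : A2 ≤ A := by linarith
        have i3 : A3 ≤ A := by linarith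
        nlinarith [mul_le_mul_of_nonneg_right i1 hB1, mul_le_mul_of_nonneg_right i2 hB2,
          mul_le_mul_of_nonneg_right i3 hB3]
      _ ≤ A * (κ * (18 * mb * D + 256 * (c * mb) ^ 3)) + A * (B1 + B2 + B3) := by gcongr
      _ = A * κ * (18 * mb) * D + (A * κ * (256 * (c * mb) ^ 3) + A * (B1 + B2 + B3)) := by ring
      _ = _ := by rw [hκA]
  unfold Rg
  have q1 : θ1 * (∫ x, χ x ^ 3 * (h x ^ 2 / 2)) ≤ θ1 / 2 * (P * m) := by
    calc _ ≤ θ1 * (P / 2 * m) := mul_le_mul_of_nonneg_left p1 h1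
      _ = _ := by ring
  have q2 := mul_le_mul_of_nonneg_left p2 hμ.le
  have q3 := mul_le_mul_of_nonneg_left p3 (by positivity : 0 ≤ 1 / (2 * μ))
  refine add_le_add q1 (mul_le_mul_of_nonneg_left ?_ h0)
  linarith

/-- hypotheses common to the smoothing estimates -/
structure Loc (r t1 t2 q m M1 C0 : ℝ) (d F S : ℝ → ℝ → ℝ) : Prop where
  d1 : ∀ t ∈ Icc t1 t2, ∫ x in Icc (-r) r, |d t x| ≤ m
  s1 : ∀ t ∈ Icc t1 t2, ∫ x in Icc (-r) r, |S t x| ≤ M1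
  f1 : ∀ t ∈ Icc t1 t2, ∀ x, |x| ≤ r → |F t x| ≤ C0 * (|d t x| + |d t x| ^ q)

lemma jj_sq : JJ 1 (fun s : ℝ => s ^ 2 / 2) (fun s => s) (fun _ => 1) where
  d1 s := by
    have h1 := ((hasDerivAt_id s).pow 2).div_const 2
    refine HasDerivAt.congr_deriv (f := fun s : ℝ => s ^ 2 / 2) h1 ?_
    simp
  d2 s := hasDerivAt_id s
  c2 := continuous_const
  n2 _ := zero_le_one
  le _ := le_rfl
  z := by simp
  z1 := rfl

set_option maxHeartbeats 800000 in
lemma SL {μ q c mb M1 C0 : ℝ} (hμ : 0 < μ) (hq : 1 < q) (hq2 : q < 2) (hmb : 0 < mb)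
    (hM1 : 0 ≤ M1) (hC0 : 0 ≤ C0) (hc : 0 ≤ c) :
    ∃ K, 0 ≤ K ∧ ∀ (r r' t1 t2 m : ℝ) (χ : ℝ → ℝ) (d F S : ℝ → ℝ → ℝ) (b : ℝ → ℝ),
      Cut r c χ → EL μ r' t1 t2 d F S b → Loc r t1 t2 q m M1 C0 d F S → 0 < r' → r < r' →
      t1 < t2 → t2 - t1 ≤ 1 → 0 < m → m ≤ mb →
      ∫ x, χ x ^ 3 * d t2 x ^ 2 ≤ K * ((t2 - t1) + m ^ 2 / √(t2 - t1)) := by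
  obtain ⟨K, hK, hrow⟩ := rowB hμ hq hq2 hmb hM1 hC0 hc
  obtain ⟨C1, hC1, y⟩ := rpow_young (a := 1) (κ := μ / 144) (by norm_num) (by norm_num) (by positivity)
  set K' := K + 256 * (μ / 144) * c ^ 3 * mb ^ 2 + C1 with hK'
  have hK0 : 0 ≤ K' := by positivity
  refine ⟨2 * K', by positivity, ?_⟩
  intro r r' t1 t2 m χ d F S b hχ h hL hr0 hrr h12 hΔ hm hmm
  set Δ := t2 - t1 with hΔd
  have hΔ0 : 0 < Δ := by linarith
  have hθ : ∀ t, HasDerivAt (fun t : ℝ => (t - t1) ^ 2) (2 * (t - t1)) t := by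
    intro t
    have h1 := ((hasDerivAt_id t).sub_const t1).pow 2
    refine HasDerivAt.congr_deriv (f := fun t : ℝ => (t - t1) ^ 2) h1 ?_
    simp
  obtain ⟨i1, i2, hmain⟩ := h.main jj_sq (cube_test hχ.t) hr0 hrr (fun x => pow_nonneg (hχ.n x) 3) hθ
    (by fun_prop) (fun t _ => sq_nonneg _)
  have key : ∀ t ∈ Icc t1 t2,
      Rg μ (fun x => χ x ^ 3) (fun s => s ^ 2 / 2) (fun s => s) (fun _ => 1) (2 * (t - t1))
        ((t - t1) ^ 2) (d t) (fun x => F t x ^ 2) (F t) (S t)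
      ≤ μ / 4 * ((t - t1) ^ 2 * ∫ x, χ x ^ 3 * (1 * deriv (d t) x ^ 2))
        + K' * (Δ ^ 2 + m ^ 2 * √Δ) := by
    intro t ht
    obtain ⟨P, hP0, hP3, hR⟩ := hrow r χ (d t) (F t) (S t) m hχ (h.dC t ht) (h.Sl t ht)
      hm hmm (hL.d1 t ht) (hL.s1 t ht) (hL.f1 t ht)
    set τ := t - t1 with hτ
    have τ0 : 0 ≤ τ := by have := ht.1; linarith
    have τΔ : τ ≤ Δ := by have := ht.2; linarith
    set D := ∫ x, χ x ^ 3 * (1 * deriv (d t) x ^ 2) with hD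
    refine (hR _ _ (by linarith) (sq_nonneg _)).trans ?_
    have hs : √τ ^ 2 = τ := Real.sq_sqrt τ0
    set s := √τ with hsd
    have s0 : 0 ≤ s := Real.sqrt_nonneg _
    have sΔ : s ≤ √Δ := Real.sqrt_le_sqrt τΔ
    have yy := y (s * P / m) (by positivity)
    rw [Real.rpow_one] at yy
    have e1 : τ * (P * m) ≤ μ / 144 * (τ ^ 2 * (P ^ 3 / m)) + C1 * (m ^ 2 * s) := by
      have := mul_le_mul_of_nonneg_left yy (by positivity : 0 ≤ m ^ 2 * s)
      calc τ * (P * m) = m ^ 2 * s * (s * P / m) := by rw [← hs]; field_simp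
        _ ≤ _ := this
        _ = _ := by rw [← hs]; field_simp
    have e2 : P ^ 3 / m ≤ 18 * D + 256 * c ^ 3 * m ^ 2 := by
      rw [div_le_iff₀ hm]
      calc P ^ 3 ≤ _ := hP3
        _ = _ := by ring
    have e3 : 256 * c ^ 3 * m ^ 2 ≤ 256 * c ^ 3 * mb ^ 2 := by gcongr
    have e4 : τ ^ 2 * (P ^ 3 / m) ≤ τ ^ 2 * (18 * D + 256 * c ^ 3 * mb ^ 2) := by
      refine mul_le_mul_of_nonneg_left (by linarith) (by positivity)
    have e5 : τ ^ 2 ≤ Δ ^ 2 := by gcongr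
    have e6 : 0 ≤ K + 256 * (μ / 144) * c ^ 3 * mb ^ 2 := by positivity
    have e7 : m ^ 2 * s ≤ m ^ 2 * √Δ := by gcongr
    have e8 : 0 ≤ m ^ 2 * √Δ := by positivity
    calc 2 * τ / 2 * (P * m) + τ ^ 2 * (μ / 8 * D + K)
        ≤ μ / 144 * (τ ^ 2 * (18 * D + 256 * c ^ 3 * mb ^ 2)) + C1 * (m ^ 2 * s)
          + τ ^ 2 * (μ / 8 * D + K) := by
          have : 2 * τ / 2 * (P * m) = τ * (P * m) := by ring
          rw [this]
          have := mul_le_mul_of_nonneg_left e4 (by positivity : 0 ≤ μ / 144)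
          linarith
      _ = μ / 4 * (τ ^ 2 * D) + (K + 256 * (μ / 144) * c ^ 3 * mb ^ 2) * τ ^ 2 + C1 * (m ^ 2 * s) := by
          ring
      _ ≤ μ / 4 * (τ ^ 2 * D) + (K + 256 * (μ / 144) * c ^ 3 * mb ^ 2) * Δ ^ 2 + C1 * (m ^ 2 * √Δ) := by
          gcongr
      _ ≤ _ := by
          rw [hK']
          nlinarith [mul_nonneg e6 e8, mul_nonneg hC1 (sq_nonneg Δ)]
  have hintg : ∫ t in Icc t1 t2, Rg μ (fun x => χ x ^ 3) (fun s => s ^ 2 / 2) (fun s => s) (fun _ => 1)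
        (2 * (t - t1)) ((t - t1) ^ 2) (d t) (fun x => F t x ^ 2) (F t) (S t)
      ≤ μ / 4 * (∫ t in Icc t1 t2, (t - t1) ^ 2 * ∫ x, χ x ^ 3 * (1 * deriv (d t) x ^ 2))
        + Δ * (K' * (Δ ^ 2 + m ^ 2 * √Δ)) := by
    have ic : IntegrableOn (fun _ : ℝ => K' * (Δ ^ 2 + m ^ 2 * √Δ)) (Icc t1 t2) :=
      integrableOn_const (by simp)
    refine (setIntegral_mono_on i2 ((i1.const_mul (μ / 4)).add ic) measurableSet_Icc key).trans
      (le_of_eq ?_)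
    have := integral_add (i1.const_mul (μ / 4)) ic
    simp only [Pi.add_apply]
    rw [this, integral_const_mul]
    simp [Real.volume_real_Icc_of_le h12.le, hΔd]
  have i0 : 0 ≤ ∫ t in Icc t1 t2, (t - t1) ^ 2 * ∫ x, χ x ^ 3 * (1 * deriv (d t) x ^ 2) :=
    integral_nonneg fun t => mul_nonneg (sq_nonneg _) (integral_nonneg fun x => by
      have := hχ.n x
      positivity)
  have e : ∫ x, χ x ^ 3 * (d t2 x ^ 2 / 2) = 1 / 2 * ∫ x, χ x ^ 3 * d t2 x ^ 2 := by
    rw [← integral_const_mul]; congr 1; funext x; ring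
  have hm2 : Δ ^ 2 * (1 / 2 * ∫ x, χ x ^ 3 * d t2 x ^ 2) ≤ Δ * (K' * (Δ ^ 2 + m ^ 2 * √Δ)) := by
    rw [e] at hmain
    have z : (t1 - t1) ^ 2 * (∫ x, χ x ^ 3 * (d t1 x ^ 2 / 2)) = 0 := by simp
    rw [z, zero_add] at hmain
    have : 0 ≤ μ / 4 * ∫ t in Icc t1 t2, (t - t1) ^ 2 * ∫ x, χ x ^ 3 * (1 * deriv (d t) x ^ 2) := by
      positivity
    linarith
  have hsq : √Δ ^ 2 = Δ := Real.sq_sqrt hΔ0.le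
  have hsp : 0 < √Δ := Real.sqrt_pos.2 hΔ0
  have e9 : Δ * (K' * (Δ ^ 2 + m ^ 2 * √Δ)) = Δ ^ 2 * (K' * (Δ + m ^ 2 / √Δ)) := by
    have : √Δ = Δ / √Δ := by field_simp; linarith
    have e10 : m ^ 2 * √Δ = Δ * (m ^ 2 / √Δ) := by
      rw [this]; field_simp; rw [hsq]
    rw [e10]; ring
  rw [e9] at hm2
  have := le_of_mul_le_mul_left hm2 (by positivity)
  linarith

lemma SL1 {μ q c mb M1 C0 : ℝ} (hμ : 0 < μ) (hq : 1 < q) (hq2 : q < 2) (hmb : 0 < mb)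
    (hM1 : 0 ≤ M1) (hC0 : 0 ≤ C0) (hc : 0 ≤ c) :
    ∃ K, 0 ≤ K ∧ ∀ (r r' t1 t2 : ℝ) (χ : ℝ → ℝ) (d F S : ℝ → ℝ → ℝ) (b : ℝ → ℝ),
      Cut r c χ → EL μ r' t1 t2 d F S b → Loc r t1 t2 q mb M1 C0 d F S → 0 < r' → r < r' →
      IntegrableOn (fun t => ∫ x, χ x ^ 3 * deriv (d t) x ^ 2) (Icc t1 t2) ∧
      (∫ x, χ x ^ 3 * d t2 x ^ 2) + μ / 2 * (∫ t in Icc t1 t2, ∫ x, χ x ^ 3 * deriv (d t) x ^ 2)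
        ≤ (∫ x, χ x ^ 3 * d t1 x ^ 2) + K * (t2 - t1) := by
  obtain ⟨K, hK, hrow⟩ := rowB hμ hq hq2 hmb hM1 hC0 hc
  refine ⟨2 * K, by positivity, ?_⟩
  intro r r' t1 t2 χ d F S b hχ h hL hr0 hrr
  have h12 := h.t12
  obtain ⟨i1, i2, hmain⟩ := h.main jj_sq (cube_test hχ.t) hr0 hrr (fun x => pow_nonneg (hχ.n x) 3)
    (θ := fun _ => 1) (θ' := fun _ => 0) (fun t => hasDerivAt_const _ _)
    (by fun_prop) (fun t _ => zero_le_one)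
  simp only [one_mul] at i1 hmain
  have key : ∀ t ∈ Icc t1 t2,
      Rg μ (fun x => χ x ^ 3) (fun s => s ^ 2 / 2) (fun s => s) (fun _ => 1) 0
        1 (d t) (fun x => F t x ^ 2) (F t) (S t)
      ≤ μ / 4 * (∫ x, χ x ^ 3 * (deriv (d t) x ^ 2)) + K := by
    intro t ht
    obtain ⟨P, hP0, hP3, hR⟩ := hrow r χ (d t) (F t) (S t) mb hχ (h.dC t ht) (h.Sl t ht)
      hmb le_rfl (hL.d1 t ht) (hL.s1 t ht) (hL.f1 t ht)
    refine (hR 0 1 le_rfl zero_le_one).trans ?_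
    simp only [one_mul, zero_div, zero_mul, zero_add]
    have : 0 ≤ ∫ x, χ x ^ 3 * (deriv (d t) x ^ 2) := integral_nonneg fun x => by
      have := hχ.n x
      positivity
    nlinarith
  refine ⟨i1, ?_⟩
  have hintg : ∫ t in Icc t1 t2, Rg μ (fun x => χ x ^ 3) (fun s => s ^ 2 / 2) (fun s => s) (fun _ => 1)
        0 1 (d t) (fun x => F t x ^ 2) (F t) (S t)
      ≤ μ / 4 * (∫ t in Icc t1 t2, ∫ x, χ x ^ 3 * (deriv (d t) x ^ 2)) + (t2 - t1) * K := by
    have ic : IntegrableOn (fun _ : ℝ => K) (Icc t1 t2) := integrableOn_const (by simp)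
    refine (setIntegral_mono_on i2 ((i1.const_mul (μ / 4)).add ic) measurableSet_Icc key).trans
      (le_of_eq ?_)
    have := integral_add (i1.const_mul (μ / 4)) ic
    simp only [Pi.add_apply]
    rw [this, integral_const_mul]
    simp [Real.volume_real_Icc_of_le h12]
  have e : ∀ t, ∫ x, χ x ^ 3 * (d t x ^ 2 / 2) = 1 / 2 * ∫ x, χ x ^ 3 * d t x ^ 2 := by
    intro t
    rw [← integral_const_mul]; congr 1; funext x; ring
  rw [e, e] at hmain
  linarith
end RegAux

namespace RegAux
open Set Topology
open scoped ContDiff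

noncomputable def w0 (δ s : ℝ) : ℝ := √(s ^ 2 + δ ^ 2)
noncomputable def j0 (δ s : ℝ) : ℝ := w0 δ s - δ
noncomputable def j01 (δ s : ℝ) : ℝ := s / w0 δ s
noncomputable def j02 (δ s : ℝ) : ℝ := δ ^ 2 / w0 δ s ^ 3

section
variable {δ : ℝ}
lemma w0_sq (δ s : ℝ) : w0 δ s ^ 2 = s ^ 2 + δ ^ 2 := Real.sq_sqrt (by positivity)
lemma w0_pos (h : 0 < δ) (s : ℝ) : 0 < w0 δ s := Real.sqrt_pos.2 (by positivity)
lemma w0_geδ (h : 0 < δ) (s : ℝ) : δ ≤ w0 δ s := Real.le_sqrt_of_sq_le (by nlinarith [sq_nonneg s])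
lemma w0_ge (δ s : ℝ) : |s| ≤ w0 δ s :=
  Real.le_sqrt_of_sq_le (by rw [sq_abs]; nlinarith [sq_nonneg δ])
lemma w0_le (h : 0 < δ) (s : ℝ) : w0 δ s ≤ |s| + δ := by
  refine Real.sqrt_le_iff.2 ⟨by positivity, ?_⟩
  nlinarith [sq_abs s, abs_nonneg s]

lemma j0_le (h : 0 < δ) (s : ℝ) : j0 δ s ≤ |s| := by have := w0_le h s; unfold j0; linarith
lemma j0_ge (δ s : ℝ) : |s| - δ ≤ j0 δ s := by have := w0_ge δ s; unfold j0; linarith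
lemma j0_nonneg (h : 0 < δ) (s : ℝ) : 0 ≤ j0 δ s := by have := w0_geδ h s; unfold j0; linarith
lemma j0_abs (h : 0 < δ) (s : ℝ) : |j0 δ s| ≤ |s| := by
  rw [abs_of_nonneg (j0_nonneg h s)]; exact j0_le h s
lemma j01_abs (h : 0 < δ) (s : ℝ) : |j01 δ s| ≤ 1 := by
  have := w0_pos h s
  rw [j01, abs_div, abs_of_pos this, div_le_one this]; exact w0_ge δ s
lemma j01_mul (h : 0 < δ) (s : ℝ) : |s| - δ ≤ j01 δ s * s := by
  have hp := w0_pos h s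
  have h1 := w0_ge δ s
  have h2 := w0_geδ h s
  have h3 := w0_sq δ s
  have : j01 δ s * s = s ^ 2 / w0 δ s := by unfold j01; ring
  rw [this, le_div_iff₀ hp]
  nlinarith [mul_le_mul_of_nonneg_left h2 h.le, mul_le_mul_of_nonneg_right h1 hp.le]
lemma j02_nonneg (h : 0 < δ) (s : ℝ) : 0 ≤ j02 δ s := by
  have hp := w0_pos h s
  unfold j02; positivity
lemma j02_sq (h : 0 < δ) (s : ℝ) : j02 δ s * s ^ 2 ≤ δ := by
  have hp := w0_pos h s
  have h2 := w0_geδ h s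
  have h3 := w0_sq δ s
  have : j02 δ s * s ^ 2 = δ ^ 2 * s ^ 2 / w0 δ s ^ 3 := by unfold j02; ring
  rw [this, div_le_iff₀ (by positivity)]
  have : s ^ 2 ≤ w0 δ s ^ 2 := by rw [h3]; nlinarith [sq_nonneg δ]
  calc δ ^ 2 * s ^ 2 ≤ δ ^ 2 * w0 δ s ^ 2 := by gcongr
    _ = δ * δ * w0 δ s ^ 2 := by ring
    _ ≤ δ * w0 δ s * w0 δ s ^ 2 := by gcongr
    _ = _ := by ring
lemma j02_four (h : 0 < δ) (s : ℝ) : j02 δ s * s ^ 4 ≤ δ ^ 2 * |s| := by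
  have hp := w0_pos h s
  have h2 := w0_ge δ s
  have : j02 δ s * s ^ 4 = δ ^ 2 * |s| * |s| ^ 3 / w0 δ s ^ 3 := by
    have : s ^ 4 = |s| * |s| ^ 3 := by
      have : |s| * |s| ^ 3 = (|s| ^ 2) ^ 2 := by ring
      rw [this, sq_abs]; ring
    rw [this]
    unfold j02; ring
  rw [this, div_le_iff₀ (by positivity)]
  gcongr
lemma jj_abs (h : 0 < δ) : JJ (1 / δ) (j0 δ) (j01 δ) (j02 δ) where
  d1 s := by
    have hp := w0_pos h s
    have h1 : HasDerivAt (fun s : ℝ => s ^ 2 + δ ^ 2) (2 * s) s := by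
      have := ((hasDerivAt_id s).pow 2).add_const (δ ^ 2)
      refine HasDerivAt.congr_deriv (f := fun s : ℝ => s ^ 2 + δ ^ 2) this ?_
      simp
    have h2 := (h1.sqrt (by positivity)).sub_const δ
    refine HasDerivAt.congr_deriv (f := j0 δ) h2 ?_
    change 2 * s / (2 * w0 δ s) = s / w0 δ s
    field_simp
  d2 s := by
    have hp := w0_pos h s
    have h1 : HasDerivAt (fun s : ℝ => s ^ 2 + δ ^ 2) (2 * s) s := by
      have := ((hasDerivAt_id s).pow 2).add_const (δ ^ 2)
      refine HasDerivAt.congr_deriv (f := fun s : ℝ => s ^ 2 + δ ^ 2) this ?_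
      simp
    have h2 := (hasDerivAt_id s).div (h1.sqrt (by positivity)) hp.ne'
    refine HasDerivAt.congr_deriv (f := j01 δ) h2 ?_
    change (1 * w0 δ s - s * (2 * s / (2 * w0 δ s))) / w0 δ s ^ 2 = δ ^ 2 / w0 δ s ^ 3
    have h3 := w0_sq δ s
    field_simp
    linarith
  c2 := by
    have : Continuous (w0 δ) := by unfold w0; fun_prop
    unfold j02
    exact continuous_const.div (this.pow 3) fun s => by have := w0_pos h s; positivity
  n2 := j02_nonneg h
  le s := by
    have hp := w0_pos h s
    unfold j02
    rw [div_le_div_iff₀ (by positivity) h]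
    calc δ ^ 2 * δ = δ ^ 3 := by ring
      _ ≤ w0 δ s ^ 3 := pow_le_pow_left₀ h.le (w0_geδ h s) 3
      _ = _ := by ring
  z := by simp [j0, w0, Real.sqrt_sq h.le]
  z1 := by simp [j01]
end

/-- `|a|^q ≤ |a| + a^2` -/
lemma rpow_le_add {q : ℝ} (hq : 1 < q) (hq2 : q < 2) (a : ℝ) : |a| ^ q ≤ |a| + a ^ 2 := by
  rcases le_total |a| 1 with h | h
  · rcases eq_or_lt_of_le (abs_nonneg a) with h0 | h0
    · rw [← h0, Real.zero_rpow (by linarith)]; positivity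
    · have := Real.rpow_le_rpow_of_exponent_ge h0 h hq.le
      rw [Real.rpow_one] at this
      nlinarith [sq_nonneg a]
  · have := Real.rpow_le_rpow_of_exponent_le h hq2.le
    rw [Real.rpow_two, sq_abs] at this
    linarith [abs_nonneg a]

lemma rowKato {μ q c C0 δ r : ℝ} (hμ : 0 < μ) (hq : 1 < q) (hq2 : q < 2)
    (hC0 : 0 ≤ C0) (hc : 0 ≤ c) (hδ : 0 < δ) (hδ1 : δ ≤ 1) {ψ h f s : ℝ → ℝ} (hψ : Test r ψ)
    (b0 : ∀ x, |ψ x| ≤ c) (b1 : ∀ x, |deriv ψ x| ≤ c) (b2 : ∀ x, |deriv (deriv ψ) x| ≤ c)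
    (hψ0 : ∀ x, 0 ≤ ψ x)
    (hh : Continuous h) (hs : LocallyIntegrable s)
    (hf : ∀ x, |x| ≤ r → |f x| ≤ C0 * (|h x| + |h x| ^ q)) :
    Rg μ ψ (j0 δ) (j01 δ) (j02 δ) 0 1 h (fun x => f x ^ 2) f s
      ≤ (μ * c + 1 / (2 * μ) * (8 * c * C0 ^ 2) + 2 * c * C0 + c) *
        ∫ x in Icc (-r) r, (|h x| + h x ^ 2 + |s x| + 1) := by
  set k := fun x => |h x| + h x ^ 2 + |s x| + 1 with hk
  have k0 : ∀ x, |k x| = k x := fun x => abs_of_nonneg (by simp only [hk]; positivity)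
  have ik : IntegrableOn k (Icc (-r) r) := by
    have i1 : IntegrableOn (fun x => |h x| + h x ^ 2 + 1) (Icc (-r) r) := by
      exact (by fun_prop : Continuous fun x => |h x| + h x ^ 2 + 1).locallyIntegrable.integrableOn_isCompact
        isCompact_Icc
    have i2 := (hs.integrableOn_isCompact (isCompact_Icc (a := -r) (b := r))).abs
    refine (i1.add i2).congr_fun (fun x _ => ?_) measurableSet_Icc
    simp only [Pi.add_apply, hk]; ring
  have hf2 : ∀ x, |x| ≤ r → |f x| ≤ C0 * (2 * |h x| + h x ^ 2) := fun x hx => by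
    refine (hf x hx).trans (mul_le_mul_of_nonneg_left ?_ hC0)
    have := rpow_le_add hq hq2 (h x)
    linarith
  have e0 : ∀ x, |h x| ≤ k x := fun x => by
    have := abs_nonneg (s x); have := sq_nonneg (h x); simp only [hk]; linarith
  have e1 : ∀ x, |s x| ≤ k x := fun x => by
    have := abs_nonneg (h x); have := sq_nonneg (h x); simp only [hk]; linarith
  have p1 : ∫ x, deriv (deriv ψ) x * j0 δ (h x) ≤ c * ∫ x in Icc (-r) r, |k x| := by
    refine row_le (fun x hx => by simp [hψ.der.der.2 x hx]) hc (fun x _ => ?_) ik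
    refine (le_abs_self _).trans ?_
    rw [abs_mul, k0]
    exact mul_le_mul (b2 x) ((j0_abs hδ _).trans (e0 x)) (abs_nonneg _) hc
  have p2 : ∫ x, ψ x * j02 δ (h x) * f x ^ 2 ≤ 8 * c * C0 ^ 2 * ∫ x in Icc (-r) r, |k x| := by
    refine row_le (fun x hx => by simp [hψ.2 x hx]) (by positivity) (fun x hx => ?_) ik
    rw [k0]
    have z1 : f x ^ 2 ≤ C0 ^ 2 * (8 * h x ^ 2 + 2 * h x ^ 4) := by
      rw [← sq_abs (f x)]
      refine (pow_le_pow_left₀ (abs_nonneg _) (hf2 x hx) 2).trans ?_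
      rw [mul_pow]
      refine mul_le_mul_of_nonneg_left ?_ (sq_nonneg _)
      have := sq_abs (h x)
      nlinarith [sq_nonneg (2 * |h x| - h x ^ 2)]
    have z2 := j02_sq hδ (h x)
    have z3 := j02_four hδ (h x)
    have z4 := j02_nonneg hδ (h x)
    have z5 : δ ^ 2 ≤ 1 := pow_le_one₀ hδ.le hδ1
    have z6 : j02 δ (h x) * f x ^ 2 ≤ C0 ^ 2 * (8 * k x) := by
      calc _ ≤ j02 δ (h x) * (C0 ^ 2 * (8 * h x ^ 2 + 2 * h x ^ 4)) :=
            mul_le_mul_of_nonneg_left z1 z4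
        _ = C0 ^ 2 * (8 * (j02 δ (h x) * h x ^ 2) + 2 * (j02 δ (h x) * h x ^ 4)) := by ring
        _ ≤ _ := by
          refine mul_le_mul_of_nonneg_left ?_ (sq_nonneg _)
          have : δ ^ 2 * |h x| ≤ |h x| := mul_le_of_le_one_left (abs_nonneg _) z5
          simp only [hk]
          nlinarith [abs_nonneg (s x), sq_nonneg (h x), abs_nonneg (h x)]
    have z7 : 0 ≤ k x := by rw [← k0]; positivity
    calc ψ x * j02 δ (h x) * f x ^ 2 = ψ x * (j02 δ (h x) * f x ^ 2) := by ring
      _ ≤ c * (C0 ^ 2 * (8 * k x)) :=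
        mul_le_mul ((le_abs_self _).trans (b0 x)) z6 (by positivity) hc
      _ = _ := by ring
  have p3 : ∫ x, deriv ψ x * j01 δ (h x) * f x ≤ 2 * c * C0 * ∫ x in Icc (-r) r, |k x| := by
    refine row_le (fun x hx => by simp [hψ.der.2 x hx]) (by positivity) (fun x hx => ?_) ik
    refine (le_abs_self _).trans ?_
    rw [abs_mul, abs_mul, k0]
    have z1 : |f x| ≤ C0 * (2 * k x) := (hf2 x hx).trans (mul_le_mul_of_nonneg_left (by
      simp only [hk]; linarith [abs_nonneg (s x), sq_nonneg (h x)]) hC0)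
    calc _ ≤ c * 1 * (C0 * (2 * k x)) := by
          refine mul_le_mul (mul_le_mul (b1 x) (j01_abs hδ _) (abs_nonneg _) hc) z1
            (abs_nonneg _) (by positivity)
      _ = _ := by ring
  have p4 : ∫ x, ψ x * j01 δ (h x) * s x ≤ c * ∫ x in Icc (-r) r, |k x| := by
    refine row_le (fun x hx => by simp [hψ.2 x hx]) (by positivity) (fun x hx => ?_) ik
    refine (le_abs_self _).trans ?_
    rw [abs_mul, abs_mul, k0]
    calc _ ≤ c * 1 * k x := by
          refine mul_le_mul (mul_le_mul (b0 x) (j01_abs hδ _) (abs_nonneg _) hc) (e1 x)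
            (abs_nonneg _) (by positivity)
      _ = _ := by ring
  have e : ∫ x in Icc (-r) r, |k x| = ∫ x in Icc (-r) r, k x := by simp only [k0]
  rw [e] at p1 p2 p3 p4
  unfold Rg
  have q1 := mul_le_mul_of_nonneg_left p1 hμ.le
  have q2 := mul_le_mul_of_nonneg_left p2 (by positivity : 0 ≤ 1 / (2 * μ))
  simp only [zero_mul, one_mul, zero_add]
  linarith

/-- crude local Kato estimate -/
lemma kato {μ q c C0 : ℝ} (hμ : 0 < μ) (hq : 1 < q) (hq2 : q < 2)
    (hC0 : 0 ≤ C0) (hc : 0 ≤ c) :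
    ∃ K, 0 ≤ K ∧ ∀ (r r' t1 t2 : ℝ) (ψ : ℝ → ℝ) (d F S : ℝ → ℝ → ℝ) (b w : ℝ → ℝ),
      Test r ψ → (∀ x, |ψ x| ≤ c) → (∀ x, |deriv ψ x| ≤ c) → (∀ x, |deriv (deriv ψ) x| ≤ c) →
      (∀ x, 0 ≤ ψ x) → EL μ r' t1 t2 d F S b → 0 < r' → r < r' →
      (∀ t ∈ Icc t1 t2, ∀ x, |x| ≤ r → |F t x| ≤ C0 * (|d t x| + |d t x| ^ q)) →
      IntegrableOn w (Icc t1 t2) →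
      (∀ t ∈ Icc t1 t2, ∫ x in Icc (-r) r, (|d t x| + d t x ^ 2 + |S t x| + 1) ≤ w t) →
      ∫ x, ψ x * |d t2 x| ≤ (∫ x, ψ x * |d t1 x|) + K * ∫ t in Icc t1 t2, w t := by
  set K := μ * c + 1 / (2 * μ) * (8 * c * C0 ^ 2) + 2 * c * C0 + c with hK
  have hK0 : 0 ≤ K := by positivity
  refine ⟨K, hK0, ?_⟩
  intro r r' t1 t2 ψ d F S b w hψ b0 b1 b2 hψ0 h hr0 hrr hF iw hw
  have h12 := h.t12
  have m1 : t1 ∈ Icc t1 t2 := ⟨le_rfl, h12⟩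
  have m2 : t2 ∈ Icc t1 t2 := ⟨h12, le_rfl⟩
  have iψ : Integrable ψ := hψ.cont.integrable_of_hasCompactSupport hψ.hcs
  have ia : ∀ t ∈ Icc t1 t2, Integrable (fun x => ψ x * |d t x|) := fun t ht =>
    hψ.integrable_mul_cont (h.dC t ht).continuous.abs
  have main : ∀ δ, 0 < δ → δ ≤ 1 → ∫ x, ψ x * |d t2 x| ≤
      (∫ x, ψ x * |d t1 x|) + K * (∫ t in Icc t1 t2, w t) + δ * ∫ x, ψ x := by
    intro δ hδ hδ1
    obtain ⟨i1, i2, hmain⟩ := h.main (jj_abs hδ) hψ hr0 hrr hψ0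
      (θ := fun _ => 1) (θ' := fun _ => 0) (fun t => hasDerivAt_const _ _)
      (by fun_prop) (fun t _ => zero_le_one)
    have hintg : ∫ t in Icc t1 t2, Rg μ ψ (j0 δ) (j01 δ) (j02 δ) 0 1 (d t) (fun x => F t x ^ 2) (F t) (S t)
        ≤ K * ∫ t in Icc t1 t2, w t := by
      rw [← integral_const_mul]
      refine setIntegral_mono_on i2 (iw.const_mul K) measurableSet_Icc fun t ht => ?_
      exact (rowKato hμ hq hq2 hC0 hc hδ hδ1 hψ b0 b1 b2 hψ0 (h.dC t ht).continuous (h.Sl t ht)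
        (hF t ht)).trans (mul_le_mul_of_nonneg_left (hw t ht) hK0)
    have i0 : 0 ≤ μ / 2 * ∫ t in Icc t1 t2, (1:ℝ) * ∫ x, ψ x * (j02 δ (d t x) * deriv (d t) x ^ 2) :=
      mul_nonneg (by positivity) (integral_nonneg fun t => by
        simp only [one_mul]
        exact integral_nonneg fun x => mul_nonneg (hψ0 x) (mul_nonneg (j02_nonneg hδ _) (sq_nonneg _)))
    have cj := (jj_abs hδ).c
    have ij : ∀ t ∈ Icc t1 t2, Integrable (fun x => ψ x * j0 δ (d t x)) := fun t ht =>
      hψ.integrable_mul_cont (cj.comp (h.dC t ht).continuous)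
    have l1 : ∫ x, ψ x * j0 δ (d t1 x) ≤ ∫ x, ψ x * |d t1 x| :=
      integral_mono (ij t1 m1) (ia t1 m1) fun x => mul_le_mul_of_nonneg_left (j0_le hδ _) (hψ0 x)
    have l2 : (∫ x, ψ x * |d t2 x|) - δ * (∫ x, ψ x) ≤ ∫ x, ψ x * j0 δ (d t2 x) := by
      have i3 : Integrable (fun x => δ * ψ x) := iψ.const_mul δ
      rw [← integral_const_mul, ← integral_sub (ia t2 m2) i3]
      refine integral_mono ((ia t2 m2).sub i3) (ij t2 m2) fun x => ?_
      have := mul_le_mul_of_nonneg_left (j0_ge δ (d t2 x)) (hψ0 x)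
      simp only
      linarith
    simp only [one_mul] at hmain i0
    linarith
  refine le_of_forall_pos_le_add fun ε hε => ?_
  have hI : 0 ≤ ∫ x, ψ x := integral_nonneg hψ0
  have hδ : 0 < min 1 (ε / ((∫ x, ψ x) + 1)) := lt_min one_pos (by positivity)
  refine (main _ hδ (min_le_left _ _)).trans (add_le_add le_rfl ?_)
  calc _ ≤ ε / ((∫ x, ψ x) + 1) * ∫ x, ψ x := mul_le_mul_of_nonneg_right (min_le_right _ _) hI
    _ ≤ ε := by
      rw [div_mul_eq_mul_div, div_le_iff₀ (by positivity)]
      nlinarith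
end RegAux

namespace RegAux
open Set Topology
open scoped ContDiff

lemma contDiff_deriv_of_two {v : ℝ → ℝ} (hv : ContDiff ℝ 2 v) : ContDiff ℝ 1 (deriv v) := by
  have h2 : ContDiff ℝ (1 + 1) v := by norm_num; exact hv
  exact (contDiff_succ_iff_deriv.1 h2).2.2

lemma rpow_small {q lam : ℝ} (hq : 1 < q) (hq2 : q < 2) (hl : 0 < lam) :
    ∃ C, 0 ≤ C ∧ ∀ a : ℝ, |a| ^ (q - 1) ≤ lam * |a| + C := by
  set L := lam ^ (1 / (2 - q)) with hL
  have L0 : 0 < L := by positivity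
  refine ⟨L ^ (-(q - 1)), by positivity, fun a => ?_⟩
  have h1 : (L * |a|) ^ (q - 1) ≤ 1 + L * |a| := by
    rcases le_total (L * |a|) 1 with h | h
    · have := Real.rpow_le_one (by positivity) h (by linarith : 0 ≤ q - 1)
      have : 0 ≤ L * |a| := by positivity
      linarith
    · have := Real.rpow_le_rpow_of_exponent_le h (by linarith : q - 1 ≤ 1)
      rw [Real.rpow_one] at this
      linarith
  rw [Real.mul_rpow L0.le (abs_nonneg a)] at h1
  have h2 : L ^ (-(q - 1)) * L ^ (q - 1) = 1 := by
    rw [← Real.rpow_add L0]; simp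
  have h3 : L ^ (-(q - 1)) * L = lam := by
    nth_rewrite 2 [← Real.rpow_one L]
    rw [← Real.rpow_add L0, hL, ← Real.rpow_mul hl.le]
    have : 1 / (2 - q) * (-(q - 1) + 1) = 1 := by
      have : 2 - q ≠ 0 := by linarith
      field_simp; ring
    rw [this, Real.rpow_one]
  have h4 := mul_le_mul_of_nonneg_left h1 (by positivity : 0 ≤ L ^ (-(q - 1)))
  calc |a| ^ (q - 1) = L ^ (-(q - 1)) * L ^ (q - 1) * |a| ^ (q - 1) := by rw [h2, one_mul]
    _ = L ^ (-(q - 1)) * (L ^ (q - 1) * |a| ^ (q - 1)) := by ring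
    _ ≤ _ := h4
    _ = L ^ (-(q - 1)) * L * |a| + L ^ (-(q - 1)) := by ring
    _ = _ := by rw [h3]

lemma sup_sq {r : ℝ} (hr : 0 < r) {w : ℝ → ℝ} (hw : ContDiff ℝ 1 w) {x : ℝ} (hx : x ∈ Icc (-r) r) :
    w x ^ 2 ≤ 1 / r * (∫ y in Icc (-r) r, w y ^ 2) + 4 * r * ∫ y in Icc (-r) r, deriv w y ^ 2 := by
  have cw := hw.continuous
  have cw' : Continuous (deriv w) := hw.continuous_deriv (by simp)
  have il : ∀ {k : ℝ → ℝ}, Continuous k → IntegrableOn k (Icc (-r) r) := fun hk =>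
    hk.locallyIntegrable.integrableOn_isCompact isCompact_Icc
  set I := ∫ y in Icc (-r) r, |deriv w y| with hI
  have hI2 : I ^ 2 ≤ 2 * r * ∫ y in Icc (-r) r, deriv w y ^ 2 := by
    have := sq_integral_le hr (il cw'.abs) (il (cw'.abs.pow 2))
    simpa only [sq_abs] using this
  have hb : ∀ y ∈ Icc (-r) r, w x ^ 2 ≤ 2 * w y ^ 2 + 2 * I ^ 2 := by
    intro y hy
    have e := intervalIntegral.integral_eq_sub_of_hasDerivAt (a := y) (b := x)
      (fun z _ => (hw.differentiable (by simp) z).hasDerivAt) (cw'.intervalIntegrable _ _)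
    have : |w x - w y| ≤ I := by
      rw [← e, ← Real.norm_eq_abs]
      refine (intervalIntegral.norm_integral_le_integral_norm_uIoc (f := deriv w)).trans ?_
      refine setIntegral_mono_set (il cw'.abs) (Eventually.of_forall fun z => abs_nonneg _) ?_
      exact (uIoc_subset_uIcc.trans (uIcc_subset_Icc hy hx)).eventuallyLE
    have h2 : (w x - w y) ^ 2 ≤ I ^ 2 := by
      rw [← sq_abs]; exact pow_le_pow_left₀ (abs_nonneg _) this 2
    nlinarith [sq_nonneg (w x - 2 * w y)]
  have h3 : ∫ y in Icc (-r) r, w x ^ 2 ≤ ∫ y in Icc (-r) r, (2 * w y ^ 2 + 2 * I ^ 2) :=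
    setIntegral_mono_on (il continuous_const) (il (by fun_prop)) measurableSet_Icc hb
  have i1 : IntegrableOn (fun y => 2 * w y ^ 2) (Icc (-r) r) := il (by fun_prop)
  have i2 : IntegrableOn (fun _ : ℝ => 2 * I ^ 2) (Icc (-r) r) := il continuous_const
  rw [integral_add i1 i2, integral_const_mul] at h3
  simp only [integral_const, measureReal_restrict_apply_univ, smul_eq_mul,
    Real.volume_real_Icc_of_le (by linarith : -r ≤ r)] at h3
  have h4 : w x ^ 2 ≤ 1 / r * (∫ y in Icc (-r) r, w y ^ 2) + 2 * I ^ 2 := by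
    have h5 : r * w x ^ 2 ≤ r * (1 / r * (∫ y in Icc (-r) r, w y ^ 2) + 2 * I ^ 2) := by
      have : r * (1 / r * (∫ y in Icc (-r) r, w y ^ 2) + 2 * I ^ 2) =
        (∫ y in Icc (-r) r, w y ^ 2) + 2 * r * I ^ 2 := by field_simp
      rw [this]; nlinarith
    exact le_of_mul_le_mul_left h5 hr
  nlinarith

section
variable (J : ℝ → ℝ) (q α μ : ℝ) (u : ℝ → ℝ → ℝ)
noncomputable def Fu (t x : ℝ) : ℝ := fq q (u t x)
noncomputable def Su (t x : ℝ) : ℝ := α * (gg J u t x - u t x)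
def dv (v : ℝ → ℝ) (t x : ℝ) : ℝ := u t x - v x
noncomputable def Fv (v : ℝ → ℝ) (t x : ℝ) : ℝ := fq q (u t x) - fq q (v x)
noncomputable def cv (v : ℝ → ℝ) (x : ℝ) : ℝ := μ * deriv (deriv v) x - |v x| ^ (q - 1) * deriv v x
noncomputable def Sv (v : ℝ → ℝ) (t x : ℝ) : ℝ := α * (gg J u t x - u t x) + cv q μ v x

/-- local goodness on a time set -/
structure GP (r : ℝ) (U : Set ℝ) : Prop where
  c1 : ∃ C, ∀ t ∈ U, ∫ x in Icc (-r) r, u t x ^ 2 ≤ C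
  c2 : IntegrableOn (fun t => ∫ x in Icc (-r) r, deriv (u t) x ^ 2) U
  w : ∀ ψ, Test r ψ → ∀ t ∈ U,
    HasDerivAt (fun s => ∫ x, ψ x * u s x) (Lf μ ψ u (Fu q u) (Su J α u) t) t
end

namespace Sol
variable {J : ℝ → ℝ} {q α μ : ℝ} {u : ℝ → ℝ → ℝ}

lemma cu (h : Sol J q α μ u) (t : ℝ) : Continuous (u t) := (h.uc t).continuous
lemma uc1 (h : Sol J q α μ u) (t : ℝ) : ContDiff ℝ 1 (u t) := (h.uc t).of_le (by norm_num)
lemma cFu (h : Sol J q α μ u) (t : ℝ) : Continuous (Fu q u t) := (fq_continuous h.q1).comp (h.cu t)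
lemma Su_int (h : Sol J q α μ u) (t : ℝ) : Integrable (Su J α u t) :=
  ((h.g_int t).sub (h.ui t)).const_mul α
lemma Su_le (h : Sol J q α μ u) (t : ℝ) : ∫ x, |Su J α u t x| ≤ 2 * α * ∫ x, |u t x| := by
  have h1 := h.g_le t
  have i1 := (h.g_int t).abs
  have i2 := (h.ui t).abs
  have : ∫ x, |Su J α u t x| ≤ ∫ x, α * (|gg J u t x| + |u t x|) := by
    refine integral_mono (h.Su_int t).abs ((i1.add i2).const_mul α) fun x => ?_
    simp only [Su]
    rw [abs_mul, abs_of_pos h.α0]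
    exact mul_le_mul_of_nonneg_left (abs_sub _ _) h.α0.le
  rw [integral_const_mul, integral_add i1 i2] at this
  nlinarith [h.α0]
lemma Su_sub_le (h : Sol J q α μ u) (s t : ℝ) :
    ∫ x, |Su J α u t x - Su J α u s x| ≤ 2 * α * ∫ x, |u t x - u s x| := by
  have h1 := h.g_sub_le s t
  have i1 := ((h.g_int t).sub (h.g_int s)).abs
  have i2 := ((h.ui t).sub (h.ui s)).abs
  simp only [Pi.sub_apply] at i1 i2
  have : ∫ x, |Su J α u t x - Su J α u s x| ≤
      ∫ x, α * (|gg J u t x - gg J u s x| + |u t x - u s x|) := by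
    refine integral_mono ((h.Su_int t).sub (h.Su_int s)).abs ((i1.add i2).const_mul α) fun x => ?_
    simp only [Su, Pi.sub_apply, Pi.add_apply]
    have : α * (gg J u t x - u t x) - α * (gg J u s x - u s x)
      = α * ((gg J u t x - gg J u s x) - (u t x - u s x)) := by ring
    rw [this, abs_mul, abs_of_pos h.α0]
    exact mul_le_mul_of_nonneg_left (abs_sub _ _) h.α0.le
  rw [integral_const_mul, integral_add i1 i2] at this
  nlinarith [h.α0]

lemma norm_cont (h : Sol J q α μ u) : ContinuousOn (fun t => ∫ x, |u t x|) (Ioi 0) := by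
  intro t0 ht0
  refine ContinuousAt.continuousWithinAt ?_
  refine tendsto_iff_dist_tendsto_zero.2 ?_
  refine squeeze_zero (fun t => dist_nonneg) (fun t => ?_) (h.ul t0 ht0)
  have i2 := ((h.ui t).sub (h.ui t0)).abs
  rw [Real.dist_eq, ← integral_sub (h.ui t).abs (h.ui t0).abs]
  refine (abs_integral_le_integral_abs).trans ?_
  exact integral_mono ((h.ui t).abs.sub (h.ui t0).abs).abs i2 fun x => abs_abs_sub_abs_le_abs_sub _ _

lemma norm_bdd (h : Sol J q α μ u) {t1 t2 : ℝ} (h1 : 0 < t1) :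
    ∃ m, 0 < m ∧ ∀ t ∈ Icc t1 t2, ∫ x, |u t x| ≤ m := by
  obtain ⟨C, hC⟩ := isCompact_Icc.exists_bound_of_continuousOn
    (h.norm_cont.mono (fun t (ht : t ∈ Icc t1 t2) => lt_of_lt_of_le h1 ht.1))
  refine ⟨max C 1, by positivity, fun t ht => ?_⟩
  exact ((le_abs_self _).trans (hC t ht)).trans (le_max_left _ _)

lemma loc_le {k : ℝ → ℝ} (hk : Integrable k) (s : Set ℝ) : ∫ x in s, |k x| ≤ ∫ x, |k x| :=
  setIntegral_le_integral hk.abs (Eventually.of_forall fun x => abs_nonneg _)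

/-- continuity of the weak right-hand side -/
lemma L_cont (h : Sol J q α μ u) {r C : ℝ} {U : Set ℝ} (hU : U ⊆ Ioi 0)
    (hC : ∀ t ∈ U, ∫ x in Icc (-r) r, u t x ^ 2 ≤ C) {ψ : ℝ → ℝ} (hψ : Test r ψ) :
    ContinuousOn (Lf μ ψ u (Fu q u) (Su J α u)) U := by
  have il : ∀ {k : ℝ → ℝ}, Continuous k → IntegrableOn k (Icc (-r) r) := fun hk =>
    hk.locallyIntegrable.integrableOn_isCompact isCompact_Icc
  obtain ⟨B0, hB0, b0⟩ := hψ.bdd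
  obtain ⟨B1, hB1, b1⟩ := hψ.der.bdd
  obtain ⟨B2, hB2, b2⟩ := hψ.der.der.bdd
  intro t0 ht0
  have hul : Tendsto (fun t => ∫ x, |u t x - u t0 x|) (𝓝[U] t0) (𝓝 0) :=
    (h.ul t0 (hU ht0)).mono_left nhdsWithin_le_nhds
  have c1 : Tendsto (fun t => ∫ x, deriv (deriv ψ) x * u t x) (𝓝[U] t0)
      (𝓝 (∫ x, deriv (deriv ψ) x * u t0 x)) := by
    refine tendsto_iff_dist_tendsto_zero.2 ?_
    refine squeeze_zero (fun t => dist_nonneg) (fun t => ?_) (by simpa using hul.const_mul B2)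
    rw [Real.dist_eq, ← integral_sub (hψ.der.der.integrable_mul_cont (h.cu t))
      (hψ.der.der.integrable_mul_cont (h.cu t0))]
    have := abs_integral_mul_le (r := r) (η := deriv (deriv ψ)) (G := fun x => u t x - u t0 x)
      hψ.der.der.2 b2 (il ((h.cu t).sub (h.cu t0)))
    simp only [mul_sub] at this
    exact this.trans (mul_le_mul_of_nonneg_left (loc_le ((h.ui t).sub (h.ui t0)) _) hB2)
  have c3 : Tendsto (fun t => ∫ x, ψ x * Su J α u t x) (𝓝[U] t0)
      (𝓝 (∫ x, ψ x * Su J α u t0 x)) := by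
    refine tendsto_iff_dist_tendsto_zero.2 ?_
    refine squeeze_zero (fun t => dist_nonneg) (fun t => ?_)
      (by simpa using hul.const_mul (B0 * (2 * α)))
    rw [Real.dist_eq, ← integral_sub (hψ.integrable_mul (h.Su_int t).locallyIntegrable)
      (hψ.integrable_mul (h.Su_int t0).locallyIntegrable)]
    have i := (h.Su_int t).sub (h.Su_int t0)
    have := abs_integral_mul_le (r := r) (η := ψ) (G := fun x => Su J α u t x - Su J α u t0 x)
      hψ.2 b0 i.integrableOn
    simp only [mul_sub] at this
    refine this.trans ((mul_le_mul_of_nonneg_left ((loc_le i _).trans (h.Su_sub_le t0 t)) hB0).trans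
      (le_of_eq (by ring)))
  have c2 : Tendsto (fun t => ∫ x, deriv ψ x * Fu q u t x) (𝓝[U] t0)
      (𝓝 (∫ x, deriv ψ x * Fu q u t0 x)) := by
    have hC0 : 0 ≤ C := (integral_nonneg fun x => sq_nonneg _).trans (hC t0 ht0)
    refine Metric.tendsto_nhds.2 fun ε hε => ?_
    set lam := ε / (2 * (B1 * (4 * C) + 1)) with hlam
    have hl : 0 < lam := by positivity
    obtain ⟨K, hK, hKb⟩ := rpow_small h.q1 h.q2 hl
    have hsmall : ∀ᶠ t in 𝓝[U] t0, B1 * (2 * K) * ∫ x, |u t x - u t0 x| < ε / 2 := by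
      have : Tendsto (fun t => B1 * (2 * K) * ∫ x, |u t x - u t0 x|) (𝓝[U] t0) (𝓝 0) := by
        simpa using hul.const_mul (B1 * (2 * K))
      exact this.eventually_lt_const (by positivity)
    filter_upwards [hsmall, self_mem_nhdsWithin] with t ht htU
    rw [Real.dist_eq, ← integral_sub (hψ.der.integrable_mul_cont (h.cFu t))
      (hψ.der.integrable_mul_cont (h.cFu t0))]
    have := abs_integral_mul_le (r := r) (η := deriv ψ) (G := fun x => Fu q u t x - Fu q u t0 x)
      hψ.der.2 b1 (il ((h.cFu t).sub (h.cFu t0)))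
    simp only [mul_sub] at this
    refine this.trans_lt ?_
    have ia : IntegrableOn (fun x => |u t x - u t0 x|) (Icc (-r) r) := il ((h.cu t).sub (h.cu t0)).abs
    have ib : IntegrableOn (fun x => u t x ^ 2) (Icc (-r) r) := il ((h.cu t).pow 2)
    have ic : IntegrableOn (fun x => u t0 x ^ 2) (Icc (-r) r) := il ((h.cu t0).pow 2)
    have hmono : ∫ x in Icc (-r) r, |Fu q u t x - Fu q u t0 x| ≤
        ∫ x in Icc (-r) r, (2 * K * |u t x - u t0 x| + lam * (2 * (u t x ^ 2 + u t0 x ^ 2))) := by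
      refine setIntegral_mono_on (il ((h.cFu t).sub (h.cFu t0)).abs)
        ((ia.const_mul (2 * K)).add (((ib.add ic).const_mul 2).const_mul lam)) measurableSet_Icc
        fun x _ => ?_
      refine (fq_sub_le h.q1 _ _).trans ?_
      have z1 := hKb (u t x)
      have z2 := hKb (u t0 x)
      set a := u t x
      set b := u t0 x
      have z3 : |a - b| ≤ |a| + |b| := abs_sub _ _
      have z4 := abs_nonneg (a - b)
      have z5 : (|a| + |b|) * |a - b| ≤ 2 * (a ^ 2 + b ^ 2) := by
        calc _ ≤ (|a| + |b|) * (|a| + |b|) := mul_le_mul_of_nonneg_left z3 (by positivity)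
          _ ≤ _ := by nlinarith [sq_abs a, sq_abs b, sq_nonneg (|a| - |b|)]
      calc _ ≤ (2 * K + lam * (|a| + |b|)) * |a - b| :=
            mul_le_mul_of_nonneg_right (by linarith) z4
        _ = 2 * K * |a - b| + lam * ((|a| + |b|) * |a - b|) := by ring
        _ ≤ _ := by gcongr
    have i1 : IntegrableOn (fun x => 2 * K * |u t x - u t0 x|) (Icc (-r) r) := ia.const_mul (2 * K)
    have i2 : IntegrableOn (fun x => lam * (2 * (u t x ^ 2 + u t0 x ^ 2))) (Icc (-r) r) :=
      ((ib.add ic).const_mul 2).const_mul lam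
    rw [integral_add i1 i2, integral_const_mul, integral_const_mul, integral_const_mul,
      integral_add ib ic] at hmono
    have e1 := hC t htU
    have e2 := hC t0 ht0
    have e3 := loc_le ((h.ui t).sub (h.ui t0)) (Icc (-r) r)
    simp only [Pi.sub_apply] at e3
    have e4 : B1 * (∫ x in Icc (-r) r, |Fu q u t x - Fu q u t0 x|) ≤
        B1 * (2 * K) * (∫ x, |u t x - u t0 x|) + lam * (B1 * (4 * C)) := by
      have : ∫ x in Icc (-r) r, |Fu q u t x - Fu q u t0 x| ≤
          2 * K * (∫ x, |u t x - u t0 x|) + lam * (4 * C) := by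
        refine hmono.trans (add_le_add (mul_le_mul_of_nonneg_left e3 (by positivity))
          (mul_le_mul_of_nonneg_left (by linarith) hl.le))
      calc _ ≤ B1 * (2 * K * (∫ x, |u t x - u t0 x|) + lam * (4 * C)) :=
            mul_le_mul_of_nonneg_left this hB1
        _ = _ := by ring
    have e5 : lam * (B1 * (4 * C)) ≤ ε / 2 := by
      have : lam * (B1 * (4 * C) + 1) = ε / 2 := by rw [hlam]; field_simp
      nlinarith
    linarith
  exact ((c1.const_mul μ).add c2).add c3

variable {v : ℝ → ℝ}

lemma cv_cont (hq : 1 < q) (hv : ContDiff ℝ 2 v) : Continuous (cv q μ v) := by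
  have h1 : ContDiff ℝ 1 (deriv v) := contDiff_deriv_of_two hv
  exact (continuous_const.mul (h1.continuous_deriv (by simp))).sub
    (((cont_absrpow hq).comp hv.continuous).mul h1.continuous)

lemma Lf_eq (h : Sol J q α μ u) (hv : ContDiff ℝ 2 v) {r : ℝ} {ψ : ℝ → ℝ} (hψ : Test r ψ) (t : ℝ) :
    Lf μ ψ (dv u v) (Fv q u v) (Sv J q α μ u v) t = Lf μ ψ u (Fu q u) (Su J α u) t := by
  have h1 : ContDiff ℝ 1 (deriv v) := contDiff_deriv_of_two hv
  have cv0 := hv.continuous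
  have cf : Continuous (fun x => fq q (v x)) := (fq_continuous h.q1).comp cv0
  have c2 := h1.continuous_deriv (by simp)
  have dvv := hv.differentiable (by simp)
  have c3 : Continuous (fun x => |v x| ^ (q - 1) * deriv v x) :=
    ((cont_absrpow h.q1).comp cv0).mul h1.continuous
  have e1 : ∫ x, ψ x * deriv (deriv v) x = ∫ x, deriv (deriv ψ) x * v x := by
    have a1 := hψ.ibp (G := deriv v) (G' := deriv (deriv v))
      (fun x => (h1.differentiable (by simp) x).hasDerivAt) c2
    have a2 := hψ.der.ibp (G := v) (G' := deriv v) (fun x => (dvv x).hasDerivAt) h1.continuous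
    rw [a1, a2, neg_neg]
  have e2 : ∫ x, ψ x * (|v x| ^ (q - 1) * deriv v x) = -∫ x, deriv ψ x * fq q (v x) :=
    hψ.ibp (G := fun x => fq q (v x)) (fun x => (fq_hasDerivAt h.q1 (v x)).comp x (dvv x).hasDerivAt) c3
  have i1 := hψ.der.der.integrable_mul_cont (h.cu t)
  have i2 := hψ.der.der.integrable_mul_cont cv0
  have i3 := hψ.der.integrable_mul_cont (h.cFu t)
  have i4 := hψ.der.integrable_mul_cont cf
  have i5 := hψ.integrable_mul (h.Su_int t).locallyIntegrable
  have i6 := hψ.integrable_mul_cont c2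
  have i7 := hψ.integrable_mul_cont c3
  have s1 : ∫ x, deriv (deriv ψ) x * dv u v t x
      = (∫ x, deriv (deriv ψ) x * u t x) - ∫ x, deriv (deriv ψ) x * v x := by
    rw [← integral_sub i1 i2]; congr 1; funext x; simp only [dv]; ring
  have s2 : ∫ x, deriv ψ x * Fv q u v t x
      = (∫ x, deriv ψ x * Fu q u t x) - ∫ x, deriv ψ x * fq q (v x) := by
    rw [← integral_sub i3 i4]; congr 1; funext x; simp only [Fv, Fu]; ring
  have s3 : ∫ x, ψ x * Sv J q α μ u v t x = (∫ x, ψ x * Su J α u t x)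
      + (μ * (∫ x, ψ x * deriv (deriv v) x) - ∫ x, ψ x * (|v x| ^ (q - 1) * deriv v x)) := by
    rw [← integral_const_mul, ← integral_sub (i6.const_mul μ) i7]
    have i8 : Integrable fun x => μ * (ψ x * deriv (deriv v) x) - ψ x * (|v x| ^ (q - 1) * deriv v x) :=
      (i6.const_mul μ).sub i7
    rw [← integral_add i5 i8]; congr 1; funext x; simp only [Sv, Su, cv]; ring
  unfold Lf
  rw [s1, s2, s3, e1, e2]; ring

lemma Sv_le (h : Sol J q α μ u) (hv : ContDiff ℝ 2 v) {r n : ℝ} (t : ℝ) (hr : 0 ≤ r)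
    (hn : ∀ x, |x| ≤ r → |cv q μ v x| ≤ n) :
    ∫ x in Icc (-r) r, |Sv J q α μ u v t x| ≤ 2 * α * (∫ x, |u t x|) + 2 * r * n := by
  have il : ∀ {k : ℝ → ℝ}, Continuous k → IntegrableOn k (Icc (-r) r) := fun hk =>
    hk.locallyIntegrable.integrableOn_isCompact isCompact_Icc
  have i1 : IntegrableOn (fun x => |Su J α u t x|) (Icc (-r) r) := (h.Su_int t).abs.integrableOn
  have i2 : IntegrableOn (fun _ : ℝ => n) (Icc (-r) r) := il continuous_const
  have i3 : IntegrableOn (fun x => Sv J q α μ u v t x) (Icc (-r) r) :=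
    (h.Su_int t).integrableOn.add (il (cv_cont h.q1 hv))
  have : ∫ x in Icc (-r) r, |Sv J q α μ u v t x| ≤ ∫ x in Icc (-r) r, (|Su J α u t x| + n) := by
    refine setIntegral_mono_on i3.abs (i1.add i2) measurableSet_Icc fun x hx => ?_
    exact (abs_add_le _ _).trans (add_le_add le_rfl (hn x (abs_le.2 hx)))
  rw [integral_add i1 i2] at this
  simp only [integral_const, measureReal_restrict_apply_univ, smul_eq_mul,
    Real.volume_real_Icc_of_le (by linarith : -r ≤ r)] at this
  have a := (loc_le (h.Su_int t) (Icc (-r) r)).trans (h.Su_le t)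
  linarith

end Sol
end RegAux

namespace RegAux
open Set Topology
open scoped ContDiff
namespace Sol
variable {J : ℝ → ℝ} {q α μ : ℝ} {u : ℝ → ℝ → ℝ} {v : ℝ → ℝ}

lemma il {r : ℝ} {k : ℝ → ℝ} (hk : Continuous k) : IntegrableOn k (Icc (-r) r) :=
  hk.locallyIntegrable.integrableOn_isCompact isCompact_Icc

lemma el (h : Sol J q α μ u) (hv : ContDiff ℝ 2 v) {r t1 t2 : ℝ} {U : Set ℝ}
    (hg : GP J q α μ u r U) (hU : Icc t1 t2 ⊆ U) (h1 : 0 < t1) (h12 : t1 ≤ t2) (hr : 0 < r) :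
    ∃ b, EL μ r t1 t2 (dv u v) (Fv q u v) (Sv J q α μ u v) b := by
  obtain ⟨C, hC⟩ := hg.c1
  obtain ⟨m, hm0, hm⟩ := h.norm_bdd (t2 := t2) h1
  obtain ⟨n, hn⟩ := isCompact_Icc.exists_bound_of_continuousOn (s := Icc (-r) r)
    (hv.continuous.pow 2).continuousOn
  obtain ⟨n', hn'⟩ := isCompact_Icc.exists_bound_of_continuousOn (s := Icc (-r) r)
    (cv_cont (μ := μ) h.q1 hv).continuousOn
  have hn2 : ∀ x ∈ Icc (-r) r, v x ^ 2 ≤ n := fun x hx => (le_abs_self _).trans (hn x hx)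
  have n0 : 0 ≤ n := (sq_nonneg _).trans (hn2 0 ⟨by linarith, hr.le⟩)
  have C0 : 0 ≤ C := (integral_nonneg fun x => sq_nonneg _).trans (hC t1 (hU ⟨le_rfl, h12⟩))
  have n'0 : 0 ≤ n' := (norm_nonneg _).trans (hn' 0 ⟨by linarith, hr.le⟩)
  set M1 := 2 * α * m + 2 * r * n' with hM1
  have M10 : 0 ≤ M1 := by have := h.α0; positivity
  set s : ℝ → ℝ := fun t => 1 / r * C + 4 * r * ∫ x in Icc (-r) r, deriv (u t) x ^ 2 with hs
  have s0 : ∀ t, 0 ≤ s t := fun t => by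
    have : 0 ≤ ∫ x in Icc (-r) r, deriv (u t) x ^ 2 := integral_nonneg fun x => sq_nonneg _
    simp only [hs]; positivity
  have hsup : ∀ t ∈ Icc t1 t2, ∀ x ∈ Icc (-r) r, u t x ^ 2 ≤ s t := fun t ht x hx => by
    have a := sup_sq hr (h.uc1 t) hx
    have b : 1 / r * (∫ y in Icc (-r) r, u t y ^ 2) ≤ 1 / r * C :=
      mul_le_mul_of_nonneg_left (hC t (hU ht)) (by positivity)
    simp only [hs]; linarith
  have vol : ∀ c : ℝ, ∫ _ in Icc (-r) r, c = 2 * r * c := fun c => by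
    simp only [integral_const, measureReal_restrict_apply_univ, smul_eq_mul,
      Real.volume_real_Icc_of_le (by linarith : -r ≤ r)]; ring
  have cd : ∀ t, Continuous (dv u v t) := fun t => (h.cu t).sub hv.continuous
  have cF : ∀ t, Continuous (Fv q u v t) := fun t =>
    (h.cFu t).sub ((fq_continuous h.q1).comp hv.continuous)
  have iS : ∀ t, LocallyIntegrable (Sv J q α μ u v t) := fun t =>
    (h.Su_int t).locallyIntegrable.add (cv_cont h.q1 hv).locallyIntegrable
  refine ⟨fun t => 4 * (C + s t * C + 2 * r * (n + n * n)) + (2 * C + 4 * r * n)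
    + (1 + 2 * s t + 2 * n) * M1, ?_⟩
  have fin : ∀ t, 0 ≤ 4 * (C + s t * C + 2 * r * (n + n * n)) ∧ 0 ≤ (2 * C + 4 * r * n) ∧
    0 ≤ (1 + 2 * s t + 2 * n) * M1 := fun t => by
      have := s0 t
      refine ⟨by positivity, by positivity, by positivity⟩
  refine ⟨h.μ0, h12, ?_, ?_, ?_, fun t _ => ?_, fun t _ => (cF t).locallyIntegrable,
    fun t _ => ((cF t).pow 2).locallyIntegrable, fun t _ => iS t, ?_, ?_, ?_, ?_, ?_, ?_⟩
  · exact h.um.sub (hv.continuous.measurable.comp measurable_snd)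
  · exact ((fq_continuous h.q1).measurable.comp h.um).sub
      ((fq_continuous h.q1).measurable.comp (hv.continuous.measurable.comp measurable_snd))
  · exact (measurable_const.mul (h.g_meas.sub h.um)).add
      ((cv_cont h.q1 hv).measurable.comp measurable_snd)
  · exact (h.uc1 t).sub (hv.of_le (by norm_num))
  · have i0 : IntegrableOn (fun t => ∫ x in Icc (-r) r, deriv (u t) x ^ 2) (Icc t1 t2) :=
      hg.c2.mono_set hU
    have ic : ∀ c : ℝ, IntegrableOn (fun _ : ℝ => c) (Icc t1 t2) := fun c => integrableOn_const (by simp)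
    have is : IntegrableOn s (Icc t1 t2) := (ic _).add (i0.const_mul _)
    exact (((((ic C).add (is.mul_const C)).add (ic _)).const_mul 4).add (ic _)).add
      ((((ic 1).add (is.const_mul 2)).add (ic _)).mul_const M1)
  · intro t ht
    have i1 : IntegrableOn (fun x => 2 * u t x ^ 2) (Icc (-r) r) := (il ((h.cu t).pow 2)).const_mul 2
    have i2 : IntegrableOn (fun _ : ℝ => 2 * n) (Icc (-r) r) := il continuous_const
    have : ∫ x in Icc (-r) r, dv u v t x ^ 2 ≤ ∫ x in Icc (-r) r, (2 * u t x ^ 2 + 2 * n) := by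
      refine setIntegral_mono_on (il ((cd t).pow 2)) (i1.add i2) measurableSet_Icc fun x hx => ?_
      have := hn2 x hx
      simp only [dv]
      nlinarith [sq_nonneg (u t x + v x)]
    rw [integral_add i1 i2, integral_const_mul, vol] at this
    have e := hC t (hU ht)
    obtain ⟨f1, f2, f3⟩ := fin t
    linarith
  · intro t ht
    have i1 : IntegrableOn (fun x => (4 + 4 * s t) * u t x ^ 2) (Icc (-r) r) :=
      (il ((h.cu t).pow 2)).const_mul _
    have i2 : IntegrableOn (fun _ : ℝ => 4 * (n + n * n)) (Icc (-r) r) := il continuous_const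
    have : ∫ x in Icc (-r) r, Fv q u v t x ^ 2 ≤
        ∫ x in Icc (-r) r, ((4 + 4 * s t) * u t x ^ 2 + 4 * (n + n * n)) := by
      refine setIntegral_mono_on (il ((cF t).pow 2)) (i1.add i2) measurableSet_Icc fun x hx => ?_
      have e1 := hn2 x hx
      have e2 := hsup t ht x hx
      have key : ∀ a : ℝ, fq q a ^ 2 ≤ 2 * a ^ 2 + 2 * (a ^ 2 * a ^ 2) := fun a => by
        have z1 := (fq_abs_le h.q1 a).trans (rpow_le_add h.q1 h.q2 a)
        have z2 : |fq q a| ^ 2 ≤ (|a| + a ^ 2) ^ 2 := pow_le_pow_left₀ (abs_nonneg _) z1 2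
        rw [sq_abs] at z2
        have : (|a| + a ^ 2) ^ 2 + (|a| - a ^ 2) ^ 2 = 2 * |a| ^ 2 + 2 * (a ^ 2 * a ^ 2) := by ring
        rw [sq_abs] at this
        linarith [sq_nonneg (|a| - a ^ 2)]
      have k1 := key (u t x)
      have k2 := key (v x)
      have p1 : u t x ^ 2 * u t x ^ 2 ≤ s t * u t x ^ 2 := mul_le_mul_of_nonneg_right e2 (sq_nonneg _)
      have p2 : v x ^ 2 * v x ^ 2 ≤ n * n := mul_le_mul e1 e1 (sq_nonneg _) n0
      have p3 : Fv q u v t x ^ 2 ≤ 2 * fq q (u t x) ^ 2 + 2 * fq q (v x) ^ 2 := by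
        simp only [Fv]; nlinarith [sq_nonneg (fq q (u t x) + fq q (v x))]
      have : (4 + 4 * s t) * u t x ^ 2 = 4 * u t x ^ 2 + 4 * (s t * u t x ^ 2) := by ring
      linarith
    rw [integral_add i1 i2, integral_const_mul, vol] at this
    have e := mul_le_mul_of_nonneg_left (hC t (hU ht)) (by have := s0 t; positivity : 0 ≤ 4 + 4 * s t)
    obtain ⟨f1, f2, f3⟩ := fin t
    have : ∫ x in Icc (-r) r, Fv q u v t x ^ 2 ≤ 4 * (C + s t * C + 2 * r * (n + n * n)) := by
      linarith
    linarith
  · intro t ht x hx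
    have e0 := (h.Sv_le hv t hr.le (fun x hx => hn' x (abs_le.1 hx)) (J := J))
    have e1 : ∫ y in Icc (-r) r, |Sv J q α μ u v t y| ≤ M1 := by
      have := mul_le_mul_of_nonneg_left (hm t ht) (by linarith [h.α0] : 0 ≤ 2 * α)
      linarith
    have e2 : |dv u v t x| ≤ 1 + 2 * s t + 2 * n := by
      have a1 := hn2 x hx
      have a2 := hsup t ht x hx
      have a3 : |dv u v t x| ≤ 1 + dv u v t x ^ 2 := by
        rw [← sq_abs]; nlinarith [sq_nonneg (|dv u v t x| - 1), abs_nonneg (dv u v t x)]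
      have a4 : dv u v t x ^ 2 ≤ 2 * u t x ^ 2 + 2 * v x ^ 2 := by
        simp only [dv]; nlinarith [sq_nonneg (u t x + v x)]
      linarith
    have e3 : |dv u v t x| * ∫ y in Icc (-r) r, |Sv J q α μ u v t y| ≤ (1 + 2 * s t + 2 * n) * M1 :=
      mul_le_mul e2 e1 (integral_nonneg fun _ => abs_nonneg _) (by have := s0 t; positivity)
    obtain ⟨f1, f2, f3⟩ := fin t
    linarith
  · intro ψ hψ t ht
    rw [h.Lf_eq hv hψ]
    have := (hg.w ψ hψ t (hU ht)).sub_const (∫ x, ψ x * v x)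
    refine this.congr_of_eventuallyEq (Eventually.of_forall fun s => ?_)
    simp only [dv]
    rw [← integral_sub (hψ.integrable_mul_cont (h.cu s)) (hψ.integrable_mul_cont hv.continuous)]
    congr 1; funext x; ring
  · intro ψ hψ
    have := h.L_cont (U := Icc t1 t2) (fun t ht => lt_of_lt_of_le h1 ht.1)
      (fun t ht => hC t (hU ht)) hψ
    exact this.congr fun t _ => h.Lf_eq hv hψ t

end Sol
end RegAux

namespace RegAux
open Set Topology
open scoped ContDiff

lemma exists_cut {r r' : ℝ} (hr : 0 < r) (hrr : r < r') :
    ∃ χ c, 1 ≤ c ∧ Cut r' c χ ∧ (∀ x ∈ Icc (-r) r, χ x = 1) ∧ (∀ x, |χ x| ≤ c) := by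
  let f : ContDiffBump (0:ℝ) := ⟨r, r', hr, hrr⟩
  have ht : Test r' (f : ℝ → ℝ) := by
    refine ⟨f.contDiff, fun x hx => f.zero_of_le_dist ?_⟩
    rw [Real.dist_eq, sub_zero]; exact hx.le
  obtain ⟨c, hc, b0, b1, b2⟩ := exists_bd3 ht
  refine ⟨f, max c 1, le_max_right _ _, ⟨ht, fun x => f.nonneg, fun x => f.le_one,
    fun x => (b1 x).trans (le_max_left _ _), fun x => (b2 x).trans (le_max_left _ _)⟩,
    fun x hx => f.one_of_mem_closedBall ?_, fun x => (b0 x).trans (le_max_left _ _)⟩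
  rw [Metric.mem_closedBall, Real.dist_eq, sub_zero]
  exact abs_le.2 hx

/-- a nonneg function on the ball, dominated by the integral against a cutoff -/
lemma cut_le {r : ℝ} {χ k : ℝ → ℝ} (h1 : ∀ x ∈ Icc (-r) r, χ x = 1) (h0 : ∀ x, 0 ≤ χ x)
    (hk : ∀ x, 0 ≤ k x) (hi : Integrable fun x => χ x * k x) :
    ∫ x in Icc (-r) r, k x ≤ ∫ x, χ x * k x := by
  have : ∫ x in Icc (-r) r, k x = ∫ x in Icc (-r) r, χ x * k x :=
    setIntegral_congr_fun measurableSet_Icc fun x hx => by simp [h1 x hx]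
  rw [this]
  exact setIntegral_le_integral hi (Eventually.of_forall fun x => mul_nonneg (h0 x) (hk x))

section
variable (J : ℝ → ℝ) (q α μ : ℝ) (u : ℝ → ℝ → ℝ)
def Good (R t : ℝ) : Prop := ∃ U ∈ 𝓝 t, ∀ r, 0 < r → r < R → GP J q α μ u r U

structure Gap (R n m a b : ℝ) : Prop where
  a0 : 0 < a
  ab : a < b
  b1 : b - a ≤ 1
  nm : ∀ t ∈ Ioo a b, ∫ x, |u t x| ≤ m
  nma : ∫ x, |u a x| ≤ m
  good : ∀ t ∈ Ioo a b, Good J q α μ u R t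
  v0 : ∀ x, |x| ≤ R → |u a x| ≤ n
  v1 : ∀ x, |x| ≤ R → |deriv (u a) x| ≤ n
  v2 : ∀ x, |x| ≤ R → |deriv (deriv (u a)) x| ≤ n
end

variable {J : ℝ → ℝ} {q α μ : ℝ} {u : ℝ → ℝ → ℝ}

lemma GP.mono {r : ℝ} {U V : Set ℝ} (h : GP J q α μ u r U) (hV : V ⊆ U) : GP J q α μ u r V :=
  ⟨h.c1.imp fun _ hC t ht => hC t (hV ht), h.c2.mono_set hV, fun ψ hψ t ht => h.w ψ hψ t (hV ht)⟩

lemma GP.compact {r R t1 t2 : ℝ} (hr : 0 < r) (hrR : r < R)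
    (h : ∀ t ∈ Icc t1 t2, Good J q α μ u R t) : GP J q α μ u r (Icc t1 t2) := by
  refine isCompact_Icc.induction_on (p := fun s => GP J q α μ u r s) ?_ ?_ ?_ ?_
  · exact ⟨⟨0, by simp⟩, by simp, by simp⟩
  · intro s t hst ht; exact ht.mono hst
  · rintro s t ⟨⟨C, hC⟩, s2, s3⟩ ⟨⟨D, hD⟩, t2, t3⟩
    refine ⟨⟨max C D, ?_⟩, s2.union t2, ?_⟩
    · rintro x (hx | hx)
      · exact (hC x hx).trans (le_max_left _ _)
      · exact (hD x hx).trans (le_max_right _ _)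
    · rintro ψ hψ x (hx | hx)
      · exact s3 ψ hψ x hx
      · exact t3 ψ hψ x hx
  · intro t ht
    obtain ⟨U, hU, hg⟩ := h t ht
    exact ⟨U, mem_nhdsWithin_of_mem_nhds hU, hg r hr hrR⟩

namespace Gap
variable {R n m a b : ℝ}

lemma el (g : Gap J q α μ u R n m a b) (h : Sol J q α μ u) {r t1 t2 : ℝ} (hr : 0 < r) (hrR : r < R)
    (h1 : a < t1) (h12 : t1 ≤ t2) (h2 : t2 < b) :
    ∃ β, EL μ r t1 t2 (dv u (u a)) (Fv q u (u a)) (Sv J q α μ u (u a)) β :=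
  h.el (h.uc a) (GP.compact hr hrR fun t ht => g.good t ⟨h1.trans_le ht.1, ht.2.trans_lt h2⟩)
    subset_rfl (g.a0.trans h1) h12 hr

lemma n0 (g : Gap J q α μ u R n m a b) (hR : 0 ≤ R) : 0 ≤ n :=
  (abs_nonneg _).trans (g.v0 0 (by simpa using hR))

lemma d1 (g : Gap J q α μ u R n m a b) (h : Sol J q α μ u) {t : ℝ} (ht : t ∈ Ioo a b) (s : Set ℝ) :
    ∫ x in s, |dv u (u a) t x| ≤ 2 * m := by
  have e := Sol.loc_le ((h.ui t).sub (h.ui a)) s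
  have i1 := (h.ui t).abs
  have i2 := (h.ui a).abs
  have : ∫ x, |u t x - u a x| ≤ ∫ x, (|u t x| + |u a x|) :=
    integral_mono ((h.ui t).sub (h.ui a)).abs (i1.add i2) fun x => abs_sub _ _
  rw [integral_add i1 i2] at this
  have := g.nm t ht
  have := g.nma
  simp only [Pi.sub_apply] at e
  simp only [dv]
  linarith

lemma s1 (g : Gap J q α μ u R n m a b) (h : Sol J q α μ u) {r t : ℝ} (ht : t ∈ Ioo a b)
    (hr : 0 ≤ r) (hrR : r ≤ R) :
    ∫ x in Icc (-r) r, |Sv J q α μ u (u a) t x| ≤ 2 * α * m + 2 * R * (μ * n + n ^ (q - 1) * n) := by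
  have n0 := g.n0 (hr.trans hrR)
  have := h.Sv_le (h.uc a) t hr (n := μ * n + n ^ (q - 1) * n) fun x hx => by
    have hx' := hx.trans hrR
    unfold cv
    refine (abs_sub _ _).trans ?_
    rw [abs_mul, abs_mul, abs_of_pos h.μ0, abs_of_nonneg (Real.rpow_nonneg (abs_nonneg _) _)]
    have h3 : |u a x| ^ (q - 1) ≤ n ^ (q - 1) :=
      Real.rpow_le_rpow (abs_nonneg _) (g.v0 x hx') (by linarith [h.q1])
    exact add_le_add (mul_le_mul_of_nonneg_left (g.v2 x hx') h.μ0.le)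
      (mul_le_mul h3 (g.v1 x hx') (abs_nonneg _) (by positivity))
  refine this.trans ?_
  have e1 := mul_le_mul_of_nonneg_left (g.nm t ht) (by linarith [h.α0] : 0 ≤ 2 * α)
  have e2 : 2 * r * (μ * n + n ^ (q - 1) * n) ≤ 2 * R * (μ * n + n ^ (q - 1) * n) := by
    have := h.μ0
    gcongr
  linarith

lemma f1 (g : Gap J q α μ u R n m a b) (h : Sol J q α μ u) (t : ℝ) {x : ℝ} (hx : |x| ≤ R) :
    |Fv q u (u a) t x| ≤ (2 * n ^ (q - 1) + 1) * (|dv u (u a) t x| + |dv u (u a) t x| ^ q) := by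
  have := fq_diff_le h.q1 h.q2 (u a x) (dv u (u a) t x) (g.v0 x hx)
  simp only [dv, add_sub_cancel] at this
  simpa only [Fv, dv] using this

lemma cd (h : Sol J q α μ u) (t : ℝ) : Continuous (dv u (u a) t) := (h.cu t).sub (h.cu a)

lemma G1 (h : Sol J q α μ u) {r : ℝ} (hr : 0 < r) (hrR : r < R) (hn : 0 ≤ n) (hm : 0 < m) :
    ∃ K, 0 ≤ K ∧ ∀ a b, Gap J q α μ u R n m a b → ∀ s ∈ Ioo a b,
      ∫ x in Icc (-r) r, dv u (u a) s x ^ 2 ≤ K * (s - a) ^ (-(1 / 2) : ℝ) := by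
  set r1 := (r + R) / 2 with hr1
  set r2 := (r1 + R) / 2 with hr2
  obtain ⟨χ, c, hc, hχ, χ1, -⟩ := exists_cut hr (by linarith : r < r1)
  have hμ := h.μ0
  have hα := h.α0
  have hq := h.q1
  have hR : 0 < R := by linarith
  obtain ⟨K, hK, hSL⟩ := SL (c := c) (mb := 2 * m) (M1 := 2 * α * m + 2 * R * (μ * n + n ^ (q - 1) * n))
    (C0 := 2 * n ^ (q - 1) + 1) hμ h.q1 h.q2 (by positivity) (by positivity) (by positivity)
    (by linarith)
  refine ⟨K * (1 + 8 * m ^ 2), by positivity, fun a b g s hs => ?_⟩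
  set σ := s - a with hσ
  have σ0 : 0 < σ := by linarith [hs.1]
  have σ1 : σ ≤ 1 := by linarith [hs.2, g.b1]
  obtain ⟨β, hel⟩ := g.el h (r := r2) (t1 := a + σ / 2) (t2 := s) (by linarith) (by linarith)
    (by linarith) (by linarith) hs.2
  have hin : ∀ t ∈ Icc (a + σ / 2) s, t ∈ Ioo a b := fun t ht =>
    ⟨by linarith [ht.1], by linarith [ht.2, hs.2]⟩
  have hloc : Loc r1 (a + σ / 2) s q (2 * m) (2 * α * m + 2 * R * (μ * n + n ^ (q - 1) * n))
      (2 * n ^ (q - 1) + 1) (dv u (u a)) (Fv q u (u a)) (Sv J q α μ u (u a)) :=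
    ⟨fun t ht => g.d1 h (hin t ht) _, fun t ht => g.s1 h (hin t ht) (by linarith) (by linarith),
      fun t _ x hx => g.f1 h t (by linarith)⟩
  have := hSL r1 r2 (a + σ / 2) s (2 * m) χ _ _ _ β hχ hel hloc (by linarith) (by linarith)
    (by linarith) (by linarith) (by positivity) le_rfl
  have e : s - (a + σ / 2) = σ / 2 := by rw [hσ]; ring
  rw [e] at this
  have hp : σ ^ (-(1 / 2) : ℝ) = 1 / √σ := by
    rw [Real.rpow_neg σ0.le, ← Real.sqrt_eq_rpow, one_div]
  rw [hp]
  have k1 := cut_le (r := r) (χ := fun x => χ x ^ 3) (k := fun x => dv u (u a) s x ^ 2)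
    (fun x hx => by simp [χ1 x hx]) (fun x => pow_nonneg (hχ.n x) 3) (fun x => sq_nonneg _)
    ((cube_test hχ.t).integrable_mul_cont ((cd h s).pow 2))
  refine (k1.trans this).trans ?_
  rw [mul_assoc]
  refine mul_le_mul_of_nonneg_left ?_ hK
  have q0 : 0 < √σ := Real.sqrt_pos.2 σ0
  have q1 : √σ ≤ 1 := Real.sqrt_le_one.2 σ1
  have q2 : √σ / 2 ≤ √(σ / 2) := by
    apply Real.le_sqrt_of_sq_le
    rw [div_pow, Real.sq_sqrt σ0.le]; linarith
  have q3 : 1 / √(σ / 2) ≤ 2 / √σ := by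
    rw [div_le_div_iff₀ (by linarith) q0]; linarith
  have q4 : 1 ≤ 1 / √σ := by rw [le_div_iff₀ q0]; linarith
  have : (2 * m) ^ 2 / √(σ / 2) = 4 * m ^ 2 * (1 / √(σ / 2)) := by ring
  rw [this]
  have := mul_le_mul_of_nonneg_left q3 (by positivity : 0 ≤ 4 * m ^ 2)
  have e2 : 4 * m ^ 2 * (2 / √σ) = 8 * m ^ 2 * (1 / √σ) := by ring
  linarith

/-- Kato from the left end of the gap -/
lemma GK (h : Sol J q α μ u) {r r1 : ℝ} (hr : 0 < r) (hrr : r < r1) (hrR : r1 < R) (hn : 0 ≤ n) :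
    ∃ K, 0 ≤ K ∧ ∀ a b w, Gap J q α μ u R n m a b → IntegrableOn w (Ioo a b) → (∀ t ∈ Ioo a b, 0 ≤ w t) →
      (∀ t ∈ Ioo a b, ∫ x in Icc (-r1) r1, (|dv u (u a) t x| + dv u (u a) t x ^ 2
        + |Sv J q α μ u (u a) t x| + 1) ≤ w t) → ∀ s ∈ Ioo a b,
      ∫ x in Icc (-r) r, |dv u (u a) s x| ≤ K * ∫ t in Ioo a s, w t := by
  set r2 := (r1 + R) / 2 with hr2
  obtain ⟨χ, c, hc, hχ, χ1, χb⟩ := exists_cut hr hrr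
  have hμ := h.μ0
  obtain ⟨K, hK, hk⟩ := kato (c := c) (C0 := 2 * n ^ (q - 1) + 1) hμ h.q1 h.q2 (by positivity)
    (by linarith)
  refine ⟨K, hK, fun a b w g iw w0 hw s hs => ?_⟩
  have k1 := cut_le (χ := χ) (k := fun x => |dv u (u a) s x|)
    χ1 hχ.n (fun x => abs_nonneg _) (hχ.t.integrable_mul_cont (cd h s).abs)
  refine k1.trans ?_
  have key : ∀ᶠ t1 in 𝓝[>] a, ∫ x, χ x * |dv u (u a) s x| ≤
      c * (∫ x, |u t1 x - u a x|) + K * ∫ t in Ioo a s, w t := by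
    filter_upwards [Ioo_mem_nhdsGT hs.1] with t1 ht1
    obtain ⟨β, hel⟩ := g.el h (r := r2) (t1 := t1) (t2 := s) (by linarith) (by linarith)
      ht1.1 ht1.2.le hs.2
    have hin : ∀ t ∈ Icc t1 s, t ∈ Ioo a b := fun t ht =>
      ⟨by linarith [ht.1, ht1.1], by linarith [ht.2, hs.2]⟩
    have := hk r1 r2 t1 s χ _ _ _ β w hχ.t χb hχ.b1 hχ.b2 hχ.n hel (by linarith) (by linarith)
      (fun t _ x hx => g.f1 h t (by linarith)) (iw.mono_set hin) (fun t ht => hw t (hin t ht))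
    refine this.trans (add_le_add ?_ (mul_le_mul_of_nonneg_left ?_ hK))
    · rw [← integral_const_mul]
      refine integral_mono (hχ.t.integrable_mul_cont (cd h t1).abs)
        (((h.ui t1).sub (h.ui a)).abs.const_mul c) fun x => ?_
      exact mul_le_mul_of_nonneg_right ((le_abs_self _).trans (χb x)) (abs_nonneg _)
    · rw [integral_Icc_eq_integral_Ioc, ← integral_Ioc_eq_integral_Ioo]
      refine setIntegral_mono_set ?_ ((ae_restrict_iff' measurableSet_Ioc).2 (Eventually.of_forall
        fun t ht => w0 t ⟨ht.1, ht.2.trans_lt hs.2⟩)) (Ioc_subset_Ioc_left ht1.1.le).eventuallyLE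
      rw [integrableOn_Ioc_iff_integrableOn_Ioo]
      exact iw.mono_set (Ioo_subset_Ioo_right hs.2.le)
  have lim : Tendsto (fun t1 => c * (∫ x, |u t1 x - u a x|) + K * ∫ t in Ioo a s, w t) (𝓝[>] a)
      (𝓝 (c * 0 + K * ∫ t in Ioo a s, w t)) :=
    (((h.ul a g.a0).mono_left nhdsWithin_le_nhds).const_mul c).add_const _
  have := ge_of_tendsto lim key
  linarith

end Gap
end RegAux

namespace RegAux
open Set Topology
open scoped ContDiff
variable {J : ℝ → ℝ} {q α μ : ℝ} {u : ℝ → ℝ → ℝ}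

lemma Sol.D_meas (h : Sol J q α μ u) (r : ℝ) :
    Measurable fun t => ∫ x in Icc (-r) r, deriv (u t) x ^ 2 := by
  have h1 := meas_deriv h.um fun t => (h.uc1 t).differentiable (by simp)
  exact (StronglyMeasurable.integral_prod_right (ν := volume.restrict (Icc (-r) r))
    (f := fun t x => deriv (u t) x ^ 2) (h1.pow_const 2).stronglyMeasurable).measurable

lemma int_half {a s : ℝ} (has : a < s) :
    IntegrableOn (fun t => (t - a) ^ (-(1 / 2) : ℝ)) (Ioo a s) ∧
    ∫ t in Ioo a s, (t - a) ^ (-(1 / 2) : ℝ) = 2 * √(s - a) := by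
  have i1 : IntervalIntegrable (fun t => (t - a) ^ (-(1 / 2) : ℝ)) volume a s := by
    have := (intervalIntegral.intervalIntegrable_rpow' (a := 0) (b := s - a) (r := (-(1 / 2) : ℝ))
      (by norm_num)).comp_sub_right a
    simpa using this
  refine ⟨(integrableOn_Ioc_iff_integrableOn_Ioo).1 ((intervalIntegrable_iff_integrableOn_Ioc_of_le has.le).1 i1), ?_⟩
  rw [← integral_Ioc_eq_integral_Ioo, ← intervalIntegral.integral_of_le has.le,
    intervalIntegral.integral_comp_sub_right (fun t => t ^ (-(1 / 2) : ℝ)) a,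
    integral_rpow (Or.inl (by norm_num)), Real.sqrt_eq_rpow]
  norm_num
  ring

namespace Gap
variable {R n m a b : ℝ}

lemma wrow (g : Gap J q α μ u R n m a b) (h : Sol J q α μ u) {r t A : ℝ} (ht : t ∈ Ioo a b)
    (hr : 0 ≤ r) (hrR : r ≤ R) (hA : ∫ x in Icc (-r) r, dv u (u a) t x ^ 2 ≤ A) :
    ∫ x in Icc (-r) r, (|dv u (u a) t x| + dv u (u a) t x ^ 2 + |Sv J q α μ u (u a) t x| + 1) ≤
      (2 * m + (2 * α * m + 2 * R * (μ * n + n ^ (q - 1) * n)) + 2 * R) + A := by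
  have i1 : IntegrableOn (fun x => |dv u (u a) t x|) (Icc (-r) r) := Sol.il (cd h t).abs
  have i2 : IntegrableOn (fun x => dv u (u a) t x ^ 2) (Icc (-r) r) := Sol.il ((cd h t).pow 2)
  have i3 : IntegrableOn (fun x => |Sv J q α μ u (u a) t x|) (Icc (-r) r) :=
    ((h.Su_int t).integrableOn.add (Sol.il (Sol.cv_cont h.q1 (h.uc a)))).abs
  have i4 : IntegrableOn (fun _ : ℝ => (1:ℝ)) (Icc (-r) r) := Sol.il continuous_const
  have i12 : IntegrableOn (fun x => |dv u (u a) t x| + dv u (u a) t x ^ 2) (Icc (-r) r) := i1.add i2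
  have i123 : IntegrableOn (fun x => |dv u (u a) t x| + dv u (u a) t x ^ 2 + |Sv J q α μ u (u a) t x|)
    (Icc (-r) r) := i12.add i3
  rw [integral_add i123 i4, integral_add i12 i3, integral_add i1 i2]
  simp only [integral_const, measureReal_restrict_apply_univ, smul_eq_mul,
    Real.volume_real_Icc_of_le (by linarith : -r ≤ r)]
  have := g.d1 h ht (Icc (-r) r)
  have := g.s1 h ht hr hrR
  linarith

lemma G2 (h : Sol J q α μ u) {r : ℝ} (hr : 0 < r) (hrR : r < R) (hn : 0 ≤ n) (hm : 0 < m) :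
    ∃ K, 0 ≤ K ∧ ∀ a b, Gap J q α μ u R n m a b → ∀ s ∈ Ioo a b,
      ∫ x in Icc (-r) r, |dv u (u a) s x| ≤ K * √(s - a) := by
  set r1 := (r + R) / 2 with hr1
  have hμ := h.μ0
  have hα := h.α0
  have hR : 0 < R := by linarith
  obtain ⟨K1, hK1, h1⟩ := G1 (R := R) (r := r1) (n := n) (m := m) h (by linarith) (by linarith) hn hm
  obtain ⟨K, hK, hk⟩ := GK (R := R) (r := r) (r1 := r1) (n := n) (m := m) h hr (by linarith) (by linarith) hn
  set A := 2 * m + (2 * α * m + 2 * R * (μ * n + n ^ (q - 1) * n)) + 2 * R with hA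
  have A0 : 0 ≤ A := by positivity
  refine ⟨K * ((A + K1) * 2), by positivity, fun a b g s hs => ?_⟩
  have i0 := (int_half g.ab).1
  have := hk a b (fun t => (A + K1) * (t - a) ^ (-(1 / 2) : ℝ)) g (i0.const_mul _)
    (fun t ht => mul_nonneg (by positivity) (Real.rpow_nonneg (by linarith [ht.1]) _)) ?_ s hs
  · rw [integral_const_mul, (int_half hs.1).2] at this
    refine this.trans (le_of_eq (by ring))
  · intro t ht
    have := g.wrow h (r := r1) ht (by linarith) (by linarith) (h1 a b g t ht)
    refine this.trans ?_
    have e : 1 ≤ (t - a) ^ (-(1 / 2) : ℝ) :=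
      Real.one_le_rpow_of_pos_of_le_one_of_nonpos (by linarith [ht.1]) (by linarith [ht.2, g.b1])
        (by norm_num)
    have := mul_le_mul_of_nonneg_left e A0
    linarith

lemma G3 (h : Sol J q α μ u) {r : ℝ} (hr : 0 < r) (hrR : r < R) (hn : 0 ≤ n) (hm : 0 < m) :
    ∃ K, 0 ≤ K ∧ ∀ a b, Gap J q α μ u R n m a b → ∀ s ∈ Ioo a b,
      ∫ x in Icc (-r) r, dv u (u a) s x ^ 2 ≤ K * √(s - a) := by
  set r1 := (r + R) / 2 with hr1
  set r2 := (r1 + R) / 2 with hr2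
  obtain ⟨χ, c, hc, hχ, χ1, -⟩ := exists_cut hr (by linarith : r < r1)
  have hμ := h.μ0
  have hα := h.α0
  have hq := h.q1
  have hR : 0 < R := by linarith
  obtain ⟨K2, hK2, h2⟩ := G2 (R := R) (r := r1) (n := n) (m := m) h (by linarith) (by linarith) hn hm
  obtain ⟨K, hK, hSL⟩ := SL (c := c) (mb := K2 + 1) (M1 := 2 * α * m + 2 * R * (μ * n + n ^ (q - 1) * n))
    (C0 := 2 * n ^ (q - 1) + 1) hμ h.q1 h.q2 (by positivity) (by positivity) (by positivity)
    (by linarith)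
  refine ⟨K * (1 + 2 * (K2 + 1) ^ 2), by positivity, fun a b g s hs => ?_⟩
  set σ := s - a with hσ
  have σ0 : 0 < σ := by linarith [hs.1]
  have σ1 : σ ≤ 1 := by linarith [hs.2, g.b1]
  have q0 : 0 < √σ := Real.sqrt_pos.2 σ0
  have q1 : √σ ≤ 1 := Real.sqrt_le_one.2 σ1
  obtain ⟨β, hel⟩ := g.el h (r := r2) (t1 := a + σ / 2) (t2 := s) (by linarith) (by linarith)
    (by linarith) (by linarith) hs.2
  have hin : ∀ t ∈ Icc (a + σ / 2) s, t ∈ Ioo a b := fun t ht =>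
    ⟨by linarith [ht.1], by linarith [ht.2, hs.2]⟩
  have hloc : Loc r1 (a + σ / 2) s q ((K2 + 1) * √σ) (2 * α * m + 2 * R * (μ * n + n ^ (q - 1) * n))
      (2 * n ^ (q - 1) + 1) (dv u (u a)) (Fv q u (u a)) (Sv J q α μ u (u a)) := by
    refine ⟨fun t ht => (h2 a b g t (hin t ht)).trans ?_,
      fun t ht => g.s1 h (hin t ht) (by linarith) (by linarith),
      fun t _ x hx => g.f1 h t (by linarith)⟩
    have : √(t - a) ≤ √σ := Real.sqrt_le_sqrt (by linarith [ht.2])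
    exact mul_le_mul (by linarith) this (Real.sqrt_nonneg _) (by linarith)
  have := hSL r1 r2 (a + σ / 2) s ((K2 + 1) * √σ) χ _ _ _ β hχ hel hloc (by linarith) (by linarith)
    (by linarith) (by linarith) (by positivity) (by nlinarith)
  have e : s - (a + σ / 2) = σ / 2 := by rw [hσ]; ring
  rw [e] at this
  have k1 := cut_le (r := r) (χ := fun x => χ x ^ 3) (k := fun x => dv u (u a) s x ^ 2)
    (fun x hx => by simp [χ1 x hx]) (fun x => pow_nonneg (hχ.n x) 3) (fun x => sq_nonneg _)
    ((cube_test hχ.t).integrable_mul_cont ((cd h s).pow 2))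
  refine (k1.trans this).trans ?_
  rw [mul_assoc]
  refine mul_le_mul_of_nonneg_left ?_ hK
  have q2 : √σ / 2 ≤ √(σ / 2) := by
    apply Real.le_sqrt_of_sq_le
    rw [div_pow, Real.sq_sqrt σ0.le]; linarith
  have q5 : σ = √σ * √σ := (Real.mul_self_sqrt σ0.le).symm
  have q6 : σ / 2 ≤ √σ := by nlinarith
  have q3 : ((K2 + 1) * √σ) ^ 2 / √(σ / 2) ≤ 2 * (K2 + 1) ^ 2 * √σ := by
    rw [div_le_iff₀ (by linarith)]
    calc ((K2 + 1) * √σ) ^ 2 = 2 * (K2 + 1) ^ 2 * √σ * (√σ / 2) := by ring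
      _ ≤ _ := mul_le_mul_of_nonneg_left q2 (by positivity)
  linarith

lemma G5 (h : Sol J q α μ u) {r : ℝ} (hr : 0 < r) (hrR : r < R) (hn : 0 ≤ n) (hm : 0 < m) :
    ∃ K, 0 ≤ K ∧ ∀ a b, Gap J q α μ u R n m a b → ∀ s ∈ Ioo a b,
      ∫ x in Icc (-r) r, |dv u (u a) s x| ≤ K * (s - a) := by
  set r1 := (r + R) / 2 with hr1
  have hμ := h.μ0
  have hα := h.α0
  have hR : 0 < R := by linarith
  obtain ⟨K1, hK1, h1⟩ := G3 (R := R) (r := r1) (n := n) (m := m) h (by linarith) (by linarith) hn hm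
  obtain ⟨K, hK, hk⟩ := GK (R := R) (r := r) (r1 := r1) (n := n) (m := m) h hr (by linarith) (by linarith) hn
  set A := 2 * m + (2 * α * m + 2 * R * (μ * n + n ^ (q - 1) * n)) + 2 * R with hA
  have A0 : 0 ≤ A := by positivity
  refine ⟨K * (A + K1), by positivity, fun a b g s hs => ?_⟩
  have := hk a b (fun t => (A + K1)) g (integrableOn_const (by simp))
    (fun t ht => by positivity) ?_ s hs
  · simp only [integral_const, measureReal_restrict_apply_univ, smul_eq_mul,
      Real.volume_real_Ioo_of_le hs.1.le] at this
    refine this.trans (le_of_eq (by ring))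
  · intro t ht
    have := g.wrow h (r := r1) ht (by linarith) (by linarith) (h1 a b g t ht)
    refine this.trans ?_
    have e : √(t - a) ≤ 1 := Real.sqrt_le_one.2 (by linarith [ht.2, g.b1])
    have := mul_le_mul_of_nonneg_left e hK1
    linarith

lemma G4 (h : Sol J q α μ u) {r : ℝ} (hr : 0 < r) (hrR : r < R) (hn : 0 ≤ n) (hm : 0 < m) :
    ∃ K, 0 ≤ K ∧ ∀ a b, Gap J q α μ u R n m a b →
      IntegrableOn (fun t => ∫ x in Icc (-r) r, deriv (u t) x ^ 2) (Ioo a b) ∧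
      ∫ t in Ioo a b, (∫ x in Icc (-r) r, deriv (u t) x ^ 2) ≤ K * (b - a) := by
  set r1 := (r + R) / 2 with hr1
  set r2 := (r1 + R) / 2 with hr2
  obtain ⟨χ, c, hc, hχ, χ1, -⟩ := exists_cut hr (by linarith : r < r1)
  have hμ := h.μ0
  have hα := h.α0
  have hq := h.q1
  have hR : 0 < R := by linarith
  obtain ⟨K3, hK3, h3⟩ := G3 (R := R) (r := r1) (n := n) (m := m) h (by linarith) (by linarith) hn hm
  obtain ⟨K, hK, hSL⟩ := SL1 (c := c) (mb := 2 * m) (M1 := 2 * α * m + 2 * R * (μ * n + n ^ (q - 1) * n))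
    (C0 := 2 * n ^ (q - 1) + 1) hμ h.q1 h.q2 (by positivity) (by positivity) (by positivity)
    (by linarith)
  refine ⟨2 * (2 / μ * K) + 4 * R * n ^ 2, by positivity, fun a b g => ?_⟩
  have hab := g.ab
  set f : ℝ → ℝ := fun t => ∫ x, χ x ^ 3 * deriv (dv u (u a) t) x ^ 2 with hf
  have cdd : ∀ t, Continuous (deriv (dv u (u a) t)) := fun t =>
    ((h.uc1 t).sub (h.uc1 a)).continuous_deriv (by simp)
  have f0 : ∀ t, 0 ≤ f t := fun t => integral_nonneg fun x =>
    mul_nonneg (pow_nonneg (hχ.n x) 3) (sq_nonneg _)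
  have hloc : ∀ t1 t2, a < t1 → t1 ≤ t2 → t2 < b → IntegrableOn f (Icc t1 t2) ∧
      ∫ t in Icc t1 t2, f t ≤ 2 / μ * (K3 * √(t1 - a) + K * (b - a)) := by
    intro t1 t2 h1 h12 h2
    obtain ⟨β, hel⟩ := g.el h (r := r2) (t1 := t1) (t2 := t2) (by linarith) (by linarith) h1 h12 h2
    have hin : ∀ t ∈ Icc t1 t2, t ∈ Ioo a b := fun t ht =>
      ⟨by linarith [ht.1], by linarith [ht.2]⟩
    have hloc : Loc r1 t1 t2 q (2 * m) (2 * α * m + 2 * R * (μ * n + n ^ (q - 1) * n))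
        (2 * n ^ (q - 1) + 1) (dv u (u a)) (Fv q u (u a)) (Sv J q α μ u (u a)) :=
      ⟨fun t ht => g.d1 h (hin t ht) _, fun t ht => g.s1 h (hin t ht) (by linarith) (by linarith),
        fun t _ x hx => g.f1 h t (by linarith)⟩
    obtain ⟨e1, e2⟩ := hSL r1 r2 t1 t2 χ _ _ _ β hχ hel hloc (by linarith) (by linarith)
    refine ⟨e1, ?_⟩
    have e3 : 0 ≤ ∫ x, χ x ^ 3 * dv u (u a) t2 x ^ 2 := integral_nonneg fun x =>
      mul_nonneg (pow_nonneg (hχ.n x) 3) (sq_nonneg _)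
    have e4 : ∫ x, χ x ^ 3 * dv u (u a) t1 x ^ 2 ≤ K3 * √(t1 - a) := by
      refine le_trans ?_ (h3 a b g t1 ⟨h1, by linarith⟩)
      have := abs_integral_mul_le (r := r1) (C := 1) (η := fun x => χ x ^ 3)
        (G := fun x => dv u (u a) t1 x ^ 2) (cube_test hχ.t).2
        (fun x => by rw [abs_of_nonneg (pow_nonneg (hχ.n x) 3)]; exact pow_le_one₀ (hχ.n x) (hχ.l x))
        (Sol.il ((cd h t1).pow 2))
      have e9 : ∀ x, |dv u (u a) t1 x ^ 2| = dv u (u a) t1 x ^ 2 := fun x => abs_of_nonneg (sq_nonneg _)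
      simp only [e9, one_mul] at this
      exact (le_abs_self _).trans this
    have e5 : μ / 2 * (∫ t in Icc t1 t2, f t) ≤ K3 * √(t1 - a) + K * (b - a) := by
      have : K * (t2 - t1) ≤ K * (b - a) := mul_le_mul_of_nonneg_left (by linarith) hK
      linarith
    have e6 := mul_le_mul_of_nonneg_left e5 (by positivity : 0 ≤ 2 / μ)
    have : 2 / μ * (μ / 2 * (∫ t in Icc t1 t2, f t)) = ∫ t in Icc t1 t2, f t := by field_simp
    rwa [this] at e6
  -- exhaust the gap
  set A : ℕ → ℝ := fun k => a + (b - a) / 3 * (1 / ((k:ℝ) + 1)) with hA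
  set B : ℕ → ℝ := fun k => b - (b - a) / 3 * (1 / ((k:ℝ) + 1)) with hB
  have l0 : Tendsto (fun k : ℕ => (b - a) / 3 * (1 / ((k:ℝ) + 1))) atTop (𝓝 0) := by
    simpa using (tendsto_one_div_add_atTop_nhds_zero_nat (𝕜 := ℝ)).const_mul ((b - a) / 3)
  have lA : Tendsto A atTop (𝓝 a) := by have := l0.const_add a; rwa [add_zero] at this
  have lB : Tendsto B atTop (𝓝 b) := by have := l0.const_sub b; rwa [sub_zero] at this
  have hk : ∀ k : ℕ, 0 < (b - a) / 3 * (1 / ((k:ℝ) + 1)) ∧ (b - a) / 3 * (1 / ((k:ℝ) + 1)) ≤ (b - a) / 3 := by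
    intro k
    have : 1 / ((k:ℝ) + 1) ≤ 1 := by
      rw [div_le_one (by positivity)]; linarith [Nat.cast_nonneg (α := ℝ) k]
    have p : 0 < (b - a) / 3 := by linarith
    exact ⟨by positivity, by nlinarith⟩
  have hk1 : ∀ k, a < A k ∧ A k ≤ B k ∧ B k < b := fun k => by
    obtain ⟨p1, p2⟩ := hk k
    simp only [hA, hB]
    refine ⟨by linarith, by linarith, by linarith⟩
  have cov := aecover_Ioo_of_Icc (μ := (volume : Measure ℝ)) lA lB
  have hres : ∀ k, (volume.restrict (Ioo a b)).restrict (Icc (A k) (B k)) = volume.restrict (Icc (A k) (B k)) :=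
    fun k => by
      rw [Measure.restrict_restrict measurableSet_Icc, inter_eq_left.2]
      exact fun t ht => ⟨(hk1 k).1.trans_le ht.1, ht.2.trans_lt (hk1 k).2.2⟩
  have hintg : ∀ k, IntegrableOn f (Icc (A k) (B k)) (volume.restrict (Ioo a b)) := fun k => by
    unfold IntegrableOn; rw [hres k]
    exact (hloc _ _ (hk1 k).1 (hk1 k).2.1 (hk1 k).2.2).1
  have hbd : ∀ k, ∫ t in Icc (A k) (B k), f t ∂(volume.restrict (Ioo a b)) ≤
      2 / μ * (K3 * √(A k - a) + K * (b - a)) := fun k => by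
    rw [hres k]
    exact (hloc _ _ (hk1 k).1 (hk1 k).2.1 (hk1 k).2.2).2
  have hfi : IntegrableOn f (Ioo a b) := by
    refine cov.integrable_of_integral_bounded_of_nonneg_ae (2 / μ * (K3 * 1 + K * (b - a))) hintg
      (Eventually.of_forall f0) (Eventually.of_forall fun k => (hbd k).trans ?_)
    have : √(A k - a) ≤ 1 := Real.sqrt_le_one.2 (by linarith [hk1 k, g.b1, (hk1 k).2.2])
    gcongr
  have hle : ∫ t in Ioo a b, f t ≤ 2 / μ * (K * (b - a)) := by
    have l1 := cov.integral_tendsto_of_countably_generated hfi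
    have l2 : Tendsto (fun k => 2 / μ * (K3 * √(A k - a) + K * (b - a))) atTop
        (𝓝 (2 / μ * (K3 * √(a - a) + K * (b - a)))) :=
      ((((lA.sub_const a).sqrt).const_mul K3).add_const _).const_mul _
    have := le_of_tendsto_of_tendsto l1 l2 (Eventually.of_forall hbd)
    simpa using this
  have hrow : ∀ t, ∫ x in Icc (-r) r, deriv (u t) x ^ 2 ≤ 2 * f t + 4 * R * n ^ 2 := by
    intro t
    have k1 := cut_le (r := r) (χ := fun x => χ x ^ 3) (k := fun x => deriv (dv u (u a) t) x ^ 2)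
      (fun x hx => by simp [χ1 x hx]) (fun x => pow_nonneg (hχ.n x) 3) (fun x => sq_nonneg _)
      ((cube_test hχ.t).integrable_mul_cont ((cdd t).pow 2))
    have i1 : IntegrableOn (fun x => 2 * deriv (dv u (u a) t) x ^ 2) (Icc (-r) r) :=
      (Sol.il ((cdd t).pow 2)).const_mul 2
    have i2 : IntegrableOn (fun _ : ℝ => 2 * n ^ 2) (Icc (-r) r) := Sol.il continuous_const
    have : ∫ x in Icc (-r) r, deriv (u t) x ^ 2 ≤
        ∫ x in Icc (-r) r, (2 * deriv (dv u (u a) t) x ^ 2 + 2 * n ^ 2) := by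
      refine setIntegral_mono_on (Sol.il (((h.uc1 t).continuous_deriv (by simp)).pow 2)) (i1.add i2)
        measurableSet_Icc fun x hx => ?_
      have e1 : deriv (dv u (u a) t) x = deriv (u t) x - deriv (u a) x :=
        deriv_sub ((h.uc1 t).differentiable (by simp) x) ((h.uc1 a).differentiable (by simp) x)
      have e2 := g.v1 x ((abs_le.2 hx).trans hrR.le)
      have e3 : deriv (u a) x ^ 2 ≤ n ^ 2 := by
        rw [← sq_abs]; exact pow_le_pow_left₀ (abs_nonneg _) e2 2
      rw [e1]
      nlinarith [sq_nonneg (deriv (u t) x - 2 * deriv (u a) x)]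
    rw [integral_add i1 i2, integral_const_mul] at this
    simp only [integral_const, measureReal_restrict_apply_univ, smul_eq_mul,
      Real.volume_real_Icc_of_le (by linarith : -r ≤ r)] at this
    have e4 : (r - -r) * (2 * n ^ 2) ≤ 4 * R * n ^ 2 := by nlinarith [sq_nonneg n]
    simp only [hf]
    linarith
  have ibig : IntegrableOn (fun t => 2 * f t + 4 * R * n ^ 2) (Ioo a b) :=
    (hfi.const_mul 2).add (integrableOn_const (by simp))
  have iD : IntegrableOn (fun t => ∫ x in Icc (-r) r, deriv (u t) x ^ 2) (Ioo a b) := by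
    refine ibig.mono' (h.D_meas r).aestronglyMeasurable (Eventually.of_forall fun t => ?_)
    rw [Real.norm_of_nonneg (integral_nonneg fun x => sq_nonneg _)]
    exact hrow t
  refine ⟨iD, ?_⟩
  have := integral_mono iD ibig hrow
  rw [integral_add (hfi.const_mul 2) (integrableOn_const (by simp)), integral_const_mul] at this
  simp only [integral_const, measureReal_restrict_apply_univ, smul_eq_mul,
    Real.volume_real_Ioo_of_le hab.le] at this
  nlinarith

lemma main (h : Sol J q α μ u) {r : ℝ} (hr : 0 < r) (hrR : r < R) (hn : 0 ≤ n) (hm : 0 < m) :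
    ∃ K, 0 ≤ K ∧ ∀ a b, Gap J q α μ u R n m a b →
      (∀ s ∈ Ioo a b, ∫ x in Icc (-r) r, u s x ^ 2 ≤ K) ∧
      (∀ s ∈ Ioo a b, ∫ x in Icc (-r) r, |u s x - u a x| ≤ K * (s - a)) ∧
      IntegrableOn (fun t => ∫ x in Icc (-r) r, deriv (u t) x ^ 2) (Ioo a b) ∧
      ∫ t in Ioo a b, (∫ x in Icc (-r) r, deriv (u t) x ^ 2) ≤ K * (b - a) := by
  obtain ⟨K3, hK3, h3⟩ := G3 (R := R) (r := r) (n := n) (m := m) h hr hrR hn hm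
  obtain ⟨K4, hK4, h4⟩ := G4 (R := R) (r := r) (n := n) (m := m) h hr hrR hn hm
  obtain ⟨K5, hK5, h5⟩ := G5 (R := R) (r := r) (n := n) (m := m) h hr hrR hn hm
  have hR : 0 < R := by linarith
  set K := 2 * K3 + 4 * R * n ^ 2 + K4 + K5 with hK
  have : 0 ≤ 4 * R * n ^ 2 := by positivity
  refine ⟨K, by positivity, fun a b g => ⟨fun s hs => ?_, fun s hs => ?_, (h4 a b g).1, ?_⟩⟩
  · have e := h3 a b g s hs
    have e1 : √(s - a) ≤ 1 := Real.sqrt_le_one.2 (by linarith [hs.2, g.b1])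
    have e2 := mul_le_mul_of_nonneg_left e1 hK3
    have i1 : IntegrableOn (fun x => 2 * dv u (u a) s x ^ 2) (Icc (-r) r) :=
      (Sol.il ((cd h s).pow 2)).const_mul 2
    have i2 : IntegrableOn (fun _ : ℝ => 2 * n ^ 2) (Icc (-r) r) := Sol.il continuous_const
    have : ∫ x in Icc (-r) r, u s x ^ 2 ≤ ∫ x in Icc (-r) r, (2 * dv u (u a) s x ^ 2 + 2 * n ^ 2) := by
      refine setIntegral_mono_on (Sol.il ((h.cu s).pow 2)) (i1.add i2)
        measurableSet_Icc fun x hx => ?_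
      have e2 := g.v0 x ((abs_le.2 hx).trans hrR.le)
      have e3 : u a x ^ 2 ≤ n ^ 2 := by
        rw [← sq_abs]; exact pow_le_pow_left₀ (abs_nonneg _) e2 2
      simp only [dv]
      nlinarith [sq_nonneg (u s x - 2 * u a x)]
    rw [integral_add i1 i2, integral_const_mul] at this
    simp only [integral_const, measureReal_restrict_apply_univ, smul_eq_mul,
      Real.volume_real_Icc_of_le (by linarith : -r ≤ r)] at this
    have e4 : (r - -r) * (2 * n ^ 2) ≤ 4 * R * n ^ 2 := by nlinarith [sq_nonneg n]
    linarith
  · refine (h5 a b g s hs).trans (mul_le_mul_of_nonneg_right (by linarith) (by linarith [hs.1]))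
  · refine (h4 a b g).2.trans (mul_le_mul_of_nonneg_right (by linarith) (by linarith [g.ab]))

end Gap
end RegAux

namespace RegAux
open Set Topology
open scoped ContDiff

def gaps (B : Set ℝ) : Set (ℝ × ℝ) := {p | p.1 ∈ B ∧ p.2 ∈ B ∧ p.1 < p.2 ∧ ∀ s ∈ Ioo p.1 p.2, s ∉ B}

def gi {B : Set ℝ} (i : gaps B) : Set ℝ := Ioo i.1.1 i.1.2

lemma gaps_disj (B : Set ℝ) : Pairwise (Function.onFun Disjoint fun i : gaps B => gi i) := by
  intro i j hne
  rw [Function.onFun, Set.disjoint_left]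
  intro s hi hj
  apply hne
  have e1 : i.1.1 = j.1.1 := by
    rcases lt_trichotomy i.1.1 j.1.1 with e | e | e
    · exact absurd j.2.1 (i.2.2.2.2 _ ⟨e, hj.1.trans hi.2⟩)
    · exact e
    · exact absurd i.2.1 (j.2.2.2.2 _ ⟨e, hi.1.trans hj.2⟩)
  have e2 : i.1.2 = j.1.2 := by
    rcases lt_trichotomy i.1.2 j.1.2 with e | e | e
    · exact absurd i.2.2.1 (j.2.2.2.2 _ ⟨hj.1.trans hi.2, e⟩)
    · exact e
    · exact absurd j.2.2.1 (i.2.2.2.2 _ ⟨hi.1.trans hj.2, e⟩)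
  exact Subtype.ext (Prod.ext e1 e2)

lemma gaps_cnt (B : Set ℝ) : Countable (gaps B) := by
  have := Set.PairwiseDisjoint.countable_of_isOpen (s := fun i : gaps B => gi i) (a := univ)
    (fun i _ j _ hij => gaps_disj B hij) (fun i _ => isOpen_Ioo)
    (fun i _ => nonempty_Ioo.2 i.2.2.2.1)
  exact countable_univ_iff.1 this

lemma gaps_cover {B : Set ℝ} {c t : ℝ} (hB : IsClosed B) (hc : c ∈ B) (ht : t ∈ B) {s : ℝ}
    (hs : s ∈ Icc c t) (hsB : s ∉ B) : ∃ i : gaps B, s ∈ gi i := by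
  have b1 : BddAbove (B ∩ Iic s) := ⟨s, fun x hx => hx.2⟩
  have b2 : BddBelow (B ∩ Ici s) := ⟨s, fun x hx => hx.2⟩
  have m1 := (hB.inter isClosed_Iic).csSup_mem ⟨c, hc, hs.1⟩ b1
  have m2 := (hB.inter isClosed_Ici).csInf_mem ⟨t, ht, hs.2⟩ b2
  set a := sSup (B ∩ Iic s)
  set b := sInf (B ∩ Ici s)
  have l1 : a < s := lt_of_le_of_ne m1.2 fun e => hsB (e ▸ m1.1)
  have l2 : s < b := lt_of_le_of_ne m2.2 fun e => hsB (e ▸ m2.1)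
  refine ⟨⟨(a, b), m1.1, m2.1, l1.trans l2, fun x hx hxB => ?_⟩, l1, l2⟩
  rcases le_total x s with e | e
  · exact absurd (le_csSup b1 ⟨hxB, e⟩) (not_le.2 hx.1)
  · exact absurd (csInf_le b2 ⟨hxB, e⟩) (not_le.2 hx.2)

lemma gaps_union {B : Set ℝ} {c t : ℝ} (hB : IsClosed B) (hc : c ∈ B) (ht : t ∈ B)
    (hs : B ⊆ Icc c t) : (⋃ i : gaps B, gi i) = Icc c t \ B := by
  ext s
  simp only [mem_iUnion, mem_diff]
  constructor
  · rintro ⟨i, hi⟩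
    exact ⟨⟨(hs i.2.1).1.trans hi.1.le, hi.2.le.trans (hs i.2.2.1).2⟩, i.2.2.2.2 s hi⟩
  · rintro ⟨h1, h2⟩; exact gaps_cover hB hc ht h1 h2

lemma gaps_hasSum {B : Set ℝ} {c t : ℝ} (hB : IsClosed B) (hc : c ∈ B) (ht : t ∈ B)
    (hs : B ⊆ Icc c t) {f : ℝ → ℝ} (hf : IntegrableOn f (Icc c t)) :
    HasSum (fun i : gaps B => ∫ s in gi i, f s) ((∫ s in Icc c t, f s) - ∫ s in B, f s) := by
  haveI := gaps_cnt B
  have hu := gaps_union hB hc ht hs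
  have := hasSum_integral_iUnion (μ := volume) (f := f) (s := fun i : gaps B => gi i)
    (fun i => measurableSet_Ioo) (gaps_disj B) (by rw [hu]; exact hf.mono_set diff_subset)
  rw [hu, integral_diff hB.measurableSet hf hs] at this
  exact this

lemma gaps_len {B : Set ℝ} {c t : ℝ} (hB : IsClosed B) (hc : c ∈ B) (ht : t ∈ B)
    (hs : B ⊆ Icc c t) : Summable (fun i : gaps B => i.1.2 - i.1.1) := by
  have := (gaps_hasSum hB hc ht hs (f := fun _ => (1:ℝ)) (integrableOn_const (by simp))).summable
  refine this.congr fun i => ?_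
  simp [gi, Real.volume_real_Ioo_of_le i.2.2.2.1.le]

/-- integrability from gaps -/
lemma gaps_integrable {B : Set ℝ} {c t : ℝ} (hB : IsClosed B) (hc : c ∈ B) (ht : t ∈ B)
    (hs : B ⊆ Icc c t) {f : ℝ → ℝ} (h0 : ∀ s, 0 ≤ f s) (hfB : IntegrableOn f B)
    {K : ℝ} (h1 : ∀ i : gaps B, IntegrableOn f (gi i))
    (h2 : ∀ i : gaps B, ∫ s in gi i, f s ≤ K * (i.1.2 - i.1.1)) : IntegrableOn f (Icc c t) := by
  haveI := gaps_cnt B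
  have hu := gaps_union hB hc ht hs
  have := integrableOn_iUnion_of_summable_integral_norm (μ := volume) (f := f) (s := fun i : gaps B => gi i)
    (h1) (by
      refine Summable.of_nonneg_of_le (fun i => integral_nonneg fun s => norm_nonneg _)
        (fun i => ?_) ((gaps_len hB hc ht hs).mul_left K)
      have : (fun s => ‖f s‖) = f := by ext s; exact Real.norm_of_nonneg (h0 s)
      rw [this]; exact h2 i)
  rw [hu] at this
  exact (hfB.union this).mono_set (by rw [union_diff_self]; exact subset_union_right)
end RegAux

namespace RegAux
open Set Topology
open scoped ContDiff

def Bn (R n : ℝ) (v : ℝ → ℝ) : Prop :=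
  ∀ x, |x| ≤ R → |v x| ≤ n ∧ |deriv v x| ≤ n ∧ |deriv (deriv v) x| ≤ n

lemma Bn.mono {R n n' : ℝ} {v : ℝ → ℝ} (h : Bn R n v) (hn : n ≤ n') : Bn R n' v :=
  fun x hx => ⟨(h x hx).1.trans hn, (h x hx).2.1.trans hn, (h x hx).2.2.trans hn⟩

lemma exists_Bn {v : ℝ → ℝ} (hv : ContDiff ℝ 2 v) (R : ℝ) : ∃ n : ℕ, Bn R n v := by
  have hv1 : ContDiff ℝ 1 (deriv v) := contDiff_deriv_of_two hv
  have hc : Continuous fun x => |v x| + |deriv v x| + |deriv (deriv v) x| :=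
    (hv.continuous.abs.add hv1.continuous.abs).add (hv1.continuous_deriv (by norm_num)).abs
  obtain ⟨C, hC⟩ := (isCompact_Icc (a := -R) (b := R)).bddAbove_image hc.continuousOn
  obtain ⟨n, hn⟩ := exists_nat_ge C
  refine ⟨n, fun x hx => ?_⟩
  have := (hC ⟨x, abs_le.1 hx, rfl⟩).trans hn
  simp only at this
  have a := abs_nonneg (v x); have b := abs_nonneg (deriv v x)
  have c := abs_nonneg (deriv (deriv v) x)
  exact ⟨by linarith, by linarith, by linarith⟩

def CN (K : Set ℝ) (n : ℝ) (v : ℝ → ℝ) : Prop :=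
  (∀ x ∈ K, |v x| ≤ n) ∧ (∀ x ∈ K, ∀ y ∈ K, |v x - v y| ≤ n * |x - y|) ∧
  ConvexOn ℝ K (fun x => n * x ^ 2 + v x) ∧ ConvexOn ℝ K (fun x => n * x ^ 2 - v x)

lemma d2_quad {v : ℝ → ℝ} (hv : ContDiff ℝ 2 v) (n : ℝ) :
    deriv (fun x => n * x ^ 2 + v x) = (fun x => n * (2 * x) + deriv v x) ∧
    deriv (fun x => n * (2 * x) + deriv v x) = fun x => n * 2 + deriv (deriv v) x := by
  have hv1 : ContDiff ℝ 1 (deriv v) := contDiff_deriv_of_two hv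
  constructor
  · ext x
    have h1 : HasDerivAt (fun x : ℝ => n * x ^ 2) (n * (2 * x)) x := by
      simpa using (hasDerivAt_pow 2 x).const_mul n
    exact (h1.add (hv.differentiable (by norm_num) x).hasDerivAt).deriv
  · ext x
    have h1 : HasDerivAt (fun x : ℝ => n * (2 * x)) (n * 2) x := by
      simpa using ((hasDerivAt_id x).const_mul 2).const_mul n
    exact (h1.add (hv1.differentiable (by norm_num) x).hasDerivAt).deriv

lemma convex_quad {v : ℝ → ℝ} (hv : ContDiff ℝ 2 v) {R n : ℝ}
    (h : ∀ x ∈ Icc (-R) R, -n ≤ deriv (deriv v) x) (hn : 0 ≤ n) :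
    ConvexOn ℝ (Icc (-R) R) (fun x => n * x ^ 2 + v x) := by
  have hv1 : ContDiff ℝ 1 (deriv v) := contDiff_deriv_of_two hv
  obtain ⟨e1, e2⟩ := d2_quad hv n
  have hd : Differentiable ℝ (fun x => n * x ^ 2 + v x) :=
    ((differentiable_id.pow 2).const_mul n).add (hv.differentiable (by norm_num))
  refine convexOn_of_deriv2_nonneg' (convex_Icc _ _) hd.differentiableOn ?_ ?_
  · rw [e1]
    exact (((differentiable_id.const_mul 2).const_mul n).add
      (hv1.differentiable (by norm_num))).differentiableOn
  · intro x hx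
    simp only [Function.iterate_succ, Function.iterate_zero, Function.comp, id]
    rw [e1, e2]
    have := h x hx
    simp only; linarith

lemma quad_convex {v : ℝ → ℝ} (hv : ContDiff ℝ 2 v) {R n x : ℝ}
    (h : ConvexOn ℝ (Icc (-R) R) (fun x => n * x ^ 2 + v x)) (hx : |x| < R) :
    -(2 * n) ≤ deriv (deriv v) x := by
  obtain ⟨e1, e2⟩ := d2_quad hv n
  have hd : Differentiable ℝ (fun x => n * x ^ 2 + v x) :=
    ((differentiable_id.pow 2).const_mul n).add (hv.differentiable (by norm_num))
  have hm := h.monotoneOn_deriv fun x _ => hd x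
  have := hm.derivWithin_nonneg (x := x)
  rw [derivWithin_of_mem_nhds (Icc_mem_nhds (abs_lt.1 hx).1 (abs_lt.1 hx).2), e1, e2] at this
  simp only at this; linarith

lemma CN_of_Bn {v : ℝ → ℝ} (hv : ContDiff ℝ 2 v) {R n : ℝ} (hn : 0 ≤ n) (h : Bn R n v) :
    CN (Icc (-R) R) n v := by
  refine ⟨fun x hx => (h x (abs_le.2 hx)).1, fun x hx y hy => ?_, convex_quad hv
    (fun x hx => (abs_le.1 (h x (abs_le.2 hx)).2.2).1) hn, ?_⟩
  · have := (convex_Icc (-R) R).norm_image_sub_le_of_norm_deriv_le (f := v) (C := n)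
      (fun z _ => hv.differentiable (by norm_num) z) (fun z hz => (h z (abs_le.2 hz)).2.1) hy hx
    simpa [Real.norm_eq_abs] using this
  · have hv' : ContDiff ℝ 2 (fun x => - v x) := hv.neg
    have e : deriv (fun x => - v x) = fun x => - deriv v x := by ext x; simp
    have := convex_quad hv' (R := R) (n := n) (fun x hx => by
      rw [e, deriv.fun_neg]; exact neg_le_neg (abs_le.1 (h x (abs_le.2 hx)).2.2).2) hn
    simpa [sub_eq_add_neg] using this

lemma Bn_of_CN {v : ℝ → ℝ} (hv : ContDiff ℝ 2 v) {R n : ℝ} (hn : 0 ≤ n)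
    (h : CN (Icc (-(R+1)) (R+1)) n v) : Bn R (2 * n) v := by
  intro x hx
  have hx' : |x| < R + 1 := by linarith
  refine ⟨(h.1 x (abs_le.1 hx'.le)).trans (by linarith), ?_, abs_le.2 ⟨quad_convex hv h.2.2.1 hx', ?_⟩⟩
  · have h1 : ‖deriv v x‖ ≤ n := by
      rw [norm_deriv_eq_norm_fderiv]
      refine norm_fderiv_le_of_lip' ℝ hn ?_
      filter_upwards [Icc_mem_nhds (abs_lt.1 hx').1 (abs_lt.1 hx').2] with y hy
      exact h.2.1 y hy x (abs_le.1 hx'.le)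
    rw [Real.norm_eq_abs] at h1; linarith
  · have hv' : ContDiff ℝ 2 (fun x => - v x) := hv.neg
    have e : deriv (fun x => - v x) = fun x => - deriv v x := by ext x; simp
    have := quad_convex hv' (R := R + 1) (n := n) (by simpa [sub_eq_add_neg] using h.2.2.2) hx'
    rw [e, deriv.fun_neg] at this; linarith

lemma closed_convex {K : Set ℝ} (hK : Convex ℝ K) {f : ℝ → ℝ → ℝ} {t : ℝ} {F : Filter ℝ} [NeBot F]
    (hf : ∀ x, Tendsto (fun s => f s x) F (𝓝 (f t x))) (h : ∀ᶠ s in F, ConvexOn ℝ K (f s)) :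
    ConvexOn ℝ K (f t) := by
  refine ⟨hK, fun x hx y hy a b ha hb hab => ?_⟩
  refine le_of_tendsto_of_tendsto (hf _) (((hf x).const_smul a).add ((hf y).const_smul b)) ?_
  filter_upwards [h] with s hs using hs.2 hx hy ha hb hab

lemma closed_CN {K : Set ℝ} (hK : Convex ℝ K) {u : ℝ → ℝ → ℝ} {n t : ℝ} {F : Filter ℝ} [NeBot F]
    (hf : ∀ x, Tendsto (fun s => u s x) F (𝓝 (u t x))) (h : ∀ᶠ s in F, CN K n (u s)) :
    CN K n (u t) := by
  refine ⟨fun x hx => ?_, fun x hx y hy => ?_, ?_, ?_⟩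
  · exact le_of_tendsto (hf x).abs (h.mono fun s hs => hs.1 x hx)
  · exact le_of_tendsto ((hf x).sub (hf y)).abs (h.mono fun s hs => hs.2.1 x hx y hy)
  · exact closed_convex hK (f := fun s x => n * x ^ 2 + u s x)
      (fun x => (hf x).const_add _) (h.mono fun s hs => hs.2.2.1)
  · exact closed_convex hK (f := fun s x => n * x ^ 2 - u s x)
      (fun x => (hf x).const_sub _) (h.mono fun s hs => hs.2.2.2)

variable {J : ℝ → ℝ} {q α μ : ℝ} {u : ℝ → ℝ → ℝ}

lemma Sol.ct (h : Sol J q α μ u) (x : ℝ) {t : ℝ} (ht : 0 < t) : ContinuousAt (fun s => u s x) t :=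
  ((h.ut x).continuousOn.continuousAt (Ioi_mem_nhds ht))

lemma Sol.baire (h : Sol J q α μ u) (R : ℝ) {S : Set ℝ} (hS : IsLocallyClosed S) (hne : S.Nonempty)
    (hS0 : S ⊆ Ioi 0) : ∃ n : ℝ, 0 ≤ n ∧ ∃ t0 ∈ S, ∃ l r, 0 < l ∧ l < t0 ∧ t0 < r ∧ r - l ≤ 1 ∧
      ∀ t ∈ S ∩ Ioo l r, Bn R n (u t) := by
  haveI : LocallyCompactSpace S := hS.locallyCompactSpace
  haveI : Nonempty S := hne.to_subtype
  obtain ⟨n, ⟨t0, ht0⟩, hi⟩ := nonempty_interior_of_iUnion_of_closed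
    (f := fun n : ℕ => {t : S | CN (Icc (-(R+1)) (R+1)) n (u t)}) (by
      intro n
      rw [← isSeqClosed_iff_isClosed]
      intro s t hs ht
      have h2 : Tendsto (fun k => (s k : ℝ)) atTop (𝓝 t) := (continuous_subtype_val.tendsto t).comp ht
      refine closed_CN (F := map (fun k => (s k : ℝ)) atTop) (convex_Icc _ _) (fun x => ?_) ?_
      · exact (h.ct x (hS0 t.2)).tendsto.comp h2
      · exact eventually_map.2 (Eventually.of_forall hs))
    (by
      refine eq_univ_of_forall fun t => mem_iUnion.2 ?_
      obtain ⟨n, hn⟩ := exists_Bn (h.uc t) (R + 1)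
      exact ⟨n, CN_of_Bn (h.uc t) (Nat.cast_nonneg n) hn⟩)
  have hi' : {t : S | CN (Icc (-(R+1)) (R+1)) n (u t)} ∈ 𝓝 (⟨t0, ht0⟩ : S) :=
    mem_interior_iff_mem_nhds.1 hi
  obtain ⟨V, hV, hVs⟩ := mem_nhds_subtype _ _ _ |>.1 hi'
  obtain ⟨ε, ε0, hε⟩ := Metric.mem_nhds_iff.1 hV
  have t0' : 0 < t0 := hS0 ht0
  set δ := min (min (ε/2) (t0/2)) (1/2) with hδ
  have d0 : 0 < δ := by positivity
  have d1 : δ ≤ ε/2 := (min_le_left _ _).trans (min_le_left _ _)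
  have d2 : δ ≤ t0/2 := (min_le_left _ _).trans (min_le_right _ _)
  have d3 : δ ≤ 1/2 := min_le_right _ _
  refine ⟨2 * n, by positivity, t0, ht0, t0 - δ, t0 + δ, by linarith, by linarith, by linarith,
    by linarith, fun t ht => ?_⟩
  refine Bn_of_CN (h.uc t) (Nat.cast_nonneg n) ?_
  refine hVs (show (⟨t, ht.1⟩ : S) ∈ _ from hε ?_)
  rw [Metric.mem_ball, Real.dist_eq, abs_lt]
  constructor <;> linarith [ht.2.1, ht.2.2]
end RegAux

namespace RegAux
open Set Topology
open scoped ContDiff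

structure Cfg (J : ℝ → ℝ) (q α μ : ℝ) (u : ℝ → ℝ → ℝ) (R n m c t : ℝ) (B : Set ℝ) : Prop where
  c0 : 0 < c
  ct : c < t
  len : t - c ≤ 1
  cl : IsClosed B
  cB : c ∈ B
  tB : t ∈ B
  sub : B ⊆ Icc c t
  bn : ∀ s ∈ B, s < t → Bn R n (u s)
  good : ∀ s ∈ Icc c t, s ∉ B → Good J q α μ u R s
  nm : ∀ s ∈ Icc c t, ∫ x, |u s x| ≤ m

variable {J : ℝ → ℝ} {q α μ : ℝ} {u : ℝ → ℝ → ℝ} {R n m c t : ℝ} {B : Set ℝ}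

namespace Cfg

lemma gap (g : Cfg J q α μ u R n m c t B) (i : gaps B) : Gap J q α μ u R n m i.1.1 i.1.2 := by
  have h1 := g.sub i.2.1
  have h2 := g.sub i.2.2.1
  have ab := i.2.2.2.1
  have hb := g.bn _ i.2.1 (ab.trans_le h2.2)
  have hI : ∀ s ∈ Ioo i.1.1 i.1.2, s ∈ Icc c t := fun s hs => ⟨h1.1.trans hs.1.le, hs.2.le.trans h2.2⟩
  exact ⟨g.c0.trans_le h1.1, ab, by linarith [h1.1, h2.2, g.len], fun s hs => g.nm s (hI s hs),
    g.nm _ h1, fun s hs => g.good s (hI s hs) (i.2.2.2.2 s hs), fun x hx => (hb x hx).1,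
    fun x hx => (hb x hx).2.1, fun x hx => (hb x hx).2.2⟩

lemma sq_row {n r : ℝ} {v : ℝ → ℝ} (hr : 0 ≤ r) (hv : Continuous v) (h : ∀ x, |x| ≤ r → |v x| ≤ n) :
    ∫ x in Icc (-r) r, v x ^ 2 ≤ 2 * r * n ^ 2 := by
  have : ∫ x in Icc (-r) r, v x ^ 2 ≤ ∫ x in Icc (-r) r, n ^ 2 := by
    refine setIntegral_mono_on (Sol.il (hv.pow 2)) (integrableOn_const (by simp)) measurableSet_Icc
      fun x hx => ?_
    exact sq_le_sq' (by linarith [(abs_le.1 (h x (abs_le.2 hx))).1]) (abs_le.1 (h x (abs_le.2 hx))).2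
  refine this.trans (le_of_eq ?_)
  simp only [integral_const, measureReal_restrict_apply_univ, smul_eq_mul,
    Real.volume_real_Icc_of_le (show -r ≤ r by linarith)]
  ring

lemma c1 (g : Cfg J q α μ u R n m c t B) (h : Sol J q α μ u) {r : ℝ} (hr : 0 < r) (hrR : r < R)
    (hn : 0 ≤ n) (hm : 0 < m) :
    ∃ C, ∀ s ∈ Icc c t, ∫ x in Icc (-r) r, u s x ^ 2 ≤ C := by
  obtain ⟨K, hK, hG⟩ := Gap.main (R := R) (r := r) (n := n) (m := m) h hr hrR hn hm
  refine ⟨K + 2 * r * n ^ 2 + ∫ x in Icc (-r) r, u t x ^ 2, fun s hs => ?_⟩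
  have p1 : 0 ≤ 2 * r * n ^ 2 := by positivity
  have p2 : 0 ≤ ∫ x in Icc (-r) r, u t x ^ 2 := integral_nonneg fun x => sq_nonneg _
  rcases eq_or_lt_of_le hs.2 with e | e
  · rw [e]; linarith
  by_cases hB : s ∈ B
  · have := sq_row hr.le (h.cu s) fun x hx => (g.bn s hB e x (hx.trans hrR.le)).1
    linarith
  · obtain ⟨i, hi⟩ := gaps_cover g.cl g.cB g.tB hs hB
    have := (hG _ _ (g.gap i)).1 s hi
    linarith

lemma c2 (g : Cfg J q α μ u R n m c t B) (h : Sol J q α μ u) {r : ℝ} (hr : 0 < r) (hrR : r < R)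
    (hn : 0 ≤ n) (hm : 0 < m) :
    IntegrableOn (fun s => ∫ x in Icc (-r) r, deriv (u s) x ^ 2) (Icc c t) := by
  obtain ⟨K, hK, hG⟩ := Gap.main (R := R) (r := r) (n := n) (m := m) h hr hrR hn hm
  have hfin : volume B ≠ ⊤ := ne_top_of_le_ne_top (by simp) (measure_mono g.sub)
  have nn : ∀ s, 0 ≤ ∫ x in Icc (-r) r, deriv (u s) x ^ 2 := fun s => integral_nonneg fun x => sq_nonneg _
  refine gaps_integrable g.cl g.cB g.tB g.sub nn ?_
    (fun i => (hG _ _ (g.gap i)).2.2.1) (fun i => (hG _ _ (g.gap i)).2.2.2)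
  refine Integrable.mono' (integrableOn_const (C := 2 * r * n ^ 2) hfin) (h.D_meas r).aestronglyMeasurable ?_
  have : ∀ᵐ s ∂(volume.restrict B), s ≠ t := ae_restrict_of_ae (by simp [ae_iff])
  filter_upwards [ae_restrict_mem g.cl.measurableSet, this] with s hs hst
  rw [Real.norm_of_nonneg (nn s)]
  exact sq_row hr.le ((h.uc1 s).continuous_deriv (by simp)) fun x hx =>
    (g.bn s hs (lt_of_le_of_ne (g.sub hs).2 hst) x (hx.trans hrR.le)).2.1

end Cfg

/-- the time derivative, from the equation -/
noncomputable def udt (J : ℝ → ℝ) (q α μ : ℝ) (u : ℝ → ℝ → ℝ) (t x : ℝ) : ℝ := Sv J q α μ u (u t) t x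

lemma Sol.ut_hasDeriv (h : Sol J q α μ u) {t : ℝ} (ht : 0 < t) (x : ℝ) :
    HasDerivAt (fun s => u s x) (udt J q α μ u t x) t := by
  have h1 := ((h.ut x).differentiableOn (by simp)).differentiableAt (Ioi_mem_nhds ht)
  have h2 := h1.hasDerivAt
  have h3 := h.pde t ht x
  refine h2.congr_deriv ?_
  simp only [udt, Sv, cv]; linarith

lemma Sol.ut_cont (h : Sol J q α μ u) (x : ℝ) : ContinuousOn (fun t => udt J q α μ u t x) (Ioi 0) := by
  have h1 := (h.ut x).continuousOn_deriv_of_isOpen isOpen_Ioi (by simp)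
  exact h1.congr fun t ht => ((h.ut_hasDeriv ht x).deriv).symm

lemma Sol.ut_meas (h : Sol J q α μ u) : Measurable (Function.uncurry (udt J q α μ u)) := by
  have m1 := meas_deriv h.um fun t => (h.uc1 t).differentiable (by simp)
  have m2 := meas_deriv m1 fun t => (contDiff_deriv_of_two (h.uc t)).differentiable (by simp)
  have m3 : Measurable fun z : ℝ => |z| ^ (q - 1) := (cont_absrpow h.q1).measurable
  exact ((h.g_meas.sub h.um).const_mul α).add ((m2.const_mul μ).sub ((m3.comp h.um).mul m1))

lemma Sol.ut_row (h : Sol J q α μ u) {r : ℝ} {ψ : ℝ → ℝ} (hψ : Test r ψ) (t : ℝ) :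
    ∫ x, ψ x * udt J q α μ u t x = Lf μ ψ u (Fu q u) (Su J α u) t := by
  rw [← h.Lf_eq (h.uc t) hψ t]
  simp [Lf, dv, Fv, udt]

lemma Sol.ut_ftc (h : Sol J q α μ u) {a b : ℝ} (ha : 0 < a) (hab : a ≤ b) (x : ℝ) :
    IntegrableOn (fun s => udt J q α μ u s x) (Icc a b) ∧
    ∫ s in Icc a b, udt J q α μ u s x = u b x - u a x := by
  have hc : ContinuousOn (fun s => udt J q α μ u s x) (Icc a b) :=
    (h.ut_cont x).mono fun s hs => lt_of_lt_of_le ha hs.1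
  refine ⟨hc.integrableOn_Icc, ?_⟩
  rw [integral_Icc_eq_integral_Ioc, ← intervalIntegral.integral_of_le hab]
  refine intervalIntegral.integral_eq_sub_of_hasDerivAt (f := fun s => u s x) (fun s hs => ?_) ?_
  · rw [uIcc_of_le hab] at hs
    exact h.ut_hasDeriv (lt_of_lt_of_le ha hs.1) x
  · exact hc.intervalIntegrable_of_Icc hab

lemma Sol.ut_locInt (h : Sol J q α μ u) (t r : ℝ) :
    IntegrableOn (udt J q α μ u t) (Icc (-r) r) :=
  (h.Su_int t).integrableOn.add (Sol.il (Sol.cv_cont h.q1 (h.uc t)))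

lemma Sol.ut_le (h : Sol J q α μ u) {r n t : ℝ} (hr : 0 ≤ r) (hn : 0 ≤ n) (hb : Bn r n (u t)) :
    ∫ x in Icc (-r) r, |udt J q α μ u t x| ≤
      2 * α * (∫ x, |u t x|) + 2 * r * (μ * n + n ^ (q - 1) * n) := by
  refine h.Sv_le (h.uc t) t hr fun x hx => ?_
  obtain ⟨h0, h1, h2⟩ := hb x hx
  simp only [cv]
  refine (abs_sub _ _).trans ?_
  rw [abs_mul, abs_mul, abs_of_pos h.μ0, abs_of_nonneg (a := |u t x| ^ (q-1)) (by positivity)]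
  have hq := h.q1; have := h.μ0
  gcongr

lemma Sol.ψ_cont (h : Sol J q α μ u) {r : ℝ} {ψ : ℝ → ℝ} (hψ : Test r ψ) :
    ContinuousOn (fun t => ∫ x, ψ x * u t x) (Ioi 0) := by
  intro t0 ht0
  obtain ⟨C, hC, hb⟩ := hψ.bdd
  refine ContinuousAt.continuousWithinAt (tendsto_iff_dist_tendsto_zero.2 ?_)
  have := (h.ul t0 ht0).const_mul C
  rw [mul_zero] at this
  refine squeeze_zero (fun t => dist_nonneg) (fun t => ?_) this
  rw [Real.dist_eq, ← integral_sub (hψ.integrable_mul_cont (h.cu t)) (hψ.integrable_mul_cont (h.cu t0)),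
    ← integral_const_mul]
  have i2 := ((h.ui t).sub (h.ui t0)).abs
  refine abs_integral_le_integral_abs.trans (integral_mono_of_nonneg (Eventually.of_forall fun x => abs_nonneg _)
    (i2.const_mul C) (Eventually.of_forall fun x => ?_))
  simp only [Pi.sub_apply]
  rw [← mul_sub, abs_mul]
  exact mul_le_mul_of_nonneg_right (hb x) (abs_nonneg _)

lemma Sol.end_le (h : Sol J q α μ u) {r a b K : ℝ} (ha : 0 < a) (hab : a < b)
    (hK : ∀ s ∈ Ioo a b, ∫ x in Icc (-r) r, |u s x - u a x| ≤ K * (s - a)) :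
    ∫ x in Icc (-r) r, |u b x - u a x| ≤ K * (b - a) := by
  have hb : 0 < b := ha.trans hab
  haveI : (𝓝[<] b).NeBot := nhdsLT_neBot b
  have t1 : Tendsto (fun s => (∫ x, |u s x - u b x|) + K * (s - a)) (𝓝[<] b) (𝓝 (0 + K * (b - a))) := by
    refine ((h.ul b hb).mono_left nhdsWithin_le_nhds).add (Tendsto.mono_left ?_ nhdsWithin_le_nhds)
    exact (continuous_const.mul (continuous_id.sub continuous_const)).tendsto b
  rw [zero_add] at t1
  refine ge_of_tendsto t1 ?_
  filter_upwards [Ioo_mem_nhdsLT hab] with s hs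
  have i1 : Integrable fun x => u s x - u b x := (h.ui s).sub (h.ui b)
  have i2 : Integrable fun x => u s x - u a x := (h.ui s).sub (h.ui a)
  have i3 : Integrable fun x => u b x - u a x := (h.ui b).sub (h.ui a)
  calc ∫ x in Icc (-r) r, |u b x - u a x| ≤
      ∫ x in Icc (-r) r, (|u s x - u b x| + |u s x - u a x|) := by
        refine integral_mono i3.abs.integrableOn (i1.abs.add i2.abs).integrableOn fun x => ?_
        simp only
        have := abs_sub (u s x - u a x) (u s x - u b x)
        rw [show u s x - u a x - (u s x - u b x) = u b x - u a x by ring] at this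
        linarith
    _ = (∫ x in Icc (-r) r, |u s x - u b x|) + ∫ x in Icc (-r) r, |u s x - u a x| :=
        integral_add i1.abs.integrableOn i2.abs.integrableOn
    _ ≤ _ := add_le_add (Sol.loc_le i1 _) (hK s hs)

end RegAux

namespace RegAux
open Set Topology
open scoped ContDiff

variable {J : ℝ → ℝ} {q α μ : ℝ} {u : ℝ → ℝ → ℝ} {R n m c t : ℝ} {B : Set ℝ}
namespace Cfg

lemma fub (g : Cfg J q α μ u R n m c t B) (h : Sol J q α μ u) {r : ℝ} (hr : 0 < r) (hrR : r < R)
    (hn : 0 ≤ n) {ψ : ℝ → ℝ} (hψ : Test r ψ) :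
    Integrable (fun x => ψ x * ∫ s in B, udt J q α μ u s x) ∧
    ∫ x, ψ x * ∫ s in B, udt J q α μ u s x =
      ∫ s in B, Lf μ ψ u (Fu q u) (Su J α u) s := by
  obtain ⟨C, hC, hb⟩ := hψ.bdd
  have hfin : volume B ≠ ⊤ := ne_top_of_le_ne_top (by simp) (measure_mono g.sub)
  have hm : Measurable (Function.uncurry fun s x => ψ x * udt J q α μ u s x) :=
    (hψ.cont.measurable.comp measurable_snd).mul h.ut_meas
  have il : ∀ s, IntegrableOn (fun x => |udt J q α μ u s x|) (Icc (-r) r) := fun s => (h.ut_locInt s r).abs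
  have li : ∀ s, LocallyIntegrable (udt J q α μ u s) := fun s =>
    (h.Su_int s).locallyIntegrable.add (Sol.cv_cont h.q1 (h.uc s)).locallyIntegrable
  have hi : Integrable (Function.uncurry fun s x => ψ x * udt J q α μ u s x)
      ((volume.restrict B).prod volume) := by
    rw [integrable_prod_iff hm.aestronglyMeasurable]
    refine ⟨Eventually.of_forall fun s => hψ.integrable_mul (li s), ?_⟩
    refine Integrable.mono' (integrableOn_const (C := C * (2 * α * m + 2 * r * (μ * n + n ^ (q - 1) * n))) hfin)
      (hm.norm.stronglyMeasurable.integral_prod_right (f := fun s x => ‖ψ x * udt J q α μ u s x‖)).aestronglyMeasurable ?_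
    have : ∀ᵐ s ∂(volume.restrict B), s ≠ t := ae_restrict_of_ae (by simp [ae_iff])
    filter_upwards [ae_restrict_mem g.cl.measurableSet, this] with s hs hst
    rw [Real.norm_of_nonneg (integral_nonneg fun x => norm_nonneg _)]
    have hbn : Bn r n (u s) := fun x hx =>
      g.bn s hs (lt_of_le_of_ne (g.sub hs).2 hst) x (hx.trans hrR.le)
    have h1 := h.ut_le hr.le hn hbn
    have h2 := abs_integral_mul_le (η := fun x => |ψ x|) (G := fun x => |udt J q α μ u s x|) (r := r) (C := C)
      (fun x hx => by simp [hψ.2 x hx]) (fun x => by rw [abs_abs]; exact hb x) (il s)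
    have h3 := g.nm s (g.sub hs)
    have e : ∀ x, ‖ψ x * udt J q α μ u s x‖ = |ψ x| * |udt J q α μ u s x| := fun x => by
      rw [Real.norm_eq_abs, abs_mul]
    simp only [Function.uncurry, e]
    refine ((le_abs_self _).trans h2).trans ?_
    simp only [abs_abs]
    have := h.α0
    gcongr
    refine h1.trans ?_
    gcongr
  have e2 := integral_integral_swap hi
  have e3 : ∀ x, ∫ s in B, ψ x * udt J q α μ u s x = ψ x * ∫ s in B, udt J q α μ u s x :=
    fun x => integral_const_mul _ _
  constructor
  · have := hi.integral_prod_right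
    simpa only [Function.uncurry, e3] using this
  · simp only [e3] at e2
    rw [← e2]
    exact integral_congr_ae (Eventually.of_forall fun s => h.ut_row hψ s)

set_option maxHeartbeats 1000000 in
lemma ident (g : Cfg J q α μ u R n m c t B) (h : Sol J q α μ u) {r : ℝ} (hr : 0 < r) (hrR : r < R)
    (hn : 0 ≤ n) (hm : 0 < m) {ψ : ℝ → ℝ} (hψ : Test r ψ) :
    (∫ x, ψ x * u t x) - (∫ x, ψ x * u c x) = ∫ s in Icc c t, Lf μ ψ u (Fu q u) (Su J α u) s := by
  haveI := gaps_cnt B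
  obtain ⟨K, hK, hG⟩ := Gap.main (R := R) (r := r) (n := n) (m := m) h hr hrR hn hm
  obtain ⟨C, hC, hb⟩ := hψ.bdd
  obtain ⟨C1, hC1⟩ := g.c1 h hr hrR hn hm
  have hpos : Icc c t ⊆ Ioi 0 := fun s hs => lt_of_lt_of_le g.c0 hs.1
  have Lc := h.L_cont hpos hC1 hψ
  have Li : IntegrableOn (Lf μ ψ u (Fu q u) (Su J α u)) (Icc c t) := Lc.integrableOn_Icc
  obtain ⟨f1, f2⟩ := g.fub h hr hrR hn hψ
  let F : gaps B → ℝ → ℝ := fun i x => ψ x * (u i.1.2 x - u i.1.1 x)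
  have hFi : ∀ i, Integrable (F i) := fun i => hψ.integrable_mul_cont ((h.cu _).sub (h.cu _))
  have hFs : Summable fun i => ∫ x, ‖F i x‖ := by
    refine Summable.of_nonneg_of_le (fun i => integral_nonneg fun x => norm_nonneg _)
      (fun i => ?_) (((gaps_len g.cl g.cB g.tB g.sub).mul_left K).mul_left C)
    have h1 := h.end_le (g.gap i).a0 (g.gap i).ab (hG _ _ (g.gap i)).2.1
    have h2 := abs_integral_mul_le (η := fun x => |ψ x|) (G := fun x => |u i.1.2 x - u i.1.1 x|)
      (r := r) (C := C)
      (fun x hx => by simp [hψ.2 x hx]) (fun x => by rw [abs_abs]; exact hb x)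
      (Sol.il ((h.cu _).sub (h.cu _)).abs)
    have e : ∀ x, ‖F i x‖ = |ψ x| * |u i.1.2 x - u i.1.1 x| := fun x => by
      rw [Real.norm_eq_abs, abs_mul]
    simp only [e]
    refine ((le_abs_self _).trans h2).trans ?_
    simp only [abs_abs]
    gcongr
  have hs1 := hasSum_integral_of_summable_integral_norm hFi hFs
  have hFL : ∀ i, ∫ x, F i x = ∫ s in gi i, Lf μ ψ u (Fu q u) (Su J α u) s := by
    intro i
    have hg := g.gap i
    have hsub : Icc i.1.1 i.1.2 ⊆ Icc c t := Icc_subset_Icc (g.sub i.2.1).1 (g.sub i.2.2.1).2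
    have e := intervalIntegral.integral_eq_sub_of_hasDerivAt_of_le hg.ab.le
      ((h.ψ_cont hψ).mono (hsub.trans hpos)) (f' := Lf μ ψ u (Fu q u) (Su J α u)) (fun s hs => by
        obtain ⟨U, hU, hgp⟩ := hg.good s hs
        exact (hgp r hr hrR).w ψ hψ s (mem_of_mem_nhds hU))
      ((Lc.mono hsub).intervalIntegrable_of_Icc hg.ab.le)
    rw [intervalIntegral.integral_of_le hg.ab.le, integral_Ioc_eq_integral_Ioo] at e
    rw [gi, e, ← integral_sub (hψ.integrable_mul_cont (h.cu _)) (hψ.integrable_mul_cont (h.cu _))]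
    simp only [F, mul_sub]
  simp only [hFL] at hs1
  have hs2 := gaps_hasSum g.cl g.cB g.tB g.sub Li
  have e1 := hs1.unique hs2
  have hp : ∀ x, u t x - u c x - ∫ s in B, udt J q α μ u s x = ∑' i : gaps B, (u i.1.2 x - u i.1.1 x) := by
    intro x
    obtain ⟨j1, j2⟩ := h.ut_ftc g.c0 g.ct.le x
    have hs3 := gaps_hasSum g.cl g.cB g.tB g.sub j1
    rw [j2] at hs3
    rw [← hs3.tsum_eq]
    refine tsum_congr fun i => ?_
    rw [gi, ← (h.ut_ftc (g.gap i).a0 (g.gap i).ab.le x).2, integral_Icc_eq_integral_Ioo]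
  have e2 : ∀ x, ∑' i, F i x = ψ x * u t x - ψ x * u c x - ψ x * ∫ s in B, udt J q α μ u s x := by
    intro x
    simp only [F]
    rw [tsum_mul_left, ← hp x]; ring
  simp only [e2] at e1
  have i1 := hψ.integrable_mul_cont (h.cu t)
  have i2 := hψ.integrable_mul_cont (h.cu c)
  have i3 : Integrable fun x => ψ x * u t x - ψ x * u c x := i1.sub i2
  rw [integral_sub i3 f1, integral_sub i1 i2, f2] at e1
  linarith
end Cfg

theorem Sol.good_all (h : Sol J q α μ u) {R : ℝ} (hR : 0 < R) :
    ∀ t, 0 < t → Good J q α μ u R t := by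
  by_contra hcon
  push Not at hcon
  obtain ⟨τ, τ0, hτ⟩ := hcon
  have ho : IsOpen {t | Good J q α μ u R t} := by
    rw [isOpen_iff_mem_nhds]
    rintro t ⟨U, hU, hg⟩
    rw [← eventually_mem_nhds_iff] at hU
    filter_upwards [hU] with s hs
    exact ⟨U, hs, hg⟩
  let S : Set ℝ := Ioi 0 ∩ {t | Good J q α μ u R t}ᶜ
  have hSl : IsLocallyClosed S := isOpen_Ioi.isLocallyClosed.inter ho.isClosed_compl.isLocallyClosed
  obtain ⟨n, hn, t0, ht0, l, ρ, l0, lt, tr, hlr, hb⟩ := h.baire R hSl ⟨τ, τ0, hτ⟩ inter_subset_left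
  obtain ⟨c, hc1, hc2⟩ := exists_between lt
  obtain ⟨e, he1, he2⟩ := exists_between tr
  have c0 : 0 < c := l0.trans hc1
  obtain ⟨n', hn'⟩ := exists_Bn (h.uc c) R
  obtain ⟨m, hm, hmb⟩ := h.norm_bdd (t2 := e) c0
  have cfg : ∀ t, c < t → t ≤ e → Cfg J q α μ u R (n + n') m c t
      (({t | Good J q α μ u R t}ᶜ ∩ Icc c t) ∪ {c, t}) := by
    intro t ht hte
    refine ⟨c0, ht, by linarith, ?_, Or.inr (by simp), Or.inr (by simp), ?_, ?_, ?_, ?_⟩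
    · exact (ho.isClosed_compl.inter isClosed_Icc).union (Set.Finite.isClosed (by simp))
    · rintro s (hs | hs | hs)
      · exact hs.2
      · rw [hs]; exact ⟨le_rfl, ht.le⟩
      · rw [mem_singleton_iff] at hs; rw [hs]; exact ⟨ht.le, le_rfl⟩
    · rintro s (hs | hs | hs) hst
      · refine (hb s ⟨⟨lt_of_lt_of_le c0 hs.2.1, hs.1⟩, hc1.trans_le hs.2.1, by linarith [hs.2.2]⟩).mono ?_
        have : (0:ℝ) ≤ n' := Nat.cast_nonneg _
        linarith
      · rw [hs]; exact hn'.mono (by linarith)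
      · rw [mem_singleton_iff] at hs; linarith
    · intro s hs hsB
      by_contra hc
      exact hsB (Or.inl ⟨hc, hs⟩)
    · intro s hs
      exact hmb s ⟨hs.1, hs.2.trans hte⟩
  have hnn : 0 ≤ n + n' := by positivity
  refine ht0.2 ⟨Ioo c e, Ioo_mem_nhds hc2 he1, fun r hr hrR => ?_⟩
  have ce : c < e := hc2.trans he1
  obtain ⟨C, hC⟩ := (cfg e ce le_rfl).c1 h hr hrR hnn hm
  have hpos : Icc c e ⊆ Ioi 0 := fun s hs => lt_of_lt_of_le c0 hs.1
  refine ⟨⟨C, fun t ht => hC t (Ioo_subset_Icc_self ht)⟩,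
    ((cfg e ce le_rfl).c2 h hr hrR hnn hm).mono_set Ioo_subset_Icc_self, fun ψ hψ t ht => ?_⟩
  have Lc := h.L_cont hpos hC hψ
  have hd : HasDerivAt (fun s => ∫ z in c..s, Lf μ ψ u (Fu q u) (Su J α u) z)
      (Lf μ ψ u (Fu q u) (Su J α u) t) t := by
    refine intervalIntegral.integral_hasDerivAt_right ?_ ?_ ?_
    · exact (Lc.mono (Icc_subset_Icc_right ht.2.le)).intervalIntegrable_of_Icc ht.1.le
    · exact (Lc.mono Ioo_subset_Icc_self).stronglyMeasurableAtFilter isOpen_Ioo _ ht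
    · exact (Lc.mono Ioo_subset_Icc_self).continuousAt (Ioo_mem_nhds ht.1 ht.2)
  have hd2 := hd.const_add (∫ x, ψ x * u c x)
  refine hd2.congr_of_eventuallyEq ?_
  filter_upwards [Ioo_mem_nhds ht.1 ht.2] with s hs
  have := (cfg s hs.1 hs.2.le).ident h hr hrR hnn hm hψ
  rw [intervalIntegral.integral_of_le hs.1.le, ← integral_Icc_eq_integral_Ioc, ← this]
  ring

/-- the conclusion: local goodness on all compact time intervals -/
theorem Sol.gp (h : Sol J q α μ u) {r t1 t2 : ℝ} (hr : 0 < r) (h1 : 0 < t1) :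
    GP J q α μ u r (Icc t1 t2) :=
  GP.compact hr (lt_add_one r) fun t ht => h.good_all (by linarith) t (lt_of_lt_of_le h1 ht.1)
end RegAux

namespace RegAux
open Set Topology
open scoped ContDiff

lemma cs {X : Type*} [MeasurableSpace X] {ν : Measure X} {f g : X → ℝ}
    (hf : Integrable (fun x => f x ^ 2) ν) (hg : Integrable (fun x => g x ^ 2) ν)
    (hfg : Integrable (fun x => f x * g x) ν) :
    (∫ x, f x * g x ∂ν) ^ 2 ≤ (∫ x, f x ^ 2 ∂ν) * ∫ x, g x ^ 2 ∂ν := by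
  have h := discrim_le_zero (a := ∫ x, g x ^ 2 ∂ν) (b := 2 * ∫ x, f x * g x ∂ν) (c := ∫ x, f x ^ 2 ∂ν)
    (fun s => by
      have i1 : Integrable (fun x => s ^ 2 * g x ^ 2) ν := hg.const_mul _
      have i2 : Integrable (fun x => 2 * s * (f x * g x)) ν := hfg.const_mul _
      have i3 : Integrable (fun x => s ^ 2 * g x ^ 2 + 2 * s * (f x * g x)) ν := i1.add i2
      have e : ∫ x, (s * g x + f x) ^ 2 ∂ν = s ^ 2 * (∫ x, g x ^ 2 ∂ν) + 2 * s * (∫ x, f x * g x ∂ν)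
          + ∫ x, f x ^ 2 ∂ν := by
        rw [← integral_const_mul, ← integral_const_mul, ← integral_add i1 i2, ← integral_add i3 hf]
        congr 1; ext x; ring
      have : 0 ≤ ∫ x, (s * g x + f x) ^ 2 ∂ν := integral_nonneg fun x => sq_nonneg _
      rw [e] at this
      linarith)
  unfold discrim at h
  nlinarith

lemma sup_sq2 {r : ℝ} (hr : 0 < r) {w : ℝ → ℝ} (hw : ContDiff ℝ 1 w) {x : ℝ} (hx : x ∈ Icc (-r) r) :
    w x ^ 2 ≤ 1 / (2 * r) * (∫ y in Icc (-r) r, w y ^ 2) + 2 * ∫ y in Icc (-r) r, |w y| * |deriv w y| := by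
  have cw := hw.continuous
  have cw' : Continuous (deriv w) := hw.continuous_deriv (by simp)
  set I := ∫ y in Icc (-r) r, |w y| * |deriv w y| with hI
  have ii : IntegrableOn (fun y => |w y| * |deriv w y|) (Icc (-r) r) := Sol.il (cw.abs.mul cw'.abs)
  have key : ∀ y ∈ Icc (-r) r, w x ^ 2 - 2 * I ≤ w y ^ 2 := by
    intro y hy
    have hd : ∀ z, HasDerivAt (fun z => w z ^ 2) (2 * w z * deriv w z) z := fun z => by
      have h1 := ((hw.differentiable (by simp) z).hasDerivAt).pow 2
      refine HasDerivAt.congr_deriv (f := fun z => w z ^ 2) h1 ?_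
      simp
    have e := intervalIntegral.integral_eq_sub_of_hasDerivAt (a := y) (b := x) (f := fun z => w z ^ 2)
      (fun z _ => hd z) ((continuous_const.mul cw).mul cw').continuousOn.intervalIntegrable
    have h2 : ‖∫ z in y..x, 2 * w z * deriv w z‖ ≤ ∫ z in uIoc y x, ‖2 * w z * deriv w z‖ :=
      intervalIntegral.norm_integral_le_integral_norm_uIoc
    have h3 : ∫ z in uIoc y x, ‖2 * w z * deriv w z‖ ≤ 2 * I := by
      rw [hI, ← integral_const_mul]
      have : ∀ z, ‖2 * w z * deriv w z‖ = 2 * (|w z| * |deriv w z|) := fun z => by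
        rw [Real.norm_eq_abs, abs_mul, abs_mul, abs_two]; ring
      simp only [this]
      refine setIntegral_mono_set (ii.const_mul 2) (Eventually.of_forall fun z => by positivity)
        (HasSubset.Subset.eventuallyLE ?_)
      exact uIoc_subset_uIcc.trans (uIcc_subset_Icc hy hx)
    rw [e, Real.norm_eq_abs] at h2
    linarith [le_abs_self (w x ^ 2 - w y ^ 2)]
  have h4 : ∫ y in Icc (-r) r, (w x ^ 2 - 2 * I) ≤ ∫ y in Icc (-r) r, w y ^ 2 :=
    setIntegral_mono_on (integrableOn_const (by simp)) (Sol.il (cw.pow 2)) measurableSet_Icc key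
  simp only [integral_const, measureReal_restrict_apply_univ, smul_eq_mul,
    Real.volume_real_Icc_of_le (show -r ≤ r by linarith)] at h4
  have h5 : w x ^ 2 - 2 * I ≤ 1 / (2 * r) * ∫ y in Icc (-r) r, w y ^ 2 := by
    rw [one_div, ← div_eq_inv_mul, le_div_iff₀ (by linarith)]; linarith
  linarith

lemma exists_cuts : ∃ c : ℝ, 1 ≤ c ∧ ∃ X : ℝ → ℝ → ℝ, ∀ R, 1 ≤ R → Cut (2 * R) c (X R) ∧
    (∀ x ∈ Icc (-R) R, X R x = 1) ∧ (∀ x, |deriv (X R) x| ≤ c / R) ∧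
    (∀ x, |deriv (deriv (X R)) x| ≤ c / R) := by
  obtain ⟨χ, c, hc, hχ, h1, -⟩ := exists_cut (r := 1) (r' := 2) one_pos one_lt_two
  refine ⟨c, hc, fun R x => χ (x * R⁻¹), fun R hR => ?_⟩
  have R0 : 0 < R := by linarith
  have Ri : R⁻¹ ≤ 1 := inv_le_one_of_one_le₀ hR
  have Ri0 : 0 < R⁻¹ := inv_pos.2 R0
  have e1 : deriv (fun x => χ (x * R⁻¹)) = fun x => deriv χ (x * R⁻¹) * R⁻¹ := by
    ext x
    have := (hχ.t.diff (x * R⁻¹)).hasDerivAt.comp x ((hasDerivAt_id x).mul_const R⁻¹)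
    simpa [Function.comp_def] using this.deriv
  have e2 : deriv (deriv (fun x => χ (x * R⁻¹))) = fun x => deriv (deriv χ) (x * R⁻¹) * R⁻¹ * R⁻¹ := by
    ext x
    rw [e1]
    have := ((hχ.t.der.diff (x * R⁻¹)).hasDerivAt.comp x ((hasDerivAt_id x).mul_const R⁻¹)).mul_const R⁻¹
    simpa [Function.comp_def] using this.deriv
  have b1 : ∀ x, |deriv (fun x => χ (x * R⁻¹)) x| ≤ c / R := fun x => by
    rw [e1]; simp only [abs_mul, abs_of_pos Ri0]; rw [div_eq_mul_inv]
    exact mul_le_mul_of_nonneg_right (hχ.b1 _) Ri0.le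
  have b2 : ∀ x, |deriv (deriv (fun x => χ (x * R⁻¹))) x| ≤ c / R := fun x => by
    rw [e2]; simp only [abs_mul, abs_of_pos Ri0]; rw [div_eq_mul_inv, mul_assoc]
    have := hχ.b2 (x * R⁻¹)
    refine mul_le_mul this ?_ (by positivity) (by linarith)
    nlinarith
  have cR : c / R ≤ c := div_le_self (by linarith) hR
  refine ⟨⟨⟨hχ.t.1.comp (contDiff_id.mul contDiff_const), fun x hx => hχ.t.2 _ ?_⟩, fun x => hχ.n _, fun x => hχ.l _,
    fun x => (b1 x).trans cR, fun x => (b2 x).trans cR⟩, fun x hx => h1 _ ?_, b1, b2⟩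
  · rw [abs_mul, abs_of_pos Ri0, ← div_eq_mul_inv, lt_div_iff₀ R0]; exact hx
  · rw [← div_eq_mul_inv]
    exact ⟨by rw [le_div_iff₀ R0]; linarith [hx.1], by rw [div_le_iff₀ R0]; linarith [hx.2]⟩

variable {J : ℝ → ℝ} {q α μ : ℝ} {u : ℝ → ℝ → ℝ}

lemma Sol.el0 (h : Sol J q α μ u) {r t1 t2 : ℝ} (h1 : 0 < t1) (h12 : t1 ≤ t2) (hr : 0 < r) :
    ∃ b, EL μ r t1 t2 u (Fu q u) (Su J α u) b := by
  obtain ⟨b, hb⟩ := h.el (v := fun _ => 0) contDiff_const (h.gp (t2 := t2) hr h1) subset_rfl h1 h12 hr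
  have e1 : dv u (fun _ => 0) = u := by ext t x; simp [dv]
  have e2 : Fv q u (fun _ => 0) = Fu q u := by ext t x; simp [Fv, Fu, fq_zero]
  have e3 : Sv J q α μ u (fun _ => 0) = Su J α u := by
    ext t x; simp [Sv, Su, cv]
  rw [e1, e2, e3] at hb
  exact ⟨b, hb⟩

lemma Sol.loc0 (h : Sol J q α μ u) {t1 t2 m : ℝ} (hm : ∀ t ∈ Icc t1 t2, ∫ x, |u t x| ≤ m) (r : ℝ) :
    Loc r t1 t2 q m (2 * α * m) 1 u (Fu q u) (Su J α u) := by
  have := h.α0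
  refine ⟨fun t ht => (Sol.loc_le (h.ui t) _).trans (hm t ht), fun t ht => ?_, fun t ht x _ => ?_⟩
  · refine (Sol.loc_le (h.Su_int t) _).trans ((h.Su_le t).trans ?_)
    have := hm t ht
    gcongr
  · rw [one_mul]
    exact (fq_abs_le h.q1 _).trans (by linarith [abs_nonneg (u t x)])

/-- L² contraction of the convolution. -/
lemma Sol.g_sq (h : Sol J q α μ u) (t : ℝ) (h2 : Integrable fun x => u t x ^ 2) :
    Integrable (fun x => gg J u t x ^ 2) ∧ ∫ x, gg J u t x ^ 2 ≤ ∫ x, u t x ^ 2 := by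
  obtain ⟨c1, c2⟩ := conv_aux h.J0 h.Ji h.J1 h2
  have a1 := (h.ui t).ae_convolution_exists (ContinuousLinearMap.mul ℝ ℝ) h.Ji
  have a2 := h2.ae_convolution_exists (ContinuousLinearMap.mul ℝ ℝ) h.Ji
  have key : ∀ᵐ x, gg J u t x ^ 2 ≤ ∫ y, J (x - y) * u t y ^ 2 := by
    filter_upwards [a1, a2] with x hx1 hx2
    have b1 : Integrable (fun y => J (x - y) * u t y) := by
      refine Integrable.congr (ConvolutionExistsAt.integrable hx1) (Eventually.of_forall fun y => ?_)
      simp [mul_comm]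
    have b2 : Integrable (fun y => J (x - y) * u t y ^ 2) := by
      refine Integrable.congr (ConvolutionExistsAt.integrable hx2) (Eventually.of_forall fun y => ?_)
      simp [mul_comm]
    have b3 : Integrable (fun y => J (x - y)) := h.Ji.comp_sub_left x
    have e3 : ∫ y, J (x - y) = 1 := by rw [integral_sub_left_eq_self (f := J)]; exact h.J1
    set G := gg J u t x with hG
    have hG' : ∫ y, J (x - y) * u t y = G := rfl
    have n : 0 ≤ ∫ y, J (x - y) * (u t y - G) ^ 2 :=
      integral_nonneg fun y => mul_nonneg (h.J0 _) (sq_nonneg _)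
    have j1 : Integrable (fun y => 2 * G * (J (x - y) * u t y)) := b1.const_mul _
    have j2 : Integrable (fun y => G ^ 2 * J (x - y)) := b3.const_mul _
    have j3 : Integrable (fun y => J (x - y) * u t y ^ 2 - 2 * G * (J (x - y) * u t y)) := b2.sub j1
    have e : ∫ y, J (x - y) * (u t y - G) ^ 2 = (∫ y, J (x - y) * u t y ^ 2) - 2 * G * G + G ^ 2 * 1 := by
      rw [← e3, ← integral_const_mul]
      nth_rewrite 3 [← hG']
      rw [← integral_const_mul, ← integral_sub b2 j1, ← integral_add j3 j2]
      congr 1; ext y; ring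
    rw [e] at n
    nlinarith
  have i1 : Integrable (fun x => gg J u t x ^ 2) := by
    refine c1.mono' ((h.g_int t).aestronglyMeasurable.pow 2) ?_
    filter_upwards [key] with x hx
    rw [Real.norm_of_nonneg (sq_nonneg _)]; exact hx
  refine ⟨i1, (integral_mono_ae i1 c1 key).trans ?_⟩
  refine ((integral_mono c1 c1.abs fun x => le_abs_self _)).trans (c2.trans (le_of_eq ?_))
  congr 1; ext x; exact abs_of_nonneg (sq_nonneg _)

/-- first global estimate -/
lemma Sol.B1 (h : Sol J q α μ u) {t1 t2 : ℝ} (h1 : 0 < t1) :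
    ∃ C, 0 ≤ C ∧ (∀ t ∈ Icc t1 t2, Integrable (fun x => u t x ^ 2) ∧ ∫ x, u t x ^ 2 ≤ C) ∧
      ∀ R, ∫ t in Icc t1 t2, (∫ x in Icc (-R) R, deriv (u t) x ^ 2) ≤ C := by
  obtain ⟨c, hc, X, hX⟩ := exists_cuts
  set δ := min (t1 / 2) 1 with hδ
  have δ0 : 0 < δ := by positivity
  have δ1 : δ ≤ 1 := min_le_right _ _
  have δt : δ ≤ t1 / 2 := min_le_left _ _
  obtain ⟨m, hm0, hm⟩ := h.norm_bdd (t1 := t1 - δ) (t2 := t2) (by linarith)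
  have hα := h.α0
  obtain ⟨K, hK, sl⟩ := SL (μ := μ) (q := q) (c := c) (mb := m) (M1 := 2 * α * m) (C0 := 1) h.μ0 h.q1 h.q2
    hm0 (by positivity) zero_le_one (by linarith)
  obtain ⟨K1, hK1, sl1⟩ := SL1 (μ := μ) (q := q) (c := c) (mb := m) (M1 := 2 * α * m) (C0 := 1) h.μ0 h.q1 h.q2
    hm0 (by positivity) zero_le_one (by linarith)
  set C1 := K * (δ + m ^ 2 / √δ) with hC1
  have hC10 : 0 ≤ C1 := by positivity
  have s1 : ∀ t ∈ Icc t1 t2, ∀ R, 1 ≤ R → ∫ x, X R x ^ 3 * u t x ^ 2 ≤ C1 := by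
    intro t ht R hR
    obtain ⟨b, hb⟩ := h.el0 (r := 2 * R + 1) (t1 := t - δ) (t2 := t) (by linarith [ht.1]) (by linarith) (by linarith)
    have := sl (2 * R) (2 * R + 1) (t - δ) t m (X R) u (Fu q u) (Su J α u) b (hX R hR).1 hb
      (h.loc0 (fun s hs => hm s ⟨by linarith [ht.1, hs.1], hs.2.trans ht.2⟩) _) (by linarith) (by linarith)
      (by linarith) (by linarith) hm0 le_rfl
    rwa [show t - (t - δ) = δ by ring] at this
  have ci : ∀ R, 1 ≤ R → ∀ k : ℝ → ℝ, Continuous k → (∀ x, 0 ≤ k x) →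
      ∫ x in Icc (-R) R, k x ≤ ∫ x, X R x ^ 3 * k x := by
    intro R hR k hk hk0
    exact cut_le (fun x hx => by rw [(hX R hR).2.1 x hx]; norm_num) (fun x => pow_nonneg ((hX R hR).1.n x) 3)
      hk0 ((cube_test (hX R hR).1.t).integrable_mul_cont hk)
  have s2 : ∀ t ∈ Icc t1 t2, Integrable (fun x => u t x ^ 2) ∧ ∫ x, u t x ^ 2 ≤ C1 := by
    intro t ht
    have hk : Continuous fun x => u t x ^ 2 := (h.cu t).pow 2
    have hle : ∀ k : ℕ, ∫ x in Icc (-((k:ℝ)+1)) ((k:ℝ)+1), u t x ^ 2 ≤ C1 := fun k =>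
      (ci _ (by linarith [(Nat.cast_nonneg k : (0:ℝ) ≤ k)]) _ hk fun x => sq_nonneg _).trans
        (s1 t ht _ (by linarith [(Nat.cast_nonneg k : (0:ℝ) ≤ k)]))
    have hn : Tendsto (fun k : ℕ => ((k:ℝ)+1)) atTop atTop :=
      tendsto_atTop_add_const_right _ _ tendsto_natCast_atTop_atTop
    have cov : AECover volume atTop (fun k : ℕ => Icc (-((k:ℝ)+1)) ((k:ℝ)+1)) :=
      aecover_Icc (tendsto_neg_atTop_atBot.comp hn) hn
    have i1 : Integrable (fun x => u t x ^ 2) :=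
      cov.integrable_of_integral_bounded_of_nonneg_ae C1 (fun k => Sol.il hk)
        (Eventually.of_forall fun x => sq_nonneg _) (Eventually.of_forall hle)
    exact ⟨i1, le_of_tendsto' (cov.integral_tendsto_of_countably_generated i1) hle⟩
  refine ⟨(C1 + 2 / μ * (C1 + K1 * (t2 - t1))) ⊔ 0, le_sup_right, fun t ht => ⟨(s2 t ht).1, ?_⟩, ?_⟩
  · have := ht.1.trans ht.2
    have hμ := h.μ0
    have : 0 ≤ 2 / μ * (C1 + K1 * (t2 - t1)) :=
      mul_nonneg (by positivity) (add_nonneg hC10 (mul_nonneg hK1 (by linarith)))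
    exact (s2 t ht).2.trans ((by linarith : C1 ≤ _).trans le_sup_left)
  · intro R
    rcases lt_or_ge t2 t1 with h12 | h12
    · rw [Icc_eq_empty (not_le.2 h12)]; simp
    set R' := max R 1 with hR'
    have R1 : 1 ≤ R' := le_max_right _ _
    obtain ⟨b, hb⟩ := h.el0 (r := 2 * R' + 1) (t1 := t1) (t2 := t2) h1 h12 (by linarith)
    obtain ⟨j1, j2⟩ := sl1 (2 * R') (2 * R' + 1) t1 t2 (X R') u (Fu q u) (Su J α u) b (hX R' R1).1 hb
      (h.loc0 (fun s hs => hm s ⟨by linarith [hs.1], hs.2⟩) _) (by linarith) (by linarith)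
    have k1 := s1 t1 ⟨le_rfl, h12⟩ R' R1
    have k2 : 0 ≤ ∫ x, X R' x ^ 3 * u t2 x ^ 2 := integral_nonneg fun x =>
      mul_nonneg (pow_nonneg ((hX R' R1).1.n x) 3) (sq_nonneg _)
    have k3 : ∫ t in Icc t1 t2, (∫ x in Icc (-R) R, deriv (u t) x ^ 2) ≤
        ∫ t in Icc t1 t2, ∫ x, X R' x ^ 3 * deriv (u t) x ^ 2 := by
      refine integral_mono_of_nonneg (Eventually.of_forall fun t => integral_nonneg fun x => sq_nonneg _) j1
        (Eventually.of_forall fun t => ?_)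
      have cd : Continuous (deriv (u t)) := (h.uc1 t).continuous_deriv (by simp)
      refine le_trans ?_ (ci R' R1 _ (cd.pow 2) fun x => sq_nonneg _)
      exact setIntegral_mono_set (Sol.il (cd.pow 2)) (Eventually.of_forall fun x => sq_nonneg _)
        (HasSubset.Subset.eventuallyLE (Icc_subset_Icc (neg_le_neg (le_max_left _ _)) (le_max_left _ _)))
    have hμ := h.μ0
    refine k3.trans (le_trans ?_ le_sup_left)
    have : (∫ t in Icc t1 t2, ∫ x, X R' x ^ 3 * deriv (u t) x ^ 2) =
      2 / μ * (μ / 2 * (∫ t in Icc t1 t2, ∫ x, X R' x ^ 3 * deriv (u t) x ^ 2)) := by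
      field_simp
    rw [this]
    have : 2 / μ * (μ / 2 * (∫ t in Icc t1 t2, ∫ x, X R' x ^ 3 * deriv (u t) x ^ 2)) ≤
        2 / μ * (C1 + K1 * (t2 - t1)) := by
      refine mul_le_mul_of_nonneg_left (by linarith) (by positivity)
    linarith
end RegAux

namespace RegAux
open Set Topology
open scoped ContDiff

/-- generic row bound -/
lemma rowGen {μ c r θ1 θ0 : ℝ} (hμ : 0 < μ) (hc : 0 ≤ c) (h1 : 0 ≤ θ1) (h0 : 0 ≤ θ0)
    {ψ j j1 j2 h f s k : ℝ → ℝ} (hψ : Test r ψ)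
    (b0 : ∀ x, |ψ x| ≤ c) (b1 : ∀ x, |deriv ψ x| ≤ c) (b2 : ∀ x, |deriv (deriv ψ) x| ≤ c)
    (ik : IntegrableOn k (Icc (-r) r)) (k0 : ∀ x, 0 ≤ k x)
    (e1 : ∀ x, |x| ≤ r → |j (h x)| ≤ k x) (e2 : ∀ x, |x| ≤ r → |j2 (h x) * f x ^ 2| ≤ k x)
    (e3 : ∀ x, |x| ≤ r → |j1 (h x) * f x| ≤ k x) (e4 : ∀ x, |x| ≤ r → |j1 (h x) * s x| ≤ k x) :
    Rg μ ψ j j1 j2 θ1 θ0 h (fun x => f x ^ 2) f s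
      ≤ c * (θ1 + θ0 * (μ + 1 / (2 * μ) + 2)) * ∫ x in Icc (-r) r, k x := by
  have ka : ∀ x, |k x| = k x := fun x => abs_of_nonneg (k0 x)
  have key : ∀ (η G : ℝ → ℝ), (∀ x, r < |x| → η x = 0) → (∀ x, |η x| ≤ c) → (∀ x, |x| ≤ r → |G x| ≤ k x) →
      ∫ x, η x * G x ≤ c * ∫ x in Icc (-r) r, k x := by
    intro η G z hη hG
    have := row_le (k := fun x => η x * G x) (A := c) (h := k) (r := r) (fun x hx => by simp [z x hx]) hc
      (fun x hx => by
        refine (le_abs_self _).trans ?_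
        rw [abs_mul, ka]
        exact mul_le_mul (hη x) (hG x hx) (abs_nonneg _) hc) ik
    simpa only [ka] using this
  have p0 := key ψ (fun x => j (h x)) hψ.2 b0 e1
  have p1 := key (deriv (deriv ψ)) (fun x => j (h x)) hψ.der.der.2 b2 e1
  have p2 := key ψ (fun x => j2 (h x) * f x ^ 2) hψ.2 b0 e2
  have p3 := key (deriv ψ) (fun x => j1 (h x) * f x) hψ.der.2 b1 e3
  have p4 := key ψ (fun x => j1 (h x) * s x) hψ.2 b0 e4
  simp only [← mul_assoc] at p2 p3 p4
  unfold Rg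
  set I := ∫ x in Icc (-r) r, k x
  have q0 := mul_le_mul_of_nonneg_left p0 h1
  have q1 := mul_le_mul_of_nonneg_left p1 hμ.le
  have q2 := mul_le_mul_of_nonneg_left p2 (show 0 ≤ 1 / (2 * μ) by positivity)
  have q := mul_le_mul_of_nonneg_left (add_le_add (add_le_add (add_le_add q1 q2) p3) p4) h0
  refine (add_le_add q0 q).trans (le_of_eq ?_)
  ring

noncomputable def k2 (k s : ℝ) : ℝ := min (1 + s ^ 2) k
noncomputable def k1 (k s : ℝ) : ℝ := ∫ w in (0:ℝ)..s, k2 k w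
noncomputable def kk (k s : ℝ) : ℝ := ∫ w in (0:ℝ)..s, k1 k w

lemma k2_cont (k : ℝ) : Continuous (k2 k) := by unfold k2; fun_prop

lemma k1_deriv (k s : ℝ) : HasDerivAt (k1 k) (k2 k s) s :=
  intervalIntegral.integral_hasDerivAt_right ((k2_cont k).intervalIntegrable _ _)
    ((k2_cont k).stronglyMeasurableAtFilter _ _) (k2_cont k).continuousAt

lemma k1_cont (k : ℝ) : Continuous (k1 k) :=
  continuous_iff_continuousAt.2 fun s => (k1_deriv k s).continuousAt

lemma jj_k {k : ℝ} (hk : 0 ≤ k) : JJ k (kk k) (k1 k) (k2 k) where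
  d1 s := intervalIntegral.integral_hasDerivAt_right ((k1_cont k).intervalIntegrable _ _)
    ((k1_cont k).stronglyMeasurableAtFilter _ _) (k1_cont k).continuousAt
  d2 := k1_deriv k
  c2 := k2_cont k
  n2 s := le_min (by positivity) hk
  le s := min_le_right _ _
  z := by simp [kk]
  z1 := by simp [k1]

lemma kk_nonneg {k : ℝ} (hk : 0 ≤ k) (s : ℝ) : 0 ≤ kk k s := by
  have p : ∀ s, 0 ≤ s → 0 ≤ k1 k s := fun s hs =>
    intervalIntegral.integral_nonneg hs fun w _ => (jj_k hk).n2 w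
  have m : ∀ s, s ≤ 0 → k1 k s ≤ 0 := fun s hs => by
    unfold k1
    rw [intervalIntegral.integral_symm]
    exact neg_nonpos.2 (intervalIntegral.integral_nonneg hs fun w _ => (jj_k hk).n2 w)
  rcases le_total 0 s with h | h
  · exact intervalIntegral.integral_nonneg h fun w hw => p w hw.1
  · unfold kk
    rw [intervalIntegral.integral_symm, ← intervalIntegral.integral_neg]
    exact intervalIntegral.integral_nonneg h fun w hw => neg_nonneg.2 (m w hw.2)

lemma k2_le (k s : ℝ) : k2 k s ≤ 1 + s ^ 2 := min_le_left _ _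

lemma uIoc0_abs {s w : ℝ} (hw : w ∈ uIoc 0 s) : |w| ≤ |s| := by
  rcases le_total 0 s with h | h
  · rw [uIoc_of_le h] at hw
    rw [abs_of_pos hw.1, abs_of_nonneg h]; exact hw.2
  · rw [uIoc_of_ge h] at hw
    rw [abs_of_nonpos hw.2, abs_of_nonpos h]; linarith [hw.1]

lemma k1_abs {k : ℝ} (hk : 0 ≤ k) (s : ℝ) : |k1 k s| ≤ (1 + s ^ 2) * |s| := by
  have := intervalIntegral.norm_integral_le_of_norm_le_const (a := 0) (b := s) (f := k2 k) (C := 1 + s ^ 2)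
    (fun w hw => by
      have := uIoc0_abs hw
      rw [Real.norm_of_nonneg ((jj_k hk).n2 w)]
      have := sq_le_sq' (by linarith [abs_nonneg w]) this
      rw [sq_abs, sq_abs] at this
      linarith [k2_le k w])
  simpa [k1] using this

lemma kk_abs {k : ℝ} (hk : 0 ≤ k) (s : ℝ) : |kk k s| ≤ (1 + s ^ 2) * s ^ 2 := by
  have := intervalIntegral.norm_integral_le_of_norm_le_const (a := 0) (b := s) (f := k1 k) (C := (1 + s ^ 2) * |s|)
    (fun w hw => by
      have h1 := uIoc0_abs hw
      have := sq_le_sq' (by linarith [abs_nonneg w]) h1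
      rw [sq_abs, sq_abs] at this
      refine (k1_abs hk w).trans ?_
      gcongr)
  have e : (1 + s ^ 2) * s ^ 2 = (1 + s ^ 2) * |s| * |s| := by rw [mul_assoc, abs_mul_abs_self]; ring
  rw [e]
  simpa [kk] using this

lemma poly1 {a : ℝ} (ha : 0 ≤ a) : 2 * a ^ 2 ≤ a + a ^ 3 := by nlinarith [mul_nonneg ha (sq_nonneg (a - 1))]

/-- pointwise bounds for B2 -/
lemma ptB2 {q α k w g : ℝ} (hq : 1 < q) (hq2 : q < 2) (hα : 0 < α) (hk : 0 ≤ k) :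
    |kk k w| ≤ (4 + 3 * α) * (w ^ 2 + w ^ 6 + g ^ 2) ∧
    |k2 k w * fq q w ^ 2| ≤ (4 + 3 * α) * (w ^ 2 + w ^ 6 + g ^ 2) ∧
    |k1 k w * fq q w| ≤ (4 + 3 * α) * (w ^ 2 + w ^ 6 + g ^ 2) ∧
    |k1 k w * (α * (g - w))| ≤ (4 + 3 * α) * (w ^ 2 + w ^ 6 + g ^ 2) := by
  set b := |w| with hb
  have b0 : 0 ≤ b := abs_nonneg w
  have hw : w ^ 2 = b ^ 2 := (sq_abs w).symm
  have hw6 : w ^ 6 = (b ^ 2) ^ 3 := by rw [← hw]; ring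
  have hF : |fq q w| ≤ b + b ^ 2 := by
    have := (fq_abs_le hq w).trans (rpow_le_add hq hq2 w)
    rwa [hw] at this
  have K1 := k1_abs hk w
  have K0 := kk_abs hk w
  have K2 := k2_le k w
  have K2n := (jj_k hk).n2 w
  rw [hw] at K1 K0 K2
  rw [hw, hw6]
  rw [← hb] at K1
  set a := b ^ 2 with ha
  have a0 : 0 ≤ a := sq_nonneg b
  have P := poly1 a0
  have a3 : 0 ≤ a ^ 3 := by positivity
  have g0 := sq_nonneg g
  have ab : 2 * (a * b) ≤ a + a ^ 2 := by nlinarith [mul_nonneg a0 (sq_nonneg (b - 1))]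
  set T := a + a ^ 3 + g ^ 2 with hT
  have T0 : 0 ≤ T := by positivity
  have aT : a + a ^ 3 ≤ T := by linarith
  have αT : 0 ≤ α * T := by positivity
  have e : (4 + 3 * α) * T = 4 * T + 3 * (α * T) := by ring
  rw [e]
  have S1 : (1 + a) * a ≤ 2 * (a + a ^ 3) := by nlinarith
  refine ⟨?_, ?_, ?_, ?_⟩
  · linarith
  · rw [abs_mul, abs_of_nonneg K2n, abs_of_nonneg (sq_nonneg _), ← sq_abs (fq q w)]
    have f2 : |fq q w| ^ 2 ≤ 2 * a + 2 * a ^ 2 := by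
      refine (pow_le_pow_left₀ (abs_nonneg _) hF 2).trans ?_
      nlinarith [sq_nonneg (b - a)]
    have := mul_le_mul K2 f2 (sq_nonneg _) (by linarith)
    nlinarith
  · rw [abs_mul]
    have := mul_le_mul K1 hF (abs_nonneg _) (by positivity)
    have e2 : (1 + a) * b * (b + a) = (1 + a) * (a + a * b) := by rw [ha]; ring
    have : (1 + a) * (a + a * b) ≤ (1 + a) * (a + (a + a ^ 2) / 2) :=
      mul_le_mul_of_nonneg_left (by linarith) (by linarith)
    nlinarith
  · rw [abs_mul, abs_mul, abs_of_pos hα]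
    have h1 : |g - w| ≤ |g| + b := abs_sub g w
    have h2 : |k1 k w| * (α * |g - w|) ≤ (1 + a) * b * (α * (|g| + b)) :=
      mul_le_mul K1 (mul_le_mul_of_nonneg_left h1 hα.le) (by positivity) (by positivity)
    have e2 : (1 + a) * b * (α * (|g| + b)) = α * ((1 + a) * b * |g| + (1 + a) * a) := by rw [ha]; ring
    have h3 : (1 + a) * b * |g| ≤ ((1 + a) ^ 2 * a + g ^ 2) / 2 := by
      have := sq_nonneg ((1 + a) * b - |g|)
      have e3 : ((1 + a) * b - |g|) ^ 2 = (1 + a) ^ 2 * a + |g| ^ 2 - 2 * ((1 + a) * b * |g|) := by rw [ha]; ring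
      rw [e3, sq_abs] at this
      linarith
    have h4 : (1 + a) * b * |g| + (1 + a) * a ≤ 3 * T := by nlinarith
    have := mul_le_mul_of_nonneg_left h4 hα.le
    linarith

variable {J : ℝ → ℝ} {q α μ : ℝ} {u : ℝ → ℝ → ℝ}

/-- square of sup of square is controlled by the gradient -/
lemma sup_four {r C : ℝ} (hr : 1 ≤ r) {w : ℝ → ℝ} (hw : ContDiff ℝ 1 w) (hC : ∫ y in Icc (-r) r, w y ^ 2 ≤ C)
    {x : ℝ} (hx : x ∈ Icc (-r) r) : w x ^ 4 ≤ 2 * C ^ 2 + 8 * C * ∫ y in Icc (-r) r, deriv w y ^ 2 := by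
  have cw := hw.continuous
  have cd : Continuous (deriv w) := hw.continuous_deriv (by simp)
  have h1 := sup_sq2 (by linarith) hw hx
  have n0 : 0 ≤ ∫ y in Icc (-r) r, w y ^ 2 := integral_nonneg fun y => sq_nonneg _
  have n1 : 0 ≤ ∫ y in Icc (-r) r, deriv w y ^ 2 := integral_nonneg fun y => sq_nonneg _
  have i1 : Integrable (fun y => |w y| ^ 2) (volume.restrict (Icc (-r) r)) := Sol.il (cw.abs.pow 2)
  have i2 : Integrable (fun y => |deriv w y| ^ 2) (volume.restrict (Icc (-r) r)) := Sol.il (cd.abs.pow 2)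
  have h2 := cs i1 i2 (Sol.il (cw.abs.mul cd.abs))
  simp only [sq_abs] at h2
  set A := ∫ y in Icc (-r) r, w y ^ 2
  set B := ∫ y in Icc (-r) r, |w y| * |deriv w y|
  set Y := ∫ y in Icc (-r) r, deriv w y ^ 2
  have h3 : 1 / (2 * r) * A ≤ C := by
    have : 1 / (2 * r) ≤ 1 := by rw [div_le_one (by linarith)]; linarith
    nlinarith
  have h4 : w x ^ 2 ≤ C + 2 * B := by linarith
  have h5 : w x ^ 4 ≤ (C + 2 * B) ^ 2 := by
    have := pow_le_pow_left₀ (sq_nonneg (w x)) h4 2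
    calc w x ^ 4 = (w x ^ 2) ^ 2 := by ring
      _ ≤ _ := this
  have h6 : A * Y ≤ C * Y := mul_le_mul_of_nonneg_right hC n1
  nlinarith [sq_nonneg (C - 2 * B)]

lemma Sol.rowB2 (h : Sol J q α μ u) {C1 : ℝ} {t : ℝ} (h2 : Integrable fun x => u t x ^ 2)
    (hC : ∫ x, u t x ^ 2 ≤ C1) {r : ℝ} (hr : 1 ≤ r) :
    IntegrableOn (fun x => (4 + 3 * α) * (u t x ^ 2 + u t x ^ 6 + gg J u t x ^ 2)) (Icc (-r) r) ∧
    ∫ x in Icc (-r) r, (4 + 3 * α) * (u t x ^ 2 + u t x ^ 6 + gg J u t x ^ 2) ≤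
      (4 + 3 * α) * (2 * C1 + C1 * (2 * C1 ^ 2 + 8 * C1 * ∫ y in Icc (-r) r, deriv (u t) y ^ 2)) := by
  have hα := h.α0
  obtain ⟨g1, g2⟩ := h.g_sq t h2
  have cu := h.cu t
  have C0 : 0 ≤ C1 := (integral_nonneg fun x => sq_nonneg _).trans hC
  have l1 : ∫ x in Icc (-r) r, u t x ^ 2 ≤ C1 :=
    (setIntegral_le_integral h2 (Eventually.of_forall fun x => sq_nonneg _)).trans hC
  have l2 : ∫ x in Icc (-r) r, gg J u t x ^ 2 ≤ C1 :=
    (setIntegral_le_integral g1 (Eventually.of_forall fun x => sq_nonneg _)).trans (g2.trans hC)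
  set Y := ∫ y in Icc (-r) r, deriv (u t) y ^ 2 with hY
  have Y0 : 0 ≤ Y := integral_nonneg fun y => sq_nonneg _
  set Q := 2 * C1 ^ 2 + 8 * C1 * Y with hQ
  have Q0 : 0 ≤ Q := by positivity
  have i2 : IntegrableOn (fun x => u t x ^ 2) (Icc (-r) r) := h2.integrableOn
  have i6 : IntegrableOn (fun x => u t x ^ 6) (Icc (-r) r) := Sol.il (cu.pow 6)
  have ig : IntegrableOn (fun x => gg J u t x ^ 2) (Icc (-r) r) := g1.integrableOn
  have l3 : ∫ x in Icc (-r) r, u t x ^ 6 ≤ Q * C1 := by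
    refine le_trans ?_ (mul_le_mul_of_nonneg_left l1 Q0)
    rw [← integral_const_mul]
    refine setIntegral_mono_on i6 (i2.const_mul Q) measurableSet_Icc fun x hx => ?_
    have := sup_four hr (h.uc1 t) l1 hx
    calc u t x ^ 6 = u t x ^ 4 * u t x ^ 2 := by ring
      _ ≤ _ := mul_le_mul_of_nonneg_right this (sq_nonneg _)
  have i26 : IntegrableOn (fun x => u t x ^ 2 + u t x ^ 6) (Icc (-r) r) := i2.add i6
  have it : IntegrableOn (fun x => u t x ^ 2 + u t x ^ 6 + gg J u t x ^ 2) (Icc (-r) r) := i26.add ig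
  refine ⟨it.const_mul _, ?_⟩
  rw [integral_const_mul, integral_add i26 ig, integral_add i2 i6]
  refine mul_le_mul_of_nonneg_left ?_ (by positivity)
  linarith

/-- second global estimate -/
lemma Sol.B2 (h : Sol J q α μ u) {t1 t2 : ℝ} (h1 : 0 < t1) :
    ∃ C, ∀ R, IntegrableOn (fun t => ∫ x in Icc (-R) R, (1 + u t x ^ 2) * deriv (u t) x ^ 2) (Icc t1 t2) ∧
      ∫ t in Icc t1 t2, (∫ x in Icc (-R) R, (1 + u t x ^ 2) * deriv (u t) x ^ 2) ≤ C := by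
  rcases lt_or_ge t2 t1 with h12 | h12
  · exact ⟨0, fun R => by rw [Icc_eq_empty (not_le.2 h12)]; simp⟩
  obtain ⟨c, hc, X, hX⟩ := exists_cuts
  have hα := h.α0
  have hμ := h.μ0
  set t0 := t1 / 2 with ht0
  have t00 : 0 < t0 := by positivity
  have t02 : t0 ≤ t2 := by linarith
  obtain ⟨C1, hC1, hB, hD⟩ := h.B1 (t1 := t0) (t2 := t2) t00
  set A := c * (1 + t2 * (μ + 1 / (2 * μ) + 2)) with hA
  have A0 : 0 ≤ A := by have : 0 ≤ t2 := by linarith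
                        positivity
  set P := A * (4 + 3 * α) with hP
  have P0 : 0 ≤ P := by positivity
  set C' := P * ((2 * C1 + C1 * (2 * C1 ^ 2)) * (t2 - t0) + 8 * C1 * C1 * C1) with hC'
  have key : ∀ R, 1 ≤ R → IntegrableOn (fun t => (t - t0) * ∫ x, X R x * ((1 + u t x ^ 2) * deriv (u t) x ^ 2))
      (Icc t0 t2) ∧ ∫ t in Icc t0 t2, (t - t0) * ∫ x, X R x * ((1 + u t x ^ 2) * deriv (u t) x ^ 2) ≤ 2 / μ * C' := by
    intro R hR
    obtain ⟨hχ, hχ1, -, -⟩ := hX R hR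
    obtain ⟨b, hb⟩ := h.el0 (r := 2 * R + 1) (t1 := t0) (t2 := t2) t00 t02 (by linarith)
    have hm : ∀ k : ℕ, IntegrableOn (fun t => (t - t0) * ∫ x, X R x * (k2 k (u t x) * deriv (u t) x ^ 2)) (Icc t0 t2) ∧
        ∫ t in Icc t0 t2, (t - t0) * ∫ x, X R x * (k2 k (u t x) * deriv (u t) x ^ 2) ≤ 2 / μ * C' := by
      intro k
      have k0 : (0:ℝ) ≤ k := Nat.cast_nonneg k
      obtain ⟨i1, i2, hmain⟩ := hb.main (jj_k k0) hχ.t (by linarith) (by linarith) hχ.n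
        (θ := fun t => t - t0) (θ' := fun _ => 1) (fun t => (hasDerivAt_id t).sub_const t0)
        continuous_const (fun t ht => sub_nonneg.2 ht.1)
      refine ⟨i1, ?_⟩
      have ib : IntegrableOn (fun t => P * ((2 * C1 + C1 * (2 * C1 ^ 2)) + 8 * C1 * C1 * ∫ y in Icc (-(2 * R)) (2 * R), deriv (u t) y ^ 2))
          (Icc t0 t2) := by
        refine Integrable.const_mul (Integrable.add (integrableOn_const (by simp)) (Integrable.const_mul ?_ _)) _
        exact (h.gp (by linarith) t00).c2
      have hintg : ∫ t in Icc t0 t2, Rg μ (X R) (kk k) (k1 k) (k2 k) 1 (t - t0) (u t) (fun x => Fu q u t x ^ 2)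
          (Fu q u t) (Su J α u t) ≤ C' := by
        refine (setIntegral_mono_on i2 ib measurableSet_Icc fun t ht => ?_).trans ?_
        · obtain ⟨r1, r2⟩ := h.rowB2 (hB t ht).1 (hB t ht).2 (r := 2 * R) (by linarith)
          have θ0 : 0 ≤ t - t0 := sub_nonneg.2 ht.1
          refine (rowGen hμ (by linarith) zero_le_one θ0 hχ.t
            (fun x => by rw [abs_of_nonneg (hχ.n x)]; linarith [hχ.l x]) hχ.b1 hχ.b2 r1
            (fun x => by positivity)
            (fun x _ => (ptB2 h.q1 h.q2 hα k0).1) (fun x _ => (ptB2 h.q1 h.q2 hα k0).2.1)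
            (fun x _ => (ptB2 h.q1 h.q2 hα k0).2.2.1) (fun x _ => (ptB2 h.q1 h.q2 hα k0).2.2.2)).trans ?_
          have I0 := (integral_nonneg (μ := volume.restrict (Icc (-(2*R)) (2*R))) (f := fun x => (4 + 3 * α) * (u t x ^ 2 + u t x ^ 6 + gg J u t x ^ 2))
            fun x => by positivity)
          have : c * (1 + (t - t0) * (μ + 1 / (2 * μ) + 2)) ≤ A := by
            rw [hA]
            have : t - t0 ≤ t2 := by linarith [ht.2]
            gcongr
          refine (mul_le_mul this r2 I0 A0).trans (le_of_eq ?_)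
          rw [hP]; ring
        · have ic : IntegrableOn (fun t => 8 * C1 * C1 * ∫ y in Icc (-(2 * R)) (2 * R), deriv (u t) y ^ 2) (Icc t0 t2) :=
            Integrable.const_mul (h.gp (by linarith) t00).c2 _
          have ic0 : IntegrableOn (fun _ : ℝ => 2 * C1 + C1 * (2 * C1 ^ 2)) (Icc t0 t2) := integrableOn_const (by simp)
          rw [integral_const_mul, integral_add ic0 ic, integral_const_mul]
          simp only [integral_const, measureReal_restrict_apply_univ, smul_eq_mul,
            Real.volume_real_Icc_of_le t02]
          rw [hC']
          refine mul_le_mul_of_nonneg_left ?_ P0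
          have := mul_le_mul_of_nonneg_left (hD (2 * R)) (show 0 ≤ 8 * C1 * C1 by positivity)
          linarith
      have jn : 0 ≤ ∫ x, X R x * kk k (u t2 x) := by
        refine integral_nonneg fun x => mul_nonneg (hχ.n x) ?_
        exact kk_nonneg k0 _
      have jn' := mul_nonneg (sub_nonneg.2 t02) jn
      simp only [sub_self, zero_mul, zero_add] at hmain
      have : μ / 2 * (∫ t in Icc t0 t2, (t - t0) * ∫ x, X R x * (k2 k (u t x) * deriv (u t) x ^ 2)) ≤ C' := by linarith
      rw [div_mul_eq_mul_div, le_div_iff₀ hμ]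
      linarith
    refine fatou_real (fun k => (hm k).1) (fun k => ?_) (fun k => (hm k).2) tendsto_const_nhds ?_
    · refine (ae_restrict_iff' measurableSet_Icc).2 (Eventually.of_forall fun t ht => ?_)
      exact mul_nonneg (sub_nonneg.2 ht.1) (integral_nonneg fun x => mul_nonneg (hχ.n x)
        (mul_nonneg ((jj_k (Nat.cast_nonneg k)).n2 _) (sq_nonneg _)))
    · refine Eventually.of_forall fun t => Tendsto.const_mul _ ?_
      obtain ⟨D, hDb⟩ := isCompact_Icc.exists_bound_of_continuousOn (s := Icc (-(2*R)) (2*R))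
        (f := fun x => 1 + u t x ^ 2) (by have := h.cu t; fun_prop)
      obtain ⟨N, hN⟩ := exists_nat_ge D
      refine tendsto_const_nhds.congr' ?_
      filter_upwards [eventually_ge_atTop N] with k hk
      refine integral_congr_ae (Eventually.of_forall fun x => ?_)
      simp only
      by_cases hx : 2 * R < |x|
      · rw [hχ.t.2 x hx]; simp
      · have h1 := (le_abs_self _).trans (hDb x (abs_le.1 (not_lt.1 hx)))
        have : (N:ℝ) ≤ k := by exact_mod_cast hk
        have : k2 k (u t x) = 1 + u t x ^ 2 := min_eq_left (by linarith)
        rw [this]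
  have hC'0 : 0 ≤ C' := by
    have : 0 ≤ t2 - t0 := by linarith
    positivity
  refine ⟨1 / t0 * (2 / μ * C'), fun R => ?_⟩
  set R' := max R 1 with hR'
  have R1 : 1 ≤ R' := le_max_right _ _
  obtain ⟨k1, k2⟩ := key R' R1
  obtain ⟨hχ, hχ1, -, -⟩ := hX R' R1
  have sub : Icc t1 t2 ⊆ Icc t0 t2 := Icc_subset_Icc (by linarith) le_rfl
  have n : ∀ t, 0 ≤ ∫ x, X R' x * ((1 + u t x ^ 2) * deriv (u t) x ^ 2) := fun t =>
    integral_nonneg fun x => mul_nonneg (hχ.n x) (by positivity)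
  have le1 : ∀ t ∈ Icc t1 t2, ∫ x in Icc (-R) R, (1 + u t x ^ 2) * deriv (u t) x ^ 2 ≤
      1 / t0 * ((t - t0) * ∫ x, X R' x * ((1 + u t x ^ 2) * deriv (u t) x ^ 2)) := by
    intro t ht
    have cd : Continuous (deriv (u t)) := (h.uc1 t).continuous_deriv (by simp)
    have ck : Continuous fun x => (1 + u t x ^ 2) * deriv (u t) x ^ 2 := by have := h.cu t; fun_prop
    have a1 : ∫ x in Icc (-R) R, (1 + u t x ^ 2) * deriv (u t) x ^ 2 ≤ ∫ x in Icc (-R') R', (1 + u t x ^ 2) * deriv (u t) x ^ 2 :=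
      setIntegral_mono_set (Sol.il ck) (Eventually.of_forall fun x => by positivity)
        (HasSubset.Subset.eventuallyLE (Icc_subset_Icc (neg_le_neg (le_max_left _ _)) (le_max_left _ _)))
    have a2 : ∫ x in Icc (-R') R', (1 + u t x ^ 2) * deriv (u t) x ^ 2 ≤ ∫ x, X R' x * ((1 + u t x ^ 2) * deriv (u t) x ^ 2) :=
      cut_le hχ1 hχ.n (fun x => by positivity) (hχ.t.integrable_mul_cont ck)
    refine (a1.trans a2).trans ?_
    rw [← mul_assoc]
    refine le_mul_of_one_le_left (n t) ?_
    rw [one_div, ← div_eq_inv_mul, one_le_div t00]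
    linarith [ht.1]
  have ig : IntegrableOn (fun t => 1 / t0 * ((t - t0) * ∫ x, X R' x * ((1 + u t x ^ 2) * deriv (u t) x ^ 2))) (Icc t1 t2) :=
    (k1.mono_set sub).const_mul _
  have m1 := meas_deriv h.um fun t => (h.uc1 t).differentiable (by simp)
  have m2 : Measurable (Function.uncurry fun t x => (1 + u t x ^ 2) * deriv (u t) x ^ 2) :=
    ((h.um.pow_const 2).const_add 1).mul (m1.pow_const 2)
  have mm : Measurable fun t => ∫ x in Icc (-R) R, (1 + u t x ^ 2) * deriv (u t) x ^ 2 :=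
    (StronglyMeasurable.integral_prod_right (ν := volume.restrict (Icc (-R) R))
      (f := fun t x => (1 + u t x ^ 2) * deriv (u t) x ^ 2)
      m2.stronglyMeasurable).measurable
  have il : IntegrableOn (fun t => ∫ x in Icc (-R) R, (1 + u t x ^ 2) * deriv (u t) x ^ 2) (Icc t1 t2) := by
    refine ig.mono' mm.aestronglyMeasurable ((ae_restrict_iff' measurableSet_Icc).2 (Eventually.of_forall fun t ht => ?_))
    rw [Real.norm_of_nonneg (integral_nonneg fun x => by positivity)]
    exact le1 t ht
  refine ⟨il, (setIntegral_mono_on il ig measurableSet_Icc le1).trans ?_⟩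
  rw [integral_const_mul]
  refine mul_le_mul_of_nonneg_left (le_trans ?_ k2) (by positivity)
  refine setIntegral_mono_set k1 ((ae_restrict_iff' measurableSet_Icc).2 (Eventually.of_forall fun t ht => ?_)) (HasSubset.Subset.eventuallyLE sub)
  exact mul_nonneg (sub_nonneg.2 ht.1) (n t)
end RegAux

namespace RegAux
open Set Topology
open scoped ContDiff

noncomputable def dx (u : ℝ → ℝ → ℝ) (t x : ℝ) : ℝ := deriv (u t) x
noncomputable def Fx (J : ℝ → ℝ) (q α : ℝ) (u : ℝ → ℝ → ℝ) (t x : ℝ) : ℝ :=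
  |u t x| ^ (q - 1) * deriv (u t) x - Su J α u t x

variable {J : ℝ → ℝ} {q α μ : ℝ} {u : ℝ → ℝ → ℝ}

lemma absrpow_sq {q : ℝ} (hq : 1 < q) (hq2 : q < 2) (a : ℝ) : (|a| ^ (q - 1)) ^ 2 ≤ 1 + a ^ 2 := by
  have h0 := Real.rpow_nonneg (abs_nonneg a) (q - 1)
  rcases le_total |a| 1 with h | h
  · have := Real.rpow_le_one (abs_nonneg a) h (by linarith : 0 ≤ q - 1)
    nlinarith [sq_nonneg a]
  · have : |a| ^ (q - 1) ≤ |a| ^ (1:ℝ) := Real.rpow_le_rpow_of_exponent_le h (by linarith)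
    rw [Real.rpow_one] at this
    have := pow_le_pow_left₀ h0 this 2
    rw [sq_abs] at this
    linarith

lemma Sol.Lf3 (h : Sol J q α μ u) {r : ℝ} {ψ : ℝ → ℝ} (hψ : Test r ψ) (t : ℝ) :
    Lf μ ψ (dx u) (Fx J q α u) (fun _ _ => 0) t = -Lf μ (deriv ψ) u (Fu q u) (Su J α u) t := by
  have cd : Continuous (deriv (u t)) := (h.uc1 t).continuous_deriv (by simp)
  have ca : Continuous fun x => |u t x| ^ (q - 1) * deriv (u t) x :=
    ((cont_absrpow h.q1).comp (h.cu t)).mul cd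
  have e1 : ∫ x, deriv (deriv ψ) x * dx u t x = -∫ x, deriv (deriv (deriv ψ)) x * u t x :=
    hψ.der.der.ibp (fun x => ((h.uc1 t).differentiable (by simp) x).hasDerivAt) cd
  have e2 : ∫ x, deriv ψ x * (|u t x| ^ (q - 1) * deriv (u t) x) = -∫ x, deriv (deriv ψ) x * Fu q u t x :=
    hψ.der.ibp (G := Fu q u t) (fun x => (fq_hasDerivAt h.q1 (u t x)).comp x
      ((h.uc1 t).differentiable (by simp) x).hasDerivAt) ca
  have e3 : ∫ x, deriv ψ x * Fx J q α u t x = (∫ x, deriv ψ x * (|u t x| ^ (q - 1) * deriv (u t) x))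
      - ∫ x, deriv ψ x * Su J α u t x := by
    rw [← integral_sub (hψ.der.integrable_mul_cont ca) (hψ.der.integrable_mul (h.Su_int t).locallyIntegrable)]
    congr 1; ext x; simp only [Fx]; ring
  unfold Lf
  rw [e1, e3, e2]
  simp only [mul_zero, integral_zero]
  ring

lemma Sol.el3 (h : Sol J q α μ u) {t1 t2 : ℝ} (h1 : 0 < t1) (h12 : t1 ≤ t2) :
    ∃ C, 0 ≤ C ∧ ∀ r, 0 < r → ∃ b, EL μ r t1 t2 (dx u) (Fx J q α u) (fun _ _ => 0) b ∧
      ∫ t in Icc t1 t2, b t ≤ C := by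
  obtain ⟨C1, hC1, hB, hD⟩ := h.B1 (t1 := t1) (t2 := t2) h1
  obtain ⟨C2, hC2⟩ := h.B2 (t1 := t1) (t2 := t2) h1
  have hα := h.α0
  have C20 : 0 ≤ C2 := (integral_nonneg fun t => integral_nonneg fun x => by positivity).trans (hC2 0).2
  refine ⟨2 * C2 + 8 * α ^ 2 * C1 * (t2 - t1), by have : 0 ≤ t2 - t1 := by linarith
                                                  positivity, fun r hr => ?_⟩
  obtain ⟨j1, j2⟩ := hC2 r
  set Y := fun t => ∫ x in Icc (-r) r, (1 + u t x ^ 2) * deriv (u t) x ^ 2 with hY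
  have Y0 : ∀ t, 0 ≤ Y t := fun t => integral_nonneg fun x => by positivity
  have cd : ∀ t, Continuous (deriv (u t)) := fun t => (h.uc1 t).continuous_deriv (by simp)
  have ca : ∀ t, Continuous fun x => |u t x| ^ (q - 1) * deriv (u t) x := fun t =>
    ((cont_absrpow h.q1).comp (h.cu t)).mul (cd t)
  have m1 := meas_deriv h.um fun t => (h.uc1 t).differentiable (by simp)
  have mS : Measurable (Function.uncurry (Su J α u)) := measurable_const.mul (h.g_meas.sub h.um)
  have mF : Measurable (Function.uncurry (Fx J q α u)) :=
    (((cont_absrpow h.q1).measurable.comp h.um).mul m1).sub mS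
  have lF : ∀ t, LocallyIntegrable (Fx J q α u t) := fun t =>
    (ca t).locallyIntegrable.sub (h.Su_int t).locallyIntegrable
  have pt : ∀ t x, Fx J q α u t x ^ 2 ≤ 2 * ((1 + u t x ^ 2) * deriv (u t) x ^ 2) + 4 * α ^ 2 * (gg J u t x ^ 2 + u t x ^ 2) := by
    intro t x
    have a1 := mul_le_mul_of_nonneg_right (absrpow_sq h.q1 h.q2 (u t x)) (sq_nonneg (deriv (u t) x))
    rw [← mul_pow] at a1
    have a2 : Su J α u t x ^ 2 ≤ α ^ 2 * (2 * (gg J u t x ^ 2 + u t x ^ 2)) := by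
      simp only [Su, mul_pow]
      refine mul_le_mul_of_nonneg_left ?_ (sq_nonneg _)
      nlinarith [sq_nonneg (gg J u t x + u t x)]
    unfold Fx
    nlinarith [sq_nonneg (|u t x| ^ (q - 1) * deriv (u t) x + Su J α u t x)]
  have cw : ∀ t, Continuous fun x => 2 * ((1 + u t x ^ 2) * deriv (u t) x ^ 2) := fun t => by
    have := h.cu t; have := cd t; fun_prop
  have ig : ∀ t ∈ Icc t1 t2, Integrable fun x => 4 * α ^ 2 * (gg J u t x ^ 2 + u t x ^ 2) := fun t ht =>
    ((h.g_sq t (hB t ht).1).1.add (hB t ht).1).const_mul _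
  have L2 : ∀ t ∈ Icc t1 t2, LocallyIntegrable fun x => Fx J q α u t x ^ 2 := fun t ht => by
    refine ((cw t).locallyIntegrable.add (ig t ht).locallyIntegrable).mono
      (((mF.comp (measurable_prodMk_left (x := t))).pow_const 2).aestronglyMeasurable) (Eventually.of_forall fun x => ?_)
    rw [Real.norm_of_nonneg (sq_nonneg _)]
    exact (pt t x).trans (le_abs_self _)
  have ib : IntegrableOn (fun t => 2 * Y t) (Icc t1 t2) := j1.const_mul 2
  have ic : IntegrableOn (fun _ : ℝ => 8 * α ^ 2 * C1) (Icc t1 t2) := integrableOn_const (by simp)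
  refine ⟨fun t => 2 * Y t + 8 * α ^ 2 * C1, ⟨h.μ0, h12, m1, mF, measurable_const, fun t _ => contDiff_deriv_of_two (h.uc t),
    fun t _ => lF t, L2, fun t _ => locallyIntegrable_zero, ib.add ic, ?_, ?_, ?_, ?_, ?_⟩, ?_⟩
  · intro t ht
    have : ∫ x in Icc (-r) r, dx u t x ^ 2 ≤ Y t := by
      refine setIntegral_mono_on (Sol.il ((cd t).pow 2)) (Sol.il (by have := h.cu t; have := cd t; fun_prop)) measurableSet_Icc
        fun x _ => ?_
      simp only [dx]
      nlinarith [mul_nonneg (sq_nonneg (u t x)) (sq_nonneg (deriv (u t) x))]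
    have := Y0 t
    have : 0 ≤ 8 * α ^ 2 * C1 := by positivity
    linarith
  · intro t ht
    have i2 : IntegrableOn (fun x => 4 * α ^ 2 * (gg J u t x ^ 2 + u t x ^ 2)) (Icc (-r) r) := (ig t ht).integrableOn
    have : ∫ x in Icc (-r) r, Fx J q α u t x ^ 2 ≤ ∫ x in Icc (-r) r, (2 * ((1 + u t x ^ 2) * deriv (u t) x ^ 2)
        + 4 * α ^ 2 * (gg J u t x ^ 2 + u t x ^ 2)) :=
      setIntegral_mono_on ((L2 t ht).integrableOn_isCompact isCompact_Icc) (IntegrableOn.add (Sol.il (cw t)) i2) measurableSet_Icc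
        fun x _ => pt t x
    rw [integral_add (Sol.il (cw t)) i2, integral_const_mul] at this
    have e : ∫ x in Icc (-r) r, 4 * α ^ 2 * (gg J u t x ^ 2 + u t x ^ 2) ≤ 8 * α ^ 2 * C1 := by
      refine (setIntegral_le_integral (ig t ht) (Eventually.of_forall fun x => by positivity)).trans ?_
      obtain ⟨g1, g2⟩ := h.g_sq t (hB t ht).1
      rw [integral_const_mul, integral_add g1 (hB t ht).1]
      have : (∫ x, gg J u t x ^ 2) + (∫ x, u t x ^ 2) ≤ 2 * C1 := by linarith [(hB t ht).2]
      have := mul_le_mul_of_nonneg_left this (show 0 ≤ 4 * α ^ 2 by positivity)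
      linarith
    linarith
  · intro t ht x hx
    have := Y0 t
    simp only [abs_zero, integral_zero, mul_zero]
    positivity
  · intro ψ hψ t ht
    have t0 : 0 < t := h1.trans_le ht.1
    have w := ((h.gp (t2 := t2) hr h1).w _ hψ.der t ht).neg
    rw [h.Lf3 hψ]
    refine w.congr_of_eventuallyEq (Eventually.of_forall fun s => ?_)
    exact hψ.ibp (fun x => ((h.uc1 s).differentiable (by simp) x).hasDerivAt) (cd s)
  · intro ψ hψ
    obtain ⟨C, hC⟩ := (h.gp (t2 := t2) hr h1).c1
    have := (h.L_cont (U := Icc t1 t2) (fun t ht => lt_of_lt_of_le h1 ht.1) hC hψ.der).neg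
    exact this.congr fun t _ => h.Lf3 hψ t
  · rw [integral_add ib ic, integral_const_mul]
    simp only [integral_const, measureReal_restrict_apply_univ, smul_eq_mul, Real.volume_real_Icc_of_le h12]
    linarith

/-- gradient bound in L² -/
lemma Sol.B3 (h : Sol J q α μ u) {t1 t2 : ℝ} (h1 : 0 < t1) :
    ∃ C, 0 ≤ C ∧ ∀ t ∈ Icc t1 t2, ∀ R, ∫ x in Icc (-R) R, deriv (u t) x ^ 2 ≤ C := by
  rcases lt_or_ge t2 t1 with h12 | h12
  · exact ⟨0, le_rfl, fun t ht => by rw [Icc_eq_empty (not_le.2 h12)] at ht; exact ht.elim⟩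
  obtain ⟨c, hc, X, hX⟩ := exists_cuts
  have hα := h.α0
  have hμ := h.μ0
  set t0 := t1 / 2 with ht0
  have t00 : 0 < t0 := by positivity
  obtain ⟨C, hC, hE⟩ := h.el3 (t1 := t0) (t2 := t2) t00 (by linarith)
  have t20 : 0 ≤ t2 := by linarith
  set A := c * (1 + t2 * (μ + 1 / (2 * μ) + 2)) with hA
  have A0 : 0 ≤ A := by positivity
  refine ⟨2 / t0 * (A * (2 * C)), by positivity, fun t ht R => ?_⟩
  set R' := max R 1 with hR'
  have R1 : 1 ≤ R' := le_max_right _ _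
  obtain ⟨hχ, hχ1, -, -⟩ := hX R' R1
  obtain ⟨b, hb0, hbC⟩ := hE (2 * R' + 1) (by linarith)
  have cd : ∀ t, Continuous (deriv (u t)) := fun t => (h.uc1 t).continuous_deriv (by simp)
  have sub : Icc t0 t ⊆ Icc t0 t2 := Icc_subset_Icc le_rfl ht.2
  have hb : EL μ (2 * R' + 1) t0 t (dx u) (Fx J q α u) (fun _ _ => 0) b :=
    ⟨hμ, by linarith [ht.1], hb0.dm, hb0.Fm, hb0.Sm, fun s hs => hb0.dC s (sub hs), fun s hs => hb0.Fl s (sub hs),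
      fun s hs => hb0.F2 s (sub hs), fun s hs => hb0.Sl s (sub hs), hb0.bi.mono_set sub, fun s hs => hb0.bd s (sub hs),
      fun s hs => hb0.bF s (sub hs), fun s hs => hb0.bS s (sub hs), fun ψ hψ s hs => hb0.wi ψ hψ s (sub hs),
      fun ψ hψ => (hb0.wc ψ hψ).mono sub⟩
  have b0 : ∀ s ∈ Icc t0 t2, 0 ≤ b s := fun s hs => (integral_nonneg fun x => sq_nonneg _).trans (hb0.bd s hs)
  obtain ⟨i1, i2, hmain⟩ := hb.main jj_sq hχ.t (by linarith) (by linarith) hχ.n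
    (θ := fun t => t - t0) (θ' := fun _ => 1) (fun t => (hasDerivAt_id t).sub_const t0)
    continuous_const (fun t ht => sub_nonneg.2 ht.1)
  have hintg : ∫ s in Icc t0 t, Rg μ (X R') (fun s => s ^ 2 / 2) (fun s => s) (fun _ => 1) 1 (s - t0) (dx u s)
      (fun x => Fx J q α u s x ^ 2) (Fx J q α u s) (fun _ => 0) ≤ A * (2 * C) := by
    refine (setIntegral_mono_on i2 ((hb.bi.const_mul 2).const_mul A) measurableSet_Icc fun s hs => ?_).trans ?_
    · have θ0 : 0 ≤ s - t0 := sub_nonneg.2 hs.1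
      have iF : ∀ r, IntegrableOn (fun x => Fx J q α u s x ^ 2) (Icc (-r) r) := fun r =>
        (hb.F2 s hs).integrableOn_isCompact isCompact_Icc
      have iD : ∀ r, IntegrableOn (fun x => dx u s x ^ 2) (Icc (-r) r) := fun r => Sol.il ((cd s).pow 2)
      refine (rowGen (k := fun x => dx u s x ^ 2 + Fx J q α u s x ^ 2) hμ (by linarith) zero_le_one θ0 hχ.t
        (fun x => by rw [abs_of_nonneg (hχ.n x)]; linarith [hχ.l x]) hχ.b1 hχ.b2 ((iD _).add (iF _))
        (fun x => by positivity) (fun x _ => ?_) (fun x _ => ?_) (fun x _ => ?_) (fun x _ => ?_)).trans ?_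
      · rw [abs_of_nonneg (by positivity)]; linarith [sq_nonneg (dx u s x), sq_nonneg (Fx J q α u s x)]
      · rw [one_mul, abs_of_nonneg (by positivity)]; linarith [sq_nonneg (dx u s x)]
      · refine abs_le.2 ⟨?_, ?_⟩
        · nlinarith [sq_nonneg (dx u s x + Fx J q α u s x), sq_nonneg (dx u s x), sq_nonneg (Fx J q α u s x)]
        · nlinarith [sq_nonneg (dx u s x - Fx J q α u s x), sq_nonneg (dx u s x), sq_nonneg (Fx J q α u s x)]
      · simp only [mul_zero, abs_zero]; positivity
      · have bs := b0 s (sub hs)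
        have I2 : ∫ x in Icc (-(2 * R')) (2 * R'), (dx u s x ^ 2 + Fx J q α u s x ^ 2) ≤ 2 * b s := by
          rw [integral_add (iD _) (iF _)]
          have ss : Icc (-(2 * R')) (2 * R') ⊆ Icc (-(2 * R' + 1)) (2 * R' + 1) := Icc_subset_Icc (by linarith) (by linarith)
          have l1 := (setIntegral_mono_set (iD _) (Eventually.of_forall fun x => sq_nonneg _)
            (HasSubset.Subset.eventuallyLE ss)).trans (hb.bd s hs)
          have l2 := (setIntegral_mono_set (iF _) (Eventually.of_forall fun x => sq_nonneg _)
            (HasSubset.Subset.eventuallyLE ss)).trans (hb.bF s hs)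
          linarith
        have : c * (1 + (s - t0) * (μ + 1 / (2 * μ) + 2)) ≤ A := by
          rw [hA]
          have : s - t0 ≤ t2 := by linarith [hs.2, ht.2]
          gcongr
        exact mul_le_mul this I2 (integral_nonneg fun x => by positivity) A0
    · rw [integral_const_mul, integral_const_mul]
      refine mul_le_mul_of_nonneg_left (mul_le_mul_of_nonneg_left (le_trans ?_ hbC) zero_le_two) A0
      exact setIntegral_mono_set hb0.bi ((ae_restrict_iff' measurableSet_Icc).2 (Eventually.of_forall b0))
        (HasSubset.Subset.eventuallyLE sub)
  have dn : 0 ≤ μ / 2 * (∫ s in Icc t0 t, (s - t0) * ∫ x, X R' x * (1 * deriv (dx u s) x ^ 2)) := by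
    refine mul_nonneg (by positivity) (setIntegral_nonneg measurableSet_Icc fun s hs => ?_)
    exact mul_nonneg (sub_nonneg.2 hs.1) (integral_nonneg fun x => mul_nonneg (hχ.n x) (by positivity))
  have fin : (t - t0) * (∫ x, X R' x * (dx u t x ^ 2 / 2)) ≤ A * (2 * C) := by
    simp only [sub_self, zero_mul, zero_add] at hmain
    linarith
  have a2 : ∫ x in Icc (-R') R', deriv (u t) x ^ 2 / 2 ≤ ∫ x, X R' x * (deriv (u t) x ^ 2 / 2) :=
    cut_le hχ1 hχ.n (fun x => by positivity) (hχ.t.integrable_mul_cont (((cd t).pow 2).div_const 2))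
  have a1 : ∫ x in Icc (-R) R, deriv (u t) x ^ 2 ≤ ∫ x in Icc (-R') R', deriv (u t) x ^ 2 :=
    setIntegral_mono_set (Sol.il ((cd t).pow 2)) (Eventually.of_forall fun x => by positivity)
      (HasSubset.Subset.eventuallyLE (Icc_subset_Icc (neg_le_neg (le_max_left _ _)) (le_max_left _ _)))
  rw [integral_div] at a2
  have tt : t0 ≤ t - t0 := by linarith [ht.1]
  have nn : 0 ≤ ∫ x, X R' x * (deriv (u t) x ^ 2 / 2) := integral_nonneg fun x => mul_nonneg (hχ.n x) (by positivity)
  have f2 : t0 * (∫ x, X R' x * (deriv (u t) x ^ 2 / 2)) ≤ A * (2 * C) := (mul_le_mul_of_nonneg_right tt nn).trans fin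
  rw [div_mul_eq_mul_div, le_div_iff₀ t00]
  nlinarith
end RegAux

namespace RegAux
open Set Topology
open scoped ContDiff
variable {J : ℝ → ℝ} {q α μ : ℝ} {u : ℝ → ℝ → ℝ}

lemma pt4 {w : ℝ → ℝ} (hw : ContDiff ℝ 1 w) {x A K : ℝ} (hA : ∫ y in Icc (x - 1) (x + 1), w y ^ 2 ≤ A)
    (hK : ∫ y in Icc (x - 1) (x + 1), deriv w y ^ 2 ≤ K) : w x ^ 4 ≤ 2 * A ^ 2 + 8 * A * K := by
  have tr : ∀ f : ℝ → ℝ, ∫ y in Icc (-1:ℝ) 1, f (y + x) = ∫ y in Icc (x - 1) (x + 1), f y := by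
    intro f
    rw [integral_Icc_eq_integral_Ioc, integral_Icc_eq_integral_Ioc,
      ← intervalIntegral.integral_of_le (by linarith), ← intervalIntegral.integral_of_le (by linarith),
      intervalIntegral.integral_comp_add_right (fun y => f y)]
    congr 1 <;> ring
  have hA0 : 0 ≤ A := le_trans (integral_nonneg fun y => sq_nonneg _) hA
  have hw' : ContDiff ℝ 1 (fun y => w (y + x)) := by fun_prop
  have h1 := sup_four (r := 1) le_rfl hw' (C := A) (by rw [tr (fun y => w y ^ 2)]; exact hA) (x := 0)
    (by constructor <;> norm_num)
  have e : deriv (fun y => w (y + x)) = fun y => deriv w (y + x) := by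
    funext y; exact deriv_comp_add_const w x y
  rw [e, tr (fun y => deriv w y ^ 2)] at h1
  simp only [zero_add] at h1
  nlinarith

lemma Icc_sub_abs (x : ℝ) : Icc (x - 1) (x + 1) ⊆ Icc (-(|x| + 1)) (|x| + 1) := by
  intro y hy
  have := neg_abs_le x; have := le_abs_self x
  constructor <;> linarith [hy.1, hy.2]

lemma Sol.du_cont (h : Sol J q α μ u) (t : ℝ) : Continuous (deriv (u t)) :=
  (h.uc t).continuous_deriv (by norm_num)

lemma Sol.K_le (h : Sol J q α μ u) {t1 t2 C : ℝ} (hC : ∀ t ∈ Icc t1 t2, ∀ R, ∫ x in Icc (-R) R, deriv (u t) x ^ 2 ≤ C)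
    {t : ℝ} (ht : t ∈ Icc t1 t2) (x : ℝ) : ∫ y in Icc (x - 1) (x + 1), deriv (u t) y ^ 2 ≤ C := by
  refine le_trans ?_ (hC t ht (|x| + 1))
  exact setIntegral_mono_set (((h.du_cont t).pow 2).continuousOn.integrableOn_compact isCompact_Icc)
    (Eventually.of_forall fun y => sq_nonneg _) (Icc_sub_abs x).eventuallyLE

lemma Sol.bdd (h : Sol J q α μ u) {t1 t2 : ℝ} (h1 : 0 < t1) :
    ∃ P, 0 ≤ P ∧ ∀ t ∈ Icc t1 t2, ∀ x, |u t x| ≤ P := by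
  obtain ⟨C, hC0, hC, -⟩ := h.B1 (t2 := t2) h1
  obtain ⟨K, hK0, hK⟩ := h.B3 (t2 := t2) h1
  refine ⟨1 + (2 * C ^ 2 + 8 * C * K), by positivity, fun t ht x => ?_⟩
  have a := pt4 ((h.uc t).of_le (by norm_num)) (x := x) (A := C) (K := K) ?_ (h.K_le hK ht x)
  · have e : u t x ^ 4 = |u t x| ^ 4 := by rw [← abs_pow, abs_of_nonneg (by positivity)]
    rw [e] at a
    by_contra hh
    push Not at hh
    have h5 : 1 ≤ |u t x| := by nlinarith [mul_nonneg hC0 hK0, sq_nonneg C]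
    have : |u t x| ≤ |u t x| ^ 4 := le_self_pow₀ h5 (by norm_num)
    linarith
  · exact (setIntegral_le_integral (hC t ht).1 (Eventually.of_forall fun y => sq_nonneg _)).trans (hC t ht).2

lemma Sol.near (h : Sol J q α μ u) {t1 t2 : ℝ} (h1 : 0 < t1) {t0 : ℝ} (ht0 : t0 ∈ Icc t1 t2) {ε : ℝ} (hε : 0 < ε) :
    ∀ᶠ t in 𝓝[Icc t1 t2] t0, ∀ x, |u t x - u t0 x| ≤ ε := by
  obtain ⟨P, hP0, hP⟩ := h.bdd (t2 := t2) h1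
  obtain ⟨K, hK0, hK⟩ := h.B3 (t2 := t2) h1
  have l1 := h.ul t0 (lt_of_lt_of_le h1 ht0.1)
  have l2 : Tendsto (fun t => 2 * (2 * P * ∫ x, |u t x - u t0 x|) ^ 2
      + 8 * (2 * P * ∫ x, |u t x - u t0 x|) * (4 * K)) (𝓝 t0) (𝓝 0) := by
    have := (((l1.const_mul (2 * P)).pow 2).const_mul 2).add (((l1.const_mul (2 * P)).const_mul 8).mul_const (4 * K))
    simpa using this
  have l3 := (l2.mono_left (nhdsWithin_le_nhds (s := Icc t1 t2))).eventually (gt_mem_nhds (show 0 < ε ^ 4 by positivity))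
  filter_upwards [l3, self_mem_nhdsWithin] with t hlt ht x
  have cw : ContDiff ℝ 2 (fun y => u t y - u t0 y) := (h.uc t).sub (h.uc t0)
  have id := ((h.ui t).sub (h.ui t0)).abs
  have a := pt4 (w := fun y => u t y - u t0 y) (cw.of_le (by norm_num)) (x := x)
    (A := 2 * P * ∫ x, |u t x - u t0 x|) (K := 4 * K) ?_ ?_
  · have e : (u t x - u t0 x) ^ 4 = |u t x - u t0 x| ^ 4 := by rw [← abs_pow, abs_of_nonneg (by positivity)]
    rw [e] at a
    exact le_of_lt (lt_of_pow_lt_pow_left₀ 4 hε.le (a.trans_lt hlt))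
  · calc _ ≤ ∫ y in Icc (x - 1) (x + 1), 2 * P * |u t y - u t0 y| := by
          refine setIntegral_mono_on ((cw.continuous.pow 2).continuousOn.integrableOn_compact isCompact_Icc)
            (id.const_mul _).integrableOn measurableSet_Icc fun y _ => ?_
          rw [← sq_abs, sq]
          refine mul_le_mul_of_nonneg_right ?_ (abs_nonneg _)
          exact (abs_sub _ _).trans (by linarith [hP t ht y, hP t0 ht0 y])
      _ ≤ ∫ y, 2 * P * |u t y - u t0 y| :=
          setIntegral_le_integral (id.const_mul _) (Eventually.of_forall fun y => by
            show 0 ≤ 2 * P * |u t y - u t0 y|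
            positivity)
      _ = _ := integral_const_mul _ _
  · have e : deriv (fun y => u t y - u t0 y) = fun y => deriv (u t) y - deriv (u t0) y := by
      funext y
      exact deriv_fun_sub ((h.uc t).differentiable (by norm_num) y) ((h.uc t0).differentiable (by norm_num) y)
    rw [e]
    have i1 : ∀ s, IntegrableOn (fun y => 2 * deriv (u s) y ^ 2) (Icc (x - 1) (x + 1)) := fun s =>
      (((h.du_cont s).pow 2).const_mul 2).continuousOn.integrableOn_compact isCompact_Icc
    calc _ ≤ ∫ y in Icc (x - 1) (x + 1), (2 * deriv (u t) y ^ 2 + 2 * deriv (u t0) y ^ 2) := by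
          refine setIntegral_mono_on ((((h.du_cont t).sub (h.du_cont t0)).pow 2).continuousOn.integrableOn_compact
            isCompact_Icc) ((i1 t).add (i1 t0)) measurableSet_Icc fun y _ => ?_
          nlinarith [sq_nonneg (deriv (u t) y + deriv (u t0) y)]
      _ = 2 * (∫ y in Icc (x - 1) (x + 1), deriv (u t) y ^ 2) + 2 * ∫ y in Icc (x - 1) (x + 1), deriv (u t0) y ^ 2 := by
          rw [integral_add (i1 t) (i1 t0), integral_const_mul, integral_const_mul]
      _ ≤ 4 * K := by linarith [h.K_le hK ht x, h.K_le hK ht0 x]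

lemma Sol.decay1 (h : Sol J q α μ u) {t : ℝ} (ht : 0 < t) {ε : ℝ} (hε : 0 < ε) :
    ∃ R, 0 ≤ R ∧ ∀ x, R ≤ |x| → |u t x| ≤ ε := by
  obtain ⟨C, hC0, hC, -⟩ := h.B1 (t2 := t) ht
  obtain ⟨K, hK0, hK⟩ := h.B3 (t2 := t) ht
  have tm : t ∈ Icc t t := ⟨le_rfl, le_rfl⟩
  have i2 := (hC t tm).1
  have l0 : Tendsto (fun n : ℕ => ∫ y in Icc (-(n:ℝ)) n, u t y ^ 2) atTop (𝓝 (∫ y, u t y ^ 2)) :=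
    AECover.integral_tendsto_of_countably_generated
      (aecover_Icc (tendsto_neg_atTop_atBot.comp tendsto_natCast_atTop_atTop) tendsto_natCast_atTop_atTop) i2
  have l1 : Tendsto (fun n : ℕ => (∫ y, u t y ^ 2) - ∫ y in Icc (-(n:ℝ)) n, u t y ^ 2) atTop (𝓝 0) := by
    have := l0.const_sub (∫ y, u t y ^ 2)
    simpa using this
  have l2 : Tendsto (fun n : ℕ => 2 * ((∫ y, u t y ^ 2) - ∫ y in Icc (-(n:ℝ)) n, u t y ^ 2) ^ 2
      + 8 * ((∫ y, u t y ^ 2) - ∫ y in Icc (-(n:ℝ)) n, u t y ^ 2) * K) atTop (𝓝 0) := by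
    have := ((l1.pow 2).const_mul 2).add ((l1.const_mul 8).mul_const K)
    simpa using this
  obtain ⟨n, hn⟩ := (l2.eventually (gt_mem_nhds (show 0 < ε ^ 4 by positivity))).exists
  refine ⟨n + 2, by positivity, fun x hx => ?_⟩
  have a := pt4 ((h.uc t).of_le (by norm_num)) (x := x) (A := (∫ y, u t y ^ 2) - ∫ y in Icc (-(n:ℝ)) n, u t y ^ 2)
    (K := K) ?_ (h.K_le hK tm x)
  · have e : u t x ^ 4 = |u t x| ^ 4 := by rw [← abs_pow, abs_of_nonneg (by positivity)]
    rw [e] at a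
    exact le_of_lt (lt_of_pow_lt_pow_left₀ 4 hε.le (a.trans_lt hn))
  · rw [le_sub_iff_add_le, ← setIntegral_union _ measurableSet_Icc i2.integrableOn i2.integrableOn]
    · exact setIntegral_le_integral i2 (Eventually.of_forall fun y => sq_nonneg _)
    · rw [Set.disjoint_left]
      intro y hy hy'
      rcases le_total 0 x with h0 | h0
      · rw [abs_of_nonneg h0] at hx; linarith [hy.1, hy'.2]
      · rw [abs_of_nonpos h0] at hx; linarith [hy.2, hy'.1]

lemma Sol.decay (h : Sol J q α μ u) {t1 t2 : ℝ} (h1 : 0 < t1) {ε : ℝ} (hε : 0 < ε) :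
    ∃ R, 0 ≤ R ∧ ∀ t ∈ Icc t1 t2, ∀ x, R ≤ |x| → |u t x| ≤ ε := by
  refine IsCompact.induction_on (s := Icc t1 t2) (p := fun s => ∃ R, 0 ≤ R ∧ ∀ t ∈ s, ∀ x, R ≤ |x| → |u t x| ≤ ε)
    isCompact_Icc ⟨0, le_rfl, fun t ht => ht.elim⟩ ?_ ?_ ?_
  · rintro s s' hs ⟨R, h0, hR⟩
    exact ⟨R, h0, fun t ht => hR t (hs ht)⟩
  · rintro s s' ⟨R, h0, hR⟩ ⟨R', h0', hR'⟩
    refine ⟨max R R', le_max_of_le_left h0, fun t ht x hx => ?_⟩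
    rcases ht with ht | ht
    · exact hR t ht x ((le_max_left _ _).trans hx)
    · exact hR' t ht x ((le_max_right _ _).trans hx)
  · intro t0 ht0
    obtain ⟨R, h0, hR⟩ := h.decay1 (lt_of_lt_of_le h1 ht0.1) (half_pos hε)
    refine ⟨_, h.near h1 ht0 (half_pos hε), R, h0, fun t ht x hx => ?_⟩
    have a := ht x
    have b := hR x hx
    have := abs_add_le (u t x - u t0 x) (u t0 x)
    rw [sub_add_cancel] at this
    linarith

lemma Sol.joint (h : Sol J q α μ u) {t1 t2 : ℝ} (h1 : 0 < t1) :
    ContinuousOn (Function.uncurry u) (Icc t1 t2 ×ˢ univ) := by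
  rintro ⟨t0, x0⟩ ⟨ht0, -⟩
  simp only at ht0
  rw [ContinuousWithinAt, nhdsWithin_prod_eq, nhdsWithin_univ, Metric.tendsto_nhds]
  intro ε hε
  have a := h.near h1 ht0 (half_pos hε)
  have b : ∀ᶠ x in 𝓝 x0, |u t0 x - u t0 x0| < ε / 2 := by
    have := Metric.tendsto_nhds.1 ((h.uc t0).continuous.tendsto x0) (ε / 2) (half_pos hε)
    simpa [Real.dist_eq] using this
  filter_upwards [a.prod_mk b] with p hp
  rw [Real.dist_eq]
  have e := abs_add_le (u p.1 p.2 - u t0 p.2) (u t0 p.2 - u t0 x0)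
  rw [sub_add_sub_cancel] at e
  have := hp.1 p.2
  have := hp.2
  simp only [Function.uncurry]
  linarith
end RegAux

namespace RegAux
open Set Topology
open scoped ContDiff
variable {J : ℝ → ℝ} {q α μ : ℝ} {u : ℝ → ℝ → ℝ}

lemma gint {η G : ℝ → ℝ} {C : ℝ} (hC : ∀ x, |η x| ≤ C) (hG : Integrable G) :
    |∫ x, η x * G x| ≤ C * ∫ x, |G x| := by
  rw [← integral_const_mul]
  refine abs_integral_le_integral_abs.trans ?_
  refine integral_mono_of_nonneg (Eventually.of_forall fun x => abs_nonneg _) (hG.abs.const_mul C)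
    (Eventually.of_forall fun x => ?_)
  simp only [abs_mul]
  exact mul_le_mul_of_nonneg_right (hC x) (abs_nonneg _)

lemma cutlim {X : ℕ → ℝ → ℝ} (hc : ∀ n, Continuous (X n)) (hn : ∀ n x, 0 ≤ X n x) (hl : ∀ n x, X n x ≤ 1)
    (h1 : ∀ n : ℕ, ∀ x ∈ Icc (-((n:ℝ) + 1)) (n + 1), X n x = 1) {f : ℝ → ℝ} (hf : Integrable f) :
    Tendsto (fun n => ∫ x, X n x * f x) atTop (𝓝 (∫ x, f x)) := by
  refine tendsto_integral_of_dominated_convergence (fun x => |f x|)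
    (fun n => (hc n).aestronglyMeasurable.mul hf.aestronglyMeasurable) hf.abs ?_ ?_
  · intro n
    refine Eventually.of_forall fun x => ?_
    rw [Real.norm_eq_abs, abs_mul, abs_of_nonneg (hn n x)]
    exact mul_le_of_le_one_left (abs_nonneg _) (hl n x)
  · refine Eventually.of_forall fun x => tendsto_const_nhds.congr' ?_
    obtain ⟨N, hN⟩ := exists_nat_ge |x|
    filter_upwards [eventually_ge_atTop N] with n hn
    have : (N:ℝ) ≤ n := by exact_mod_cast hn
    have := neg_abs_le x; have := le_abs_self x
    rw [h1 n x ⟨by linarith, by linarith⟩, one_mul]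

/-- uniform data on a time interval -/
lemma Sol.data (h : Sol J q α μ u) {t1 t2 : ℝ} (h1 : 0 < t1) : ∃ m L, 0 ≤ m ∧ 0 ≤ L ∧ ∀ t ∈ Icc t1 t2,
    ∫ x, |u t x| ≤ m ∧ ∀ x, |Fu q u t x| ≤ L * |u t x| := by
  obtain ⟨m, hm0, hm⟩ := h.norm_bdd (t2 := t2) h1
  obtain ⟨P, hP0, hP⟩ := h.bdd (t2 := t2) h1
  refine ⟨m, P ^ (q - 1), hm0.le, by positivity, fun t ht => ⟨hm t ht, fun x => ?_⟩⟩
  refine (fq_abs_le h.q1 _).trans ?_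
  rw [← rpow_mul_self h.q1]
  exact mul_le_mul_of_nonneg_right (Real.rpow_le_rpow (abs_nonneg _) (hP t ht x) (by linarith [h.q1])) (abs_nonneg _)

lemma Sol.Su_zero (h : Sol J q α μ u) (t : ℝ) : ∫ x, Su J α u t x = 0 := by
  have e : ∫ x, gg J u t x = ∫ x, u t x := by
    have h2 := integral_convolution (ContinuousLinearMap.mul ℝ ℝ) (h.ui t) h.Ji
    have e : (convolution (u t) J (ContinuousLinearMap.mul ℝ ℝ) volume) = gg J u t := by
      funext x; simp only [convolution, ContinuousLinearMap.mul_apply', gg]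
      exact integral_congr_ae (Eventually.of_forall fun y => mul_comm _ _)
    rw [e] at h2
    rw [h2]; simp [h.J1]
  unfold Su
  rw [integral_const_mul, integral_sub (h.g_int t) (h.ui t), e]; simp

lemma Sol.Fu_int (h : Sol J q α μ u) {t L : ℝ} (hL : ∀ x, |Fu q u t x| ≤ L * |u t x|) :
    Integrable (Fu q u t) :=
  Integrable.mono' ((h.ui t).abs.const_mul L) ((fq_continuous h.q1).comp (h.uc t).continuous).aestronglyMeasurable
    (Eventually.of_forall hL)

lemma Sol.Fu_l1 (h : Sol J q α μ u) {t L : ℝ} (hL : ∀ x, |Fu q u t x| ≤ L * |u t x|) :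
    ∫ x, |Fu q u t x| ≤ L * ∫ x, |u t x| := by
  rw [← integral_const_mul]
  exact integral_mono (h.Fu_int hL).abs ((h.ui t).abs.const_mul L) hL

/-- conservation of mass -/
lemma Sol.mass (h : Sol J q α μ u) {t1 t2 : ℝ} (h1 : 0 < t1) (h12 : t1 ≤ t2) :
    ∫ x, u t2 x = ∫ x, u t1 x := by
  obtain ⟨c, hc, X, hX⟩ := exists_cuts
  obtain ⟨m, L, hm0, hL0, hD⟩ := h.data (t2 := t2) h1
  have hμ := h.μ0
  have hα := h.α0
  have R1 : ∀ n : ℕ, (1:ℝ) ≤ n + 1 := fun n => by have : (0:ℝ) ≤ n := n.cast_nonneg; linarith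
  set Y : ℕ → ℝ → ℝ := fun n => X (n + 1) with hY
  have lim : ∀ {f : ℝ → ℝ}, Integrable f → Tendsto (fun n => ∫ x, Y n x * f x) atTop (𝓝 (∫ x, f x)) := fun hf =>
    cutlim (fun n => (hX _ (R1 n)).1.t.cont) (fun n => (hX _ (R1 n)).1.n) (fun n => (hX _ (R1 n)).1.l)
      (fun n => (hX _ (R1 n)).2.1) hf
  set W : ℕ → ℝ → ℝ := fun n => Lf μ (Y n) u (Fu q u) (Su J α u) with hW
  have cW : ∀ n, ContinuousOn (W n) (Icc t1 t2) := fun n => by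
    have G := h.gp (t2 := t2) (r := 2 * ((n:ℝ) + 1)) (by linarith [R1 n]) h1
    obtain ⟨C, hC⟩ := G.c1
    exact h.L_cont (fun t ht => lt_of_lt_of_le h1 ht.1) hC (hX _ (R1 n)).1.t
  have ftc : ∀ n, ∫ t in Icc t1 t2, W n t = (∫ x, Y n x * u t2 x) - ∫ x, Y n x * u t1 x := fun n => by
    have G := h.gp (t2 := t2) (r := 2 * ((n:ℝ) + 1)) (by linarith [R1 n]) h1
    rw [integral_Icc_eq_integral_Ioc, ← intervalIntegral.integral_of_le h12]
    refine intervalIntegral.integral_eq_sub_of_hasDerivAt (f := fun s => ∫ x, Y n x * u s x) (fun t ht => ?_) ?_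
    · rw [uIcc_of_le h12] at ht
      exact G.w _ (hX _ (R1 n)).1.t t ht
    · refine ContinuousOn.intervalIntegrable ?_
      rw [uIcc_of_le h12]; exact cW n
  have small : ∀ n : ℕ, ∀ t ∈ Icc t1 t2, |W n t - ∫ x, Y n x * Su J α u t x| ≤ c / ((n:ℝ) + 1) * ((μ + L) * m) := by
    intro n t ht
    obtain ⟨a1, a2⟩ := hD t ht
    have b1 := gint (hX _ (R1 n)).2.2.2 (h.ui t)
    have b2 := gint (hX _ (R1 n)).2.2.1 (h.Fu_int a2)
    have b3 := (h.Fu_l1 a2).trans (mul_le_mul_of_nonneg_left a1 hL0)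
    have c0 : 0 ≤ c / ((n:ℝ) + 1) := by have := R1 n; positivity
    have b4 := b1.trans (mul_le_mul_of_nonneg_left a1 c0)
    have b5 := b2.trans (mul_le_mul_of_nonneg_left b3 c0)
    have e : W n t - ∫ x, Y n x * Su J α u t x = μ * (∫ x, deriv (deriv (Y n)) x * u t x)
        + ∫ x, deriv (Y n) x * Fu q u t x := by simp only [hW, Lf]; ring
    rw [e]
    refine (abs_add_le _ _).trans ?_
    rw [abs_mul, abs_of_pos hμ]
    have := mul_le_mul_of_nonneg_left b4 hμ.le
    simp only [hY] at *
    linarith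
  have l0 : Tendsto (fun n : ℕ => c / ((n:ℝ) + 1) * ((μ + L) * m)) atTop (𝓝 0) := by
    have := (tendsto_one_div_add_atTop_nhds_zero_nat (𝕜 := ℝ)).const_mul (c * ((μ + L) * m))
    rw [mul_zero] at this
    refine this.congr fun n => by ring
  have l1 : Tendsto (fun n => ∫ t in Icc t1 t2, W n t) atTop (𝓝 (∫ t in Icc t1 t2, (0:ℝ))) := by
    refine tendsto_integral_of_dominated_convergence (fun _ => c * ((μ + L) * m) + 2 * α * m)
      (fun n => (cW n).aestronglyMeasurable measurableSet_Icc) (integrableOn_const (by simp)) ?_ ?_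
    · intro n
      refine (ae_restrict_iff' measurableSet_Icc).2 (Eventually.of_forall fun t ht => ?_)
      have a := small n t ht
      have b := gint (η := Y n) (C := 1) (fun x => by
        rw [abs_of_nonneg ((hX _ (R1 n)).1.n x)]; exact (hX _ (R1 n)).1.l x) (h.Su_int t)
      rw [one_mul] at b
      have b2 := b.trans ((h.Su_le t).trans (mul_le_mul_of_nonneg_left (hD t ht).1 (by positivity)))
      have a2 : c / ((n:ℝ) + 1) * ((μ + L) * m) ≤ c * ((μ + L) * m) :=
        mul_le_mul_of_nonneg_right (div_le_self (by linarith) (R1 n)) (by positivity)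
      rw [Real.norm_eq_abs]
      have := abs_add_le (W n t - ∫ x, Y n x * Su J α u t x) (∫ x, Y n x * Su J α u t x)
      rw [sub_add_cancel] at this
      linarith
    · refine (ae_restrict_iff' measurableSet_Icc).2 (Eventually.of_forall fun t ht => ?_)
      have a := lim (h.Su_int t)
      rw [h.Su_zero] at a
      have b : Tendsto (fun n => W n t - ∫ x, Y n x * Su J α u t x) atTop (𝓝 0) :=
        squeeze_zero_norm (fun n => small n t ht) l0
      simpa using b.add a
  have l2 := (lim (h.ui t2)).sub (lim (h.ui t1))
  have := tendsto_nhds_unique l1 (l2.congr fun n => (ftc n).symm)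
  simp only [integral_zero] at this
  linarith

/-- `L¹` norms decrease -/
lemma Sol.contr (h : Sol J q α μ u) {t1 t2 : ℝ} (h1 : 0 < t1) (h12 : t1 ≤ t2) :
    ∫ x, |u t2 x| ≤ ∫ x, |u t1 x| := by
  obtain ⟨c, hc, X, hX⟩ := exists_cuts
  obtain ⟨m, L, hm0, hL0, hD⟩ := h.data (t2 := t2) h1
  have hμ := h.μ0
  have hα := h.α0
  have R1 : ∀ n : ℕ, (1:ℝ) ≤ n + 1 := fun n => by have : (0:ℝ) ≤ n := n.cast_nonneg; linarith
  have m1 : t1 ∈ Icc t1 t2 := ⟨le_rfl, h12⟩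
  have m2 : t2 ∈ Icc t1 t2 := ⟨h12, le_rfl⟩
  set Y : ℕ → ℝ → ℝ := fun n => X (n + 1) with hY
  have YT : ∀ n : ℕ, Test (2 * ((n:ℝ) + 1)) (Y n) := fun n => (hX _ (R1 n)).1.t
  have Y0 : ∀ n x, 0 ≤ Y n x := fun n => (hX _ (R1 n)).1.n
  have Y1 : ∀ n x, Y n x ≤ 1 := fun n => (hX _ (R1 n)).1.l
  have lim : ∀ {f : ℝ → ℝ}, Integrable f → Tendsto (fun n => ∫ x, Y n x * f x) atTop (𝓝 (∫ x, f x)) := fun hf =>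
    cutlim (fun n => (YT n).cont) Y0 Y1 (fun n => (hX _ (R1 n)).2.1) hf
  have ia : ∀ n t, Integrable (fun x => Y n x * |u t x|) := fun n t =>
    (YT n).integrable_mul_cont (h.uc t).continuous.abs
  have iψ : ∀ n, Integrable (Y n) := fun n => (YT n).cont.integrable_of_hasCompactSupport (YT n).hcs
  set V : ℕ → ℝ → ℝ := fun n t => (∫ x, |u t x|) - ∫ x, Y n x * |u t x| with hV
  have V0 : ∀ n t, 0 ≤ V n t := fun n t => sub_nonneg.2 (integral_mono (ia n t) (h.ui t).abs fun x =>
    mul_le_of_le_one_left (abs_nonneg _) (Y1 n x))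
  have Vm : ∀ n, ∀ t ∈ Icc t1 t2, V n t ≤ m := fun n t ht => by
    have : 0 ≤ ∫ x, Y n x * |u t x| := integral_nonneg fun x => mul_nonneg (Y0 n x) (abs_nonneg _)
    simp only [hV]; linarith [(hD t ht).1]
  have Vme : ∀ n, Measurable (V n) := fun n => by
    have m1 : Measurable (Function.uncurry fun t x => |u t x|) := h.um.abs
    have m2 : Measurable (Function.uncurry fun t x => Y n x * |u t x|) :=
      ((YT n).cont.measurable.comp measurable_snd).mul h.um.abs
    exact (meas_row m1).sub (meas_row m2)
  have iV : ∀ n, IntegrableOn (V n) (Icc t1 t2) := fun n =>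
    Measure.integrableOn_of_bounded (M := m) (by simp) (Vme n).aestronglyMeasurable
      ((ae_restrict_iff' measurableSet_Icc).2 (Eventually.of_forall fun t ht => by
        rw [Real.norm_of_nonneg (V0 n t)]; exact Vm n t ht))
  have row : ∀ n : ℕ, ∀ δ, 0 < δ → ∀ t ∈ Icc t1 t2,
      Rg μ (Y n) (j0 δ) (j01 δ) (j02 δ) 0 1 (u t) (fun x => Fu q u t x ^ 2) (Fu q u t) (Su J α u t)
        ≤ (c / ((n:ℝ) + 1) * ((μ + L) * m) + δ * ((L ^ 2 / (2 * μ) + α) * ∫ x, Y n x)) + α * V n t := by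
    intro n δ hδ t ht
    obtain ⟨a1, a2⟩ := hD t ht
    have cu := (h.uc t).continuous
    have c0 : 0 ≤ c / ((n:ℝ) + 1) := by have := R1 n; positivity
    have i0 : Integrable (fun x => j0 δ (u t x)) := Integrable.mono' (h.ui t).abs
      ((jj_abs hδ).c.comp cu).aestronglyMeasurable (Eventually.of_forall fun x => j0_abs hδ _)
    have b1 := le_of_abs_le (gint (hX _ (R1 n)).2.2.2 i0)
    have b1' : ∫ x, |j0 δ (u t x)| ≤ m := (integral_mono i0.abs (h.ui t).abs fun x => j0_abs hδ _).trans a1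
    have iF := h.Fu_int a2
    have b2 : ∫ x, deriv (Y n) x * j01 δ (u t x) * Fu q u t x ≤ c / ((n:ℝ) + 1) * ∫ x, |Fu q u t x| :=
      le_of_abs_le (gint (η := fun x => deriv (Y n) x * j01 δ (u t x)) (fun x => by
        rw [abs_mul]
        exact (mul_le_of_le_one_right (abs_nonneg _) (j01_abs hδ _)).trans ((hX _ (R1 n)).2.2.1 x)) iF)
    have b2' := (h.Fu_l1 a2).trans (mul_le_mul_of_nonneg_left a1 hL0)
    have b3 : ∫ x, Y n x * j02 δ (u t x) * Fu q u t x ^ 2 ≤ δ * L ^ 2 * ∫ x, Y n x := by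
      rw [← integral_const_mul]
      refine integral_mono_of_nonneg (Eventually.of_forall fun x =>
        mul_nonneg (mul_nonneg (Y0 n x) (j02_nonneg hδ _)) (sq_nonneg _)) ((iψ n).const_mul _)
        (Eventually.of_forall fun x => ?_)
      have z1 : Fu q u t x ^ 2 ≤ L ^ 2 * u t x ^ 2 := by
        rw [← sq_abs, ← sq_abs (u t x), ← mul_pow]
        exact pow_le_pow_left₀ (abs_nonneg _) (a2 x) 2
      calc Y n x * j02 δ (u t x) * Fu q u t x ^ 2 ≤ Y n x * j02 δ (u t x) * (L ^ 2 * u t x ^ 2) :=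
            mul_le_mul_of_nonneg_left z1 (mul_nonneg (Y0 n x) (j02_nonneg hδ _))
        _ = Y n x * L ^ 2 * (j02 δ (u t x) * u t x ^ 2) := by ring
        _ ≤ Y n x * L ^ 2 * δ := mul_le_mul_of_nonneg_left (j02_sq hδ _) (mul_nonneg (Y0 n x) (sq_nonneg _))
        _ = _ := by ring
    have ig : Integrable (fun x => Y n x * |gg J u t x|) := (YT n).integrable_mul (h.g_int t).abs.locallyIntegrable
    have id : Integrable (fun x => δ * Y n x) := (iψ n).const_mul δ
    have b4 : ∫ x, Y n x * j01 δ (u t x) * Su J α u t x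
        ≤ α * ((∫ x, Y n x * |gg J u t x|) - (∫ x, Y n x * |u t x|) + δ * ∫ x, Y n x) := by
      have i3 : Integrable (fun x => Y n x * |gg J u t x| - Y n x * |u t x|) := ig.sub (ia n t)
      rw [← integral_const_mul δ, ← integral_sub ig (ia n t), ← integral_add i3 id, ← integral_const_mul]
      have i4 : Integrable fun x => α * (Y n x * |gg J u t x| - Y n x * |u t x| + δ * Y n x) :=
        (i3.add id).const_mul α
      refine integral_mono ?_ i4 fun x => ?_
      · have := (h.Su_int t).bdd_mul (c := 1) (f := fun x => Y n x * j01 δ (u t x))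
          ((YT n).cont.mul ((jj_abs hδ).c1.comp cu)).aestronglyMeasurable
          (Eventually.of_forall fun x => by
            rw [Real.norm_eq_abs, abs_mul, abs_of_nonneg (Y0 n x)]
            exact mul_le_one₀ (Y1 n x) (abs_nonneg _) (j01_abs hδ _))
        exact this
      · simp only [Su]
        have z1 : j01 δ (u t x) * gg J u t x ≤ |gg J u t x| := by
          refine (le_abs_self _).trans ?_
          rw [abs_mul]
          exact mul_le_of_le_one_left (abs_nonneg _) (j01_abs hδ _)
        have z2 := j01_mul hδ (u t x)
        have z3 : j01 δ (u t x) * gg J u t x - j01 δ (u t x) * u t x ≤ |gg J u t x| - |u t x| + δ := by linarith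
        have := mul_le_mul_of_nonneg_left z3 (mul_nonneg hα.le (Y0 n x))
        linarith
    have b5 : ∫ x, Y n x * |gg J u t x| ≤ ∫ x, |u t x| :=
      (integral_mono ig (h.g_int t).abs fun x => mul_le_of_le_one_left (abs_nonneg _) (Y1 n x)).trans (h.g_le t)
    have b6 : (∫ x, Y n x * |gg J u t x|) - (∫ x, Y n x * |u t x|) + δ * (∫ x, Y n x) ≤ V n t + δ * ∫ x, Y n x := by
      simp only [hV]; linarith
    have b7 := b4.trans (mul_le_mul_of_nonneg_left b6 hα.le)
    have b8 := mul_le_mul_of_nonneg_left (b1.trans (mul_le_mul_of_nonneg_left b1' c0)) hμ.le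
    have b9 := b2.trans (mul_le_mul_of_nonneg_left b2' c0)
    have b10 := mul_le_mul_of_nonneg_left b3 (show 0 ≤ 1 / (2 * μ) by positivity)
    unfold Rg
    simp only [zero_mul, one_mul, zero_add]
    refine (add_le_add (add_le_add (add_le_add b8 b10) b9) b7).trans (le_of_eq ?_)
    ring
  have stepn : ∀ n : ℕ, ∫ x, Y n x * |u t2 x| ≤ (∫ x, Y n x * |u t1 x|)
      + (t2 - t1) * (c / ((n:ℝ) + 1) * ((μ + L) * m)) + α * ∫ t in Icc t1 t2, V n t := by
    intro n
    have hI : 0 ≤ ∫ x, Y n x := integral_nonneg (Y0 n)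
    have main : ∀ δ, 0 < δ → ∫ x, Y n x * |u t2 x| ≤ ((∫ x, Y n x * |u t1 x|)
      + (t2 - t1) * (c / ((n:ℝ) + 1) * ((μ + L) * m)) + α * ∫ t in Icc t1 t2, V n t)
        + δ * ((1 + (t2 - t1) * (L ^ 2 / (2 * μ) + α)) * ∫ x, Y n x) := by
      intro δ hδ
      obtain ⟨b, hE⟩ := h.el0 (r := 2 * ((n:ℝ) + 1) + 1) h1 h12 (by linarith [R1 n])
      obtain ⟨i1, i2, hmain⟩ := hE.main (jj_abs hδ) (YT n) (by linarith [R1 n]) (lt_add_one _) (Y0 n)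
        (θ := fun _ => 1) (θ' := fun _ => 0) (fun t => hasDerivAt_const _ _)
        (by fun_prop) (fun t _ => zero_le_one)
      have iA : IntegrableOn (fun _ : ℝ => (c / ((n:ℝ) + 1) * ((μ + L) * m)
          + δ * ((L ^ 2 / (2 * μ) + α) * ∫ x, Y n x))) (Icc t1 t2) := integrableOn_const (by simp)
      have iB : IntegrableOn (fun t => α * V n t) (Icc t1 t2) := (iV n).const_mul α
      have hintg := setIntegral_mono_on i2 (iA.add iB) measurableSet_Icc (fun t ht => row n δ hδ t ht)
      simp only [Pi.add_apply] at hintg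
      rw [integral_add iA iB, integral_const_mul] at hintg
      simp only [integral_const, measureReal_restrict_apply_univ, smul_eq_mul, Real.volume_real_Icc_of_le h12] at hintg
      have i0 : 0 ≤ μ / 2 * ∫ t in Icc t1 t2, (1:ℝ) * ∫ x, Y n x * (j02 δ (u t x) * deriv (u t) x ^ 2) :=
        mul_nonneg (by positivity) (integral_nonneg fun t => by
          simp only [one_mul]
          exact integral_nonneg fun x => mul_nonneg (Y0 n x) (mul_nonneg (j02_nonneg hδ _) (sq_nonneg _)))
      have ij : ∀ t, Integrable (fun x => Y n x * j0 δ (u t x)) := fun t =>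
        (YT n).integrable_mul_cont ((jj_abs hδ).c.comp (h.uc t).continuous)
      have l1 : ∫ x, Y n x * j0 δ (u t1 x) ≤ ∫ x, Y n x * |u t1 x| :=
        integral_mono (ij t1) (ia n t1) fun x => mul_le_mul_of_nonneg_left (j0_le hδ _) (Y0 n x)
      have l2 : (∫ x, Y n x * |u t2 x|) - δ * (∫ x, Y n x) ≤ ∫ x, Y n x * j0 δ (u t2 x) := by
        have i3 : Integrable (fun x => δ * Y n x) := (iψ n).const_mul δ
        rw [← integral_const_mul, ← integral_sub (ia n t2) i3]
        refine integral_mono ((ia n t2).sub i3) (ij t2) fun x => ?_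
        have := mul_le_mul_of_nonneg_left (j0_ge δ (u t2 x)) (Y0 n x)
        simp only
        linarith
      simp only [one_mul] at hmain i0
      linarith
    refine le_of_forall_pos_le_add fun ε hε => ?_
    have hZ : 0 ≤ (1 + (t2 - t1) * (L ^ 2 / (2 * μ) + α)) * ∫ x, Y n x := by
      have : 0 ≤ t2 - t1 := by linarith
      positivity
    set Z := (1 + (t2 - t1) * (L ^ 2 / (2 * μ) + α)) * ∫ x, Y n x
    refine (main (ε / (Z + 1)) (by positivity)).trans (add_le_add le_rfl ?_)
    rw [div_mul_eq_mul_div, div_le_iff₀ (by positivity)]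
    nlinarith
  have l0 : Tendsto (fun n : ℕ => (t2 - t1) * (c / ((n:ℝ) + 1) * ((μ + L) * m))) atTop (𝓝 0) := by
    have := (tendsto_one_div_add_atTop_nhds_zero_nat (𝕜 := ℝ)).const_mul ((t2 - t1) * (c * ((μ + L) * m)))
    rw [mul_zero] at this
    refine this.congr fun n => by ring
  have l1 : Tendsto (fun n => ∫ t in Icc t1 t2, V n t) atTop (𝓝 (∫ t in Icc t1 t2, (0:ℝ))) := by
    refine tendsto_integral_of_dominated_convergence (fun _ => m)
      (fun n => (Vme n).aestronglyMeasurable) (integrableOn_const (by simp)) ?_ ?_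
    · exact fun n => (ae_restrict_iff' measurableSet_Icc).2 (Eventually.of_forall fun t ht => by
        rw [Real.norm_of_nonneg (V0 n t)]; exact Vm n t ht)
    · refine Eventually.of_forall fun t => ?_
      have := (lim (h.ui t).abs).const_sub (∫ x, |u t x|)
      rw [sub_self] at this
      exact this
  rw [integral_zero] at l1
  have l2 := (((lim (h.ui t1).abs).add l0).add (l1.const_mul α))
  rw [mul_zero, add_zero, add_zero] at l2
  exact le_of_tendsto_of_tendsto' (lim (h.ui t2).abs) l2 stepn
end RegAux

namespace RegAux
open Set Topology
open scoped ContDiff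

lemma nl {r a b c e : ℝ} (r0 : 0 < r) (r1 : r < 1) (ha : 0 < a) (hb : 0 < b) (hc : 0 < c) (he : 0 < e)
    (hab : b ^ r ≤ a ^ r) (hm : c ^ r ≤ e ^ r + (a ^ r - b ^ r)) :
    a ^ (r - 1) * c ≤ b ^ (r - 1) * e + (a ^ r - b ^ r) := by
  have A0 : 0 < a ^ r := by positivity
  have B0 : 0 < b ^ r := by positivity
  have E0 : 0 < e ^ r := by positivity
  have C0 : 0 < c ^ r := by positivity
  have m1 : 1 ≤ 1 / r := by rw [le_div_iff₀ r0]; linarith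
  have inv : ∀ {s : ℝ}, 0 < s → (s ^ r) ^ (1 / r) = s := fun hs => by
    rw [← Real.rpow_mul hs.le, mul_one_div_cancel r0.ne', Real.rpow_one]
  have sub1 : ∀ {s : ℝ}, 0 < s → s ^ (r - 1) = s ^ r / s := fun hs => Real.rpow_sub_one hs.ne' r
  have k := (convexOn_rpow m1).2 (show e ^ r / b ^ r ∈ Ici (0:ℝ) from by simp only [mem_Ici]; positivity)
    (show (1:ℝ) ∈ Ici (0:ℝ) by simp)
    (show 0 ≤ b ^ r / a ^ r by positivity) (show 0 ≤ (a ^ r - b ^ r) / a ^ r from div_nonneg (by linarith) A0.le) (by field_simp; ring)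
  simp only [smul_eq_mul] at k
  rw [Real.one_rpow, Real.div_rpow E0.le B0.le, inv he, inv hb] at k
  have k2 : c / a ≤ (b ^ r / a ^ r * (e ^ r / b ^ r) + (a ^ r - b ^ r) / a ^ r * 1) ^ (1 / r) := by
    have e1 : c / a = (c ^ r / a ^ r) ^ (1 / r) := by rw [Real.div_rpow C0.le A0.le, inv hc, inv ha]
    rw [e1]
    refine Real.rpow_le_rpow (by positivity) ?_ (by positivity)
    have : b ^ r / a ^ r * (e ^ r / b ^ r) + (a ^ r - b ^ r) / a ^ r * 1 = (e ^ r + (a ^ r - b ^ r)) / a ^ r := by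
      field_simp
    rw [this]
    gcongr
  have k3 := mul_le_mul_of_nonneg_left (k2.trans k) A0.le
  rw [sub1 ha, sub1 hb]
  calc a ^ r / a * c = a ^ r * (c / a) := by ring
    _ ≤ _ := k3
    _ = _ := by field_simp

lemma conc {r σ U V : ℝ} (r0 : 0 < r) (r1 : r < 1) (hσ : 0 < σ) (hV : 0 ≤ V) (hUV : V ≤ U) :
    (U + σ) ^ r - (V + σ) ^ r ≤ U ^ r - V ^ r := by
  have hc := (Real.concaveOn_rpow r0.le r1.le).2
  have hd : 0 < U + σ - V := by linarith
  set l := σ / (U + σ - V) with hl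
  set k := (U - V) / (U + σ - V) with hk
  have l0 : 0 ≤ l := by positivity
  have k0 : 0 ≤ k := div_nonneg (by linarith) hd.le
  have lk : l + k = 1 := by rw [hl, hk, ← add_div, div_eq_one_iff_eq hd.ne']; ring
  have mV : V ∈ Ici (0:ℝ) := hV
  have mU : U + σ ∈ Ici (0:ℝ) := by simp only [mem_Ici]; linarith
  have a1 := hc mV mU k0 l0 (by linarith)
  have a2 := hc mV mU l0 k0 lk
  simp only [smul_eq_mul] at a1 a2
  have e1 : k * V + l * (U + σ) = V + σ := by rw [hl, hk]; field_simp; ring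
  have e2 : l * V + k * (U + σ) = U := by rw [hl, hk]; field_simp; ring
  rw [e1] at a1
  rw [e2] at a2
  have : l = 1 - k := by linarith
  rw [this] at a1 a2
  linarith

lemma left_max {f : ℝ → ℝ} {f' a t : ℝ} (hf : HasDerivAt f f' t) (hat : a < t) (hm : ∀ s ∈ Icc a t, f s ≤ f t) :
    0 ≤ f' := by
  have l := (hasDerivAt_iff_tendsto_slope_left_right.1 hf).1
  refine ge_of_tendsto l ?_
  filter_upwards [Ioo_mem_nhdsLT hat] with s hs
  rw [slope_def_field]
  exact div_nonneg_of_nonpos (by linarith [hm s ⟨hs.1.le, hs.2.le⟩]) (by linarith [hs.2])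

lemma second {f f1 : ℝ → ℝ} {x f2 : ℝ} (h1 : ∀ᶠ y in 𝓝 x, HasDerivAt f (f1 y) y) (h2 : HasDerivAt f1 f2 x)
    (hm : IsLocalMax f x) : f1 x = 0 ∧ f2 ≤ 0 := by
  have e : deriv f =ᶠ[𝓝 x] f1 := h1.mono fun y hy => hy.deriv
  have z : f1 x = 0 := hm.hasDerivAt_eq_zero h1.self_of_nhds
  refine ⟨z, ?_⟩
  by_contra hh
  push Not at hh
  have d2 : deriv (deriv f) x = f2 := by rw [e.deriv_eq, h2.deriv]
  have mn := isLocalMin_of_deriv_deriv_pos (by rw [d2]; exact hh) (by rw [h1.self_of_nhds.deriv, z])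
    h1.self_of_nhds.continuousAt
  have ec : f =ᶠ[𝓝 x] fun _ => f x := by
    filter_upwards [hm, mn] with y a b
    exact le_antisymm a b
  have : deriv (deriv f) x = 0 := by
    rw [ec.deriv.deriv_eq]; simp
  linarith
end RegAux

namespace RegAux
open Set Topology
open scoped ContDiff
variable {J : ℝ → ℝ} {q α μ : ℝ} {u : ℝ → ℝ → ℝ}

lemma Sol.ut_hasDeriv' (h : Sol J q α μ u) {t : ℝ} (ht : 0 < t) (x : ℝ) :
    HasDerivAt (fun s => u s x) (α * (gg J u t x - u t x) + μ * deriv (deriv (u t)) x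
      - |u t x| ^ (q - 1) * deriv (u t) x) t := by
  have h1 := ((h.ut x).differentiableOn (by simp)).differentiableAt (Ioi_mem_nhds ht)
  refine h1.hasDerivAt.congr_deriv ?_
  linarith [h.pde t ht x]

/-- the nonlocal term as an average of translates -/
lemma Sol.g_tr (h : Sol J q α μ u) {t P σ : ℝ} (hP : ∀ x, |u t x| ≤ P) (x : ℝ) :
    Integrable (fun w => J w * (u t (x - w) + σ)) ∧ gg J u t x + σ = ∫ w, J w * (u t (x - w) + σ) := by
  have cu := (h.uc t).continuous
  have i1 : Integrable (fun w => J w * u t (x - w)) := h.Ji.mul_bdd (c := P)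
    (cu.comp (continuous_const.sub continuous_id)).aestronglyMeasurable (Eventually.of_forall fun w => hP _)
  have i2 : Integrable (fun w => J w * σ) := h.Ji.mul_const σ
  have e : (fun w => J w * (u t (x - w) + σ)) = fun w => J w * u t (x - w) + J w * σ := by funext w; ring
  rw [e]
  refine ⟨i1.add i2, ?_⟩
  rw [integral_add i1 i2, integral_mul_const, h.J1, one_mul, gg]
  congr 1
  have := integral_sub_left_eq_self (fun w => J w * u t (x - w)) volume x
  rw [← this]
  exact integral_congr_ae (Eventually.of_forall fun y => by simp)

/-- spatial derivatives of `(v + σ)^r` -/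
lemma zder {v : ℝ → ℝ} (hv : ContDiff ℝ 2 v) {r σ : ℝ} (hp : ∀ x, 0 < v x + σ) :
    (∀ x, HasDerivAt (fun y => (v y + σ) ^ r) (deriv v x * r * (v x + σ) ^ (r - 1)) x) ∧
    ∀ x, HasDerivAt (fun y => deriv v y * r * (v y + σ) ^ (r - 1))
      (deriv (deriv v) x * r * (v x + σ) ^ (r - 1)
        + deriv v x * r * (deriv v x * (r - 1) * (v x + σ) ^ (r - 1 - 1))) x := by
  have d1 : ∀ x, HasDerivAt v (deriv v x) x := fun x => (hv.differentiable (by norm_num) x).hasDerivAt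
  have d2 : ∀ x, HasDerivAt (deriv v) (deriv (deriv v) x) x := fun x =>
    ((contDiff_deriv_of_two hv).differentiable (by norm_num) x).hasDerivAt
  refine ⟨fun x => ((d1 x).add_const σ).rpow_const (Or.inl (hp x).ne'), fun x => ?_⟩
  exact ((d2 x).mul_const r).mul (((d1 x).add_const σ).rpow_const (p := r - 1) (Or.inl (hp x).ne'))

/-- algebra at a point where the first order condition holds -/
lemma visc {r κ A a1 a2 : ℝ} (r0 : 0 < r) (hA : 0 < A) (hk : a1 * r * A ^ (r - 1) = κ) :
    a2 * r * A ^ (r - 1) = (a2 * r * A ^ (r - 1) + a1 * r * (a1 * (r - 1) * A ^ (r - 1 - 1)))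
      + (1 - r) / r * κ ^ 2 * (A ^ r)⁻¹ := by
  have e1 : A ^ (r - 1) = A ^ r / A := Real.rpow_sub_one hA.ne' r
  have e2 : A ^ (r - 1 - 1) = A ^ r / A / A := by rw [Real.rpow_sub_one hA.ne', e1]
  have : 0 < A ^ r := by positivity
  rw [← hk, e1, e2]
  field_simp
  ring

/-- the core inequality at a maximum point -/
lemma Sol.core (h : Sol J q α μ u) {t P σ κ η x y f' : ℝ} (ht : 0 < t) (h0 : ∀ x, 0 ≤ u t x) (hP : ∀ x, |u t x| ≤ P)
    (hσ : 0 < σ) (hκ : 0 < κ) (hη : 0 < η)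
    (hlt : (u t y + σ) ^ (q - 1) < (u t x + σ) ^ (q - 1))
    (hx1 : deriv (u t) x * (q - 1) * (u t x + σ) ^ (q - 1 - 1) = κ)
    (hy1 : deriv (u t) y * (q - 1) * (u t y + σ) ^ (q - 1 - 1) = κ)
    (hx2 : deriv (deriv (u t)) x * (q - 1) * (u t x + σ) ^ (q - 1 - 1)
        + deriv (u t) x * (q - 1) * (deriv (u t) x * (q - 1 - 1) * (u t x + σ) ^ (q - 1 - 1 - 1)) ≤ 0)
    (hy2 : 0 ≤ deriv (deriv (u t)) y * (q - 1) * (u t y + σ) ^ (q - 1 - 1)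
        + deriv (u t) y * (q - 1) * (deriv (u t) y * (q - 1 - 1) * (u t y + σ) ^ (q - 1 - 1 - 1)))
    (hmax : ∀ w, (u t (x - w) + σ) ^ (q - 1) - (u t (y - w) + σ) ^ (q - 1)
      ≤ (u t x + σ) ^ (q - 1) - (u t y + σ) ^ (q - 1))
    (ht1 : HasDerivAt (fun s => (u s x + σ) ^ (q - 1) - (u s y + σ) ^ (q - 1)) f' t)
    (hf' : -κ * ((u t x + σ) ^ (q - 1) - (u t y + σ) ^ (q - 1) - η) ≤ f') : False := by
  set r := q - 1 with hr
  have r0 : 0 < r := by linarith [h.q1]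
  have r1 : r < 1 := by linarith [h.q2]
  have hμ := h.μ0
  have hα := h.α0
  have p : ∀ z, 0 < u t z + σ := fun z => by linarith [h0 z]
  have ft : ∀ z, HasDerivAt (fun s => (u s z + σ) ^ r) _ t := fun z =>
    ((h.ut_hasDeriv' ht z).add_const σ).rpow_const (p := r) (Or.inl (p z).ne')
  have ef := ht1.unique ((ft x).sub (ft y))
  rw [abs_of_nonneg (h0 x), abs_of_nonneg (h0 y)] at ef
  obtain ⟨ix, gx⟩ := h.g_tr (σ := σ) hP x
  obtain ⟨iy, gy⟩ := h.g_tr (σ := σ) hP y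
  set A := u t x + σ with hA
  set B := u t y + σ with hB
  have A0 : 0 < A := p x
  have B0 : 0 < B := p y
  have vx := visc (a2 := deriv (deriv (u t)) x) r0 A0 hx1
  have vy := visc (a2 := deriv (deriv (u t)) y) r0 B0 hy1
  -- nonlocal part
  have N : A ^ (r - 1) * (gg J u t x - u t x) ≤ B ^ (r - 1) * (gg J u t y - u t y) := by
    have i3 : Integrable (fun w => J w * (A ^ r - B ^ r)) := h.Ji.mul_const _
    have k1 : A ^ (r - 1) * (gg J u t x + σ) ≤ B ^ (r - 1) * (gg J u t y + σ) + (A ^ r - B ^ r) := by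
      have e3 : A ^ r - B ^ r = ∫ w, J w * (A ^ r - B ^ r) := by rw [integral_mul_const, h.J1, one_mul]
      rw [gx, gy, ← integral_const_mul, ← integral_const_mul]
      rw [e3]
      have iy' : Integrable (fun w => B ^ (r - 1) * (J w * (u t (y - w) + σ))) := iy.const_mul _
      rw [← integral_add iy' i3]
      refine integral_mono (ix.const_mul _) (iy'.add i3) fun w => ?_
      have := nl r0 r1 A0 B0 (p (x - w)) (p (y - w)) hlt.le (by linarith [hmax w])
      have := mul_le_mul_of_nonneg_left this (h.J0 w)
      simp only
      linarith
    have e1 : ∀ {C : ℝ}, 0 < C → C ^ (r - 1) * C = C ^ r := fun hC => by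
      rw [Real.rpow_sub_one hC.ne']; field_simp
    have e2 := e1 A0
    have e4 := e1 B0
    have ux : u t x = A - σ := by rw [hA]; ring
    have uy : u t y = B - σ := by rw [hB]; ring
    rw [ux, uy]
    linarith
  have hUV : u t y ≤ u t x := by
    have := (Real.rpow_lt_rpow_iff B0.le A0.le r0).1 hlt
    linarith
  have cc := conc r0 r1 hσ (h0 y) hUV
  rw [← hA, ← hB] at cc
  have ApBp : (A ^ r)⁻¹ ≤ (B ^ r)⁻¹ := inv_anti₀ (by positivity) hlt.le
  have s1 : (1 - r) / r * κ ^ 2 * (A ^ r)⁻¹ ≤ (1 - r) / r * κ ^ 2 * (B ^ r)⁻¹ :=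
    mul_le_mul_of_nonneg_left ApBp (mul_nonneg (div_nonneg (by linarith) r0.le) (sq_nonneg _))
  have s2 : deriv (deriv (u t)) x * r * A ^ (r - 1) ≤ deriv (deriv (u t)) y * r * B ^ (r - 1) := by linarith
  have s3 := mul_le_mul_of_nonneg_left s2 hμ.le
  have s4 := mul_le_mul_of_nonneg_left N (mul_nonneg hα.le r0.le)
  have s5 := mul_le_mul_of_nonneg_left cc hκ.le
  have s6 : u t x ^ r * κ = u t x ^ r * (deriv (u t) x * r * A ^ (r - 1)) := by rw [hx1]
  have s7 : u t y ^ r * κ = u t y ^ r * (deriv (u t) y * r * B ^ (r - 1)) := by rw [hy1]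
  have s8 : f' ≤ -κ * (A ^ r - B ^ r) := by
    rw [ef]
    linarith
  have : 0 < κ * η := by positivity
  linarith

/-- one-sided Lipschitz bound for `(u+σ)^{q-1}`, with slack -/
lemma Sol.olei0 (h : Sol J q α μ u) (h0 : ∀ t, 0 < t → ∀ x, 0 ≤ u t x) {t0 T σ η : ℝ} (ht0 : 0 < t0)
    (hσ : 0 < σ) (hη : 0 < η) : ∀ t ∈ Icc t0 T, ∀ x y, y ≤ x →
    (t - t0) * ((u t x + σ) ^ (q - 1) - (u t y + σ) ^ (q - 1) - η) ≤ x - y := by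
  by_contra hcon
  push Not at hcon
  obtain ⟨s, hs, x1, y1, hxy1, hpos⟩ := hcon
  set r := q - 1 with hr
  have r0 : 0 < r := by linarith [h.q1]
  have r1 : r < 1 := by linarith [h.q2]
  obtain ⟨P, hP0, hP⟩ := h.bdd (t2 := T) ht0
  obtain ⟨R, hR0, hR⟩ := h.decay (t2 := T) ht0 (show 0 < η ^ (1 / r) by positivity)
  have p : ∀ t ∈ Icc t0 T, ∀ z, 0 < u t z + σ := fun t ht z => by
    linarith [h0 t (lt_of_lt_of_le ht0 ht.1) z]
  have htT : t0 ≤ T := hs.1.trans hs.2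
  set Φ : ℝ × ℝ × ℝ → ℝ := fun z => (z.1 - t0) * ((u z.1 z.2.1 + σ) ^ r - (u z.1 z.2.2 + σ) ^ r - η) - (z.2.1 - z.2.2)
    with hΦ
  set B := (P + σ) ^ r with hB
  have B0 : 0 ≤ B := by positivity
  set Q := R + (T - t0) * B with hQ
  set K : Set (ℝ × ℝ × ℝ) := (Icc t0 T ×ˢ (Icc (-Q) Q ×ˢ Icc (-Q) Q)) ∩ {z | z.2.2 ≤ z.2.1} with hK
  have inK : ∀ t x y, t ∈ Icc t0 T → y ≤ x → 0 < Φ (t, x, y) → (t, x, y) ∈ K := by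
    intro t x y ht hxy hp
    simp only [hΦ] at hp
    have tt : 0 ≤ t - t0 := by linarith [ht.1]
    have zy : 0 < (u t y + σ) ^ r := Real.rpow_pos_of_pos (p t ht y) _
    have zx : (u t x + σ) ^ r ≤ B := Real.rpow_le_rpow (p t ht x).le
      (by linarith [le_abs_self (u t x), hP t ht x]) r0.le
    have d1 : 0 < (t - t0) * ((u t x + σ) ^ r - (u t y + σ) ^ r - η) := by linarith
    have d2 : 0 < (u t x + σ) ^ r - (u t y + σ) ^ r - η := (pos_iff_pos_of_mul_pos d1).1 (lt_of_le_of_ne tt (fun e => by rw [← e, zero_mul] at d1; exact lt_irrefl _ d1))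
    have hx : |x| < R := by
      by_contra hx
      push Not at hx
      have a := hR t ht x hx
      have ux := h0 t (lt_of_lt_of_le ht0 ht.1) x
      have uy := h0 t (lt_of_lt_of_le ht0 ht.1) y
      rw [abs_of_nonneg ux] at a
      have a2 : u t x ^ r ≤ η := by
        refine (Real.rpow_le_rpow ux a r0.le).trans (le_of_eq ?_)
        rw [← Real.rpow_mul hη.le, one_div_mul_cancel r0.ne', Real.rpow_one]
      have a3 := Real.rpow_add_le_add_rpow ux hσ.le r0.le r1.le
      have a4 : σ ^ r ≤ (u t y + σ) ^ r := Real.rpow_le_rpow hσ.le (by linarith) r0.le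
      linarith
    have hd : x - y ≤ (T - t0) * B := by
      have : (t - t0) * ((u t x + σ) ^ r - (u t y + σ) ^ r - η) ≤ (T - t0) * B :=
        mul_le_mul (by linarith [ht.2]) (by linarith) d2.le (by linarith)
      linarith
    have := abs_lt.1 hx
    have q0 : 0 ≤ (T - t0) * B := mul_nonneg (by linarith) B0
    exact ⟨⟨ht, ⟨by linarith, by linarith⟩, ⟨by linarith, by linarith⟩⟩, hxy⟩
  have Kc : IsCompact K := (isCompact_Icc.prod (isCompact_Icc.prod isCompact_Icc)).inter_right
    (isClosed_le (by fun_prop) (by fun_prop))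
  have jc := h.joint (t2 := T) ht0
  have cx : ContinuousOn (fun z : ℝ × ℝ × ℝ => u z.1 z.2.1) K :=
    jc.comp (f := fun z : ℝ × ℝ × ℝ => (z.1, z.2.1)) (by fun_prop) (fun z hz => ⟨hz.1.1, mem_univ _⟩)
  have cy : ContinuousOn (fun z : ℝ × ℝ × ℝ => u z.1 z.2.2) K :=
    jc.comp (f := fun z : ℝ × ℝ × ℝ => (z.1, z.2.2)) (by fun_prop) (fun z hz => ⟨hz.1.1, mem_univ _⟩)
  have cΦ : ContinuousOn Φ K := by
    have a1 : ContinuousOn (fun z : ℝ × ℝ × ℝ => (u z.1 z.2.1 + σ) ^ r) K :=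
      (cx.add continuousOn_const).rpow_const fun z _ => Or.inr r0.le
    have a2 : ContinuousOn (fun z : ℝ × ℝ × ℝ => (u z.1 z.2.2 + σ) ^ r) K :=
      (cy.add continuousOn_const).rpow_const fun z _ => Or.inr r0.le
    have b1 : ContinuousOn (fun z : ℝ × ℝ × ℝ => z.1 - t0) K := by fun_prop
    have b2 : ContinuousOn (fun z : ℝ × ℝ × ℝ => z.2.1 - z.2.2) K := by fun_prop
    exact (b1.mul ((a1.sub a2).sub continuousOn_const)).sub b2
  have hp1 : 0 < Φ (s, x1, y1) := by simp only [hΦ]; linarith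
  have k1 := inK s x1 y1 hs hxy1 hp1
  obtain ⟨⟨t, x, y⟩, hz, hmx⟩ := Kc.exists_isMaxOn ⟨_, k1⟩ cΦ
  have hpz : 0 < Φ (t, x, y) := hp1.trans_le (hmx k1)
  have gm : ∀ t' x' y', t' ∈ Icc t0 T → y' ≤ x' → Φ (t', x', y') ≤ Φ (t, x, y) := by
    intro t' x' y' ht' hxy'
    by_cases hc : 0 < Φ (t', x', y')
    · exact hmx (inK _ _ _ ht' hxy' hc)
    · linarith
  have htm : t ∈ Icc t0 T := hz.1.1
  have hyx : y ≤ x := hz.2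
  have hpz' := hpz
  simp only [hΦ] at hpz' gm
  have tpos : t0 < t := by
    rcases eq_or_lt_of_le htm.1 with e | e
    · rw [← e, sub_self, zero_mul] at hpz'; linarith
    · exact e
  have d0 : 0 < t - t0 := by linarith
  have hlt : y < x := by
    rcases eq_or_lt_of_le hyx with e | e
    · rw [← e] at hpz'
      have := mul_pos d0 hη
      nlinarith
    · exact e
  have t00 : 0 < t := by linarith
  have pt := p t htm
  obtain ⟨z1, z2⟩ := zder (h.uc t) (r := r) (σ := σ) pt
  -- conditions in x
  have X := second (f := fun x' => (t - t0) * ((u t x' + σ) ^ r - (u t y + σ) ^ r - η) - (x' - y))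
    (f1 := fun x' => (t - t0) * (deriv (u t) x' * r * (u t x' + σ) ^ (r - 1)) - 1) (x := x)
    (Eventually.of_forall fun x' => by
      exact ((((z1 x').sub_const _).sub_const η).const_mul (t - t0)).sub ((hasDerivAt_id x').sub_const y))
    (((z2 x).const_mul (t - t0)).sub_const 1)
    (by
      filter_upwards [Ioi_mem_nhds hlt] with x' hx'
      exact gm t x' y htm (le_of_lt hx'))
  have Y := second (f := fun y' => (t - t0) * ((u t x + σ) ^ r - (u t y' + σ) ^ r - η) - (x - y'))
    (f1 := fun y' => (t - t0) * (-(deriv (u t) y' * r * (u t y' + σ) ^ (r - 1))) - (-1)) (x := y)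
    (Eventually.of_forall fun y' => by
      exact ((((z1 y').const_sub _).sub_const η).const_mul (t - t0)).sub ((hasDerivAt_id y').const_sub x))
    (((z2 y).neg.const_mul (t - t0)).sub_const (-1))
    (by
      filter_upwards [Iio_mem_nhds hlt] with y' hy'
      exact gm t x y' htm (le_of_lt hy'))
  obtain ⟨X1, X2⟩ := X
  obtain ⟨Y1, Y2⟩ := Y
  have dpos : 0 < (t - t0) * ((u t x + σ) ^ r - (u t y + σ) ^ r - η) := by linarith
  have d2 : 0 < (u t x + σ) ^ r - (u t y + σ) ^ r - η := (pos_iff_pos_of_mul_pos dpos).1 (lt_of_le_of_ne d0.le (fun e => by rw [← e, zero_mul] at dpos; exact lt_irrefl _ dpos))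
  have ft : ∀ z, HasDerivAt (fun s => (u s z + σ) ^ r) _ t := fun z =>
    ((h.ut_hasDeriv' t00 z).add_const σ).rpow_const (p := r) (Or.inl (pt z).ne')
  have ht1 := (ft x).sub (ft y)
  have hft := ((hasDerivAt_id t).sub_const t0).mul (ht1.sub_const η)
  have lm := left_max hft tpos (fun s hs => by
    have := gm s x y ⟨hs.1, hs.2.trans htm.2⟩ hyx
    simp only [Pi.mul_apply, Pi.sub_apply, id] at this ⊢
    linarith)
  simp only [Pi.mul_apply, Pi.sub_apply, id, one_mul] at lm
  refine h.core (η := η) (κ := 1 / (t - t0)) t00 (h0 t t00) (hP t htm) hσ (by positivity) hη (x := x) (y := y)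
    ?_ ?_ ?_ ?_ ?_ ?_ ht1 ?_
  · linarith
  · rw [eq_div_iff d0.ne']; linarith
  · rw [eq_div_iff d0.ne']; linarith
  · exact nonpos_of_mul_nonpos_right X2 d0
  · have := nonpos_of_mul_nonpos_right Y2 d0
    exact neg_nonpos.1 this
  · intro w
    have := gm t (x - w) (y - w) htm (by linarith)
    have e : x - w - (y - w) = x - y := by ring
    rw [e] at this
    have := le_of_mul_le_mul_left ((sub_le_sub_iff_right _).1 this) d0
    linarith
  · rw [neg_mul, neg_le_iff_add_nonneg, ← mul_le_mul_iff_right₀ d0]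
    rw [mul_zero, mul_add, ← mul_assoc, mul_one_div_cancel d0.ne', one_mul]
    linarith
end RegAux

namespace RegAux
open Set Topology
open scoped ContDiff
variable {J : ℝ → ℝ} {q α μ : ℝ} {u : ℝ → ℝ → ℝ}

/-- one-sided Lipschitz bound for `u^{q-1}` -/
lemma Sol.olei (h : Sol J q α μ u) (h0 : ∀ t, 0 < t → ∀ x, 0 ≤ u t x) {t : ℝ} (ht : 0 < t) {x y : ℝ} (hxy : y ≤ x) :
    t * (u t x ^ (q - 1) - u t y ^ (q - 1)) ≤ x - y := by
  have r0 : 0 < q - 1 := by linarith [h.q1]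
  have l1 : Tendsto (fun n : ℕ => 1 / ((n:ℝ) + 1)) atTop (𝓝 0) := tendsto_one_div_add_atTop_nhds_zero_nat
  have l2 : Tendsto (fun n : ℕ => t - t * (1 / ((n:ℝ) + 1))) atTop (𝓝 t) := by
    simpa using (l1.const_mul t).const_sub t
  have l3 : ∀ z, Tendsto (fun n : ℕ => (u t z + 1 / ((n:ℝ) + 1)) ^ (q - 1)) atTop (𝓝 (u t z ^ (q - 1))) := fun z => by
    have := (l1.const_add (u t z)).rpow_const (p := q - 1) (Or.inr r0.le)
    simpa using this
  have l4 := l2.mul (((l3 x).sub (l3 y)).sub l1)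
  rw [sub_zero] at l4
  refine le_of_tendsto' l4 fun n => ?_
  have n0 : 0 < 1 / ((n:ℝ) + 1) := by positivity
  have n1 : 1 / ((n:ℝ) + 1) ≤ 1 := by
    rw [div_le_one (by positivity)]; have : (0:ℝ) ≤ n := n.cast_nonneg; linarith
  exact h.olei0 h0 (t0 := t * (1 / ((n:ℝ) + 1))) (T := t) (by positivity) n0 n0 t
    ⟨mul_le_of_le_one_right ht.le n1, le_rfl⟩ x y hxy

lemma sup_final {v : ℝ → ℝ} {t M : ℝ} (hq : 1 < q) (ht : 0 < t) (hM : 0 < M) (cv : Continuous v)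
    (v0 : ∀ x, 0 ≤ v x) (vi : Integrable v) (vM : ∫ x, v x ≤ M)
    (hv : ∀ x y, y ≤ x → t * (v x ^ (q - 1) - v y ^ (q - 1)) ≤ x - y) (x : ℝ) :
    v x ≤ (q * M / ((q - 1) * t)) ^ (1 / q) := by
  have r0 : 0 < q - 1 := by linarith
  have q0 : 0 < q := by linarith
  set A := v x ^ (q - 1) with hA
  have A0 : 0 ≤ A := Real.rpow_nonneg (v0 x) _
  set m := 1 / (q - 1) with hm
  have m0 : 0 < m := by positivity
  have m1 : m + 1 = q / (q - 1) := by rw [hm]; field_simp; ring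
  have inv : ∀ {s : ℝ}, 0 ≤ s → (s ^ (q - 1)) ^ m = s := fun hs => by
    rw [← Real.rpow_mul hs, hm, mul_one_div_cancel r0.ne', Real.rpow_one]
  have dG : ∀ y, HasDerivAt (fun y => t / (m + 1) * (A - (x - y) / t) ^ (m + 1)) ((A - (x - y) / t) ^ m) y := fun y => by
    have a : HasDerivAt (fun y => A - (x - y) / t) (1 / t) y := by
      have := (((hasDerivAt_id y).const_sub x).div_const t).const_sub A
      refine HasDerivAt.congr_deriv (f := fun y => A - (x - y) / t) this ?_
      ring
    have b := (a.rpow_const (p := m + 1) (Or.inr (by linarith))).const_mul (t / (m + 1))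
    refine b.congr_deriv ?_
    rw [add_sub_cancel_right]
    field_simp
  have cG : Continuous (fun y => (A - (x - y) / t) ^ m) :=
    (by fun_prop : Continuous fun y => A - (x - y) / t).rpow_const fun y => Or.inr m0.le
  have hle : x - A * t ≤ x := by nlinarith
  have I : ∫ y in (x - A * t)..x, (A - (x - y) / t) ^ m = t / (m + 1) * A ^ (m + 1) := by
    rw [intervalIntegral.integral_eq_sub_of_hasDerivAt (fun y _ => dG y) (cG.intervalIntegrable _ _)]
    have e1 : A - (x - x) / t = A := by simp
    have e2 : A - (x - (x - A * t)) / t = 0 := by field_simp; ring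
    rw [e1, e2, Real.zero_rpow (by positivity)]; ring
  have I2 : ∫ y in (x - A * t)..x, (A - (x - y) / t) ^ m ≤ ∫ y in (x - A * t)..x, v y := by
    refine intervalIntegral.integral_mono_on hle (cG.intervalIntegrable _ _) (cv.intervalIntegrable _ _) fun y hy => ?_
    have a := hv x y hy.2
    have b0 : 0 ≤ A - (x - y) / t := by
      rw [sub_nonneg, div_le_iff₀ ht]; linarith [hy.1]
    have b : A - (x - y) / t ≤ v y ^ (q - 1) := by
      rw [sub_le_comm, le_div_iff₀ ht]; linarith
    calc _ ≤ (v y ^ (q - 1)) ^ m := Real.rpow_le_rpow b0 b m0.le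
      _ = v y := inv (v0 y)
  have I3 : ∫ y in (x - A * t)..x, v y ≤ M := by
    rw [intervalIntegral.integral_of_le hle]
    exact (setIntegral_le_integral vi (Eventually.of_forall v0)).trans vM
  have e : A ^ (m + 1) = v x ^ q := by
    rw [hA, m1, ← Real.rpow_mul (v0 x)]; congr 1; field_simp
  have k : v x ^ q ≤ q * M / ((q - 1) * t) := by
    have : t / (m + 1) * v x ^ q ≤ M := by rw [← e, ← I]; exact I2.trans I3
    rw [m1] at this
    rw [le_div_iff₀ (by positivity)]
    have e2 : t / (q / (q - 1)) * v x ^ q = v x ^ q * ((q - 1) * t) / q := by field_simp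
    rw [e2, div_le_iff₀ q0] at this
    linarith
  calc v x = (v x ^ q) ^ (1 / q) := by rw [← Real.rpow_mul (v0 x), mul_one_div_cancel q0.ne', Real.rpow_one]
    _ ≤ _ := Real.rpow_le_rpow (Real.rpow_nonneg (v0 x) _) k (by positivity)

lemma lp_final {v : ℝ → ℝ} {t M p : ℝ} (hq : 1 < q) (ht : 0 < t) (hM : 0 < M) (hp : 1 ≤ p)
    (v0 : ∀ x, 0 ≤ v x) (vi : Integrable v) (vM : ∫ x, v x ≤ M)
    (hS : ∀ x, v x ≤ (q * M / ((q - 1) * t)) ^ (1 / q)) :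
    (∫ x, |v x| ^ p) ^ (1 / p) ≤
      ((q * M / (q - 1)) ^ (1 / q * (p - 1)) * M) ^ (1 / p) * t ^ (-(1 / q) * (1 - 1 / p)) := by
  have r0 : 0 < q - 1 := by linarith
  have q0 : 0 < q := by linarith
  have p0 : 0 < p := by linarith
  set D := q * M / (q - 1) with hD
  have D0 : 0 < D := by positivity
  have eD : q * M / ((q - 1) * t) = D / t := by rw [hD]; field_simp
  rw [eD] at hS
  have hSp : 0 ≤ (D / t) ^ (1 / q) := by positivity
  have k : ∫ x, |v x| ^ p ≤ ((D / t) ^ (1 / q)) ^ (p - 1) * M := by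
    refine le_trans ?_ (mul_le_mul_of_nonneg_left vM (by positivity))
    rw [← integral_const_mul]
    refine integral_mono_of_nonneg (Eventually.of_forall fun x => by positivity) (vi.const_mul _)
      (Eventually.of_forall fun x => ?_)
    simp only
    rw [abs_of_nonneg (v0 x)]
    have e : v x ^ p = v x ^ (p - 1) * v x := by
      have := Real.rpow_add_one' (v0 x) (y := p - 1) (by linarith)
      rw [← this]; congr 1; ring
    rw [e]
    exact mul_le_mul_of_nonneg_right (Real.rpow_le_rpow (v0 x) (hS x) (by linarith)) (v0 x)
  refine (Real.rpow_le_rpow (integral_nonneg fun x => by positivity) k (by positivity)).trans (le_of_eq ?_)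
  rw [← Real.rpow_mul (by positivity), Real.div_rpow D0.le ht.le, Real.mul_rpow (by positivity) hM.le,
    Real.mul_rpow (by positivity) hM.le, Real.div_rpow (by positivity) (by positivity), ← Real.rpow_mul ht.le,
    neg_mul, Real.rpow_neg ht.le]
  have : 1 / q * (p - 1) * (1 / p) = 1 / q * (1 - 1 / p) := by field_simp
  rw [this]
  ring

lemma grad_final {v : ℝ → ℝ} {t M : ℝ} (hq : 1 < q) (hq2 : q < 2) (ht : 0 < t) (hM : 0 < M)
    (dv : Differentiable ℝ v) (v0 : ∀ x, 0 ≤ v x)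
    (hS : ∀ x, v x ≤ (q * M / ((q - 1) * t)) ^ (1 / q))
    (hv : ∀ x y, y ≤ x → t * (v x ^ (q - 1) - v y ^ (q - 1)) ≤ x - y) (x : ℝ) :
    deriv v x ≤ (q * M / (q - 1)) ^ (1 / q * (2 - q)) / (q - 1) * t ^ (-(2 / q)) := by
  have r0 : 0 < q - 1 := by linarith
  have q0 : 0 < q := by linarith
  set D := q * M / (q - 1) with hD
  have D0 : 0 < D := by positivity
  have eD : q * M / ((q - 1) * t) = D / t := by rw [hD]; field_simp
  rw [eD] at hS
  rcases eq_or_lt_of_le (v0 x) with e | hpos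
  · have : IsLocalMin v x := Eventually.of_forall fun y => by rw [← e]; exact v0 y
    rw [this.deriv_eq_zero]; positivity
  · have d1 := (dv x).hasDerivAt.rpow_const (p := q - 1) (Or.inl hpos.ne')
    have d2 := (hasDerivAt_id x).sub (d1.const_mul t)
    have k := left_max d2 (a := x - 1) (by linarith) (fun s hs => by
      have := hv x s hs.2
      simp only [Pi.sub_apply, id]
      linarith)
    have e1 : v x ^ (q - 1 - 1) * v x ^ (2 - q) = 1 := by
      rw [← Real.rpow_add hpos]
      have : q - 1 - 1 + (2 - q) = 0 := by ring
      rw [this, Real.rpow_zero]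
    have k2 : deriv v x * (q - 1) * t ≤ v x ^ (2 - q) := by
      have := mul_le_mul_of_nonneg_right (sub_nonneg.1 k) (Real.rpow_nonneg (v0 x) (2 - q))
      rw [one_mul] at this
      calc deriv v x * (q - 1) * t = t * (deriv v x * (q - 1)) * (v x ^ (q - 1 - 1) * v x ^ (2 - q)) := by
            rw [e1]; ring
        _ = t * (deriv v x * (q - 1) * v x ^ (q - 1 - 1)) * v x ^ (2 - q) := by ring
        _ ≤ _ := this
    have k3 : v x ^ (2 - q) ≤ ((D / t) ^ (1 / q)) ^ (2 - q) := Real.rpow_le_rpow (v0 x) (hS x) (by linarith)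
    have k4 : deriv v x ≤ ((D / t) ^ (1 / q)) ^ (2 - q) / ((q - 1) * t) := by
      rw [le_div_iff₀ (by positivity)]; linarith
    refine k4.trans (le_of_eq ?_)
    rw [← Real.rpow_mul (by positivity), Real.div_rpow D0.le ht.le]
    have e2 : t ^ (-(2 / q)) = (t ^ (1 / q * (2 - q)))⁻¹ * t⁻¹ := by
      rw [← Real.rpow_neg ht.le, ← Real.rpow_neg_one t, ← Real.rpow_add ht]
      congr 1; field_simp; ring
    rw [e2]
    have : 0 < t ^ (1 / q * (2 - q)) := by positivity
    field_simp
end RegAux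

namespace RegAux
open Set Topology
open scoped ContDiff
lemma preprocess {J φ : ℝ → ℝ} {q α μ M : ℝ} {u : ℝ → ℝ → ℝ} (hq1 : 1 < q) (hq2 : q < 2)
    (hd : RegData J q α μ φ M u) :
    ∃ J' : ℝ → ℝ, Sol J' q α μ (fun t x => if 0 < t then u t x else 0) := by
  obtain ⟨J0, -, Ji, J1, hα, hμ, -, -, -, hui, hul, huc, hut, hpde, -⟩ := hd
  set K := Ji.aestronglyMeasurable.mk J with hK
  have hKm : Measurable K := Ji.aestronglyMeasurable.stronglyMeasurable_mk.measurable
  have hJK : J =ᵐ[volume] fun x => |K x| := by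
    filter_upwards [Ji.aestronglyMeasurable.ae_eq_mk] with x hx
    rw [hK, ← hx, abs_of_nonneg (J0 x)]
  set w : ℝ → ℝ → ℝ := fun t x => if 0 < t then u t x else 0 with hw
  have wp : ∀ {t : ℝ}, 0 < t → w t = u t := fun {t} ht => by
    funext x; simp [hw, ht]
  have wn : ∀ {t : ℝ}, ¬ 0 < t → w t = fun _ => 0 := fun {t} ht => by
    funext x; simp [hw, ht]
  have wev : ∀ {t : ℝ}, 0 < t → ∀ x, (fun s => w s x) =ᶠ[𝓝 t] fun s => u s x := fun {t} ht x => by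
    filter_upwards [Ioi_mem_nhds ht] with s hs
    rw [wp hs]
  refine ⟨fun x => |K x|, hq1, hq2, hα, hμ, fun x => abs_nonneg _, hKm.abs, Ji.congr hJK, ?_, ?_, ?_, ?_, ?_, ?_, ?_⟩
  · rw [← J1]; exact (integral_congr_ae hJK).symm
  · intro t
    by_cases ht : 0 < t
    · have := hui t ht.le
      rw [← wp ht] at this; exact this
    · have : Integrable (w t) := by rw [wn ht]; exact integrable_zero _ _ _
      exact this
  · intro t
    by_cases ht : 0 < t
    · have := huc t ht
      rw [← wp ht] at this; exact this
    · have : ContDiff ℝ 2 (w t) := by rw [wn ht]; exact contDiff_const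
      exact this
  · intro t₀ ht
    have h1 := hul t₀ ht.le
    rw [nhdsWithin_eq_nhds.2 (Ici_mem_nhds ht)] at h1
    refine h1.congr' ?_
    filter_upwards [Ioi_mem_nhds ht] with s hs
    have : ∀ x, |u s x - u t₀ x| = |w s x - w t₀ x| := fun x => by rw [wp hs, wp ht]
    exact integral_congr_ae (Eventually.of_forall this)
  · intro x
    refine (hut x).congr fun s hs => ?_
    exact congrFun (wp hs) x
  · intro t ht x
    have h1 := hpde t ht x
    have e1 : deriv (fun s => w s x) t = deriv (fun s => u s x) t := (wev ht x).deriv_eq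
    have e2 : gg (fun x => |K x|) w t x = ∫ y, J (x - y) * u t y := by
      unfold gg
      rw [wp ht]
      have := (Measure.measurePreserving_sub_left (volume : Measure ℝ) x).quasiMeasurePreserving.ae_eq_comp hJK
      refine integral_congr_ae ?_
      filter_upwards [this] with y hy
      simp only [Function.comp] at hy
      rw [hy]
    have h2 : deriv (fun s => w s x) t + |w t x| ^ (q - 1) * deriv (w t) x
      = α * (gg (fun x => |K x|) w t x - w t x) + μ * deriv (deriv (w t)) x := by
      rw [e1, e2, wp ht]; exact h1
    exact h2
  · have h1 : Measurable (Function.uncurry fun x t => w t x) := by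
      refine measurable_uncurry_of_continuous_of_measurable (fun t => ?_) fun x => ?_
      · by_cases ht : 0 < t
        · have := (huc t ht).continuous
          rw [← wp ht] at this; exact this
        · have : Continuous (w t) := by rw [wn ht]; exact continuous_const
          exact this
      · classical
        have := ContinuousOn.measurable_piecewise (s := Ioi (0:ℝ)) (hut x).continuousOn
          (continuous_const (y := (0:ℝ))).continuousOn measurableSet_Ioi
        convert this using 1
        funext s
        simp [hw, Set.piecewise]
    exact h1.comp measurable_swap

lemma posmass {J φ : ℝ → ℝ} {q α μ M : ℝ} {u : ℝ → ℝ → ℝ} (hq1 : 1 < q) (hq2 : q < 2)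
    (hd : RegData J q α μ φ M u) {t : ℝ} (ht : 0 < t) :
    (∀ x, 0 ≤ u t x) ∧ ∫ x, u t x = M := by
  obtain ⟨J', hs⟩ := preprocess hq1 hq2 hd
  obtain ⟨J0, -, Ji, J1, hα, hμ, φi, φ0, φM, hui, hul, huc, hut, hpde, hini⟩ := hd
  have i0 := hui 0 le_rfl
  have m0 : ∫ x, u 0 x = M := by rw [← φM]; exact integral_congr_ae hini
  have a0 : ∫ x, |u 0 x| = M := by
    rw [← m0]
    refine integral_congr_ae ?_
    filter_upwards [hini] with x hx
    rw [hx, abs_of_nonneg (φ0 x)]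
  have lim : Tendsto (fun s => ∫ x, |u s x - u 0 x|) (𝓝[>] 0) (𝓝 0) :=
    (hul 0 le_rfl).mono_left (nhdsWithin_mono _ Ioi_subset_Ici_self)
  have ev : ∀ᶠ s in 𝓝[>] (0:ℝ), 0 < s ∧ s < t := by
    filter_upwards [Ioo_mem_nhdsGT ht] with s hs using hs
  have mm : ∀ s, 0 < s → s < t → ∫ x, u t x = ∫ x, u s x := fun s h1 h2 => by
    have := hs.mass h1 h2.le
    simpa only [ht, h1, if_true] using this
  have cc : ∀ s, 0 < s → s < t → ∫ x, |u t x| ≤ ∫ x, |u s x| := fun s h1 h2 => by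
    have := hs.contr h1 h2.le
    simpa only [ht, h1, if_true] using this
  have it := hui t ht.le
  have A : |(∫ x, u t x) - M| ≤ 0 := by
    refine ge_of_tendsto lim ?_
    filter_upwards [ev] with s hs'
    rw [mm s hs'.1 hs'.2, ← m0, ← integral_sub (hui s hs'.1.le) i0]
    exact abs_integral_le_integral_abs
  have B : (∫ x, |u t x|) - M ≤ 0 := by
    refine ge_of_tendsto lim ?_
    filter_upwards [ev] with s hs'
    have i1 := hui s hs'.1.le
    have i2 : Integrable fun x => |u s x| := i1.abs
    have i3 : Integrable fun x => |u 0 x| := i0.abs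
    have i4 : Integrable fun x => |u s x - u 0 x| := (i1.sub i0).abs
    have : ∫ x, (|u s x| - |u 0 x|) ≤ ∫ x, |u s x - u 0 x| :=
      integral_mono (i2.sub i3) i4 fun x => abs_sub_abs_le_abs_sub _ _
    rw [integral_sub i2 i3] at this
    linarith [cc s hs'.1 hs'.2]
  have A' : ∫ x, u t x = M := by
    have := abs_nonpos_iff.1 A; linarith
  refine ⟨?_, A'⟩
  have i5 : Integrable fun x => |u t x| := it.abs
  have i6 : Integrable fun x => |u t x| - u t x := i5.sub it
  have n6 : ∀ x, 0 ≤ |u t x| - u t x := fun x => by linarith [le_abs_self (u t x)]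
  have z : ∫ x, (|u t x| - u t x) = 0 := by
    refine le_antisymm ?_ (integral_nonneg n6)
    rw [integral_sub i5 it]; linarith
  have cu : Continuous (u t) := (huc t ht).continuous
  have hae := (integral_eq_zero_iff_of_nonneg n6 i6).1 z
  have heq : (fun x => |u t x| - u t x) = fun _ => 0 :=
    Continuous.ae_eq_iff_eq volume (by fun_prop) continuous_const |>.1 hae
  intro x
  have := congrFun heq x
  linarith [abs_nonneg (u t x)]

lemma allbounds {J φ : ℝ → ℝ} {q α μ M : ℝ} {u : ℝ → ℝ → ℝ} (hq1 : 1 < q) (hq2 : q < 2)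
    (hM : 0 < M) (hd : RegData J q α μ φ M u) {t : ℝ} (ht : 0 < t) :
    (∀ x, 0 ≤ u t x) ∧ ∫ x, u t x = M ∧ Integrable (u t) ∧ Differentiable ℝ (u t) ∧
    (∀ x y, y ≤ x → t * (u t x ^ (q - 1) - u t y ^ (q - 1)) ≤ x - y) ∧
    (∀ x, u t x ≤ (q * M / ((q - 1) * t)) ^ (1 / q)) := by
  have hpm := posmass hq1 hq2 hd ht
  have ui := hd.2.2.2.2.2.2.2.2.2.1 t ht.le
  have uc := hd.2.2.2.2.2.2.2.2.2.2.2.1 t ht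
  obtain ⟨J', hs⟩ := preprocess hq1 hq2 hd
  have ho : ∀ x y, y ≤ x → t * (u t x ^ (q - 1) - u t y ^ (q - 1)) ≤ x - y := fun x y hxy => by
    have := hs.olei (fun s h x => by simpa only [h, if_true] using (posmass hq1 hq2 hd h).1 x) ht hxy
    simpa only [ht, if_true] using this
  exact ⟨hpm.1, hpm.2, ui, uc.differentiable (by norm_num), ho,
    fun x => sup_final hq1 ht hM uc.continuous hpm.1 ui hpm.2.le ho x⟩

end RegAux

theorem stmt11
    (q M p : ℝ) (hq1 : 1 < q) (hq2 : q < 2) (hM : 0 < M) (hp : 1 ≤ p) :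
    -- (i) explicit L^∞ bound, uniform in α, μ and J
    (∀ (J φ : ℝ → ℝ) (α μ : ℝ) (u : ℝ → ℝ → ℝ), RegData J q α μ φ M u →
      ∀ t : ℝ, 0 < t → ∀ᵐ x ∂(volume : Measure ℝ),
        0 ≤ u t x ∧ u t x ≤ (q * M / ((q - 1) * t)) ^ (1 / q)) ∧
    -- (ii) L^p decay with a constant C(M,p,q) independent of α, μ and J
    (∃ C : ℝ, 0 < C ∧
      ∀ (J φ : ℝ → ℝ) (α μ : ℝ) (u : ℝ → ℝ → ℝ), RegData J q α μ φ M u →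
        ∀ t : ℝ, 0 < t →
          (∫ x, |u t x| ^ p) ^ (1 / p) ≤ C * t ^ (-(1 / q) * (1 - 1 / p))) ∧
    -- (iii) one-sided gradient bound with a constant C(M,q) independent of α, μ and J
    (∃ C : ℝ, 0 < C ∧
      ∀ (J φ : ℝ → ℝ) (α μ : ℝ) (u : ℝ → ℝ → ℝ), RegData J q α μ φ M u →
        ∀ t : ℝ, 0 < t → ∀ᵐ x ∂(volume : Measure ℝ),
          deriv (u t) x ≤ C * t ^ (-(2 / q))) := by
  have r0 : 0 < q - 1 := by linarith
  have q0 : 0 < q := by linarith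
  refine ⟨?_, ⟨((q * M / (q - 1)) ^ (1 / q * (p - 1)) * M) ^ (1 / p), by positivity, ?_⟩,
    ⟨(q * M / (q - 1)) ^ (1 / q * (2 - q)) / (q - 1), by positivity, ?_⟩⟩
  · intro J φ α μ u hd t ht
    obtain ⟨h1, h2, h3, h4, h5, h6⟩ := RegAux.allbounds hq1 hq2 hM hd ht
    exact Eventually.of_forall fun x => ⟨h1 x, h6 x⟩
  · intro J φ α μ u hd t ht
    obtain ⟨h1, h2, h3, h4, h5, h6⟩ := RegAux.allbounds hq1 hq2 hM hd ht
    exact RegAux.lp_final hq1 ht hM hp h1 h3 h2.le h6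
  · intro J φ α μ u hd t ht
    obtain ⟨h1, h2, h3, h4, h5, h6⟩ := RegAux.allbounds hq1 hq2 hM hd ht
    exact Eventually.of_forall fun x => RegAux.grad_final hq1 hq2 ht hM h4 h1 h6 h5 x
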